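/- For every compact set $\mathcal{K} \subset \mathbb{R}$ there exist constants $C>0$ and $s_0>0$ such that for all $x \in \mathcal{K}$ and all $s \ge s_0$ the Fredholm determinant $\det(I-\check{K}_{\mathrm{csin}})$ of the integral operator with kernel $\check{K}_{\mathrm{csin}}$ on $L^2((-s,s))$ is a positive real number and $\bigl|\ln\det(I-\check{K}_{\mathrm{csin}}) - \bigl(-\tfrac{2}{3}s^6 - s^4 x - \tfrac{1}{2}s^2x^2 - \tfrac{3}{4}\ln s - \tfrac{1}{6}\ln 2 + 3\zeta'(-1)\bigr)\bigr| \le C/s$, where $\zeta'$ is the derivative of the Riemann zeta function. -/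

import Mathlib

noncomputable section
open MeasureTheory Filter Topology

/-- The cubic sine kernel `K^t_csin(λ,μ)` with parameters `x` and `t`,
with its continuous diagonal value `(4tλ²+x)/π`. -/
def Kcsin (x t : ℝ) (lam mu : ℝ) : ℂ :=
  if lam = mu then (((4*t*lam^2 + x) / Real.pi : ℝ) : ℂ)
  else ((Real.sin ((4/3)*t*(lam^3 - mu^3) + x*(lam - mu)) / (Real.pi * (lam - mu)) : ℝ) : ℂ)

/-- The Fredholm determinant `det(I - k)` of the integral operator with continuous kernel `k`
acting on `L²((-s,s))`, defined by the Fredholm series. -/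
def fredholmDet (s : ℝ) (k : ℝ → ℝ → ℂ) : ℂ :=
  1 + ∑' n : ℕ, ((-1:ℂ)^(n+1) / (Nat.factorial (n+1) : ℂ)) *
    ∫ v : Fin (n+1) → ℝ in Set.pi Set.univ (fun _ => Set.Ioo (-s) s),
      (Matrix.of fun i j : Fin (n+1) => k (v i) (v j)).det


section
open MeasureTheory Filter Topology

namespace Csin

open scoped ComplexOrder in
/-- Hadamard type bound for determinants with bounded entries. -/
theorem hadamard_bound {n : ℕ} (A : Matrix (Fin n) (Fin n) ℂ) {M : ℝ} (hM : 0 ≤ M)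
    (hA : ∀ i j, ‖A i j‖ ≤ M) : ‖A.det‖ ≤ (Real.sqrt n * M) ^ n := by
  rcases Nat.eq_zero_or_pos n with rfl | hn
  · simp
  have hH : (A.conjTranspose * A).PosSemidef := Matrix.posSemidef_conjTranspose_mul_self A
  have hdet := hH.isHermitian.det_eq_prod_eigenvalues
  have htr := hH.isHermitian.trace_eq_sum_eigenvalues
  set ev := hH.isHermitian.eigenvalues with hev
  have hnn : ∀ i, 0 ≤ ev i := fun i => hH.eigenvalues_nonneg i
  have h1 : ‖A.det‖ ^ 2 = ∏ i, ev i := by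
    have h2 : (A.conjTranspose * A).det = ((‖A.det‖ ^ 2 : ℝ) : ℂ) := by
      rw [Matrix.det_mul, Matrix.det_conjTranspose]
      simpa using Complex.conj_mul' A.det
    rw [h2] at hdet
    have : ((‖A.det‖ ^ 2 : ℝ) : ℂ) = ((∏ i, ev i : ℝ) : ℂ) := by
      rw [hdet]; push_cast; rfl
    exact_mod_cast this
  have h3 : ∑ i, ev i ≤ n * (n * M ^ 2) := by
    have h4 : (A.conjTranspose * A).trace = ((∑ j, ∑ i, ‖A i j‖ ^ 2 : ℝ) : ℂ) := by
      simp only [Matrix.trace, Matrix.diag, Matrix.mul_apply, Matrix.conjTranspose_apply]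
      push_cast
      refine Finset.sum_congr rfl fun j _ => Finset.sum_congr rfl fun i _ => ?_
      simpa using Complex.conj_mul' (A i j)
    rw [h4] at htr
    have h5 : (∑ j, ∑ i, ‖A i j‖ ^ 2 : ℝ) = ∑ i, ev i := by
      have : ((∑ j, ∑ i, ‖A i j‖ ^ 2 : ℝ) : ℂ) = ((∑ i, ev i : ℝ) : ℂ) := by
        rw [htr]; push_cast; rfl
      exact_mod_cast this
    rw [← h5]
    calc (∑ j, ∑ i, ‖A i j‖ ^ 2 : ℝ) ≤ ∑ j : Fin n, ∑ i : Fin n, M ^ 2 := by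
          refine Finset.sum_le_sum fun j _ => Finset.sum_le_sum fun i _ => ?_
          exact pow_le_pow_left₀ (norm_nonneg _) (hA i j) 2
      _ = n * (n * M ^ 2) := by simp
  have hn' : (0:ℝ) < n := by exact_mod_cast hn
  have h6 : ∏ i, ev i ≤ (n * M ^ 2) ^ n := by
    have key := Real.geom_mean_le_arith_mean_weighted (Finset.univ : Finset (Fin n))
      (fun _ => (1 / n : ℝ)) ev (fun i _ => by positivity) (by simp; field_simp)
      (fun i _ => hnn i)
    rw [Real.finsetProd_rpow _ _ (fun i _ => hnn i)] at key
    rw [← Finset.mul_sum] at key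
    have h7 : (∏ i, ev i) ^ (1 / n : ℝ) ≤ n * M ^ 2 := by
      refine key.trans ?_
      rw [one_div, inv_mul_le_iff₀ hn']; exact h3
    have hp : 0 ≤ ∏ i, ev i := Finset.prod_nonneg fun i _ => hnn i
    calc ∏ i, ev i = ((∏ i, ev i) ^ (1 / n : ℝ)) ^ n := by
          rw [← Real.rpow_natCast, ← Real.rpow_mul hp]; field_simp; simp
      _ ≤ _ := pow_le_pow_left₀ (by positivity) h7 n
  have h8 : ‖A.det‖ ^ 2 ≤ ((Real.sqrt n * M) ^ n) ^ 2 := by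
    rw [h1]
    refine h6.trans (le_of_eq ?_)
    rw [← pow_mul, mul_comm n 2, pow_mul, mul_pow (Real.sqrt n), Real.sq_sqrt hn'.le]
  exact le_of_sq_le_sq h8 (by positivity)

/-- Hadamard constant -/
def hb (M : ℝ) (n : ℕ) : ℝ := (Real.sqrt n * M) ^ n

theorem hb_nonneg {M : ℝ} (hM : 0 ≤ M) (n : ℕ) : 0 ≤ hb M n := by unfold hb; positivity

theorem summable_hb {M c : ℝ} (hM : 0 ≤ M) (hc : 0 ≤ c) :
    Summable fun n : ℕ => hb M (n+1) * c ^ n / (n.factorial : ℝ) := by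
  set B : ℝ := 4 * (M ^ 2 * c ^ 2 * Real.exp 1) with hB
  have hs : Summable fun n : ℕ => (1/2 : ℝ) ^ n + M ^ 2 * Real.exp 1 * (B ^ n / (n.factorial : ℝ)) :=
    (summable_geometric_of_lt_one (by norm_num) (by norm_num)).add
      ((Real.summable_pow_div_factorial B).mul_left _)
  refine Summable.of_nonneg_of_le (fun n => ?_) (fun n => ?_) hs
  · have := hb_nonneg hM (n+1); positivity
  set t := hb M (n+1) * c ^ n / (n.factorial : ℝ) with ht
  have hf : (0:ℝ) < (n.factorial : ℝ) := by exact_mod_cast n.factorial_pos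
  have h1 : ((n:ℝ)+1) ^ (n+1) ≤ Real.exp 1 ^ (n+1) * (((n:ℝ)+1) * (n.factorial : ℝ)) := by
    have := Real.pow_div_factorial_le_exp ((n:ℝ)+1) (by positivity) (n+1)
    rw [div_le_iff₀ (by positivity), Nat.factorial_succ] at this
    push_cast at this
    rw [← Real.exp_nat_mul]
    push_cast
    simpa using this
  have h2 : ((n:ℝ)+1) ≤ 2 ^ n := by
    have := Nat.lt_two_pow_self (n := n)
    have h : n + 1 ≤ 2 ^ n := this
    exact_mod_cast h
  have h3 : t ^ 2 = ((n:ℝ)+1) ^ (n+1) * (M ^ 2) ^ (n+1) * (c ^ 2) ^ n / (n.factorial : ℝ) ^ 2 := by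
    rw [ht, hb, div_pow, mul_pow, ← pow_mul, mul_comm (n+1) 2, pow_mul, mul_pow, Real.sq_sqrt
      (by positivity), mul_pow]
    push_cast
    ring
  have h4 : t ^ 2 ≤ 2 ^ n * (M ^ 2 * Real.exp 1 * ((M ^ 2 * c ^ 2 * Real.exp 1) ^ n / (n.factorial : ℝ))) := by
    rw [h3, div_le_iff₀ (by positivity)]
    calc ((n:ℝ)+1) ^ (n+1) * (M ^ 2) ^ (n+1) * (c ^ 2) ^ n
        ≤ (Real.exp 1 ^ (n+1) * (2 ^ n * (n.factorial : ℝ))) * (M ^ 2) ^ (n+1) * (c ^ 2) ^ n := by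
          gcongr
          exact h1.trans (by gcongr)
      _ = _ := by field_simp; ring
  have h5 : t ≤ (1/2 : ℝ) ^ n + 2 ^ n * t ^ 2 := by
    have hp : (0:ℝ) < 2 ^ n := by positivity
    have e : (1/2 : ℝ) ^ n * 2 ^ n = 1 := by rw [← mul_pow]; norm_num
    have hq : (0:ℝ) < (1/2 : ℝ) ^ n := by positivity
    nlinarith [sq_nonneg (2 ^ n * t - 1), sq_nonneg (2 ^ n * t), mul_pos hp hp]
  refine h5.trans ?_
  have e2 : B ^ n = 2 ^ n * (2 ^ n * (M ^ 2 * c ^ 2 * Real.exp 1) ^ n) := by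
    rw [hB, mul_pow, ← mul_assoc, ← mul_pow (2:ℝ) 2 n]; norm_num
  have : 2 ^ n * t ^ 2 ≤ M ^ 2 * Real.exp 1 * (B ^ n / (n.factorial : ℝ)) := by
    calc _ ≤ 2 ^ n * (2 ^ n * (M ^ 2 * Real.exp 1 * ((M ^ 2 * c ^ 2 * Real.exp 1) ^ n / (n.factorial : ℝ)))) := by
          gcongr
      _ = _ := by rw [e2]; ring
  linarith

end Csin

end

section
open MeasureTheory Filter Topology

namespace Csin

def dk (k : ℝ → ℝ → ℂ) {n : ℕ} (v : Fin n → ℝ) : Matrix (Fin n) (Fin n) ℂ :=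
  Matrix.of fun i j => k (v i) (v j)

/-- bordered matrix -/
def bord (k : ℝ → ℝ → ℂ) (a : ℝ → ℂ) (x : ℝ) {n : ℕ} (v : Fin n → ℝ) :
    Matrix (Fin (n+1)) (Fin (n+1)) ℂ :=
  Matrix.of fun i j => (Fin.cons (a ((Fin.cons x v : Fin (n+1) → ℝ) i))
    (fun j' => k ((Fin.cons x v : Fin (n+1) → ℝ) i) (v j')) : Fin (n+1) → ℂ) j

theorem cons_removeNth {n : ℕ} (v : Fin (n+1) → ℝ) (j : Fin (n+1)) (i : Fin (n+1)) :
    (Fin.cons (v j) (j.removeNth v) : Fin (n+1) → ℝ) i = v (j.cycleRange.symm i) := by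
  refine Fin.cases ?_ (fun l => ?_) i
  · simp
  · simp [Fin.removeNth]

theorem bord_row (k : ℝ → ℝ → ℂ) (a : ℝ → ℂ) (x : ℝ) {n : ℕ} (v : Fin (n+1) → ℝ) :
    (bord k a x v).det = a x * (dk k v).det
      - ∑ j, k x (v j) * (bord k a (v j) (j.removeNth v)).det := by
  rw [Matrix.det_succ_row_zero, Fin.sum_univ_succ, sub_eq_add_neg, ← Finset.sum_neg_distrib]
  congr 1
  · simp [bord]
    left
    congr 1
  · refine Finset.sum_congr rfl fun j _ => ?_
    have h1 : (bord k a (v j) (j.removeNth v)).det =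
        (-1) ^ (j:ℕ) * ((bord k a x v).submatrix Fin.succ j.succ.succAbove).det := by
      have : bord k a (v j) (j.removeNth v) =
          ((bord k a x v).submatrix Fin.succ j.succ.succAbove).submatrix (j.cycleRange.symm) id := by
        ext i l
        simp only [bord, Matrix.of_apply, Matrix.submatrix_apply, cons_removeNth, Fin.cons_succ, id]
        refine Fin.cases ?_ (fun l => ?_) l
        · simp
        · simp [Fin.removeNth]
      rw [this, Matrix.det_permute]
      simp [Fin.sign_cycleRange]
    rw [h1]
    simp only [bord, Matrix.of_apply, Fin.cons_zero, Fin.cons_succ, Fin.val_succ]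
    have : ((-1:ℂ)) ^ (j:ℕ) * (-1) ^ (j:ℕ) = 1 := by rw [← mul_pow]; simp
    ring

theorem updateCol_bord (k : ℝ → ℝ → ℂ) (a : ℝ → ℂ) {n : ℕ} (v : Fin (n+1) → ℝ) (j : Fin (n+1)) :
    ((dk k v).updateCol j (fun i => a (v i))).det = (bord k a (v j) (j.removeNth v)).det := by
  rw [← Matrix.det_submatrix_equiv_self j.cycleRange.symm]
  congr 1
  ext i l
  simp only [bord, dk, Matrix.of_apply, Matrix.submatrix_apply, cons_removeNth]
  refine Fin.cases ?_ (fun l => ?_) l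
  · simp
  · rw [Matrix.updateCol_ne (by simp [Fin.succAbove_ne])]
    simp [Fin.removeNth]

theorem hasDerivAt_det {n : ℕ} {A A' : ℝ → Matrix (Fin n) (Fin n) ℂ} {s : ℝ}
    (h : ∀ i j, HasDerivAt (fun s => A s i j) (A' s i j) s) :
    HasDerivAt (fun s => (A s).det) (∑ j, ((A s).updateCol j (fun i => A' s i j)).det) s := by
  simp only [Matrix.det_apply]
  rw [Finset.sum_comm]
  refine HasDerivAt.fun_sum fun σ _ => ?_
  have := HasDerivAt.fun_finsetProd (u := Finset.univ) (x := s)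
    (f := fun (i : Fin n) (s : ℝ) => A s (σ i) i) (f' := fun i => A' s (σ i) i) (fun i _ => h (σ i) i)
  have h2 := this.const_smul (Equiv.Perm.sign σ : ℤˣ)
  refine h2.congr_deriv ?_
  rw [Finset.smul_sum]
  refine Finset.sum_congr rfl fun j _ => ?_
  congr 1
  rw [← Finset.mul_prod_erase _ _ (Finset.mem_univ j)]
  simp only [Matrix.updateCol_self, smul_eq_mul]
  rw [mul_comm]
  congr 1
  refine Finset.prod_congr rfl fun l hl => ?_
  rw [Matrix.updateCol_ne (Finset.ne_of_mem_erase hl)]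

theorem measurable_det {α : Type*} [MeasurableSpace α] {n : ℕ} {A : α → Matrix (Fin n) (Fin n) ℂ}
    (h : ∀ i j, Measurable fun x => A x i j) : Measurable fun x => (A x).det := by
  simp only [Matrix.det_apply]
  refine Finset.measurable_sum _ fun σ _ => ?_
  refine Measurable.const_smul ?_ _
  exact Finset.measurable_prod _ fun i _ => h _ _

end Csin

end

section
set_option linter.all false
open MeasureTheory Filter Topology

namespace Csin

/-- bounded measurable kernel -/
structure KOK (k : ℝ → ℝ → ℂ) (M : ℝ) : Prop where
  meas : Measurable (Function.uncurry k)
  bd : ∀ x y, ‖k x y‖ ≤ M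

/-- bounded measurable function -/
structure FOK (a : ℝ → ℂ) (M : ℝ) : Prop where
  meas : Measurable a
  bd : ∀ x, ‖a x‖ ≤ M

theorem KOK.nonneg {k : ℝ → ℝ → ℂ} {M : ℝ} (h : KOK k M) : 0 ≤ M := (norm_nonneg _).trans (h.bd 0 0)

def FT (μ : Measure ℝ) (k : ℝ → ℝ → ℂ) (n : ℕ) : ℂ :=
  ∫ v : Fin n → ℝ, (dk k v).det ∂(Measure.pi fun _ => μ)
def FN (μ : Measure ℝ) (k : ℝ → ℝ → ℂ) (a : ℝ → ℂ) (n : ℕ) (x : ℝ) : ℂ :=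
  ∫ v : Fin n → ℝ, (bord k a x v).det ∂(Measure.pi fun _ => μ)
def FD (μ : Measure ℝ) (k : ℝ → ℝ → ℂ) : ℂ := ∑' n : ℕ, ((-1:ℂ)^n / (n.factorial : ℂ)) * FT μ k n
def FG (μ : Measure ℝ) (k : ℝ → ℝ → ℂ) (a : ℝ → ℂ) (x : ℝ) : ℂ :=
  ∑' n : ℕ, ((-1:ℂ)^n / (n.factorial : ℂ)) * FN μ k a n x

variable {μ : Measure ℝ} [IsFiniteMeasure μ] {k : ℝ → ℝ → ℂ} {a : ℝ → ℂ} {M : ℝ}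

theorem pi_real (n : ℕ) : (Measure.pi fun _ : Fin n => μ).real Set.univ = (μ.real Set.univ) ^ n := by
  simp [Measure.real, Measure.pi_univ]

theorem KOK.meas_entry (hk : KOK k M) {α : Type*} [MeasurableSpace α] {f g : α → ℝ}
    (hf : Measurable f) (hg : Measurable g) : Measurable fun z => k (f z) (g z) :=
  hk.meas.comp (hf.prodMk hg)

theorem KOK.meas_dk (hk : KOK k M) (n : ℕ) : Measurable fun v : Fin n → ℝ => (dk k v).det :=
  measurable_det fun i j => hk.meas_entry (measurable_pi_apply i) (measurable_pi_apply j)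

theorem KOK.bd_dk (hk : KOK k M) {n : ℕ} (v : Fin n → ℝ) : ‖(dk k v).det‖ ≤ hb M n :=
  hadamard_bound _ hk.nonneg fun i j => hk.bd _ _

theorem meas_bord (hk : KOK k M) (ha : FOK a M) (n : ℕ) :
    Measurable fun p : ℝ × (Fin n → ℝ) => (bord k a p.1 p.2).det := by
  refine measurable_det fun i j => ?_
  have hp : Measurable fun p : ℝ × (Fin n → ℝ) => (Fin.cons p.1 p.2 : Fin (n+1) → ℝ) i := by
    refine Fin.cases ?_ (fun l => ?_) i
    · simpa using measurable_fst
    · exact (measurable_pi_apply l).comp measurable_snd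
  refine Fin.cases ?_ (fun l => ?_) j
  · exact ha.meas.comp hp
  · simpa [bord] using hk.meas_entry hp ((measurable_pi_apply l).comp measurable_snd)

theorem bd_bord (hk : KOK k M) (ha : FOK a M) {n : ℕ} (x : ℝ) (v : Fin n → ℝ) :
    ‖(bord k a x v).det‖ ≤ hb M (n+1) := by
  refine hadamard_bound _ hk.nonneg fun i j => ?_
  refine Fin.cases ?_ (fun l => ?_) j
  · simpa [bord] using ha.bd _
  · simpa [bord] using hk.bd _ _

theorem FT_bound (hk : KOK k M) (n : ℕ) : ‖FT μ k n‖ ≤ hb M n * (μ.real Set.univ) ^ n := by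
  rw [← pi_real]
  exact norm_integral_le_of_norm_le_const (ae_of_all _ fun v => hk.bd_dk v)

theorem FN_bound (hk : KOK k M) (ha : FOK a M) (n : ℕ) (x : ℝ) :
    ‖FN μ k a n x‖ ≤ hb M (n+1) * (μ.real Set.univ) ^ n := by
  rw [← pi_real]
  exact norm_integral_le_of_norm_le_const (ae_of_all _ fun v => bd_bord hk ha x v)

theorem FN_meas (hk : KOK k M) (ha : FOK a M) (n : ℕ) : Measurable (FN μ k a n) :=
  ((meas_bord hk ha n).stronglyMeasurable.integral_prod_right').measurable

theorem integral_removeNth {n : ℕ} {Φ : ℝ → (Fin n → ℝ) → ℂ} {C : ℝ}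
    (hm : Measurable (Function.uncurry Φ)) (hC : ∀ t u, ‖Φ t u‖ ≤ C) (j : Fin (n+1)) :
    ∫ v : Fin (n+1) → ℝ, Φ (v j) (j.removeNth v) ∂(Measure.pi fun _ => μ) =
      ∫ t, ∫ u : Fin n → ℝ, Φ t u ∂(Measure.pi fun _ => μ) ∂μ := by
  have h := (measurePreserving_piFinSuccAbove (fun _ : Fin (n+1) => μ) j).integral_comp'
    (g := fun p : ℝ × (Fin n → ℝ) => Φ p.1 p.2)
  have h2 : ∫ p : ℝ × (Fin n → ℝ), Φ p.1 p.2 ∂(μ.prod (Measure.pi fun _ => μ)) =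
      ∫ t, ∫ u : Fin n → ℝ, Φ t u ∂(Measure.pi fun _ => μ) ∂μ := by
    refine integral_prod _ ?_
    exact Integrable.of_bound (hm.aestronglyMeasurable) C (ae_of_all _ fun p => hC p.1 p.2)
  rw [← h2, ← h]
  rfl

theorem sum_removeNth {n : ℕ} {Φ : ℝ → (Fin n → ℝ) → ℂ} {C : ℝ}
    (hm : Measurable (Function.uncurry Φ)) (hC : ∀ t u, ‖Φ t u‖ ≤ C) :
    ∫ v : Fin (n+1) → ℝ, ∑ j : Fin (n+1), Φ (v j) (j.removeNth v) ∂(Measure.pi fun _ => μ) =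
      (n+1) * ∫ t, ∫ u : Fin n → ℝ, Φ t u ∂(Measure.pi fun _ => μ) ∂μ := by
  rw [integral_finsetSum]
  · simp only [integral_removeNth hm hC]
    simp
  · intro j _
    refine Integrable.of_bound (Measurable.aestronglyMeasurable ?_) C (ae_of_all _ fun p => hC _ _)
    refine hm.comp (f := fun v : Fin (n+1) → ℝ => (v j, j.removeNth v)) ?_
    exact (measurable_pi_apply j).prodMk (measurable_pi_iff.2 fun i => measurable_pi_apply _)

theorem FN_succ (hk : KOK k M) (ha : FOK a M) (n : ℕ) (x : ℝ) :
    FN μ k a (n+1) x = a x * FT μ k (n+1) - (n+1) * ∫ t, k x t * FN μ k a n t ∂μ := by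
  have hm : Measurable (Function.uncurry fun (t : ℝ) (u : Fin n → ℝ) => k x t * (bord k a t u).det) :=
    (hk.meas_entry measurable_const measurable_fst).mul (meas_bord hk ha n)
  have hC : ∀ (t : ℝ) (u : Fin n → ℝ), ‖k x t * (bord k a t u).det‖ ≤ M * hb M (n+1) := fun t u => by
    rw [norm_mul]
    exact mul_le_mul (hk.bd _ _) (bd_bord hk ha _ _) (norm_nonneg _) hk.nonneg
  have h1 := sum_removeNth (μ := μ) hm hC
  unfold FN
  simp only [bord_row]
  rw [integral_sub, integral_const_mul]
  · rw [h1]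
    simp only [integral_const_mul]
    rfl
  · refine Integrable.const_mul ?_ _
    exact Integrable.of_bound (hk.meas_dk _).aestronglyMeasurable _ (ae_of_all _ fun v => hk.bd_dk v)
  · refine integrable_finsetSum _ fun j _ => ?_
    refine Integrable.of_bound (Measurable.aestronglyMeasurable ?_) (M * hb M (n+1)) (ae_of_all _ fun p => hC _ _)
    refine hm.comp (f := fun v : Fin (n+1) → ℝ => (v j, j.removeNth v)) ?_
    exact (measurable_pi_apply j).prodMk (measurable_pi_iff.2 fun i => measurable_pi_apply _)

theorem FT_zero : FT μ k 0 = 1 := by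
  simp [FT, measureReal_def]

theorem FN_zero (x : ℝ) : FN μ k a 0 x = a x := by
  simp [FN, bord, measureReal_def]

theorem norm_coef (n : ℕ) : ‖((-1:ℂ)^n / (n.factorial : ℂ))‖ = 1 / (n.factorial : ℝ) := by
  simp

theorem summable_FG' (hM : 0 ≤ M) : Summable fun n : ℕ =>
    1 / (n.factorial : ℝ) * (hb M (n+1) * (μ.real Set.univ) ^ n) := by
  refine (summable_hb hM (c := μ.real Set.univ) measureReal_nonneg).congr fun n => ?_
  ring

theorem summable_FD' (hM : 0 ≤ M) : Summable fun n : ℕ =>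
    1 / (n.factorial : ℝ) * (hb M n * (μ.real Set.univ) ^ n) := by
  rw [← summable_nat_add_iff 1]
  refine Summable.of_nonneg_of_le (fun n => ?_) (fun n => ?_)
    ((summable_FG' (μ := μ) hM).mul_left (μ.real Set.univ))
  · have := hb_nonneg hM (n+1); positivity
  · have h1 := hb_nonneg hM (n+1)
    have h0 : (0:ℝ) ≤ μ.real Set.univ := measureReal_nonneg
    calc 1 / ((n+1).factorial : ℝ) * (hb M (n+1) * (μ.real Set.univ) ^ (n+1)) ≤
        1 / (n.factorial : ℝ) * (hb M (n+1) * (μ.real Set.univ) ^ (n+1)) := by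
          gcongr; omega
      _ = _ := by ring

theorem summable_FD (hk : KOK k M) : Summable fun n : ℕ =>
    ((-1:ℂ)^n / (n.factorial : ℂ)) * FT μ k n := by
  refine Summable.of_norm_bounded (summable_FD' (μ := μ) hk.nonneg) fun n => ?_
  rw [norm_mul, norm_coef]
  gcongr
  exact FT_bound hk n

theorem FG_term_bound (hk : KOK k M) (ha : FOK a M) (x : ℝ) (n : ℕ) :
    ‖((-1:ℂ)^n / (n.factorial : ℂ)) * FN μ k a n x‖ ≤
      1 / (n.factorial : ℝ) * (hb M (n+1) * (μ.real Set.univ) ^ n) := by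
  rw [norm_mul, norm_coef]
  gcongr
  exact FN_bound hk ha n x

theorem summable_FG (hk : KOK k M) (ha : FOK a M) (x : ℝ) : Summable fun n : ℕ =>
    ((-1:ℂ)^n / (n.factorial : ℂ)) * FN μ k a n x :=
  Summable.of_norm_bounded (summable_FG' (μ := μ) hk.nonneg) (FG_term_bound hk ha x)

theorem FG_meas (hk : KOK k M) (ha : FOK a M) : Measurable (FG μ k a) := by
  refine measurable_of_tendsto_metrizable (f := fun N x => ∑ n ∈ Finset.range N,
    ((-1:ℂ)^n / (n.factorial : ℂ)) * FN μ k a n x) (fun N => ?_) ?_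
  · exact Finset.measurable_sum _ fun n _ => (FN_meas hk ha n).const_mul _
  · rw [tendsto_pi_nhds]
    exact fun x => (summable_FG hk ha x).hasSum.tendsto_sum_nat

theorem FG_bdd (hk : KOK k M) (ha : FOK a M) : ∃ C, FOK (FG μ k a) C :=
  ⟨_, FG_meas hk ha, fun x => tsum_of_norm_bounded (summable_FG' (μ := μ) hk.nonneg).hasSum
    (FG_term_bound hk ha x)⟩

theorem hasSum_int_FG (hk : KOK k M) (ha : FOK a M) {b : ℝ → ℂ} {Cb : ℝ} (hb' : FOK b Cb) :
    HasSum (fun n : ℕ => ((-1:ℂ)^n / (n.factorial : ℂ)) * ∫ t, b t * FN μ k a n t ∂μ)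
      (∫ t, b t * FG μ k a t ∂μ) := by
  have hC : 0 ≤ Cb := (norm_nonneg _).trans (hb'.bd 0)
  have hbd : ∀ n t, ‖b t * (((-1:ℂ)^n / (n.factorial : ℂ)) * FN μ k a n t)‖ ≤
      Cb * (1 / (n.factorial : ℝ) * (hb M (n+1) * (μ.real Set.univ) ^ n)) := fun n t => by
    rw [norm_mul]
    exact mul_le_mul (hb'.bd t) (FG_term_bound hk ha t n) (norm_nonneg _) hC
  have hintg : ∀ n, Integrable (fun t => b t * (((-1:ℂ)^n / (n.factorial : ℂ)) * FN μ k a n t)) μ :=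
    fun n => Integrable.of_bound ((hb'.meas.mul ((FN_meas hk ha n).const_mul _)).aestronglyMeasurable)
      _ (ae_of_all _ (hbd n))
  have h := hasSum_integral_of_summable_integral_norm hintg ?_
  · have e1 : (fun n : ℕ => ((-1:ℂ)^n / (n.factorial : ℂ)) * ∫ t, b t * FN μ k a n t ∂μ) =
        fun n : ℕ => ∫ t, b t * (((-1:ℂ)^n / (n.factorial : ℂ)) * FN μ k a n t) ∂μ := by
      funext n
      rw [← integral_const_mul]
      congr 1; funext t; ring
    have e2 : ∫ t, b t * FG μ k a t ∂μ =
        ∫ t, ∑' n : ℕ, b t * (((-1:ℂ)^n / (n.factorial : ℂ)) * FN μ k a n t) ∂μ := by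
      congr 1; funext t; rw [tsum_mul_left]; rfl
    rw [e1, e2]
    exact h
  · refine Summable.of_nonneg_of_le (fun n => integral_nonneg fun t => norm_nonneg _) (fun n => ?_)
      (((summable_FG' (μ := μ) hk.nonneg).mul_left Cb).mul_right (μ.real Set.univ))
    have := norm_integral_le_of_norm_le_const (μ := μ)
      (f := fun t => ‖b t * (((-1:ℂ)^n / (n.factorial : ℂ)) * FN μ k a n t)‖)
      (ae_of_all _ fun t => by rw [norm_norm]; exact hbd n t)
    exact (le_abs_self _).trans this

/-- The Fredholm resolvent equation. -/
theorem FG_eq (hk : KOK k M) (ha : FOK a M) (x : ℝ) :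
    FG μ k a x = FD μ k * a x + ∫ t, k x t * FG μ k a t ∂μ := by
  have h1 := hasSum_int_FG (μ := μ) hk ha (b := k x) (Cb := M)
    ⟨hk.meas_entry measurable_const measurable_id, fun t => hk.bd _ _⟩
  have h2 : HasSum (fun n : ℕ => ((-1:ℂ)^(n+1) / ((n+1).factorial : ℂ)) * FT μ k (n+1)) (FD μ k - 1) := by
    have := (hasSum_nat_add_iff' 1).2 (summable_FD (μ := μ) hk).hasSum
    simpa [FT_zero, FD] using this
  have h3 : HasSum (fun n : ℕ => ((-1:ℂ)^(n+1) / ((n+1).factorial : ℂ)) * FN μ k a (n+1) x)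
      (FG μ k a x - a x) := by
    have := (hasSum_nat_add_iff' 1).2 (summable_FG (μ := μ) hk ha x).hasSum
    simpa [FN_zero, FG] using this
  have h4 := (h2.mul_left (a x)).add h1
  have h5 : HasSum (fun n : ℕ => ((-1:ℂ)^(n+1) / ((n+1).factorial : ℂ)) * FN μ k a (n+1) x)
      (a x * (FD μ k - 1) + ∫ t, k x t * FG μ k a t ∂μ) := by
    refine h4.congr_fun fun n => ?_
    rw [FN_succ hk ha]
    have : (n.factorial : ℂ) ≠ 0 := by exact_mod_cast n.factorial_ne_zero
    have : (n : ℂ) + 1 ≠ 0 := by exact_mod_cast n.succ_ne_zero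
    rw [Nat.factorial_succ]
    push_cast
    field_simp
    ring
  have h6 := h3.unique h5
  linear_combination h6

end Csin

end

section
set_option linter.all false
open MeasureTheory Filter Topology

namespace Csin
variable {μ : Measure ℝ} [IsFiniteMeasure μ]

theorem KOK.mono {k : ℝ → ℝ → ℂ} {M M' : ℝ} (h : KOK k M) (hM : M ≤ M') : KOK k M' :=
  ⟨h.meas, fun x y => (h.bd x y).trans hM⟩
theorem FOK.mono {k : ℝ → ℂ} {M M' : ℝ} (h : FOK k M) (hM : M ≤ M') : FOK k M' :=
  ⟨h.meas, fun x => (h.bd x).trans hM⟩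

theorem updateCol_bd {k kd : ℝ → ℝ → ℂ} {M : ℝ} (hk : KOK k M) (hkd : KOK kd M) {n : ℕ}
    (v : Fin n → ℝ) (j : Fin n) :
    ‖((dk k v).updateCol j (fun i => kd (v i) (v j))).det‖ ≤ hb M n := by
  refine hadamard_bound _ hk.nonneg fun i l => ?_
  by_cases h : l = j
  · subst h; simpa using hkd.bd _ _
  · rw [Matrix.updateCol_ne h]; exact hk.bd _ _

theorem updateCol_meas {k kd : ℝ → ℝ → ℂ} {M : ℝ} (hk : KOK k M) (hkd : KOK kd M) {n : ℕ}
    (j : Fin n) :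
    Measurable fun v : Fin n → ℝ => ((dk k v).updateCol j (fun i => kd (v i) (v j))).det := by
  refine measurable_det fun i l => ?_
  by_cases h : l = j
  · subst h
    simpa using hkd.meas_entry (measurable_pi_apply i) (measurable_pi_apply l)
  · simp only [Matrix.updateCol_ne h]
    exact hk.meas_entry (measurable_pi_apply i) (measurable_pi_apply l)

theorem FT_hasDerivAt {I : Set ℝ} (hI : IsOpen I) {k kd : ℝ → ℝ → ℝ → ℂ} {M : ℝ}
    (hk : ∀ s ∈ I, KOK (k s) M) (hkd : ∀ s ∈ I, KOK (kd s) M)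
    (hd : ∀ s ∈ I, ∀ x y, HasDerivAt (fun s => k s x y) (kd s x y) s) {s : ℝ} (hs : s ∈ I) (n : ℕ) :
    HasDerivAt (fun s => FT μ (k s) n) (∫ v : Fin n → ℝ,
      ∑ j, ((dk (k s) v).updateCol j (fun i => kd s (v i) (v j))).det ∂(Measure.pi fun _ => μ)) s := by
  refine (hasDerivAt_integral_of_dominated_loc_of_deriv_le (s := I) (hI.mem_nhds hs)
    (F := fun s (v : Fin n → ℝ) => (dk (k s) v).det)
    (F' := fun s (v : Fin n → ℝ) => ∑ j, ((dk (k s) v).updateCol j (fun i => kd s (v i) (v j))).det)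
    (bound := fun _ => n * hb M n) ?_ ?_ ?_ ?_ ?_ ?_).2
  · filter_upwards [hI.mem_nhds hs] with s hs
    exact ((hk s hs).meas_dk n).aestronglyMeasurable
  · exact Integrable.of_bound ((hk s hs).meas_dk n).aestronglyMeasurable _
      (ae_of_all _ fun v => (hk s hs).bd_dk v)
  · exact (Finset.measurable_sum _ fun j _ => updateCol_meas (hk s hs) (hkd s hs) j).aestronglyMeasurable
  · refine ae_of_all _ fun v t ht => ?_
    refine (norm_sum_le _ _).trans ?_
    refine (Finset.sum_le_sum fun j _ => updateCol_bd (hk t ht) (hkd t ht) v j).trans ?_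
    simp
  · exact integrable_const _
  · refine ae_of_all _ fun v t ht => ?_
    exact hasDerivAt_det (A := fun s => dk (k s) v) (A' := fun s => dk (kd s) v)
      (fun i j => hd t ht (v i) (v j))

theorem FD_hasDerivAt {I : Set ℝ} (hI : IsOpen I) (hI' : IsPreconnected I)
    {k kd : ℝ → ℝ → ℝ → ℂ} {M : ℝ}
    (hk : ∀ s ∈ I, KOK (k s) M) (hkd : ∀ s ∈ I, KOK (kd s) M)
    (hd : ∀ s ∈ I, ∀ x y, HasDerivAt (fun s => k s x y) (kd s x y) s) {s : ℝ} (hs : s ∈ I)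
    {ι : Type} [Fintype ι] {α β : ι → ℝ → ℂ} (hα : ∀ m, FOK (α m) M) (hβ : ∀ m, FOK (β m) M)
    (hsplit : ∀ x y, kd s x y = ∑ m, α m x * β m y) :
    HasDerivAt (fun s => FD μ (k s)) (-∑ m, ∫ t, β m t * FG μ (k s) (α m) t ∂μ) s := by
  have hM := (hk s hs).nonneg
  set c := μ.real Set.univ with hc
  have hc0 : 0 ≤ c := measureReal_nonneg
  set T : ℕ → ℝ → ℂ := fun n s => ∫ v : Fin n → ℝ,
      ∑ j, ((dk (k s) v).updateCol j (fun i => kd s (v i) (v j))).det ∂(Measure.pi fun _ => μ) with hT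
  have hTb : ∀ n t, t ∈ I → ‖T n t‖ ≤ n * hb M n * c ^ n := fun n t ht => by
    rw [hc, ← pi_real]
    refine norm_integral_le_of_norm_le_const (ae_of_all _ fun v => ?_)
    refine (norm_sum_le _ _).trans ?_
    refine (Finset.sum_le_sum fun j _ => updateCol_bd (hk t ht) (hkd t ht) v j).trans ?_
    simp
  have hsum : Summable fun n : ℕ => 1 / (n.factorial : ℝ) * (n * hb M n * c ^ n) := by
    rw [← summable_nat_add_iff 1]
    refine ((summable_FG' (μ := μ) hM).mul_left c).congr fun n => ?_
    have : (n.factorial : ℝ) ≠ 0 := by exact_mod_cast n.factorial_ne_zero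
    rw [Nat.factorial_succ]
    push_cast
    field_simp
    rw [hc]; ring
  have main := hasDerivAt_tsum_of_isPreconnected (𝕜 := ℝ) hsum hI hI'
    (g := fun n s => ((-1:ℂ)^n / (n.factorial : ℂ)) * FT μ (k s) n)
    (g' := fun n s => ((-1:ℂ)^n / (n.factorial : ℂ)) * T n s) (y := s) (y₀ := s)
    (fun n y hy => (FT_hasDerivAt hI hk hkd hd hy n).const_mul _)
    (fun n y hy => by
      rw [norm_mul, norm_coef]
      gcongr
      exact hTb n y hy) hs (summable_FD (hk s hs)) hs
  refine main.congr_deriv ?_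
  have hks := hk s hs
  have h1 : HasSum (fun n : ℕ => -∑ m, ((-1:ℂ)^n / (n.factorial : ℂ)) * ∫ t, β m t * FN μ (k s) (α m) n t ∂μ)
      (-∑ m, ∫ t, β m t * FG μ (k s) (α m) t ∂μ) :=
    (hasSum_sum fun m _ => hasSum_int_FG hks (hα m) (hβ m)).neg
  have h2 : ∀ n : ℕ, ((-1:ℂ)^(n+1) / ((n+1).factorial : ℂ)) * T (n+1) s =
      -∑ m, ((-1:ℂ)^n / (n.factorial : ℂ)) * ∫ t, β m t * FN μ (k s) (α m) n t ∂μ := by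
    intro n
    have h3 : T (n+1) s = (n+1) * ∑ m, ∫ t, β m t * FN μ (k s) (α m) n t ∂μ := by
      have hm : ∀ m, Measurable (Function.uncurry fun (t : ℝ) (u : Fin n → ℝ) =>
          β m t * (bord (k s) (α m) t u).det) := fun m =>
        ((hβ m).meas.comp measurable_fst).mul (meas_bord hks (hα m) n)
      have hC : ∀ m (t : ℝ) (u : Fin n → ℝ), ‖β m t * (bord (k s) (α m) t u).det‖ ≤ M * hb M (n+1) :=
        fun m t u => by
          rw [norm_mul]
          exact mul_le_mul ((hβ m).bd _) (bd_bord hks (hα m) _ _) (norm_nonneg _) hM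
      have h4 : ∀ v : Fin (n+1) → ℝ,
          ∑ j, ((dk (k s) v).updateCol j (fun i => kd s (v i) (v j))).det =
          ∑ m, ∑ j, β m (v j) * (bord (k s) (α m) (v j) (j.removeNth v)).det := by
        intro v
        rw [Finset.sum_comm]
        refine Finset.sum_congr rfl fun j _ => ?_
        have : (fun i => kd s (v i) (v j)) = ∑ m, β m (v j) • (fun i => α m (v i)) := by
          funext i
          simp [hsplit, mul_comm]
        rw [this, ← Matrix.cramer_apply, map_sum, Finset.sum_apply]
        refine Finset.sum_congr rfl fun m _ => ?_
        rw [map_smul, Pi.smul_apply, Matrix.cramer_apply, updateCol_bord]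
        rfl
      simp only [hT, h4]
      rw [integral_finsetSum, Finset.mul_sum]
      · refine Finset.sum_congr rfl fun m _ => ?_
        rw [sum_removeNth (hm m) (hC m)]
        simp only [integral_const_mul]
        rfl
      · intro m _
        refine integrable_finsetSum _ fun j _ => ?_
        refine Integrable.of_bound (Measurable.aestronglyMeasurable ?_) (M * hb M (n+1))
          (ae_of_all _ fun p => hC m _ _)
        refine (hm m).comp (f := fun v : Fin (n+1) → ℝ => (v j, j.removeNth v)) ?_
        exact (measurable_pi_apply j).prodMk (measurable_pi_iff.2 fun i => measurable_pi_apply _)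
    rw [h3, ← Finset.mul_sum, Nat.factorial_succ]
    have : (n.factorial : ℂ) ≠ 0 := by exact_mod_cast n.factorial_ne_zero
    have : (n : ℂ) + 1 ≠ 0 := by exact_mod_cast n.succ_ne_zero
    push_cast
    field_simp
    ring
  have h5 : Summable fun n : ℕ => ((-1:ℂ)^n / (n.factorial : ℂ)) * T n s :=
    Summable.of_norm_bounded hsum fun n => by
      rw [norm_mul, norm_coef]
      gcongr
      exact hTb n s hs
  rw [h5.tsum_eq_zero_add]
  have h0 : T 0 s = 0 := by simp [hT]
  simp only [h2, h0, mul_zero, zero_add]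
  exact h1.tsum_eq

/-- Continuity of the Fredholm determinant under bounded pointwise convergence. -/
theorem FD_tendsto {ι : Type*} {l : Filter ι} [l.IsCountablyGenerated] {k : ι → ℝ → ℝ → ℂ} {k0 : ℝ → ℝ → ℂ} {M : ℝ}
    (hk : ∀ᶠ s in l, KOK (k s) M) (hd : ∀ x y, Tendsto (fun s => k s x y) l (𝓝 (k0 x y)))
    (hM : 0 ≤ M) :
    Tendsto (fun s => FD μ (k s)) l (𝓝 (FD μ k0)) := by
  unfold FD
  refine tendsto_tsum_of_dominated_convergence (summable_FD' (μ := μ) hM) (fun n => ?_) ?_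
  · refine Tendsto.const_mul _ ?_
    refine tendsto_integral_filter_of_dominated_convergence (fun _ => hb M n) ?_ ?_ (integrable_const _) ?_
    · filter_upwards [hk] with s hs
      exact (hs.meas_dk n).aestronglyMeasurable
    · filter_upwards [hk] with s hs
      exact ae_of_all _ fun v => hs.bd_dk v
    · refine ae_of_all _ fun v => ?_
      simp only [Matrix.det_apply]
      refine tendsto_finset_sum _ fun σ _ => Tendsto.const_smul ?_ _
      exact tendsto_finset_prod _ fun i _ => hd _ _
  · filter_upwards [hk] with s hs n
    rw [norm_mul, norm_coef]
    gcongr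
    exact FT_bound hs n

/-- the determinant only depends on the kernel on a set of full measure -/
theorem FD_congr {k k' : ℝ → ℝ → ℂ} {Ω : Set ℝ} (hΩ : ∀ᵐ x ∂μ, x ∈ Ω)
    (h : ∀ x ∈ Ω, ∀ y ∈ Ω, k x y = k' x y) : FD μ k = FD μ k' := by
  unfold FD FT
  congr 1; funext n; congr 1
  refine integral_congr_ae ?_
  have : ∀ i : Fin n, ∀ᵐ v ∂(Measure.pi fun _ : Fin n => μ), v i ∈ Ω := fun i =>
    (Measure.tendsto_eval_ae_ae (μ := fun _ : Fin n => μ) (i := i)).eventually hΩ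
  filter_upwards [ae_all_iff.2 this] with v hv
  congr 1
  ext i j
  exact h _ (hv i) _ (hv j)

end Csin

end

section
set_option linter.all false
open MeasureTheory Filter Topology

namespace Csin

/-- Lebesgue measure on `(-1,1)` -/
def vol1 : Measure ℝ := volume.restrict (Set.Ioo (-1) 1)

instance : IsFiniteMeasure vol1 := by unfold vol1; infer_instance

open scoped Pointwise in
theorem FT_scale {s : ℝ} (hs : 0 < s) (k : ℝ → ℝ → ℂ) (n : ℕ) :
    ∫ v : Fin n → ℝ in Set.pi Set.univ (fun _ => Set.Ioo (-s) s),
      (Matrix.of fun i j : Fin n => k (v i) (v j)).det =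
    FT vol1 (fun x y => s * k (s * x) (s * y)) n := by
  unfold FT vol1
  rw [← Measure.restrict_pi_pi, ← volume_pi]
  have h := Measure.setIntegral_comp_smul_of_pos (volume : Measure (Fin n → ℝ))
    (fun v : Fin n → ℝ => (Matrix.of fun i j : Fin n => k (v i) (v j)).det)
    (Set.pi Set.univ (fun _ => Set.Ioo (-1) 1)) hs
  have h2 : s • (Set.pi Set.univ (fun _ : Fin n => Set.Ioo (-1:ℝ) 1)) =
      Set.pi Set.univ (fun _ => Set.Ioo (-s) s) := by
    ext v
    rw [Set.mem_smul_set_iff_inv_smul_mem₀ hs.ne']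
    simp only [Set.mem_pi, Set.mem_univ, true_imp_iff, Set.mem_Ioo, Pi.smul_apply, smul_eq_mul]
    refine forall_congr' fun i => ?_
    rw [inv_mul_lt_iff₀ hs, lt_inv_mul_iff₀ hs]
    simp
  rw [h2] at h
  have h3 : ∀ v : Fin n → ℝ, (dk (fun x y => (s:ℂ) * k (s * x) (s * y)) v).det =
      (s:ℂ) ^ n * (Matrix.of fun i j : Fin n => k ((s • v) i) ((s • v) j)).det := by
    intro v
    have : dk (fun x y => (s:ℂ) * k (s * x) (s * y)) v =
        (s:ℂ) • (Matrix.of fun i j : Fin n => k ((s • v) i) ((s • v) j)) := by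
      ext i j; simp [dk]
    rw [this, Matrix.det_smul]; simp
  simp only [h3]
  rw [integral_const_mul, h]
  simp only [Module.finrank_pi, Fintype.card_fin]
  rw [Complex.real_smul]
  push_cast
  have : (s:ℂ) ≠ 0 := by exact_mod_cast hs.ne'
  field_simp

theorem FT_congr1 {k k' : ℝ → ℝ → ℂ}
    (h : ∀ x ∈ Set.Ioo (-1:ℝ) 1, ∀ y ∈ Set.Ioo (-1:ℝ) 1, k x y = k' x y) (n : ℕ) :
    FT vol1 k n = FT vol1 k' n := by
  unfold FT
  refine integral_congr_ae ?_
  have hΩ : ∀ᵐ x ∂vol1, x ∈ Set.Ioo (-1:ℝ) 1 := ae_restrict_mem measurableSet_Ioo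
  have : ∀ i : Fin n, ∀ᵐ v ∂(Measure.pi fun _ : Fin n => vol1), v i ∈ Set.Ioo (-1:ℝ) 1 := fun i =>
    (Measure.tendsto_eval_ae_ae (μ := fun _ : Fin n => vol1) (i := i)).eventually hΩ
  filter_upwards [ae_all_iff.2 this] with v hv
  congr 1
  ext i j
  exact h _ (hv i) _ (hv j)

theorem FD_congr1 {k k' : ℝ → ℝ → ℂ}
    (h : ∀ x ∈ Set.Ioo (-1:ℝ) 1, ∀ y ∈ Set.Ioo (-1:ℝ) 1, k x y = k' x y) :
    FD vol1 k = FD vol1 k' := by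
  unfold FD; simp only [FT_congr1 h]

theorem fredholmDet_eq {s : ℝ} (hs : 0 < s) {k k' : ℝ → ℝ → ℂ} {M : ℝ} (hk' : KOK k' M)
    (h : ∀ x ∈ Set.Ioo (-1:ℝ) 1, ∀ y ∈ Set.Ioo (-1:ℝ) 1, s * k (s * x) (s * y) = k' x y) :
    fredholmDet s k = FD vol1 k' := by
  unfold fredholmDet
  simp only [FT_scale hs]
  simp only [FT_congr1 h]
  unfold FD
  rw [(summable_FD hk').tsum_eq_zero_add]
  simp [FT_zero]

end Csin

end

section
set_option linter.all false
open MeasureTheory Filter Topology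

namespace Csin

section conj
variable {μ : Measure ℝ} [IsFiniteMeasure μ] {k : ℝ → ℝ → ℂ} {a : ℝ → ℂ} {M : ℝ}

theorem FT_conj (hk : ∀ x y, (starRingEnd ℂ) (k x y) = k x y) (n : ℕ) :
    (starRingEnd ℂ) (FT μ k n) = FT μ k n := by
  unfold FT
  rw [← integral_conj]
  congr 1; funext v
  rw [RingHom.map_det]
  congr 1; ext i j; simp [dk, hk]

theorem FD_conj (hk : ∀ x y, (starRingEnd ℂ) (k x y) = k x y) :
    (starRingEnd ℂ) (FD μ k) = FD μ k := by
  unfold FD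
  rw [Complex.conj_tsum]
  congr 1; funext n
  simp [FT_conj hk]

theorem FN_conj (hk : ∀ x y, (starRingEnd ℂ) (k x y) = k x y) (n : ℕ) (x : ℝ) :
    FN μ k (fun x => (starRingEnd ℂ) (a x)) n x = (starRingEnd ℂ) (FN μ k a n x) := by
  unfold FN
  rw [← integral_conj]
  congr 1; funext v
  rw [RingHom.map_det]
  congr 1; ext i j
  refine Fin.cases ?_ (fun l => ?_) j
  · simp [bord]
  · simp [bord, hk]

theorem FG_conj (hk : ∀ x y, (starRingEnd ℂ) (k x y) = k x y) (x : ℝ) :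
    FG μ k (fun x => (starRingEnd ℂ) (a x)) x = (starRingEnd ℂ) (FG μ k a x) := by
  unfold FG
  rw [Complex.conj_tsum]
  congr 1; funext n
  simp [FN_conj hk]
end conj

/-- generalized sine kernel -/
def Kth (θ θ' : ℝ → ℝ) (x y : ℝ) : ℂ :=
  if x = y then ((θ' x / Real.pi : ℝ) : ℂ)
  else ((Real.sin (θ x - θ y) / (Real.pi * (x - y)) : ℝ) : ℂ)

theorem Kth_conj (θ θ' : ℝ → ℝ) (x y : ℝ) : (starRingEnd ℂ) (Kth θ θ' x y) = Kth θ θ' x y := by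
  unfold Kth; split_ifs <;> exact Complex.conj_ofReal _

/-- standing hypotheses on the phase -/
structure PhOK (θ θ' : ℝ → ℝ) (L L2 : ℝ) : Prop where
  deriv : ∀ x, HasDerivAt θ (θ' x) x
  bd : ∀ x, |θ' x| ≤ L
  lip : ∀ x y, |θ' x - θ' y| ≤ L2 * |x - y|

variable {θ θ' : ℝ → ℝ} {L L2 : ℝ}

theorem PhOK.nonneg (h : PhOK θ θ' L L2) : 0 ≤ L := (abs_nonneg _).trans (h.bd 0)
theorem PhOK.nonneg2 (h : PhOK θ θ' L L2) : 0 ≤ L2 := by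
  have := (abs_nonneg _).trans (h.lip 1 0); simpa using this

theorem PhOK.cont' (h : PhOK θ θ' L L2) : Continuous θ' := by
  have : LipschitzWith (Real.toNNReal L2) θ' := LipschitzWith.of_dist_le_mul fun x y => by
    rw [Real.dist_eq, Real.dist_eq, Real.coe_toNNReal _ h.nonneg2]; exact h.lip x y
  exact this.continuous

theorem PhOK.cont (h : PhOK θ θ' L L2) : Continuous θ :=
  continuous_iff_continuousAt.2 fun x => (h.deriv x).continuousAt

theorem PhOK.lip0 (h : PhOK θ θ' L L2) (x y : ℝ) : |θ x - θ y| ≤ L * |x - y| := by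
  have := convex_univ.norm_image_sub_le_of_norm_hasDerivWithin_le (f := θ) (f' := θ') (C := L)
    (s := Set.univ) (fun x _ => (h.deriv x).hasDerivWithinAt) (fun x _ => h.bd x)
    (Set.mem_univ y) (Set.mem_univ x)
  simpa using this

theorem PhOK.KOK (h : PhOK θ θ' L L2) : KOK (Kth θ θ') L := by
  have hpi := Real.pi_gt_three
  refine ⟨?_, fun x y => ?_⟩
  · unfold Kth Function.uncurry
    refine Measurable.ite (measurableSet_eq_fun measurable_fst measurable_snd) ?_ ?_
    · exact Complex.measurable_ofReal.comp ((h.cont'.measurable.comp measurable_fst).div_const _)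
    · refine Complex.measurable_ofReal.comp (Measurable.div ?_ ?_)
      · exact Real.measurable_sin.comp ((h.cont.measurable.comp measurable_fst).sub
          (h.cont.measurable.comp measurable_snd))
      · exact (measurable_fst.sub measurable_snd).const_mul _
  · unfold Kth
    split_ifs with hxy
    · rw [Complex.norm_real, Real.norm_eq_abs, abs_div, abs_of_pos Real.pi_pos, div_le_iff₀ Real.pi_pos]
      have := h.bd x; have := h.nonneg; nlinarith
    · rw [Complex.norm_real, Real.norm_eq_abs, abs_div, abs_mul, abs_of_pos Real.pi_pos]
      have h0 : 0 < |x - y| := abs_pos.2 (sub_ne_zero.2 hxy)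
      rw [div_le_iff₀ (by positivity)]
      have h1 := h.lip0 x y
      have h2 : |Real.sin (θ x - θ y)| ≤ |θ x - θ y| := Real.abs_sin_le_abs
      have := h.nonneg
      have h3 : 0 ≤ L * |x - y| := by positivity
      nlinarith

theorem PhOK.integral_rep (h : PhOK θ θ' L L2) (x y : ℝ) :
    Kth θ θ' x y = ((1 / Real.pi * ∫ t in (0:ℝ)..1, Real.cos (θ (y + t * (x - y)) - θ y) * θ' (y + t * (x - y)) : ℝ) : ℂ) := by
  unfold Kth
  split_ifs with hxy
  · subst hxy
    simp
    ring
  · congr 1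
    have h0 : x - y ≠ 0 := sub_ne_zero.2 hxy
    have hd : ∀ t ∈ Set.uIcc (0:ℝ) 1, HasDerivAt (fun t => Real.sin (θ (y + t * (x - y)) - θ y))
        (Real.cos (θ (y + t * (x - y)) - θ y) * (θ' (y + t * (x - y)) * (x - y))) t := by
      intro t _
      have h1 : HasDerivAt (fun t : ℝ => y + t * (x - y)) (x - y) t := by
        simpa using ((hasDerivAt_id t).mul_const (x - y)).const_add y
      exact (((h.deriv (y + t * (x - y))).comp t h1).sub_const (θ y)).sin
    have hc : Continuous fun t => Real.cos (θ (y + t * (x - y)) - θ y) * (θ' (y + t * (x - y)) * (x - y)) := by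
      have := h.cont; have := h.cont'
      fun_prop
    have := intervalIntegral.integral_eq_sub_of_hasDerivAt hd (hc.intervalIntegrable _ _)
    simp only [← mul_assoc] at this
    rw [intervalIntegral.integral_mul_const] at this
    simp at this
    rw [← this, one_div, mul_div_mul_right _ _ h0, div_eq_inv_mul]

theorem PhOK.Kth_lip (h : PhOK θ θ' L L2) (x x' y : ℝ) :
    ‖Kth θ θ' x y - Kth θ θ' x' y‖ ≤ (L ^ 2 + L2) * |x - x'| := by
  rw [h.integral_rep, h.integral_rep, ← Complex.ofReal_sub, Complex.norm_real, ← mul_sub, norm_mul]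
  have hL := h.nonneg
  have hL2 := h.nonneg2
  have hc : ∀ x, Continuous fun t => Real.cos (θ (y + t * (x - y)) - θ y) * θ' (y + t * (x - y)) := by
    intro x
    have := h.cont; have := h.cont'
    fun_prop
  rw [← intervalIntegral.integral_sub ((hc x).intervalIntegrable _ _) ((hc x').intervalIntegrable _ _)]
  have h1 : ‖∫ t in (0:ℝ)..1, (Real.cos (θ (y + t * (x - y)) - θ y) * θ' (y + t * (x - y))
      - Real.cos (θ (y + t * (x' - y)) - θ y) * θ' (y + t * (x' - y)))‖ ≤
      (L ^ 2 + L2) * |x - x'| * |(1:ℝ) - 0| := by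
    refine intervalIntegral.norm_integral_le_of_norm_le_const fun t ht => ?_
    rw [Set.uIoc_of_le zero_le_one] at ht
    set p := y + t * (x - y)
    set q := y + t * (x' - y)
    have hpq : |p - q| ≤ |x - x'| := by
      have : p - q = t * (x - x') := by simp only [p, q]; ring
      rw [this, abs_mul, abs_of_pos ht.1]
      exact mul_le_of_le_one_left (abs_nonneg _) ht.2
    have e : Real.cos (θ p - θ y) * θ' p - Real.cos (θ q - θ y) * θ' q =
        (Real.cos (θ p - θ y) - Real.cos (θ q - θ y)) * θ' p + Real.cos (θ q - θ y) * (θ' p - θ' q) := by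
      ring
    rw [e]
    have c1 : |Real.cos (θ p - θ y) - Real.cos (θ q - θ y)| ≤ L * |x - x'| := by
      have := Real.abs_cos_sub_cos_le (θ p - θ y) (θ q - θ y)
      refine this.trans ?_
      have e2 : θ p - θ y - (θ q - θ y) = θ p - θ q := by ring
      rw [e2]
      exact (h.lip0 p q).trans (by gcongr)
    have c2 : |θ' p - θ' q| ≤ L2 * |x - x'| := (h.lip p q).trans (by gcongr)
    calc _ ≤ |Real.cos (θ p - θ y) - Real.cos (θ q - θ y)| * |θ' p| + |Real.cos (θ q - θ y)| * |θ' p - θ' q| := by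
          rw [Real.norm_eq_abs, ← abs_mul, ← abs_mul]; exact abs_add_le _ _
      _ ≤ (L * |x - x'|) * L + 1 * (L2 * |x - x'|) := by
          gcongr
          · exact h.bd p
          · exact Real.abs_cos_le_one _
      _ = _ := by ring
  have h2 : ‖1 / Real.pi‖ ≤ 1 := by
    rw [Real.norm_eq_abs, abs_of_pos (by positivity), div_le_one Real.pi_pos]
    linarith [Real.pi_gt_three]
  calc _ ≤ 1 * ((L ^ 2 + L2) * |x - x'| * |(1:ℝ) - 0|) := by gcongr
    _ = _ := by simp

end Csin

end

section
set_option linter.all false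
open MeasureTheory Filter Topology

namespace Csin

/-- the quadratic denominator -/
def dq (μ : ℝ) (ζ : ℂ) : ℂ := 1 - 2 * μ * ζ + ζ ^ 2

theorem dq_normSq (μ : ℝ) (ζ : ℂ) {t : ℝ} (ht : t ^ 2 = 1 - μ ^ 2) : Complex.normSq (dq μ ζ) =
    ((ζ.re - μ) ^ 2 + (ζ.im - t) ^ 2) * ((ζ.re - μ) ^ 2 + (ζ.im + t) ^ 2) := by
  have h4 : t ^ 4 = (1 - μ^2)^2 := by rw [← ht]; ring
  rw [Complex.normSq_apply]
  simp only [dq, Complex.add_re, Complex.sub_re, Complex.one_re, Complex.mul_re, Complex.add_im,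
    Complex.sub_im, Complex.one_im, Complex.mul_im, pow_two, Complex.ofReal_re, Complex.ofReal_im,
    Complex.re_ofNat, Complex.im_ofNat]
  ring_nf
  rw [h4, ht]; ring

theorem dq_lower (μ : ℝ) (hμ : μ ∈ Set.Ioo (-1:ℝ) 1) (ζ : ℂ) :
    |μ - ζ.re| * Real.sqrt (1 - μ ^ 2) ≤ ‖dq μ ζ‖ := by
  have h1 : 0 ≤ 1 - μ ^ 2 := by nlinarith [hμ.1, hμ.2]
  set t := Real.sqrt (1 - μ ^ 2) with ht
  have ht2 : t ^ 2 = 1 - μ ^ 2 := Real.sq_sqrt h1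
  have := dq_normSq μ ζ ht2
  rw [Complex.normSq_eq_norm_sq] at this
  refine abs_le_of_sq_le_sq' ?_ (norm_nonneg _) |>.2
  rw [this, mul_pow, sq_abs]
  nlinarith [sq_nonneg ((ζ.re - μ) ^ 2), sq_nonneg ((ζ.im - t) * (ζ.im + t)), mul_nonneg (sq_nonneg (ζ.re - μ)) (sq_nonneg ζ.im), mul_nonneg (sq_nonneg (ζ.re - μ)) (sq_nonneg t)]

theorem dq_lower' (μ : ℝ) (hμ : μ ∈ Set.Icc (-1:ℝ) 1) {ζ : ℂ} {R : ℝ} (h : ‖ζ‖ ≤ R) (hR : R ≤ 1) :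
    (1 - R) ^ 2 ≤ ‖dq μ ζ‖ := by
  have h1 : 0 ≤ 1 - μ ^ 2 := by nlinarith [hμ.1, hμ.2]
  set t := Real.sqrt (1 - μ ^ 2) with ht
  have ht2 : t ^ 2 = 1 - μ ^ 2 := Real.sq_sqrt h1
  have ht3 : ((t:ℂ)) ^ 2 = 1 - (μ:ℂ) ^ 2 := by exact_mod_cast ht2
  have e : dq μ ζ = ((μ + t * Complex.I) - ζ) * ((μ - t * Complex.I) - ζ) := by
    unfold dq; ring_nf; rw [ht3, Complex.I_sq]; ring
  have n1 : ‖(μ + t * Complex.I : ℂ)‖ = 1 := by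
    rw [Complex.norm_add_mul_I, Real.sqrt_eq_one]; linarith
  have n2 : ‖(μ - t * Complex.I : ℂ)‖ = 1 := by
    have : (μ - t * Complex.I : ℂ) = (μ + ((-t : ℝ):ℂ) * Complex.I) := by push_cast; ring
    rw [this, Complex.norm_add_mul_I, Real.sqrt_eq_one]; linarith [neg_sq t]
  rw [e, norm_mul]
  have a1 := norm_sub_norm_le (μ + t * Complex.I : ℂ) ζ
  have a2 := norm_sub_norm_le (μ - t * Complex.I : ℂ) ζ
  rw [n1] at a1; rw [n2] at a2
  nlinarith

theorem dq_ne (μ : ℝ) (hμ : μ ∈ Set.Icc (-1:ℝ) 1) {ζ : ℂ} (h : ‖ζ‖ < 1) : dq μ ζ ≠ 0 := by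
  have := dq_lower' μ hμ le_rfl h.le
  intro h0
  rw [h0, norm_zero] at this
  nlinarith [sq_pos_of_pos (sub_pos.2 h)]

theorem dq_ne' (μ : ℝ) (hμ : μ ∈ Set.Ioo (-1:ℝ) 1) {ζ : ℂ} (h : ζ.re ≠ μ) : dq μ ζ ≠ 0 := by
  have := dq_lower μ hμ ζ
  intro h0
  rw [h0, norm_zero] at this
  have h1 : 0 < 1 - μ ^ 2 := by nlinarith [hμ.1, hμ.2]
  have : 0 < |μ - ζ.re| * Real.sqrt (1 - μ ^ 2) :=
    mul_pos (abs_pos.2 (sub_ne_zero.2 h.symm)) (Real.sqrt_pos.2 h1)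
  linarith

theorem dq_slit (μ : ℝ) (hμ : μ ∈ Set.Icc (-1:ℝ) 1) {ζ : ℂ} (h : ‖ζ‖ < 1) : dq μ ζ ∈ Complex.slitPlane := by
  have hn : ζ.re ^ 2 + ζ.im ^ 2 < 1 := by
    have : Complex.normSq ζ < 1 := by rw [Complex.normSq_eq_norm_sq]; nlinarith [norm_nonneg ζ]
    rw [Complex.normSq_apply] at this; nlinarith
  rw [Complex.mem_slitPlane_iff]
  have hre : (dq μ ζ).re = 1 - 2 * μ * ζ.re + ζ.re ^ 2 - ζ.im ^ 2 := by
    simp [dq, pow_two]; ring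
  have him : (dq μ ζ).im = 2 * ζ.im * (ζ.re - μ) := by
    simp [dq, pow_two]; ring
  rw [hre, him]
  by_cases hv : ζ.im = 0
  · left
    rw [hv] at hn ⊢
    obtain ⟨h1, h2⟩ := hμ
    have : -1 < ζ.re ∧ ζ.re < 1 := abs_lt.1 ((sq_lt_one_iff_abs_lt_one _).1 (by linarith))
    have a1 : 0 < (1 - ζ.re)^2 := by have := this.2; nlinarith
    have a2 : 0 < (1 + ζ.re)^2 := by have := this.1; nlinarith
    have e : 1 - 2 * μ * ζ.re + ζ.re ^ 2 - 0 ^ 2 = (1 + μ) / 2 * (1 - ζ.re)^2 + (1 - μ) / 2 * (1 + ζ.re)^2 := by ring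
    rw [e]
    rcases le_or_gt μ 0 with h0 | h0
    · have : 0 < (1 - μ) / 2 * (1 + ζ.re)^2 := mul_pos (by linarith) a2
      have : 0 ≤ (1 + μ) / 2 * (1 - ζ.re)^2 := mul_nonneg (by linarith) a1.le
      linarith
    · have : 0 ≤ (1 - μ) / 2 * (1 + ζ.re)^2 := mul_nonneg (by linarith) a2.le
      have : 0 < (1 + μ) / 2 * (1 - ζ.re)^2 := mul_pos (by linarith) a1
      linarith
  · by_cases hu : ζ.re = μ
    · left; rw [hu] at hn ⊢; nlinarith
    · right; exact mul_ne_zero (mul_ne_zero two_ne_zero hv) (sub_ne_zero.2 hu)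

theorem log_formula {ζ : ℂ} (h : ‖ζ‖ < 1) :
    ζ * ∫ μ, 1 / dq μ ζ ∂vol1 = Complex.log (1 + ζ) - Complex.log (1 - ζ) := by
  have hn := Complex.abs_re_le_norm ζ
  have hr := abs_lt.1 (hn.trans_lt h)
  have hd : ∀ μ ∈ Set.uIcc (-1:ℝ) 1, HasDerivAt (fun μ : ℝ => -(1/2) * Complex.log (dq μ ζ))
      (ζ * (1 / dq μ ζ)) μ := by
    intro μ hμ
    rw [Set.uIcc_of_le (by norm_num)] at hμ
    have h1 : HasDerivAt (fun μ : ℝ => dq μ ζ) (-2 * ζ) μ := by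
      unfold dq
      have := ((((Complex.ofRealCLM.hasDerivAt (x := μ)).const_mul (2:ℂ)).mul_const ζ).const_sub 1).add_const (ζ^2)
      refine this.congr_deriv ?_
      simp
    have := (h1.clog_real (dq_slit μ hμ h)).const_mul (-(1/2):ℂ)
    refine this.congr_deriv ?_
    field_simp
  have hc : ContinuousOn (fun μ : ℝ => ζ * (1 / dq μ ζ)) (Set.uIcc (-1:ℝ) 1) := by
    rw [Set.uIcc_of_le (by norm_num)]
    refine ContinuousOn.mul continuousOn_const (ContinuousOn.div continuousOn_const ?_ fun μ hμ => dq_ne μ hμ h)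
    unfold dq; fun_prop
  have := intervalIntegral.integral_eq_sub_of_hasDerivAt hd (hc.intervalIntegrable)
  rw [intervalIntegral.integral_of_le (by norm_num), integral_Ioc_eq_integral_Ioo] at this
  rw [← MeasureTheory.integral_const_mul]
  unfold vol1
  rw [this]
  have e1 : dq 1 ζ = (1 - ζ) ^ 2 := by unfold dq; push_cast; ring
  have e2 : dq (-1) ζ = (1 + ζ) ^ 2 := by unfold dq; push_cast; ring
  have l2 : ∀ z : ℂ, 0 < z.re → Complex.log (z ^ 2) = 2 * Complex.log z := by
    intro z hz
    have := abs_lt.1 (Complex.abs_arg_lt_pi_div_two_iff.2 (Or.inl hz))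
    have hz0 : z ≠ 0 := by rintro rfl; simp at hz
    rw [pow_two, (Complex.log_mul_eq_add_log_iff hz0 hz0).2]
    · ring
    · constructor <;> linarith [this.1, this.2]
  rw [e1, e2, l2 _ (by simp; linarith), l2 _ (by simp; linarith)]
  ring

end Csin

end

section
set_option linter.all false
open MeasureTheory Filter Topology

namespace Csin

theorem vol1_ae : ∀ᵐ μ ∂vol1, μ ∈ Set.Ioo (-1:ℝ) 1 := by
  unfold vol1; exact ae_restrict_mem measurableSet_Ioo

theorem vol1_ae_ne (c : ℝ) : ∀ᵐ μ ∂vol1, μ ≠ c := by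
  unfold vol1
  refine ae_restrict_of_ae ?_
  exact Measure.ae_ne volume c

theorem cont_half {s : Set ℂ} (hs : ∀ z ∈ s, 0 ≤ z.re) : ContinuousOn (fun z : ℂ => z ^ (1/2:ℂ)) s := by
  intro z hz
  exact (Complex.continuousAt_cpow_const_of_re_pos (Or.inl (hs z hz)) (by norm_num)).continuousWithinAt

theorem cont_halflog {s : Set ℂ} (hs : ∀ z ∈ s, 0 ≤ z.re) :
    ContinuousOn (fun z : ℂ => z ^ (1/2:ℂ) * Complex.log z) s := by
  intro z hz
  by_cases h0 : z = 0
  · subst h0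
    refine ContinuousAt.continuousWithinAt ?_
    unfold ContinuousAt
    simp only [Complex.log_zero, mul_zero]
    rw [tendsto_zero_iff_norm_tendsto_zero]
    have hb : ∀ z : ℂ, ‖z ^ (1/2:ℂ) * Complex.log z‖ ≤ |Real.log ‖z‖ * ‖z‖ ^ (1/2:ℝ)| + Real.pi * ‖z‖ ^ (1/2:ℝ) := by
      intro z
      rw [norm_mul]
      by_cases hz : z = 0
      · simp [hz]
      have e : ‖z ^ (1/2:ℂ)‖ = ‖z‖ ^ (1/2:ℝ) := by
        have := Complex.norm_cpow_real z (1/2)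
        simpa using this
      rw [e, abs_mul, abs_of_nonneg (a := ‖z‖ ^ (1/2:ℝ)) (by positivity)]
      have : ‖Complex.log z‖ ≤ |Real.log ‖z‖| + Real.pi := by
        refine (Complex.norm_le_abs_re_add_abs_im _).trans ?_
        rw [Complex.log_re, Complex.log_im]
        gcongr
        exact Complex.abs_arg_le_pi z
      have h3 : 0 ≤ ‖z‖ ^ (1/2:ℝ) := by positivity
      nlinarith
    have hn : Tendsto (fun z : ℂ => ‖z‖) (𝓝 0) (𝓝 0) := by simpa using (continuous_norm (E := ℂ)).tendsto 0
    have t2 : Tendsto (fun x : ℝ => x ^ (1/2:ℝ)) (𝓝 0) (𝓝 0) := by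
      have := (Real.continuousAt_rpow_const 0 (1/2) (Or.inr (by norm_num))).tendsto
      rwa [Real.zero_rpow (by norm_num)] at this
    have t1 : Tendsto (fun x : ℝ => |Real.log x * x ^ (1/2:ℝ)|) (𝓝[≥] 0) (𝓝 0) := by
      have := (tendsto_log_mul_rpow_nhdsGT_zero (r := 1/2) (by norm_num)).abs
      rw [abs_zero] at this
      have e : Set.Ici (0:ℝ) = insert 0 (Set.Ioi 0) := by ext x; simp [le_iff_eq_or_lt, eq_comm]
      rw [e, nhdsWithin_insert, tendsto_sup]
      refine ⟨?_, this⟩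
      rw [tendsto_pure_left]
      intro s hs
      simpa using mem_of_mem_nhds hs
    have hn' : Tendsto (fun z : ℂ => ‖z‖) (𝓝 0) (𝓝[≥] 0) :=
      tendsto_nhdsWithin_iff.2 ⟨hn, Eventually.of_forall fun z => norm_nonneg z⟩
    have := (t1.comp hn').add ((t2.comp hn).const_mul Real.pi)
    rw [mul_zero, add_zero] at this
    exact squeeze_zero (fun _ => norm_nonneg _) hb this
  · have hsl : z ∈ Complex.slitPlane := by
      have := hs z hz
      rw [Complex.mem_slitPlane_iff]
      rcases this.lt_or_eq with h | h
      · exact Or.inl h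
      · right; intro hi; exact h0 (Complex.ext h.symm hi)
    exact (((Complex.continuousAt_cpow_const_of_re_pos (Or.inl (hs z hz)) (by norm_num))).mul
      (continuousAt_clog hsl)).continuousWithinAt

/-- `√(1-ζ²)` on the disc -/
def sq (ζ : ℂ) : ℂ := (1 + ζ) ^ (1/2:ℂ) * (1 - ζ) ^ (1/2:ℂ)
def sqlg (ζ : ℂ) : ℂ := (1 - ζ) ^ (1/2:ℂ) * ((1 + ζ) ^ (1/2:ℂ) * Complex.log (1 + ζ))
  - (1 + ζ) ^ (1/2:ℂ) * ((1 - ζ) ^ (1/2:ℂ) * Complex.log (1 - ζ))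

theorem sqlg_eq (ζ : ℂ) : sqlg ζ = sq ζ * (Complex.log (1 + ζ) - Complex.log (1 - ζ)) := by
  unfold sqlg sq; ring

theorem re_bd {ζ : ℂ} (h : ζ ∈ Metric.closedBall (0:ℂ) 1) : 0 ≤ (1 + ζ).re ∧ 0 ≤ (1 - ζ).re := by
  have hn := Complex.abs_re_le_norm ζ
  have h1 : ‖ζ‖ ≤ 1 := by simpa using h
  have hr := abs_le.1 (hn.trans h1)
  simp; constructor <;> linarith

theorem re_bd' {ζ : ℂ} (h : ‖ζ‖ < 1) : 0 < (1 + ζ).re ∧ 0 < (1 - ζ).re := by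
  have hn := Complex.abs_re_le_norm ζ
  have hr := abs_lt.1 (hn.trans_lt h)
  simp; constructor <;> linarith

theorem sq_cont : ContinuousOn sq (Metric.closedBall 0 1) := by
  unfold sq
  refine ContinuousOn.mul ?_ ?_
  · exact (cont_half (s := {z | 0 ≤ z.re}) (fun z hz => hz)).comp (by fun_prop) fun z hz => (re_bd hz).1
  · exact (cont_half (s := {z | 0 ≤ z.re}) (fun z hz => hz)).comp (by fun_prop) fun z hz => (re_bd hz).2

theorem sqlg_cont : ContinuousOn sqlg (Metric.closedBall 0 1) := by
  unfold sqlg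
  refine ContinuousOn.sub (ContinuousOn.mul ?_ ?_) (ContinuousOn.mul ?_ ?_)
  · exact (cont_half (s := {z | 0 ≤ z.re}) (fun z hz => hz)).comp (by fun_prop) fun z hz => (re_bd hz).2
  · exact (cont_halflog (s := {z | 0 ≤ z.re}) (fun z hz => hz)).comp (g := fun z : ℂ => z ^ (1/2:ℂ) * Complex.log z) (f := fun z => 1 + z) (by fun_prop) fun z hz => (re_bd hz).1
  · exact (cont_half (s := {z | 0 ≤ z.re}) (fun z hz => hz)).comp (by fun_prop) fun z hz => (re_bd hz).1
  · exact (cont_halflog (s := {z | 0 ≤ z.re}) (fun z hz => hz)).comp (g := fun z : ℂ => z ^ (1/2:ℂ) * Complex.log z) (f := fun z => 1 - z) (by fun_prop) fun z hz => (re_bd hz).2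

theorem sq_sq {ζ : ℂ} (h : ‖ζ‖ < 1) : sq ζ * sq ζ = 1 - ζ ^ 2 := by
  have h1 : ∀ z : ℂ, 0 < z.re → z ^ (1/2:ℂ) * z ^ (1/2:ℂ) = z := by
    intro z hz
    have hz0 : z ≠ 0 := by rintro rfl; simp at hz
    rw [← Complex.cpow_add _ _ hz0]; norm_num
  unfold sq
  have a := h1 _ (re_bd' h).1
  have b := h1 _ (re_bd' h).2
  linear_combination (1 - ζ) ^ (1/2:ℂ) * (1 - ζ) ^ (1/2:ℂ) * a + (1 + ζ) * b

theorem sq_hasDerivAt {ζ : ℂ} (h : ‖ζ‖ < 1) : HasDerivAt sq (sq ζ * (-ζ / (1 - ζ ^ 2))) ζ := by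
  obtain ⟨h1, h2⟩ := re_bd' h
  have n1 : (1 + ζ) ≠ 0 := by intro hh; rw [hh] at h1; simp at h1
  have n2 : (1 - ζ) ≠ 0 := by intro hh; rw [hh] at h2; simp at h2
  have d1 := ((hasDerivAt_id ζ).const_add 1).cpow_const (c := (1/2:ℂ)) (Or.inl h1)
  have d2 := ((hasDerivAt_id ζ).const_sub 1).cpow_const (c := (1/2:ℂ)) (Or.inl h2)
  have := d1.mul d2
  unfold sq
  refine this.congr_deriv ?_
  simp only [id]
  rw [Complex.cpow_sub _ _ n1, Complex.cpow_sub _ _ n2, Complex.cpow_one, Complex.cpow_one]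
  have e : (1:ℂ) - ζ ^ 2 = (1 + ζ) * (1 - ζ) := by ring
  rw [e]
  field_simp
  ring

end Csin

end

section
set_option linter.all false
open MeasureTheory Filter Topology

namespace Csin

def Phat (m : ℝ → ℂ) (ζ : ℂ) : ℂ := ∫ μ, m μ / dq μ ζ ∂vol1
def Jm (m : ℝ → ℂ) (ζ : ℂ) : ℂ := ∫ μ, (m μ - m ζ.re) / dq μ ζ ∂vol1
def Fm (m : ℝ → ℂ) (ζ : ℂ) : ℂ := sq ζ * ζ * Jm m ζ + m ζ.re * sqlg ζ
def Ft (m : ℝ → ℂ) (ζ : ℂ) : ℂ := if ‖ζ‖ < 1 then sq ζ * Phat m ζ else Fm m ζ / ζ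

/-- bounded Lipschitz function -/
structure LOK (m : ℝ → ℂ) (C Λ : ℝ) : Prop where
  bd : ∀ x, ‖m x‖ ≤ C
  lip : ∀ x y, ‖m x - m y‖ ≤ Λ * |x - y|

variable {m : ℝ → ℂ} {C Λ : ℝ}

theorem LOK.nonneg (h : LOK m C Λ) : 0 ≤ C := (norm_nonneg _).trans (h.bd 0)
theorem LOK.nonneg2 (h : LOK m C Λ) : 0 ≤ Λ := by
  have := (norm_nonneg _).trans (h.lip 1 0); simpa using this
theorem LOK.cont (h : LOK m C Λ) : Continuous m := by
  have : LipschitzWith (Real.toNNReal Λ) m := LipschitzWith.of_dist_le_mul fun x y => by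
    rw [dist_eq_norm, Real.dist_eq, Real.coe_toNNReal _ h.nonneg2]; exact h.lip x y
  exact this.continuous

theorem dq_cont (ζ : ℂ) : Continuous fun μ : ℝ => dq μ ζ := by unfold dq; fun_prop
theorem dq_cont' (μ : ℝ) : Continuous fun ζ : ℂ => dq μ ζ := by unfold dq; fun_prop

theorem Phat_int (h : LOK m C Λ) {ζ : ℂ} (hζ : ‖ζ‖ < 1) : Integrable (fun μ => m μ / dq μ ζ) vol1 := by
  refine Integrable.of_bound (C := C / (1 - ‖ζ‖)^2) ?_ ?_
  · exact (h.cont.measurable.div (dq_cont ζ).measurable).aestronglyMeasurable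
  · filter_upwards [vol1_ae] with μ hμ
    rw [norm_div]
    have := dq_lower' μ (Set.Ioo_subset_Icc_self hμ) le_rfl hζ.le
    have h1 : 0 < (1 - ‖ζ‖)^2 := sq_pos_of_pos (by linarith)
    gcongr
    · exact h.nonneg
    · exact h.bd μ

theorem one_LOK : LOK (fun _ => (1:ℂ)) 1 0 := ⟨by simp, by simp⟩

theorem Phat_diff (h : LOK m C Λ) {ζ : ℂ} (hζ : ‖ζ‖ < 1) : DifferentiableAt ℂ (Phat m) ζ := by
  obtain ⟨R, hR, hR1⟩ := exists_between hζ
  have hmem : Metric.ball (0:ℂ) R ∈ 𝓝 ζ := Metric.isOpen_ball.mem_nhds (by simpa using hR)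
  have hR2 : 0 < (1 - R)^2 := sq_pos_of_pos (by linarith)
  have := hasDerivAt_integral_of_dominated_loc_of_deriv_le (μ := vol1) (𝕜 := ℂ) (F := fun ζ μ => m μ / dq μ ζ)
    (F' := fun ζ μ => - (m μ * (2 * ζ - 2 * μ)) / (dq μ ζ)^2) (x₀ := ζ) (s := Metric.ball (0:ℂ) R)
    (bound := fun _ => C * 4 / ((1 - R)^2)^2) hmem ?_ (Phat_int h hζ) ?_ ?_ ?_ ?_
  · exact this.2.differentiableAt
  · exact Eventually.of_forall fun z => (h.cont.measurable.div (dq_cont z).measurable).aestronglyMeasurable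
  · refine Measurable.aestronglyMeasurable ?_
    refine Measurable.div ?_ ((dq_cont ζ).measurable.pow_const 2)
    have := h.cont
    exact Continuous.measurable (by fun_prop)
  · filter_upwards [vol1_ae] with μ hμ z hz
    have hz : ‖z‖ < R := by simpa using hz
    have hd := dq_lower' μ (Set.Ioo_subset_Icc_self hμ) hz.le hR1.le
    rw [norm_div, norm_neg, norm_mul, norm_pow]
    have hC := h.nonneg
    have : ‖2 * z - 2 * (μ:ℂ)‖ ≤ 4 := by
      refine (norm_sub_le _ _).trans ?_
      rw [norm_mul, norm_mul, Complex.norm_real]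
      have : ‖μ‖ ≤ 1 := abs_le.2 ⟨hμ.1.le, hμ.2.le⟩
      simp only [Complex.norm_ofNat]; linarith
    gcongr
    exact h.bd μ
  · exact integrable_const _
  · filter_upwards [vol1_ae] with μ hμ z hz
    have hz : ‖z‖ < R := by simpa using hz
    have hd := dq_ne μ (Set.Ioo_subset_Icc_self hμ) (hz.trans hR1)
    have h1 : HasDerivAt (fun z => dq μ z) (2 * z - 2 * μ) z := by
      unfold dq
      have := (((hasDerivAt_id z).const_mul (2 * (μ:ℂ))).const_sub 1).add ((hasDerivAt_id z).pow 2)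
      refine this.congr_deriv ?_
      simp; ring
    have := (hasDerivAt_const z (m μ)).div h1 hd
    refine this.congr_deriv ?_
    simp

theorem inv_sqrt_int : Integrable (fun μ : ℝ => 1 / Real.sqrt (1 - μ ^ 2)) vol1 := by
  have hd : ∀ x ∈ Set.Ioo (-1:ℝ) 1, HasDerivAt Real.arcsin (1 / Real.sqrt (1 - x ^ 2)) x := by
    intro x hx
    exact Real.hasDerivAt_arcsin hx.1.ne' hx.2.ne
  have := intervalIntegral.integrableOn_deriv_of_nonneg (a := -1) (b := 1) (g := Real.arcsin)
    (g' := fun x => 1 / Real.sqrt (1 - x ^ 2)) Real.continuous_arcsin.continuousOn hd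
    (fun x _ => by positivity)
  exact this.mono_set Set.Ioo_subset_Ioc_self

theorem J_bound (h : LOK m C Λ) (ζ : ℂ) {μ : ℝ} (hμ : μ ∈ Set.Ioo (-1:ℝ) 1) :
    ‖(m μ - m ζ.re) / dq μ ζ‖ ≤ Λ * (1 / Real.sqrt (1 - μ ^ 2)) := by
  have h1 : 0 < Real.sqrt (1 - μ ^ 2) := Real.sqrt_pos.2 (by nlinarith [hμ.1, hμ.2])
  rw [norm_div]
  by_cases hd : ‖dq μ ζ‖ = 0
  · rw [hd, div_zero]; have := h.nonneg2; positivity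
  have hd : 0 < ‖dq μ ζ‖ := lt_of_le_of_ne (norm_nonneg _) (Ne.symm hd)
  rw [div_le_iff₀ hd]
  refine (h.lip _ _).trans ?_
  have := dq_lower μ hμ ζ
  rw [mul_assoc]
  refine mul_le_mul_of_nonneg_left ?_ h.nonneg2
  rw [one_div, inv_mul_eq_div, le_div_iff₀ h1]
  exact this

theorem J_meas (h : LOK m C Λ) (ζ : ℂ) :
    AEStronglyMeasurable (fun μ => (m μ - m ζ.re) / dq μ ζ) vol1 :=
  ((h.cont.measurable.sub measurable_const).div (dq_cont ζ).measurable).aestronglyMeasurable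

theorem J_int (h : LOK m C Λ) (ζ : ℂ) : Integrable (fun μ => (m μ - m ζ.re) / dq μ ζ) vol1 := by
  refine Integrable.mono' (inv_sqrt_int.const_mul Λ) (J_meas h ζ) ?_
  filter_upwards [vol1_ae] with μ hμ
  exact J_bound h ζ hμ

theorem J_cont (h : LOK m C Λ) : Continuous (Jm m) := by
  refine continuous_iff_continuousAt.2 fun ζ => ?_
  unfold Jm
  refine continuousAt_of_dominated (bound := fun μ => Λ * (1 / Real.sqrt (1 - μ ^ 2)))
    (Eventually.of_forall fun z => J_meas h z) ?_ (inv_sqrt_int.const_mul Λ) ?_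
  · refine Eventually.of_forall fun z => ?_
    filter_upwards [vol1_ae] with μ hμ
    exact J_bound h z hμ
  · filter_upwards [vol1_ae, vol1_ae_ne ζ.re] with μ hμ hne
    have h1 := h.cont
    refine ContinuousAt.div ?_ (dq_cont' μ).continuousAt (dq_ne' μ hμ hne.symm)
    have : Continuous fun x : ℂ => m μ - m x.re := continuous_const.sub (h1.comp Complex.continuous_re)
    exact this.continuousAt

theorem Fm_cont (h : LOK m C Λ) : ContinuousOn (Fm m) (Metric.closedBall 0 1) := by
  unfold Fm
  have h1 : Continuous fun x : ℂ => m x.re := h.cont.comp Complex.continuous_re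
  exact ((sq_cont.mul continuousOn_id).mul (J_cont h).continuousOn).add (h1.continuousOn.mul sqlg_cont)

theorem Fm_ball (h : LOK m C Λ) {ζ : ℂ} (hζ : ‖ζ‖ < 1) : Fm m ζ = sq ζ * Phat m ζ * ζ := by
  have e : Jm m ζ = Phat m ζ - m ζ.re * ∫ μ, 1 / dq μ ζ ∂vol1 := by
    unfold Jm Phat
    rw [← integral_const_mul, ← integral_sub (Phat_int h hζ) ((Phat_int one_LOK hζ).const_mul _)]
    congr 1; funext μ; ring
  unfold Fm
  rw [sqlg_eq, ← log_formula hζ, e]; ring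

theorem Ft_eq (h : LOK m C Λ) {ζ : ℂ} (h0 : ζ ≠ 0) : Ft m ζ = Fm m ζ / ζ := by
  unfold Ft
  split_ifs with h1
  · rw [Fm_ball h h1]; field_simp
  · rfl

theorem Ft_ball {ζ : ℂ} (h1 : ‖ζ‖ < 1) : Ft m ζ = sq ζ * Phat m ζ := by
  unfold Ft; rw [if_pos h1]

theorem sq_diff {ζ : ℂ} (h : ‖ζ‖ < 1) : DifferentiableAt ℂ sq ζ := (sq_hasDerivAt h).differentiableAt

theorem Ft_diff (h : LOK m C Λ) {ζ : ℂ} (hζ : ‖ζ‖ < 1) : DifferentiableAt ℂ (Ft m) ζ := by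
  have : Ft m =ᶠ[𝓝 ζ] fun z => sq z * Phat m z := by
    filter_upwards [Metric.isOpen_ball.mem_nhds (show ζ ∈ Metric.ball (0:ℂ) 1 by simpa using hζ)] with z hz
    exact Ft_ball (by simpa using hz)
  exact this.differentiableAt_iff.2 ((sq_diff hζ).mul (Phat_diff h hζ))

theorem Ft_cont (h : LOK m C Λ) : ContinuousOn (Ft m) (Metric.closedBall 0 1) := by
  intro ζ hζ
  by_cases h0 : ζ = 0
  · subst h0
    exact (Ft_diff h (by simp)).continuousAt.continuousWithinAt
  · have h1 : Ft m =ᶠ[𝓝[Metric.closedBall 0 1] ζ] fun z => Fm m z / z := by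
      filter_upwards [mem_nhdsWithin_of_mem_nhds (isOpen_ne.mem_nhds h0)] with z hz
      exact Ft_eq h hz
    refine ContinuousWithinAt.congr_of_eventuallyEq ?_ h1 (Ft_eq h h0)
    exact ((Fm_cont h) ζ hζ).div continuousWithinAt_id h0

end Csin

end

section
set_option linter.all false
open MeasureTheory Filter Topology Complex

namespace Csin

/-- unit circle -/
def ee (t : ℝ) : ℂ := Complex.exp (t * I)

theorem ee_add (s t : ℝ) : ee (s + t) = ee s * ee t := by
  unfold ee; rw [← Complex.exp_add]; push_cast; ring_nf
theorem ee_zero : ee 0 = 1 := by simp [ee]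
theorem ee_ne (t : ℝ) : ee t ≠ 0 := Complex.exp_ne_zero _
theorem ee_neg (t : ℝ) : ee (-t) = (ee t)⁻¹ := by
  unfold ee; rw [← Complex.exp_neg]; push_cast; ring_nf
theorem ee_sub (s t : ℝ) : ee (s - t) = ee s / ee t := by
  rw [sub_eq_add_neg, ee_add, ee_neg, div_eq_mul_inv]
theorem ee_mul_neg (t : ℝ) : ee t * ee (-t) = 1 := by rw [ee_neg]; exact mul_inv_cancel₀ (ee_ne t)
theorem norm_ee (t : ℝ) : ‖ee t‖ = 1 := Complex.norm_exp_ofReal_mul_I t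
theorem ee_eq (t : ℝ) : ee t = Real.cos t + Real.sin t * I := by
  unfold ee; rw [Complex.exp_mul_I]; simp
theorem ee_re (t : ℝ) : (ee t).re = Real.cos t := by unfold ee; exact Complex.exp_ofReal_mul_I_re t
theorem ee_im (t : ℝ) : (ee t).im = Real.sin t := by unfold ee; exact Complex.exp_ofReal_mul_I_im t
theorem ee_conj (t : ℝ) : (starRingEnd ℂ) (ee t) = ee (-t) := by
  apply Complex.ext <;> simp [ee_re, ee_im]
theorem ee_cont : Continuous ee := by unfold ee; fun_prop
theorem ee_pi_div_two : ee (Real.pi/2) = I := by rw [ee_eq]; simp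
theorem ee_neg_pi_div_two : ee (-(Real.pi/2)) = -I := by rw [ee_eq]; simp
theorem two_cos (t : ℝ) : ee t + ee (-t) = 2 * Real.cos t := by
  rw [ee_eq, ee_eq]; simp; ring
theorem two_sin (t : ℝ) : ee t - ee (-t) = 2 * I * Real.sin t := by
  rw [ee_eq, ee_eq]; simp; ring
theorem sin_cast (t : ℝ) : ((Real.sin t : ℝ):ℂ) = (ee t - ee (-t)) * (-I/2) := by
  rw [two_sin]; linear_combination (Real.sin t : ℂ) * I_sq
theorem cos_cast (t : ℝ) : ((Real.cos t : ℝ):ℂ) = (ee t + ee (-t)) / 2 := by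
  rw [two_cos]; ring

theorem dq_circle (μ t : ℝ) : dq μ (ee t) = 2 * ee t * (Real.cos t - μ) := by
  rw [cos_cast]; unfold dq
  linear_combination - ee_mul_neg t

theorem log_polar {r α : ℝ} (hr : 0 < r) (h1 : -Real.pi < α) (h2 : α ≤ Real.pi) :
    Complex.log (r * ee α) = Real.log r + α * I := by
  unfold ee
  have : (r:ℂ) = Complex.exp (Real.log r) := by rw [← Complex.ofReal_exp, Real.exp_log hr]
  conv_lhs => rw [this, ← Complex.exp_add]
  rw [Complex.log_exp] <;> simp <;> assumption

theorem log1p {ε φ : ℝ} (hε : ε = 1 ∨ ε = -1) (hφ : φ ∈ Set.Ioo 0 Real.pi) :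
    Complex.log (1 + ee (ε * φ)) = Real.log (2 * Real.cos (φ/2)) + (ε * (φ/2) : ℝ) * I := by
  have hp := Real.pi_pos
  have hc : 0 < Real.cos (φ/2) := Real.cos_pos_of_mem_Ioo ⟨by linarith [hφ.1], by linarith [hφ.2]⟩
  rw [← log_polar (by positivity)]
  · congr 1
    have h1 := ee_add (ε * (φ/2)) (ε * (φ/2))
    have h2 := ee_mul_neg (ε * (φ/2))
    have h3 : Real.cos (ε * (φ/2)) = Real.cos (φ/2) := by rcases hε with rfl | rfl <;> simp
    rw [← h3]
    rw [Complex.ofReal_mul, cos_cast, Complex.ofReal_ofNat]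
    rw [show ε * φ = ε * (φ/2) + ε * (φ/2) by ring, h1]
    linear_combination - h2
  all_goals rcases hε with rfl | rfl <;> linarith [hφ.1, hφ.2]

theorem log1m {ε φ : ℝ} (hε : ε = 1 ∨ ε = -1) (hφ : φ ∈ Set.Ioo 0 Real.pi) :
    Complex.log (1 - ee (ε * φ)) = Real.log (2 * Real.sin (φ/2)) + (ε * (φ/2 - Real.pi/2) : ℝ) * I := by
  have hp := Real.pi_pos
  have hc : 0 < Real.sin (φ/2) := Real.sin_pos_of_pos_of_lt_pi (by linarith [hφ.1]) (by linarith [hφ.2])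
  rw [← log_polar (by positivity)]
  · congr 1
    have h1 := ee_add (ε * (φ/2)) (ε * (φ/2))
    have h2 := ee_mul_neg (ε * (φ/2))
    rw [Complex.ofReal_mul, sin_cast, Complex.ofReal_ofNat]
    rw [show ε * φ = ε * (φ/2) + ε * (φ/2) by ring, h1]
    rw [show ε * (φ/2 - Real.pi/2) = ε * (φ/2) + (- (ε * (Real.pi/2))) by ring, ee_add]
    rcases hε with rfl | rfl
    · simp only [one_mul] at *
      rw [ee_neg_pi_div_two]
      push_cast
      linear_combination - h2 - (ee (φ/2) * ee (φ/2) - ee (φ/2) * ee (-(φ/2))) * I_sq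
    · simp only [neg_mul, one_mul, neg_neg] at *
      rw [ee_pi_div_two]
      push_cast
      linear_combination - h2 - (ee (-(φ/2)) * ee (-(φ/2)) - ee (φ/2) * ee (-(φ/2))) * I_sq
  all_goals rcases hε with rfl | rfl <;> linarith [hφ.1, hφ.2]

def WW (φ : ℝ) : ℝ := Real.exp (1/2 * (Real.log (2 * Real.cos (φ/2)) + Real.log (2 * Real.sin (φ/2))))

theorem WW_pos (φ : ℝ) : 0 < WW φ := Real.exp_pos _

theorem sq_circle {ε φ : ℝ} (hε : ε = 1 ∨ ε = -1) (hφ : φ ∈ Set.Ioo 0 Real.pi) :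
    sq (ee (ε * φ)) = WW φ * ee (ε * (φ/2 - Real.pi/4)) := by
  have hp := Real.pi_pos
  have hc : 0 < Real.cos (φ/2) := Real.cos_pos_of_mem_Ioo ⟨by linarith [hφ.1], by linarith [hφ.2]⟩
  have hs : 0 < Real.sin (φ/2) := Real.sin_pos_of_pos_of_lt_pi (by linarith [hφ.1]) (by linarith [hφ.2])
  have h1 := log1p hε hφ
  have h2 := log1m hε hφ
  have ne1 : 1 + ee (ε * φ) ≠ 0 := by
    intro h; have := congrArg Complex.re h
    rw [Complex.add_re, ee_re] at this
    have e : Real.cos (ε * φ) = Real.cos φ := by rcases hε with rfl | rfl <;> simp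
    rw [e, show φ = 2 * (φ/2) by ring, Real.cos_two_mul] at this
    simp at this; exact hc.ne' (by simpa using this)
  have ne2 : 1 - ee (ε * φ) ≠ 0 := by
    intro h; have := congrArg Complex.re h
    rw [Complex.sub_re, ee_re] at this
    have e : Real.cos (ε * φ) = Real.cos φ := by rcases hε with rfl | rfl <;> simp
    rw [e, show φ = 2 * (φ/2) by ring, Real.cos_two_mul, Real.cos_sq'] at this
    simp at this; ring_nf at this; rw [show φ * (1/2) = φ/2 by ring] at this; have := pow_pos hs 2; linarith
  unfold sq
  rw [Complex.cpow_def_of_ne_zero ne1, Complex.cpow_def_of_ne_zero ne2, h1, h2, ← Complex.exp_add]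
  unfold WW ee
  rw [Complex.ofReal_exp, ← Complex.exp_add]
  congr 1
  push_cast
  ring

theorem lg_circle {ε φ : ℝ} (hε : ε = 1 ∨ ε = -1) (hφ : φ ∈ Set.Ioo 0 Real.pi) :
    Complex.log (1 + ee (ε * φ)) - Complex.log (1 - ee (ε * φ)) =
     ((Real.log (2 * Real.cos (φ/2)) - Real.log (2 * Real.sin (φ/2)) : ℝ) : ℂ) + ε * (Real.pi/2) * I := by
  rw [log1p hε hφ, log1m hε hφ]; push_cast; ring

variable {m : ℝ → ℂ} {C Λ : ℝ}

theorem Jm_circle (m : ℝ → ℂ) (t : ℝ) : ee t * Jm m (ee t) =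
    1/2 * ∫ μ, (m μ - m (Real.cos t)) / (Real.cos t - μ : ℂ) ∂vol1 := by
  unfold Jm
  rw [← integral_const_mul, ← integral_const_mul]
  congr 1; funext μ
  rw [ee_re, dq_circle]
  have := ee_ne t
  by_cases h : (Real.cos t - μ : ℂ) = 0
  · rw [h]; simp
  · field_simp

theorem Jm_circle_int (h : LOK m C Λ) (t : ℝ) :
    Integrable (fun μ => (m μ - m (Real.cos t)) / (Real.cos t - μ : ℂ)) vol1 := by
  have := (J_int h (ee t)).const_mul (2 * ee t)
  refine this.congr (Eventually.of_forall fun μ => ?_)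
  simp only
  rw [ee_re, dq_circle]
  have := ee_ne t
  by_cases h : (Real.cos t - μ : ℂ) = 0
  · rw [h]; simp
  · field_simp

/-- `p(e^{iεφ})` -/
def pc (m : ℝ → ℂ) (ε φ : ℝ) : ℂ :=
  1/2 * (∫ μ, (m μ - m (Real.cos φ)) / (Real.cos φ - μ : ℂ) ∂vol1) +
   m (Real.cos φ) * (((Real.log (2 * Real.cos (φ/2)) - Real.log (2 * Real.sin (φ/2)) : ℝ) : ℂ) + ε * (Real.pi/2) * I)

theorem Ft_circle (h : LOK m C Λ) {ε φ : ℝ} (hε : ε = 1 ∨ ε = -1) (hφ : φ ∈ Set.Ioo 0 Real.pi) :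
    Ft m (ee (ε * φ)) = sq (ee (ε * φ)) * pc m ε φ / ee (ε * φ) := by
  rw [Ft_eq h (ee_ne _)]
  unfold Fm pc
  have e : Real.cos (ε * φ) = Real.cos φ := by rcases hε with rfl | rfl <;> simp
  rw [sqlg_eq, lg_circle hε hφ, mul_assoc, Jm_circle, ee_re, e]
  ring

end Csin

end

section
set_option linter.all false
open MeasureTheory Filter Topology Complex

namespace Csin

theorem circ_split {g : ℂ → ℂ} (hg : ContinuousOn g (Metric.sphere 0 1)) :
    (∮ z in C(0, 1), g z) = ∫ φ in (0:ℝ)..Real.pi, (I * ee φ * g (ee φ) + I * ee (-φ) * g (ee (-φ))) := by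
  have hc : Continuous fun φ : ℝ => I * ee φ * g (ee φ) := by
    refine Continuous.mul (continuous_const.mul ee_cont) ?_
    exact hg.comp_continuous ee_cont fun t => by simp [norm_ee]
  have hper : Function.Periodic (fun φ : ℝ => I * ee φ * g (ee φ)) (2 * Real.pi) := by
    intro φ
    have : ee (φ + 2 * Real.pi) = ee φ := by unfold ee; push_cast; rw [add_mul, Complex.exp_periodic]
    simp only [this]
  have e1 : (∮ z in C(0, 1), g z) = ∫ φ in (0:ℝ)..(2 * Real.pi), I * ee φ * g (ee φ) := by
    unfold circleIntegral
    congr 1; funext φ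
    simp only [deriv_circleMap, smul_eq_mul, circleMap, ee]
    simp [mul_comm I]
  rw [e1, ← intervalIntegral.integral_add_adjacent_intervals (b := Real.pi)
    (hc.intervalIntegrable _ _) (hc.intervalIntegrable _ _)]
  have e2 : ∫ φ in Real.pi..(2 * Real.pi), I * ee φ * g (ee φ) =
      ∫ φ in (0:ℝ)..Real.pi, I * ee (-φ) * g (ee (-φ)) := by
    have h1 := intervalIntegral.integral_comp_neg (a := 0) (b := Real.pi) (fun φ : ℝ => I * ee φ * g (ee φ))
    rw [h1]
    have h2 := intervalIntegral.integral_comp_add_right (a := -Real.pi) (b := -0) (fun φ : ℝ => I * ee φ * g (ee φ)) (2 * Real.pi)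
    have h3 : (-Real.pi + 2 * Real.pi) = Real.pi := by ring
    have h4 : (-0 + 2 * Real.pi) = 2 * Real.pi := by ring
    rw [h3, h4] at h2
    rw [← h2]
    congr 1; funext φ
    exact hper φ
  rw [e2, ← intervalIntegral.integral_add (hc.intervalIntegrable _ _)]
  exact (hc.comp continuous_neg).intervalIntegrable _ _

theorem two_pole {a z : ℂ} (ha : ‖a‖ < 1) (hz : ‖z‖ < 1) : (∮ w in C(0, 1), (w - z)⁻¹ * (w - a)⁻¹) = 0 := by
  have hs : ∀ b : ℂ, ‖b‖ < 1 → ∀ w ∈ Metric.sphere (0:ℂ) 1, w - b ≠ 0 := by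
    intro b hb w hw h
    have : w = b := sub_eq_zero.1 h
    subst this
    simp at hw; linarith
  by_cases h : z = a
  · subst h
    have := circleIntegral.integral_sub_zpow_of_ne (n := -2) (by norm_num) 0 z 1
    rw [← this]
    congr 1; funext w
    rw [zpow_neg, ← mul_inv, ← pow_two]; norm_cast
  · have h0 : z - a ≠ 0 := sub_ne_zero.2 h
    have hci : ∀ b : ℂ, ‖b‖ < 1 → CircleIntegrable (fun w => (w - b)⁻¹) 0 1 := by
      intro b hb
      refine ContinuousOn.circleIntegrable (by norm_num) ?_
      exact ContinuousOn.inv₀ (by fun_prop) (hs b hb)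
    have e : (∮ w in C(0, 1), (w - z)⁻¹ * (w - a)⁻¹) = ∮ w in C(0, 1), (z - a)⁻¹ * ((w - z)⁻¹ - (w - a)⁻¹) := by
      refine circleIntegral.integral_congr (by norm_num) fun w hw => ?_
      have h1 := hs z hz w hw
      have h2 := hs a ha w hw
      field_simp
      ring
    rw [e, circleIntegral.integral_const_mul, circleIntegral.integral_sub (hci z hz) (hci a ha),
      circleIntegral.integral_sub_inv_of_mem_ball (by simpa using hz),
      circleIntegral.integral_sub_inv_of_mem_ball (by simpa using ha)]
    simp

theorem cauchy_part {fan k : ℂ → ℂ} (hfc : ContinuousOn fan (Metric.closedBall 0 1))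
    (hfd : ∀ z : ℂ, ‖z‖ < 1 → DifferentiableAt ℂ fan z)
    (hkc : ContinuousOn k (Metric.closedBall 0 1))
    (hkd : ∀ z : ℂ, ‖z‖ < 1 → DifferentiableAt ℂ k z)
    {a c : ℂ} (ha : ‖a‖ < 1) {E2 : ℝ → ℂ} {f : ℂ → ℂ} (hf : ∀ z, f z = fan z + c / (z - a))
    (R1 : ∀ φ ∈ Set.Ioo 0 Real.pi, k (ee φ) = -I * ee (-φ) * f (ee (-φ)))
    (R2 : ∀ φ ∈ Set.Ioo 0 Real.pi, f (ee φ) = -I * ee (-φ) * (2 * E2 φ * f (ee (-φ)) - k (ee (-φ))))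
    {z0 : ℂ} (hz : ‖z0‖ < 1) :
    fan z0 = (-I / Real.pi) * ∫ ψ in (0:ℝ)..Real.pi, E2 ψ * f (ee (-ψ)) / (ee ψ - z0) := by
  have hs : ∀ b : ℂ, ‖b‖ < 1 → ∀ w ∈ Metric.sphere (0:ℂ) 1, w - b ≠ 0 := by
    intro b hb w hw h
    have : w = b := sub_eq_zero.1 h
    subst this
    simp at hw; linarith
  have hs1 : ∀ w ∈ Metric.closedBall (0:ℂ) 1, 1 - z0 * w ≠ 0 := by
    intro w hw h
    have h1 : z0 * w = 1 := (sub_eq_zero.1 h).symm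
    have := congrArg norm h1
    rw [norm_mul, norm_one] at this
    have hw : ‖w‖ ≤ 1 := by simpa using hw
    nlinarith [norm_nonneg w, norm_nonneg z0]
  have hsub : Metric.sphere (0:ℂ) 1 ⊆ Metric.closedBall 0 1 := Metric.sphere_subset_closedBall
  have c1 : ContinuousOn (fun z => (z - z0)⁻¹ • fan z) (Metric.sphere 0 1) :=
    (ContinuousOn.inv₀ (by fun_prop) (hs z0 hz)).smul (hfc.mono hsub)
  have c2 : ContinuousOn (fun z => (z - z0)⁻¹ * (z - a)⁻¹) (Metric.sphere 0 1) :=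
    (ContinuousOn.inv₀ (by fun_prop) (hs z0 hz)).mul (ContinuousOn.inv₀ (by fun_prop) (hs a ha))
  have c3' : ContinuousOn (fun z => k z / (1 - z0 * z)) (Metric.closedBall 0 1) :=
    hkc.div (by fun_prop) hs1
  have c3 : ContinuousOn (fun z => k z / (1 - z0 * z)) (Metric.sphere 0 1) := c3'.mono hsub
  have i1 : (∮ z in C(0, 1), (z - z0)⁻¹ • fan z) = (2 * Real.pi * I : ℂ) • fan z0 := by
    refine Complex.circleIntegral_sub_inv_smul_of_differentiable_on_off_countable Set.countable_empty (by simpa using hz) hfc fun x hx => hfd x (by simpa using hx.1)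
  have i2 := two_pole ha hz
  have i3 : (∮ z in C(0, 1), k z / (1 - z0 * z)) = 0 := by
    refine Complex.circleIntegral_eq_zero_of_differentiable_on_off_countable (by norm_num) Set.countable_empty c3' fun x hx => ?_
    have hx' : ‖x‖ < 1 := by simpa using hx.1
    exact (hkd x hx').div (by fun_prop) (hs1 x (by simpa using hx'.le))
  have ci : ∀ {g : ℂ → ℂ}, ContinuousOn g (Metric.sphere 0 1) → CircleIntegrable g 0 1 :=
    fun h => ContinuousOn.circleIntegrable (by norm_num) h
  have c4 : ContinuousOn (fun z => (z - z0)⁻¹ • fan z + c * ((z - z0)⁻¹ * (z - a)⁻¹)) (Metric.sphere 0 1) :=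
    c1.add (continuousOn_const.mul c2)
  have c5 : ContinuousOn (fun z => ((z - z0)⁻¹ • fan z + c * ((z - z0)⁻¹ * (z - a)⁻¹)) - I * (k z / (1 - z0 * z))) (Metric.sphere 0 1) :=
    c4.sub (continuousOn_const.mul c3)
  have c6 : ContinuousOn (fun z => I * (k z / (1 - z0 * z))) (Metric.sphere 0 1) := continuousOn_const.mul c3
  have c7 : ContinuousOn (fun z => c * ((z - z0)⁻¹ * (z - a)⁻¹)) (Metric.sphere 0 1) := continuousOn_const.mul c2
  have tot : (∮ z in C(0, 1), (((z - z0)⁻¹ • fan z + c * ((z - z0)⁻¹ * (z - a)⁻¹)) - I * (k z / (1 - z0 * z)))) = (2 * Real.pi * I : ℂ) * fan z0 := by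
    rw [circleIntegral.integral_sub (ci c4) (ci c6),
      circleIntegral.integral_add (ci c1) (ci c7),
      circleIntegral.integral_const_mul, circleIntegral.integral_const_mul, i1, i2, i3]
    simp
  rw [circ_split c5] at tot
  have hcongr : (∫ φ in (0:ℝ)..Real.pi, (I * ee φ * (((ee φ - z0)⁻¹ • fan (ee φ) + c * ((ee φ - z0)⁻¹ * (ee φ - a)⁻¹)) - I * (k (ee φ) / (1 - z0 * ee φ)))
      + I * ee (-φ) * (((ee (-φ) - z0)⁻¹ • fan (ee (-φ)) + c * ((ee (-φ) - z0)⁻¹ * (ee (-φ) - a)⁻¹)) - I * (k (ee (-φ)) / (1 - z0 * ee (-φ)))))) =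
      ∫ φ in (0:ℝ)..Real.pi, 2 * (E2 φ * f (ee (-φ)) / (ee φ - z0)) := by
    refine intervalIntegral.integral_congr_Ioo_of_le Real.pi_pos.le fun φ hφ => ?_
    have mem : ∀ t, ee t ∈ Metric.sphere (0:ℂ) 1 := fun t => by simp [norm_ee]
    have n1 := hs z0 hz _ (mem φ)
    have n2 := hs z0 hz _ (mem (-φ))
    have n3 := hs a ha _ (mem φ)
    have n4 := hs a ha _ (mem (-φ))
    have n5 := hs1 _ (hsub (mem φ))
    have n6 := hs1 _ (hsub (mem (-φ)))
    have f1 : (ee φ - z0)⁻¹ • fan (ee φ) + c * ((ee φ - z0)⁻¹ * (ee φ - a)⁻¹) = f (ee φ) / (ee φ - z0) := by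
      rw [hf, smul_eq_mul]; field_simp
    have f2 : (ee (-φ) - z0)⁻¹ • fan (ee (-φ)) + c * ((ee (-φ) - z0)⁻¹ * (ee (-φ) - a)⁻¹) = f (ee (-φ)) / (ee (-φ) - z0) := by
      rw [hf, smul_eq_mul]; field_simp
    rw [f1, f2, R1 φ hφ, R2 φ hφ]
    generalize f (ee (-φ)) = F
    generalize k (ee (-φ)) = K
    have hm := ee_mul_neg φ
    have hx := ee_ne φ
    rw [ee_neg] at *
    generalize ee φ = x at *
    have n2' : 1 - z0 * x ≠ 0 := n5
    have e1 : x⁻¹ - z0 = (1 - z0 * x) / x := by field_simp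
    have e2 : 1 - z0 * x⁻¹ = (x - z0) / x := by field_simp
    rw [e1, e2]
    field_simp
    ring_nf
    simp only [I_sq, show I ^ 3 = -I from by rw [pow_succ, I_sq]; ring]
    ring
  rw [hcongr, intervalIntegral.integral_const_mul] at tot
  have hpi : (Real.pi : ℂ) ≠ 0 := by exact_mod_cast Real.pi_ne_zero
  have h2 : ∫ ψ in (0:ℝ)..Real.pi, E2 ψ * f (ee (-ψ)) / (ee ψ - z0) = Real.pi * I * fan z0 := by
    linear_combination tot / 2
  rw [h2]
  have : -I / (Real.pi:ℂ) * (Real.pi * I * fan z0) = -(I * I) * fan z0 := by field_simp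
  rw [this, I_mul_I]; ring
end Csin

end

section
set_option linter.all false
open MeasureTheory Filter Topology Complex

namespace Csin

theorem LOK.mul {f g : ℝ → ℂ} {C1 C2 Λ1 Λ2 : ℝ} (hf : LOK f C1 Λ1) (hg : LOK g C2 Λ2) :
    LOK (fun x => f x * g x) (C1 * C2) (C1 * Λ2 + Λ1 * C2) := by
  refine ⟨fun x => ?_, fun x y => ?_⟩
  · rw [norm_mul]; exact mul_le_mul (hf.bd x) (hg.bd x) (norm_nonneg _) hf.nonneg
  · have e : f x * g x - f y * g y = f x * (g x - g y) + (f x - f y) * g y := by ring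
    rw [e]
    refine (norm_add_le _ _).trans ?_
    rw [norm_mul, norm_mul]
    have h1 := mul_le_mul (hf.bd x) (hg.lip x y) (norm_nonneg _) hf.nonneg
    have h2 := mul_le_mul (hf.lip x y) (hg.bd y) (norm_nonneg _) (mul_nonneg hf.nonneg2 (abs_nonneg _))
    calc _ ≤ _ := add_le_add h1 h2
      _ = _ := by ring

theorem LOK.FOK (h : LOK f C Λ) : FOK f C := ⟨h.cont.measurable, h.bd⟩

/-- `e^{iεθ}` -/
theorem LOK_exp {θ θ' : ℝ → ℝ} {L L2 : ℝ} (h : PhOK θ θ' L L2) (ε : ℝ) (hε : |ε| = 1) :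
    LOK (fun x => ee (ε * θ x)) 1 L := by
  refine ⟨fun x => (norm_ee _).le, fun x y => ?_⟩
  have e : ee (ε * θ x) - ee (ε * θ y) = ee (ε * θ y) * (ee (ε * θ x - ε * θ y) - 1) := by
    rw [ee_sub]; have := ee_ne (ε * θ y); field_simp
  rw [e, norm_mul, norm_ee, one_mul]
  unfold ee
  rw [mul_comm]
  refine (Real.norm_exp_I_mul_ofReal_sub_one_le).trans ?_
  rw [Real.norm_eq_abs, ← mul_sub, abs_mul, hε, one_mul]
  exact h.lip0 x y

/-- `ρ_a`, `a = iβ` -/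
def rho (β x : ℝ) : ℂ := 1 / dq x (β * I)

theorem dq_imag (β x : ℝ) : dq x (β * I) = 1 - β ^ 2 - 2 * β * x * I := by
  unfold dq; linear_combination (β:ℂ)^2 * I_sq

theorem dq_imag_lower (β x : ℝ) : 1 - β ^ 2 ≤ ‖dq x (β * I)‖ := by
  refine le_trans ?_ ((le_abs_self _).trans (Complex.abs_re_le_norm _))
  rw [dq_imag]; simp [pow_two]

theorem dq_imag_ne {β : ℝ} (hβ : |β| < 1) (x : ℝ) : dq x (β * I) ≠ 0 := by
  have := dq_imag_lower β x
  have h2 : β ^ 2 < 1 := (sq_lt_one_iff_abs_lt_one β).2 hβ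
  intro h; rw [h, norm_zero] at this; linarith

theorem LOK_rho {β : ℝ} (hβ : |β| < 1) : LOK (rho β) (1 / (1 - β ^ 2)) (2 / (1 - β ^ 2) ^ 2) := by
  have h2 : 0 < 1 - β ^ 2 := by have := (sq_lt_one_iff_abs_lt_one β).2 hβ; linarith
  refine ⟨fun x => ?_, fun x y => ?_⟩
  · unfold rho; rw [norm_div, norm_one]
    exact one_div_le_one_div_of_le h2 (dq_imag_lower β x)
  · have n1 := dq_imag_ne hβ x
    have n2 := dq_imag_ne hβ y
    have e : rho β x - rho β y = (2 * β * I * ((x - y : ℝ) : ℂ)) / (dq x (β * I) * dq y (β * I)) := by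
      unfold rho
      rw [div_sub_div _ _ n1 n2]
      congr 1
      rw [dq_imag, dq_imag]; push_cast; ring
    rw [e, norm_div, norm_mul, norm_mul, norm_mul, norm_mul]
    simp only [norm_I, Complex.norm_real, Complex.norm_ofNat, mul_one, Real.norm_eq_abs]
    rw [div_mul_eq_mul_div]
    have h3 := mul_le_mul (dq_imag_lower β x) (dq_imag_lower β y) h2.le (norm_nonneg _)
    rw [← pow_two] at h3
    have h4 := abs_nonneg (x - y)
    gcongr
    nlinarith

section core
variable {θ θ' : ℝ → ℝ} {L L2 β : ℝ}

def Aβ (θ : ℝ → ℝ) (β : ℝ) (x : ℝ) : ℂ := ee (1 * θ x) * rho β x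
def GG (θ θ' : ℝ → ℝ) (β : ℝ) : ℝ → ℂ := FG vol1 (Kth θ θ') (Aβ θ β)
def DD (θ θ' : ℝ → ℝ) : ℂ := FD vol1 (Kth θ θ')
def mm (θ θ' : ℝ → ℝ) (ε β : ℝ) (x : ℝ) : ℂ := ee (ε * θ x) * GG θ θ' β x

theorem LOK.mono {f : ℝ → ℂ} {C C' Λ : ℝ} (h : LOK f C Λ) (hC : C ≤ C') : LOK f C' Λ :=
  ⟨fun x => (h.bd x).trans hC, h.lip⟩

theorem Aβ_LOK (h : PhOK θ θ' L L2) (hβ : |β| < 1) : ∃ C Λ, LOK (Aβ θ β) C Λ :=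
  ⟨_, _, (LOK_exp h 1 (by simp)).mul (LOK_rho hβ)⟩

theorem GG_eq (h : PhOK θ θ' L L2) (hβ : |β| < 1) (x : ℝ) :
    GG θ θ' β x = DD θ θ' * Aβ θ β x + ∫ t, Kth θ θ' x t * GG θ θ' β t ∂vol1 := by
  obtain ⟨C, Λ, hA⟩ := Aβ_LOK h hβ
  exact FG_eq (h.KOK.mono (le_max_left L C)) (hA.FOK.mono (le_max_right L C)) x

theorem GG_FOK (h : PhOK θ θ' L L2) (hβ : |β| < 1) : ∃ C, FOK (GG θ θ' β) C := by
  obtain ⟨C, Λ, hA⟩ := Aβ_LOK h hβ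
  exact FG_bdd (h.KOK.mono (le_max_left L C)) (hA.FOK.mono (le_max_right L C))

theorem KG_int (h : PhOK θ θ' L L2) (hβ : |β| < 1) (x : ℝ) :
    Integrable (fun t => Kth θ θ' x t * GG θ θ' β t) vol1 := by
  obtain ⟨C, hG⟩ := GG_FOK h hβ
  refine Integrable.of_bound (C := L * C) ?_ (Eventually.of_forall fun t => ?_)
  · exact ((h.KOK.meas_entry measurable_const measurable_id).mul hG.meas).aestronglyMeasurable
  · rw [norm_mul]; exact mul_le_mul (h.KOK.bd x t) (hG.bd t) (norm_nonneg _) h.nonneg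

theorem GG_LOK (h : PhOK θ θ' L L2) (hβ : |β| < 1) : ∃ C Λ, LOK (GG θ θ' β) C Λ := by
  obtain ⟨C, hG⟩ := GG_FOK h hβ
  obtain ⟨CA, ΛA, hA⟩ := Aβ_LOK h hβ
  have hC : 0 ≤ C := (norm_nonneg _).trans (hG.bd 0)
  refine ⟨C, ‖DD θ θ'‖ * ΛA + (L ^ 2 + L2) * C * vol1.real Set.univ, hG.bd, fun x y => ?_⟩
  rw [GG_eq h hβ x, GG_eq h hβ y]
  have e : DD θ θ' * Aβ θ β x + (∫ t, Kth θ θ' x t * GG θ θ' β t ∂vol1) -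
    (DD θ θ' * Aβ θ β y + ∫ t, Kth θ θ' y t * GG θ θ' β t ∂vol1) =
     DD θ θ' * (Aβ θ β x - Aβ θ β y) + ∫ t, (Kth θ θ' x t - Kth θ θ' y t) * GG θ θ' β t ∂vol1 := by
    simp only [sub_mul]
    rw [integral_sub (KG_int h hβ x) (KG_int h hβ y)]; ring
  rw [e]
  refine (norm_add_le _ _).trans ?_
  have h1 : ‖DD θ θ' * (Aβ θ β x - Aβ θ β y)‖ ≤ ‖DD θ θ'‖ * (ΛA * |x - y|) := by
    rw [norm_mul]; gcongr; exact hA.lip x y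
  have h2 : ‖∫ t, (Kth θ θ' x t - Kth θ θ' y t) * GG θ θ' β t ∂vol1‖ ≤ ((L^2 + L2) * |x - y| * C) * vol1.real Set.univ := by
    refine norm_integral_le_of_norm_le_const (Eventually.of_forall fun t => ?_)
    rw [norm_mul]
    have := h.nonneg2
    exact mul_le_mul (h.Kth_lip x y t) (hG.bd t) (norm_nonneg _) (by positivity)
  calc _ ≤ _ := add_le_add h1 h2
    _ = _ := by ring

theorem mm_LOK (h : PhOK θ θ' L L2) (hβ : |β| < 1) {ε : ℝ} (hε : |ε| = 1) : ∃ C Λ, LOK (mm θ θ' ε β) C Λ := by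
  obtain ⟨C, Λ, hG⟩ := GG_LOK h hβ
  exact ⟨_, _, (LOK_exp h ε hε).mul hG⟩

theorem pc_jump (m : ℝ → ℂ) (φ : ℝ) : pc m 1 φ = pc m (-1) φ + I * Real.pi * m (Real.cos φ) := by
  unfold pc; push_cast; ring

theorem pc_rel (h : PhOK θ θ' L L2) (hβ : |β| < 1) (φ : ℝ) :
    ee (θ (Real.cos φ)) * (pc (mm θ θ' (-1) β) (-1) φ + I * Real.pi * DD θ θ' * rho β (Real.cos φ))
      = ee (-θ (Real.cos φ)) * pc (mm θ θ' 1 β) 1 φ := by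
  obtain ⟨C1, Λ1, h1⟩ := mm_LOK h hβ (ε := -1) (by simp)
  obtain ⟨C2, Λ2, h2⟩ := mm_LOK h hβ (ε := 1) (by simp)
  have i1 := Jm_circle_int h1 φ
  have i2 := Jm_circle_int h2 φ
  have hG := GG_eq h hβ (Real.cos φ)
  set x := Real.cos φ with hx
  have hm := ee_mul_neg (θ x)
  have key : ee (θ x) * (∫ μ, (mm θ θ' (-1) β μ - mm θ θ' (-1) β x) / ((x:ℂ) - μ) ∂vol1)
      - ee (-θ x) * (∫ μ, (mm θ θ' 1 β μ - mm θ θ' 1 β x) / ((x:ℂ) - μ) ∂vol1) =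
      2 * I * Real.pi * ∫ t, Kth θ θ' x t * GG θ θ' β t ∂vol1 := by
    rw [← integral_const_mul, ← integral_const_mul, ← integral_const_mul,
      ← integral_sub (i1.const_mul _) (i2.const_mul _)]
    refine integral_congr_ae ?_
    filter_upwards [vol1_ae_ne x] with μ hne
    have hne' : (x:ℂ) - μ ≠ 0 := sub_ne_zero.2 (by exact_mod_cast hne.symm)
    unfold Kth mm
    rw [if_neg hne.symm]
    have hpi : (Real.pi : ℂ) ≠ 0 := by exact_mod_cast Real.pi_ne_zero
    rw [Complex.ofReal_div, Complex.ofReal_mul, Complex.ofReal_sub, sin_cast, neg_sub, ee_sub, ee_sub]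
    simp only [one_mul, neg_mul]
    have a1 := ee_ne (θ x)
    have a2 := ee_ne (θ μ)
    rw [ee_neg, ee_neg]
    field_simp
    ring_nf
    simp only [I_sq]
    ring
  unfold pc
  rw [← hx]
  have e1 : mm θ θ' (-1) β x = ee (-θ x) * GG θ θ' β x := by unfold mm; simp
  have e2 : mm θ θ' 1 β x = ee (θ x) * GG θ θ' β x := by unfold mm; simp
  have e3 : Aβ θ β x = ee (θ x) * rho β x := by unfold Aβ; simp
  rw [e3] at hG
  rw [e1, e2] at key ⊢
  push_cast
  push_cast at key
  linear_combination key / 2 - I * Real.pi * hG - (I * Real.pi * GG θ θ' β x) * hm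
end core
end Csin

end

section
set_option linter.all false
open MeasureTheory Filter Topology Complex

namespace Csin

structure ThOK (θ : ℝ → ℝ) (Th : ℂ → ℂ) : Prop where
  cont : ContinuousOn Th (Metric.closedBall 0 1)
  diff : ∀ z : ℂ, ‖z‖ < 1 → DifferentiableAt ℂ Th z
  rel : ∀ φ : ℝ, Th (ee φ) + Th (ee (-φ)) = 2 * I * θ (Real.cos φ)

def E2 (Th : ℂ → ℂ) (φ : ℝ) : ℂ := Complex.exp (Th (ee φ) - Th (ee (-φ)))
def gg (Th : ℂ → ℂ) (β : ℝ) (ζ : ℂ) : ℂ := sq ζ * Complex.exp (Th ζ) / (1 - β * I * ζ)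
def fan (θ θ' : ℝ → ℝ) (Th : ℂ → ℂ) (β : ℝ) (ζ : ℂ) : ℂ :=
  Complex.exp (Th ζ) * Ft (mm θ θ' (-1) β) ζ + I * Real.pi * DD θ θ' * dslope (gg Th β) (β * I) ζ
def ff (θ θ' : ℝ → ℝ) (Th : ℂ → ℂ) (β : ℝ) (ζ : ℂ) : ℂ :=
  fan θ θ' Th β ζ + I * Real.pi * DD θ θ' * gg Th β (β * I) / (ζ - β * I)
def kk (θ θ' : ℝ → ℝ) (Th : ℂ → ℂ) (β : ℝ) (ζ : ℂ) : ℂ :=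
  Complex.exp (-Th ζ) * Ft (mm θ θ' 1 β) ζ
def eta (θ θ' : ℝ → ℝ) (Th : ℂ → ℂ) (β : ℝ) (φ : ℝ) : ℂ :=
  ff θ θ' Th β (ee (-φ)) / (I * Real.pi * gg Th β (β * I) * ee (φ/2))
def eb (β φ : ℝ) : ℂ := ee (φ/2) / (1 - β * I * ee φ)

section core
variable {θ θ' : ℝ → ℝ} {L L2 β : ℝ} {Th : ℂ → ℂ}

theorem ee_mem_cb (t : ℝ) : ee t ∈ Metric.closedBall (0:ℂ) 1 := by simp [norm_ee]

theorem norm_bI (hβ : |β| < 1) : ‖(β * I : ℂ)‖ < 1 := by simpa using hβ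

theorem ee_sub_ne (hβ : |β| < 1) (t : ℝ) : ee t - β * I ≠ 0 := by
  intro h
  have := congrArg norm (sub_eq_zero.1 h)
  rw [norm_ee] at this
  have := norm_bI hβ
  linarith

theorem one_sub_ne (hβ : |β| < 1) {ζ : ℂ} (hζ : ζ ∈ Metric.closedBall (0:ℂ) 1) : 1 - β * I * ζ ≠ 0 := by
  intro h
  have := congrArg norm (sub_eq_zero.1 h)
  rw [norm_one, norm_mul] at this
  have h1 := norm_bI hβ
  have hw : ‖ζ‖ ≤ 1 := by simpa using hζ
  nlinarith [norm_nonneg ζ, norm_nonneg (β * I : ℂ)]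

theorem gg_cont (hT : ThOK θ Th) (hβ : |β| < 1) : ContinuousOn (gg Th β) (Metric.closedBall 0 1) :=
  (sq_cont.mul (Complex.continuous_exp.comp_continuousOn hT.cont)).div (by fun_prop) fun x hx => one_sub_ne hβ hx

theorem gg_diff (hT : ThOK θ Th) (hβ : |β| < 1) {z : ℂ} (hz : ‖z‖ < 1) : DifferentiableAt ℂ (gg Th β) z :=
  ((sq_diff hz).mul (hT.diff z hz).cexp).div (by fun_prop) (one_sub_ne hβ (by simpa using hz.le))

theorem sq_bI (hβ : |β| < 1) : sq (β * I) * sq (β * I) = 1 + β ^ 2 := by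
  rw [sq_sq (norm_bI hβ)]; linear_combination -(β:ℂ)^2 * I_sq

theorem one_bb : (1 + (β:ℂ) ^ 2) ≠ 0 := by
  have : (0:ℝ) < 1 + β ^ 2 := by positivity
  exact_mod_cast this.ne'

theorem gg_eq (hβ : |β| < 1) : gg Th β (β * I) * (1 + β ^ 2) = sq (β * I) * Complex.exp (Th (β * I)) := by
  unfold gg
  have : (1 - β * I * (β * I) : ℂ) = 1 + β ^ 2 := by linear_combination -(β:ℂ)^2 * I_sq
  rw [this, div_mul_cancel₀ _ one_bb]

theorem gg_ne (hβ : |β| < 1) : gg Th β (β * I) ≠ 0 := by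
  intro h
  have := gg_eq (Th := Th) hβ
  rw [h, zero_mul] at this
  have h2 := sq_bI hβ
  rcases mul_eq_zero.1 this.symm with h3 | h3
  · rw [h3, zero_mul] at h2; exact one_bb h2.symm
  · exact Complex.exp_ne_zero _ h3

theorem gg_deriv (hT : ThOK θ Th) (hβ : |β| < 1) :
    deriv (gg Th β) (β * I) = gg Th β (β * I) * deriv Th (β * I) := by
  have hb := norm_bI hβ
  have h1 := sq_hasDerivAt hb
  have h2 := (hT.diff _ hb).hasDerivAt.cexp
  have h3 : HasDerivAt (fun ζ : ℂ => 1 - β * I * ζ) (-(β * I)) (β * I) := by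
    simpa using ((hasDerivAt_id (β * I : ℂ)).const_mul (β * I : ℂ)).const_sub 1
  have hne := one_sub_ne hβ (ζ := β * I) (by simpa using hb.le)
  have h4 := (h1.mul h2).div h3 hne
  have : gg Th β = ((sq * fun ζ => Complex.exp (Th ζ)) / fun ζ => 1 - β * I * ζ) := by
    funext ζ; simp [gg]
  rw [this, h4.deriv]
  have e : (1 - (β * I) ^ 2 : ℂ) = 1 - β * I * (β * I) := by ring
  rw [e]
  simp only [Pi.div_apply, Pi.mul_apply]
  generalize (1 - β * I * (β * I) : ℂ) = Z at *
  generalize (β * I : ℂ) = a at *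
  field_simp
  ring

theorem fan_cont (h : PhOK θ θ' L L2) (hT : ThOK θ Th) (hβ : |β| < 1) :
    ContinuousOn (fan θ θ' Th β) (Metric.closedBall 0 1) := by
  obtain ⟨C1, Λ1, h1⟩ := mm_LOK h hβ (ε := -1) (by simp)
  have hb := norm_bI hβ
  refine ((Complex.continuous_exp.comp_continuousOn hT.cont).mul (Ft_cont h1)).add (continuousOn_const.mul ?_)
  refine (continuousOn_dslope (Metric.closedBall_mem_nhds_of_mem (by simpa using hb))).2 ⟨gg_cont hT hβ, gg_diff hT hβ hb⟩

theorem fan_diff (h : PhOK θ θ' L L2) (hT : ThOK θ Th) (hβ : |β| < 1) (z : ℂ) (hz : ‖z‖ < 1) :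
    DifferentiableAt ℂ (fan θ θ' Th β) z := by
  obtain ⟨C1, Λ1, h1⟩ := mm_LOK h hβ (ε := -1) (by simp)
  have hb := norm_bI hβ
  refine ((hT.diff z hz).cexp.mul (Ft_diff h1 hz)).add (DifferentiableAt.const_mul ?_ _)
  have : DifferentiableOn ℂ (dslope (gg Th β) (β * I)) (Metric.ball 0 1) :=
    (Complex.differentiableOn_dslope (Metric.isOpen_ball.mem_nhds (by simpa using hb))).2
      fun w hw => (gg_diff hT hβ (by simpa using hw)).differentiableWithinAt
  exact (this z (by simpa using hz)).differentiableAt (Metric.isOpen_ball.mem_nhds (by simpa using hz))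

theorem kk_cont (h : PhOK θ θ' L L2) (hT : ThOK θ Th) (hβ : |β| < 1) :
    ContinuousOn (kk θ θ' Th β) (Metric.closedBall 0 1) := by
  obtain ⟨C1, Λ1, h1⟩ := mm_LOK h hβ (ε := 1) (by simp)
  exact (Complex.continuous_exp.comp_continuousOn hT.cont.neg).mul (Ft_cont h1)

theorem kk_diff (h : PhOK θ θ' L L2) (hT : ThOK θ Th) (hβ : |β| < 1) (z : ℂ) (hz : ‖z‖ < 1) :
    DifferentiableAt ℂ (kk θ θ' Th β) z := by
  obtain ⟨C1, Λ1, h1⟩ := mm_LOK h hβ (ε := 1) (by simp)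
  exact (hT.diff z hz).neg.cexp.mul (Ft_diff h1 hz)

theorem ff_circle (h : PhOK θ θ' L L2) (hβ : |β| < 1) {ε φ : ℝ} (hε : ε = 1 ∨ ε = -1) (hφ : φ ∈ Set.Ioo 0 Real.pi) :
    ff θ θ' Th β (ee (ε * φ)) = Complex.exp (Th (ee (ε * φ))) * (sq (ee (ε * φ)) / ee (ε * φ)) *
      (pc (mm θ θ' (-1) β) ε φ + I * Real.pi * DD θ θ' * rho β (Real.cos φ)) := by
  obtain ⟨C1, Λ1, h1⟩ := mm_LOK h hβ (ε := -1) (by simp)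
  have hn := ee_sub_ne hβ (ε * φ)
  have hn1 := one_sub_ne hβ (ee_mem_cb (ε * φ))
  have hx := ee_ne (ε * φ)
  unfold ff fan
  rw [dslope_of_ne _ (sub_ne_zero.1 hn), slope_def_field, Ft_circle h1 hε hφ]
  have e : Real.cos (ε * φ) = Real.cos φ := by rcases hε with rfl | rfl <;> simp
  have e2 : (1 - β * I * ee (ε * φ)) * (ee (ε * φ) - β * I) = ee (ε * φ) * dq (Real.cos φ) (β * I) := by
    have h3 := ee_mul_neg (ε * φ)
    rw [← e]; unfold dq; rw [cos_cast]
    linear_combination (β * I) * h3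
  have e3 : rho β (Real.cos φ) = ee (ε * φ) / ((1 - β * I * ee (ε * φ)) * (ee (ε * φ) - β * I)) := by
    rw [e2]; unfold rho; have := dq_imag_ne hβ (Real.cos φ); field_simp
  rw [e3]
  have e4 : gg Th β (ee (ε * φ)) = sq (ee (ε * φ)) * Complex.exp (Th (ee (ε * φ))) / (1 - β * I * ee (ε * φ)) := rfl
  rw [e4]
  generalize (1 - β * I * ee (ε * φ) : ℂ) = Z1 at *
  generalize (ee (ε * φ) - β * I : ℂ) = Z2 at *
  field_simp
  ring

theorem sq_rel {φ : ℝ} (hφ : φ ∈ Set.Ioo 0 Real.pi) : sq (ee φ) = -I * ee φ * sq (ee (-φ)) := by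
  have h1 := sq_circle (ε := 1) (Or.inl rfl) hφ
  have h2 := sq_circle (ε := -1) (Or.inr rfl) hφ
  simp only [one_mul, neg_mul] at h1 h2
  rw [h1, h2, show φ / 2 - Real.pi/4 = φ + -(Real.pi/2) + -(φ/2 - Real.pi/4) by ring, ee_add, ee_add, ee_neg_pi_div_two]
  ring_nf

theorem exp_rel (hT : ThOK θ Th) (φ : ℝ) : Complex.exp (Th (ee φ)) * Complex.exp (Th (ee (-φ))) =
    ee (θ (Real.cos φ)) * ee (θ (Real.cos φ)) := by
  rw [← Complex.exp_add, hT.rel]; unfold ee; rw [← Complex.exp_add]; ring_nf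

theorem R1 (h : PhOK θ θ' L L2) (hT : ThOK θ Th) (hβ : |β| < 1) (φ : ℝ) (hφ : φ ∈ Set.Ioo 0 Real.pi) :
    kk θ θ' Th β (ee φ) = -I * ee (-φ) * ff θ θ' Th β (ee (-φ)) := by
  obtain ⟨C1, Λ1, h1⟩ := mm_LOK h hβ (ε := 1) (by simp)
  have f2 := ff_circle (Th := Th) h hβ (ε := -1) (Or.inr rfl) hφ
  have k1 := Ft_circle h1 (ε := 1) (Or.inl rfl) hφ
  simp only [one_mul, neg_mul] at f2 k1
  have hr := pc_rel h hβ φ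
  have he := exp_rel hT φ
  unfold kk
  rw [f2, k1, sq_rel hφ, Complex.exp_neg]
  set P := pc (mm θ θ' (-1) β) (-1) φ + I * Real.pi * DD θ θ' * rho β (Real.cos φ)
  set Q := pc (mm θ θ' 1 β) 1 φ
  have n1 := ee_ne φ
  have n2 := Complex.exp_ne_zero (Th (ee φ))
  have n3 := ee_ne (θ (Real.cos φ))
  rw [ee_neg (θ (Real.cos φ))] at hr
  rw [ee_neg φ] at *
  have hQ : Q = ee (θ (Real.cos φ)) * ee (θ (Real.cos φ)) * P := by
    field_simp at hr; rw [← hr]; ring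
  rw [hQ, ← he]
  field_simp

theorem R2 (h : PhOK θ θ' L L2) (hT : ThOK θ Th) (hβ : |β| < 1) (φ : ℝ) (hφ : φ ∈ Set.Ioo 0 Real.pi) :
    ff θ θ' Th β (ee φ) = -I * ee (-φ) * (2 * E2 Th φ * ff θ θ' Th β (ee (-φ)) - kk θ θ' Th β (ee (-φ))) := by
  obtain ⟨C1, Λ1, h1⟩ := mm_LOK h hβ (ε := 1) (by simp)
  have f2 := ff_circle (Th := Th) h hβ (ε := -1) (Or.inr rfl) hφ
  have f1 := ff_circle (Th := Th) h hβ (ε := 1) (Or.inl rfl) hφ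
  have k1 := Ft_circle h1 (ε := -1) (Or.inr rfl) hφ
  simp only [one_mul, neg_mul] at f1 f2 k1
  have hr := pc_rel h hβ φ
  have he := exp_rel hT φ
  have j1 := pc_jump (mm θ θ' (-1) β) φ
  have j2 := pc_jump (mm θ θ' 1 β) φ
  have hm : mm θ θ' 1 β (Real.cos φ) = ee (θ (Real.cos φ)) * ee (θ (Real.cos φ)) * mm θ θ' (-1) β (Real.cos φ) := by
    unfold mm; simp only [one_mul, neg_mul]
    have := ee_mul_neg (θ (Real.cos φ))
    linear_combination -(ee (θ (Real.cos φ)) * GG θ θ' β (Real.cos φ)) * this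
  unfold kk
  rw [f1, f2, k1, sq_rel hφ, Complex.exp_neg, E2, Complex.exp_sub, j1]
  have n1 := ee_ne φ
  have n2 := Complex.exp_ne_zero (Th (ee φ))
  have n4 := Complex.exp_ne_zero (Th (ee (-φ)))
  have n3 := ee_ne (θ (Real.cos φ))
  have n5 := ee_ne (-φ)
  rw [ee_neg (θ (Real.cos φ))] at hr
  have hQ : pc (mm θ θ' 1 β) (-1) φ = ee (θ (Real.cos φ)) * ee (θ (Real.cos φ)) * (pc (mm θ θ' (-1) β) (-1) φ + I * Real.pi * DD θ θ' * rho β (Real.cos φ)) - I * Real.pi * (ee (θ (Real.cos φ)) * ee (θ (Real.cos φ)) * mm θ θ' (-1) β (Real.cos φ)) := by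
    field_simp at hr; rw [← hm]; linear_combination -hr - j2
  rw [hQ, ← he]
  have e : ee (-φ) = (ee φ)⁻¹ := ee_neg φ
  field_simp
  ring

theorem E2_cont (hT : ThOK θ Th) : Continuous (E2 Th) := by
  unfold E2
  refine Complex.continuous_exp.comp ((hT.cont.comp_continuous ee_cont ee_mem_cb).sub
    (hT.cont.comp_continuous (ee_cont.comp continuous_neg) fun t => ee_mem_cb (-t)))

theorem ff_cont (h : PhOK θ θ' L L2) (hT : ThOK θ Th) (hβ : |β| < 1) :
    Continuous fun φ => ff θ θ' Th β (ee (-φ)) := by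
  unfold ff
  have hc : Continuous fun φ : ℝ => ee (-φ) := ee_cont.comp continuous_neg
  exact ((fan_cont h hT hβ).comp_continuous hc fun t => ee_mem_cb (-t)).add
    (continuous_const.div (hc.sub continuous_const) fun t => ee_sub_ne hβ (-t))

theorem eta_cont (h : PhOK θ θ' L L2) (hT : ThOK θ Th) (hβ : |β| < 1) : Continuous (eta θ θ' Th β) := by
  unfold eta
  refine (ff_cont h hT hβ).div (continuous_const.mul (ee_cont.comp (by fun_prop))) fun t => ?_
  have hpi : (Real.pi : ℂ) ≠ 0 := by exact_mod_cast Real.pi_ne_zero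
  exact mul_ne_zero (mul_ne_zero (mul_ne_zero I_ne_zero hpi) (gg_ne hβ)) (ee_ne _)

theorem ff_eta (hβ : |β| < 1) (φ : ℝ) : ff θ θ' Th β (ee (-φ)) = eta θ θ' Th β φ * (I * Real.pi * gg Th β (β * I) * ee (φ/2)) := by
  unfold eta
  have hpi : (Real.pi : ℂ) ≠ 0 := by exact_mod_cast Real.pi_ne_zero
  rw [div_mul_cancel₀]
  exact mul_ne_zero (mul_ne_zero (mul_ne_zero I_ne_zero hpi) (gg_ne hβ)) (ee_ne _)

theorem fan_eq (h : PhOK θ θ' L L2) (hT : ThOK θ Th) (hβ : |β| < 1) {z0 : ℂ} (hz : ‖z0‖ < 1) :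
    fan θ θ' Th β z0 = (-I / Real.pi) * ∫ ψ in (0:ℝ)..Real.pi, E2 Th ψ * ff θ θ' Th β (ee (-ψ)) / (ee ψ - z0) :=
  cauchy_part (fan_cont h hT hβ) (fan_diff h hT hβ) (kk_cont h hT hβ) (kk_diff h hT hβ) (norm_bI hβ)
    (f := ff θ θ' Th β) (fun z => rfl) (R1 h hT hβ) (R2 h hT hβ) hz

theorem fan_bdry (h : PhOK θ θ' L L2) (hT : ThOK θ Th) (hβ : |β| < 1) {φ : ℝ} (hφ : φ ∈ Set.Ioo 0 Real.pi) :
    fan θ θ' Th β (ee (-φ)) = (-I / Real.pi) * ∫ ψ in (0:ℝ)..Real.pi, E2 Th ψ * ff θ θ' Th β (ee (-ψ)) / (ee ψ - ee (-φ)) := by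
  have hs : 0 < Real.sin φ := Real.sin_pos_of_pos_of_lt_pi hφ.1 hφ.2
  have hc : Continuous fun ψ => E2 Th ψ * ff θ θ' Th β (ee (-ψ)) := (E2_cont hT).mul (ff_cont h hT hβ)
  obtain ⟨B, hB⟩ := (isCompact_Icc (a := (0:ℝ)) (b := Real.pi)).exists_bound_of_continuousOn hc.continuousOn
  have ev : ∀ᶠ r : ℝ in 𝓝[<] 1, r ∈ Set.Ioo (1/2:ℝ) 1 := Ioo_mem_nhdsLT (by norm_num)
  have low : ∀ r : ℝ, 1/2 < r → ∀ ψ ∈ Set.Icc 0 Real.pi, Real.sin φ / 2 ≤ ‖ee ψ - r * ee (-φ)‖ := by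
    intro r hr ψ hψ
    refine le_trans ?_ ((le_abs_self _).trans (Complex.abs_im_le_norm _))
    have : (ee ψ - r * ee (-φ)).im = Real.sin ψ + r * Real.sin φ := by
      rw [Complex.sub_im, Complex.im_ofReal_mul, ee_im, ee_im, Real.sin_neg]; ring
    rw [this]
    have := Real.sin_nonneg_of_nonneg_of_le_pi hψ.1 hψ.2
    nlinarith
  have low1 : ∀ ψ ∈ Set.Icc 0 Real.pi, ee ψ - ee (-φ) ≠ 0 := by
    intro ψ hψ h0
    have := low 1 (by norm_num) ψ hψ
    rw [Complex.ofReal_one, one_mul, h0, norm_zero] at this; linarith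
  have hlim : Tendsto (fun r : ℝ => (r:ℂ) * ee (-φ)) (𝓝[<] 1) (𝓝 (ee (-φ))) := by
    have : Continuous fun r : ℝ => (r:ℂ) * ee (-φ) := by fun_prop
    have := (this.tendsto 1).mono_left (nhdsWithin_le_nhds (s := Set.Iio 1))
    simpa using this
  have nrm : ∀ r : ℝ, r ∈ Set.Ioo (1/2:ℝ) 1 → ‖(r:ℂ) * ee (-φ)‖ < 1 := by
    intro r hr; rw [norm_mul, norm_ee, Complex.norm_real, Real.norm_eq_abs, abs_of_pos (by linarith [hr.1])]; linarith [hr.2]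
  have t1 : Tendsto (fun r : ℝ => fan θ θ' Th β (r * ee (-φ))) (𝓝[<] 1) (𝓝 (fan θ θ' Th β (ee (-φ)))) := by
    have h1 := fan_cont h hT hβ (ee (-φ)) (ee_mem_cb _)
    refine h1.tendsto.comp (tendsto_nhdsWithin_iff.2 ⟨hlim, ?_⟩)
    filter_upwards [ev] with r hr
    simpa using (nrm r hr).le
  have t2 : Tendsto (fun r : ℝ => ∫ ψ in (0:ℝ)..Real.pi, E2 Th ψ * ff θ θ' Th β (ee (-ψ)) / (ee ψ - r * ee (-φ))) (𝓝[<] 1)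
      (𝓝 (∫ ψ in (0:ℝ)..Real.pi, E2 Th ψ * ff θ θ' Th β (ee (-ψ)) / (ee ψ - ee (-φ)))) := by
    refine intervalIntegral.tendsto_integral_filter_of_dominated_convergence (fun _ => B / (Real.sin φ / 2)) ?_ ?_ ?_ ?_
    · refine Eventually.of_forall fun r => ?_
      exact (hc.measurable.div (ee_cont.measurable.sub measurable_const)).aestronglyMeasurable
    · filter_upwards [ev] with r hr
      refine Eventually.of_forall fun ψ hψ => ?_
      rw [Set.uIoc_of_le Real.pi_pos.le] at hψ
      have hψ' := Set.Ioc_subset_Icc_self hψ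
      rw [norm_div]
      exact div_le_div₀ ((norm_nonneg _).trans (hB ψ hψ')) (hB ψ hψ') (by linarith) (low r hr.1 ψ hψ')
    · exact intervalIntegrable_const
    · refine Eventually.of_forall fun ψ hψ => ?_
      rw [Set.uIoc_of_le Real.pi_pos.le] at hψ
      exact (tendsto_const_nhds).div (tendsto_const_nhds.sub hlim) (low1 ψ (Set.Ioc_subset_Icc_self hψ))
  refine tendsto_nhds_unique t1 ((t2.const_mul (-I / Real.pi : ℂ)).congr' ?_)
  filter_upwards [ev] with r hr
  exact (fan_eq h hT hβ (nrm r hr)).symm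

/-- the integral equation on the half-circle -/
theorem eta_eq (h : PhOK θ θ' L L2) (hT : ThOK θ Th) (hβ : |β| < 1) {φ : ℝ} (hφ : φ ∈ Set.Ioo 0 Real.pi) :
    eta θ θ' Th β φ + (1 / (2 * Real.pi)) * ∫ ψ in (0:ℝ)..Real.pi, E2 Th ψ * eta θ θ' Th β ψ / Real.sin ((φ + ψ)/2)
      = DD θ θ' * eb β φ := by
  have hb := fan_bdry h hT hβ hφ
  have hpi : (Real.pi : ℂ) ≠ 0 := by exact_mod_cast Real.pi_ne_zero
  have hg := gg_ne (Th := Th) hβ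
  have hf : ff θ θ' Th β (ee (-φ)) = fan θ θ' Th β (ee (-φ)) + I * Real.pi * DD θ θ' * gg Th β (β * I) / (ee (-φ) - β * I) := rfl
  rw [ff_eta hβ, hb] at hf
  have hintg : ∫ ψ in (0:ℝ)..Real.pi, E2 Th ψ * ff θ θ' Th β (ee (-ψ)) / (ee ψ - ee (-φ)) =
      (Real.pi * gg Th β (β * I) * ee (φ/2) / 2) * ∫ ψ in (0:ℝ)..Real.pi, E2 Th ψ * eta θ θ' Th β ψ / Real.sin ((φ + ψ)/2) := by
    rw [← intervalIntegral.integral_const_mul]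
    refine intervalIntegral.integral_congr_Ioo_of_le Real.pi_pos.le fun ψ hψ => ?_
    have e : ee ψ - ee (-φ) = ee (ψ/2) * ee (-(φ/2)) * (2 * I * Real.sin ((φ + ψ)/2)) := by
      rw [← two_sin, ← ee_add, mul_sub, ← ee_add, ← ee_add]; congr 2 <;> ring
    rw [ff_eta hβ, e]
    have s1 : (Real.sin ((φ + ψ)/2) : ℂ) ≠ 0 := by
      have := Real.sin_pos_of_pos_of_lt_pi (x := (φ + ψ)/2) (by linarith [hφ.1, hψ.1]) (by linarith [hφ.2, hψ.2])
      exact_mod_cast this.ne'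
    have := ee_ne (φ/2)
    have := ee_ne (ψ/2)
    have := I_ne_zero
    rw [ee_neg]
    field_simp
  rw [hintg] at hf
  have n1 := ee_ne (φ/2)
  have e2 : ee (-φ) - β * I = (1 - β * I * ee φ) / (ee (φ/2) * ee (φ/2)) := by
    have := ee_mul_neg φ
    rw [← ee_add, add_halves, eq_div_iff (ee_ne φ)]
    linear_combination this
  have n2 := one_sub_ne hβ (ee_mem_cb φ)
  rw [e2] at hf
  unfold eb
  generalize (∫ ψ in (0:ℝ)..Real.pi, E2 Th ψ * eta θ θ' Th β ψ / Real.sin ((φ + ψ)/2)) = X at *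
  generalize (1 - β * I * ee φ : ℂ) = Z at *
  have := I_ne_zero
  have h3 : I * Real.pi * gg Th β (β * I) * ee (φ/2) ≠ 0 :=
    mul_ne_zero (mul_ne_zero (mul_ne_zero I_ne_zero hpi) hg) n1
  apply mul_left_cancel₀ h3
  have h4 : (I * Real.pi * gg Th β (β * I) * ee (φ/2)) * (DD θ θ' * (ee (φ/2) / Z)) = I * Real.pi * DD θ θ' * gg Th β (β * I) / (Z / (ee (φ/2) * ee (φ/2))) := by
    field_simp
  rw [h4]
  have h5 : (I * Real.pi * gg Th β (β * I) * ee (φ/2)) * (1 / (2 * Real.pi) * X) = I * gg Th β (β * I) * ee (φ/2) / 2 * X := by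
    field_simp
  have h6 : -I / Real.pi * (Real.pi * gg Th β (β * I) * ee (φ/2) / 2 * X) = - (I * gg Th β (β * I) * ee (φ/2) / 2 * X) := by
    field_simp
  rw [h6] at hf
  rw [mul_add, h5]
  linear_combination hf

/-- the linear functional -/
theorem eta_fun (h : PhOK θ θ' L L2) (hT : ThOK θ Th) (hβ : |β| < 1) :
    (1 + β ^ 2) * (∫ x, ee (-θ x) * rho β x * GG θ θ' β x ∂vol1) =
      - (I * Real.pi * DD θ θ' * deriv Th (β * I)) + ∫ ψ in (0:ℝ)..Real.pi, E2 Th ψ * eta θ θ' Th β ψ * eb β (-ψ) := by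
  have hb := norm_bI hβ
  have h1 := fan_eq h hT hβ hb
  unfold fan at h1
  rw [dslope_same, gg_deriv hT hβ, Ft_ball hb] at h1
  have hP : Phat (mm θ θ' (-1) β) (β * I) = ∫ x, ee (-θ x) * rho β x * GG θ θ' β x ∂vol1 := by
    unfold Phat mm rho
    congr 1; funext x; simp only [neg_mul, one_mul]; ring
  rw [hP] at h1
  have hpi : (Real.pi : ℂ) ≠ 0 := by exact_mod_cast Real.pi_ne_zero
  have hintg : ∫ ψ in (0:ℝ)..Real.pi, E2 Th ψ * ff θ θ' Th β (ee (-ψ)) / (ee ψ - β * I) =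
      (I * Real.pi * gg Th β (β * I)) * ∫ ψ in (0:ℝ)..Real.pi, E2 Th ψ * eta θ θ' Th β ψ * eb β (-ψ) := by
    rw [← intervalIntegral.integral_const_mul]
    congr 1; funext ψ
    rw [ff_eta hβ]
    unfold eb
    have n1 := one_sub_ne hβ (ee_mem_cb (-ψ))
    have n2 := ee_sub_ne hβ ψ
    have n3 := ee_ne (ψ/2)
    have e2 : ee ψ - β * I = (1 - β * I * ee (-ψ)) * (ee (ψ/2) * ee (ψ/2)) := by
      have := ee_mul_neg ψ
      rw [← ee_add, add_halves]
      linear_combination (β * I) * this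
    rw [e2, neg_div, ee_neg (ψ/2)]
    generalize (1 - β * I * ee (-ψ) : ℂ) = Z at *
    field_simp
  rw [hintg] at h1
  have hg := gg_ne (Th := Th) hβ
  have he := gg_eq (Th := Th) hβ
  apply mul_left_cancel₀ hg
  have h6 : ∀ X : ℂ, -I / Real.pi * (I * Real.pi * gg Th β (β * I) * X) = gg Th β (β * I) * X := by
    intro X; generalize gg Th β (β * I) = G; field_simp; linear_combination (-(G * X)) * I_sq
  rw [h6] at h1
  linear_combination h1 + (∫ x, ee (-θ x) * rho β x * GG θ θ' β x ∂vol1) * he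

end core
end Csin

end

section
set_option linter.all false
open MeasureTheory Filter Topology Complex

namespace Csin

/-- Lebesgue measure on `(0,π)` -/
def nup : Measure ℝ := volume.restrict (Set.Ioo 0 Real.pi)

instance : IsFiniteMeasure nup := by unfold nup; infer_instance

theorem nup_ae : ∀ᵐ φ ∂nup, φ ∈ Set.Ioo 0 Real.pi := ae_restrict_mem measurableSet_Ioo

theorem int_nup {E : Type*} [NormedAddCommGroup E] [NormedSpace ℝ E] (f : ℝ → E) :
    ∫ φ in (0:ℝ)..Real.pi, f φ = ∫ φ, f φ ∂nup := by
  rw [intervalIntegral.integral_of_le Real.pi_pos.le, integral_Ioc_eq_integral_Ioo]; rfl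

theorem cont_int_nup {E : Type*} [NormedAddCommGroup E] {f : ℝ → E} (hf : Continuous f) : Integrable f nup := by
  have := (hf.integrableOn_Icc (μ := volume) (a := 0) (b := Real.pi))
  exact this.mono_set Set.Ioo_subset_Icc_self

theorem bdd_nup {f : ℝ → ℂ} (hf : Continuous f) : ∃ B, ∀ φ ∈ Set.Ioo 0 Real.pi, ‖f φ‖ ≤ B := by
  obtain ⟨B, hB⟩ := (isCompact_Icc (a := (0:ℝ)) (b := Real.pi)).exists_bound_of_continuousOn hf.continuousOn
  exact ⟨B, fun φ hφ => hB φ (Set.Ioo_subset_Icc_self hφ)⟩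

theorem sin_lower {φ : ℝ} (hφ : φ ∈ Set.Ioo 0 Real.pi) :
    φ ≤ 2 * Real.sin φ ∨ Real.pi - φ ≤ 2 * Real.sin φ := by
  have hp := Real.pi_pos
  have hp4 := Real.pi_le_four
  rcases le_total φ (Real.pi/2) with h | h
  · left
    have := Real.mul_le_sin hφ.1.le h
    have h3 : φ / 2 ≤ 2 / Real.pi * φ := by
      rw [div_mul_eq_mul_div, div_le_div_iff₀ (by norm_num) hp]; nlinarith [hφ.1]
    linarith
  · right
    have h1 : 0 ≤ Real.pi - φ := by linarith [hφ.2]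
    have := Real.mul_le_sin h1 (by linarith)
    rw [Real.sin_pi_sub] at this
    have h3 : (Real.pi - φ) / 2 ≤ 2 / Real.pi * (Real.pi - φ) := by
      rw [div_mul_eq_mul_div, div_le_div_iff₀ (by norm_num) hp]; nlinarith [hφ.1]
    linarith

theorem inv_sqrt_sin_int : Integrable (fun φ : ℝ => 1 / Real.sqrt (Real.sin φ)) nup := by
  have hp := Real.pi_pos
  have h1 : IntervalIntegrable (fun x : ℝ => x ^ (-(1/2) : ℝ)) volume 0 Real.pi :=
    intervalIntegral.intervalIntegrable_rpow' (by norm_num)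
  have h2 : IntervalIntegrable (fun x : ℝ => (Real.pi - x) ^ (-(1/2) : ℝ)) volume 0 Real.pi := by
    have := h1.comp_sub_left Real.pi
    simp only [sub_zero, sub_self] at this
    exact this.symm
  have h3 : Integrable (fun x : ℝ => Real.sqrt 2 * (x ^ (-(1/2) : ℝ) + (Real.pi - x) ^ (-(1/2) : ℝ))) nup := by
    have := ((h1.add h2).const_mul (Real.sqrt 2)).1
    exact this.mono_set Set.Ioo_subset_Ioc_self
  refine h3.mono' ?_ ?_
  · exact (measurable_const.div (Real.measurable_sin.sqrt)).aestronglyMeasurable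
  · filter_upwards [nup_ae] with φ hφ
    have hs : 0 < Real.sin φ := Real.sin_pos_of_pos_of_lt_pi hφ.1 hφ.2
    rw [Real.norm_eq_abs, abs_of_nonneg (by positivity)]
    have key : ∀ x : ℝ, 0 < x → x ≤ 2 * Real.sin φ → 1 / Real.sqrt (Real.sin φ) ≤ Real.sqrt 2 * x ^ (-(1/2) : ℝ) := by
      intro x hx hx2
      rw [Real.rpow_neg hx.le, ← Real.sqrt_eq_rpow, ← div_eq_mul_inv, div_le_div_iff₀ (Real.sqrt_pos.2 hs) (Real.sqrt_pos.2 hx), one_mul,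
        ← Real.sqrt_mul (by norm_num)]
      exact Real.sqrt_le_sqrt hx2
    have p1 : 0 ≤ φ ^ (-(1/2) : ℝ) := Real.rpow_nonneg hφ.1.le _
    have p2 : 0 ≤ (Real.pi - φ) ^ (-(1/2) : ℝ) := Real.rpow_nonneg (by linarith [hφ.2]) _
    have p3 := Real.sqrt_nonneg 2
    rw [mul_add]
    have p4 := mul_nonneg p3 p1
    have p5 := mul_nonneg p3 p2
    rcases sin_lower hφ with h | h
    · linarith [key φ hφ.1 h]
    · linarith [key (Real.pi - φ) (by linarith [hφ.2]) h]

theorem sin_half_pos {φ ψ : ℝ} (hφ : φ ∈ Set.Ioo 0 Real.pi) (hψ : ψ ∈ Set.Ioo 0 Real.pi) : 0 < Real.sin ((φ + ψ)/2) :=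
  Real.sin_pos_of_pos_of_lt_pi (by linarith [hφ.1, hψ.1]) (by linarith [hφ.2, hψ.2])

theorem sin_half_lower {φ ψ : ℝ} (hφ : φ ∈ Set.Ioo 0 Real.pi) (hψ : ψ ∈ Set.Ioo 0 Real.pi) :
    1 / Real.sin ((φ + ψ)/2) ≤ (1 / Real.sqrt (Real.sin φ)) * (1 / Real.sqrt (Real.sin ψ)) := by
  have hs := sin_half_pos hφ hψ
  have h1 : 0 < Real.sin φ := Real.sin_pos_of_pos_of_lt_pi hφ.1 hφ.2
  have h2 : 0 < Real.sin ψ := Real.sin_pos_of_pos_of_lt_pi hψ.1 hψ.2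
  rw [one_div_mul_one_div, ← Real.sqrt_mul h1.le]
  refine one_div_le_one_div_of_le (Real.sqrt_pos.2 (by positivity)) ?_
  rw [Real.sqrt_le_left hs.le]
  have e1 : Real.sin φ * Real.sin ψ = (Real.cos (φ - ψ) - Real.cos (φ + ψ)) / 2 := by
    rw [Real.cos_sub, Real.cos_add]; ring
  have e2 : Real.sin ((φ + ψ)/2) ^ 2 = (1 - Real.cos (φ + ψ)) / 2 := by
    rw [Real.sin_sq, Real.cos_sq]; ring_nf
  rw [e1, e2]; linarith [Real.cos_le_one (φ - ψ)]

/-- kernel as product of half-angle functions -/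
theorem sin_half_eq (φ ψ : ℝ) (hφ : φ ∈ Set.Ioo 0 Real.pi) (hψ : ψ ∈ Set.Ioo 0 Real.pi) :
    Real.sin ((φ + ψ)/2) = Real.cos (φ/2) * Real.cos (ψ/2) * (Real.tan (φ/2) + Real.tan (ψ/2)) := by
  have h1 : 0 < Real.cos (φ/2) := Real.cos_pos_of_mem_Ioo ⟨by linarith [hφ.1, Real.pi_pos], by linarith [hφ.2]⟩
  have h2 : 0 < Real.cos (ψ/2) := Real.cos_pos_of_mem_Ioo ⟨by linarith [hψ.1, Real.pi_pos], by linarith [hψ.2]⟩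
  rw [add_div, Real.sin_add, Real.tan_eq_sin_div_cos, Real.tan_eq_sin_div_cos]
  field_simp

def hT (u : ℝ → ℂ) (t φ : ℝ) : ℂ := u φ * ((Real.exp (-(t * Real.tan (φ/2))) / Real.cos (φ/2) : ℝ) : ℂ)

theorem tan_meas : Measurable Real.tan := by
  have : Real.tan = fun x => Real.sin x / Real.cos x := by funext x; exact Real.tan_eq_sin_div_cos x
  rw [this]; exact Real.measurable_sin.div Real.measurable_cos

theorem laplace {φ ψ : ℝ} (hφ : φ ∈ Set.Ioo 0 Real.pi) (hψ : ψ ∈ Set.Ioo 0 Real.pi) :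
    IntegrableOn (fun t => Real.exp (-(t * Real.tan (φ/2))) / Real.cos (φ/2) * (Real.exp (-(t * Real.tan (ψ/2))) / Real.cos (ψ/2))) (Set.Ioi 0) ∧
    ∫ t in Set.Ioi (0:ℝ), Real.exp (-(t * Real.tan (φ/2))) / Real.cos (φ/2) * (Real.exp (-(t * Real.tan (ψ/2))) / Real.cos (ψ/2))
      = 1 / Real.sin ((φ + ψ)/2) := by
  have h1 : 0 < Real.cos (φ/2) := Real.cos_pos_of_mem_Ioo ⟨by linarith [hφ.1, Real.pi_pos], by linarith [hφ.2]⟩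
  have h2 : 0 < Real.cos (ψ/2) := Real.cos_pos_of_mem_Ioo ⟨by linarith [hψ.1, Real.pi_pos], by linarith [hψ.2]⟩
  have t1 : 0 < Real.tan (φ/2) := Real.tan_pos_of_pos_of_lt_pi_div_two (by linarith [hφ.1]) (by linarith [hφ.2])
  have t2 : 0 < Real.tan (ψ/2) := Real.tan_pos_of_pos_of_lt_pi_div_two (by linarith [hψ.1]) (by linarith [hψ.2])
  have e : (fun t => Real.exp (-(t * Real.tan (φ/2))) / Real.cos (φ/2) * (Real.exp (-(t * Real.tan (ψ/2))) / Real.cos (ψ/2)))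
      = fun t => (1 / (Real.cos (φ/2) * Real.cos (ψ/2))) * Real.exp (-(Real.tan (φ/2) + Real.tan (ψ/2)) * t) := by
    funext t
    rw [div_mul_div_comm, ← Real.exp_add, div_eq_mul_one_div, mul_comm]; congr 2; ring
  have hneg : -(Real.tan (φ/2) + Real.tan (ψ/2)) < 0 := by linarith
  rw [e]
  refine ⟨(integrableOn_exp_mul_Ioi hneg 0).const_mul _, ?_⟩
  rw [integral_const_mul, integral_exp_mul_Ioi hneg, sin_half_eq φ ψ hφ hψ]
  have hpos : 0 < Real.tan (φ/2) + Real.tan (ψ/2) := by linarith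
  generalize Real.tan (φ/2) + Real.tan (ψ/2) = T at *
  rw [mul_zero, Real.exp_zero]
  field_simp

theorem kernel_int {u v : ℝ → ℂ} (hu : Measurable u) (hv : Measurable v) {B : ℝ} (hub : ∀ φ ∈ Set.Ioo 0 Real.pi, ‖u φ‖ ≤ B)
    (hvb : ∀ φ ∈ Set.Ioo 0 Real.pi, ‖v φ‖ ≤ B) :
    Integrable (fun p : ℝ × ℝ => u p.1 * v p.2 / Real.sin ((p.1 + p.2)/2)) (nup.prod nup) := by
  have hm := (inv_sqrt_sin_int.mul_prod inv_sqrt_sin_int).const_mul (B * B)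
  refine hm.mono' ?_ ?_
  · refine Measurable.aestronglyMeasurable ?_
    refine ((hu.comp measurable_fst).mul (hv.comp measurable_snd)).div ?_
    exact Complex.measurable_ofReal.comp (Real.measurable_sin.comp ((measurable_fst.add measurable_snd).div_const 2))
  · have : ∀ᵐ p ∂(nup.prod nup), p.1 ∈ Set.Ioo 0 Real.pi ∧ p.2 ∈ Set.Ioo 0 Real.pi :=
      (Measure.quasiMeasurePreserving_fst.ae nup_ae).and (Measure.quasiMeasurePreserving_snd.ae nup_ae)
    filter_upwards [this] with p hp
    have hs := sin_half_pos hp.1 hp.2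
    rw [norm_div, norm_mul, Complex.norm_real, Real.norm_eq_abs, abs_of_pos hs, div_eq_mul_one_div]
    have hB : 0 ≤ B := (norm_nonneg _).trans (hub _ hp.1)
    exact mul_le_mul (mul_le_mul (hub _ hp.1) (hvb _ hp.2) (norm_nonneg _) hB) (sin_half_lower hp.1 hp.2) (by positivity) (by positivity)

theorem kernel_pos {u : ℝ → ℂ} (hu : Measurable u) {B : ℝ} (hub : ∀ φ ∈ Set.Ioo 0 Real.pi, ‖u φ‖ ≤ B) :
    0 ≤ (∫ p : ℝ × ℝ, (starRingEnd ℂ) (u p.1) * u p.2 / Real.sin ((p.1 + p.2)/2) ∂(nup.prod nup)).re := by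
  have hcu : Measurable fun φ => (starRingEnd ℂ) (u φ) := Complex.continuous_conj.measurable.comp hu
  have aep : ∀ᵐ p ∂(nup.prod nup), p.1 ∈ Set.Ioo 0 Real.pi ∧ p.2 ∈ Set.Ioo 0 Real.pi :=
    (Measure.quasiMeasurePreserving_fst.ae nup_ae).and (Measure.quasiMeasurePreserving_snd.ae nup_ae)
  set τ := volume.restrict (Set.Ioi (0:ℝ)) with hτ
  set F : (ℝ × ℝ) × ℝ → ℂ := fun q => (starRingEnd ℂ) (hT u q.2 q.1.1) * hT u q.2 q.1.2 with hF
  have hTm : Measurable fun p : ℝ × ℝ => hT u p.1 p.2 := by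
    unfold hT
    refine (hu.comp measurable_snd).mul (Complex.measurable_ofReal.comp ?_)
    refine Measurable.div (Real.measurable_exp.comp (Measurable.neg ?_)) (Real.measurable_cos.comp (measurable_snd.div_const 2))
    exact measurable_fst.mul (tan_meas.comp (measurable_snd.div_const 2))
  have hFm : Measurable F := by
    refine (Complex.continuous_conj.measurable.comp (hTm.comp (measurable_snd.prodMk (measurable_fst.comp measurable_fst)))).mul ?_
    exact hTm.comp (measurable_snd.prodMk (measurable_snd.comp measurable_fst))
  have Feq : ∀ p : ℝ × ℝ, ∀ t, F (p, t) = ((starRingEnd ℂ) (u p.1) * u p.2) *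
      ((Real.exp (-(t * Real.tan (p.1/2))) / Real.cos (p.1/2) * (Real.exp (-(t * Real.tan (p.2/2))) / Real.cos (p.2/2)) : ℝ) : ℂ) := by
    intro p t
    simp only [hF, hT, map_mul, Complex.conj_ofReal]
    push_cast; ring
  have hFi : Integrable F ((nup.prod nup).prod τ) := by
    rw [integrable_prod_iff hFm.aestronglyMeasurable]
    constructor
    · filter_upwards [aep] with p hp
      simp only [Feq]
      exact ((laplace hp.1 hp.2).1.ofReal).const_mul _
    · have hk := (kernel_int hcu hu (B := B) (fun φ hφ => by simpa using hub φ hφ) hub).norm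
      refine hk.congr ?_
      filter_upwards [aep] with p hp
      have hs := sin_half_pos hp.1 hp.2
      have c1 : 0 < Real.cos (p.1/2) := Real.cos_pos_of_mem_Ioo ⟨by linarith [hp.1.1, Real.pi_pos], by linarith [hp.1.2]⟩
      have c2 : 0 < Real.cos (p.2/2) := Real.cos_pos_of_mem_Ioo ⟨by linarith [hp.2.1, Real.pi_pos], by linarith [hp.2.2]⟩
      simp only [Feq, norm_mul, norm_div, Complex.norm_real, Real.norm_eq_abs, abs_of_pos hs, Real.abs_exp, abs_of_pos c1, abs_of_pos c2, RCLike.norm_conj, abs_mul, abs_div]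
      rw [integral_const_mul, (laplace hp.1 hp.2).2, ← div_eq_mul_one_div]
  have e1 : (∫ p : ℝ × ℝ, (starRingEnd ℂ) (u p.1) * u p.2 / Real.sin ((p.1 + p.2)/2) ∂(nup.prod nup)) = ∫ q, F q ∂((nup.prod nup).prod τ) := by
    rw [integral_prod _ hFi]
    refine integral_congr_ae ?_
    filter_upwards [aep] with p hp
    simp only [Feq]
    rw [integral_const_mul, integral_complex_ofReal, (laplace hp.1 hp.2).2]
    push_cast
    ring
  rw [e1, integral_prod_symm _ hFi]
  have e2 : ∀ t, ∫ p, F (p, t) ∂(nup.prod nup) = ((‖∫ φ, hT u t φ ∂nup‖ ^ 2 : ℝ) : ℂ) := by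
    intro t
    simp only [hF]
    rw [integral_prod_mul (fun φ => (starRingEnd ℂ) (hT u t φ)) (fun φ => hT u t φ), integral_conj, mul_comm, Complex.mul_conj, Complex.normSq_eq_norm_sq]
  simp only [e2]
  rw [integral_complex_ofReal, Complex.ofReal_re]
  exact integral_nonneg fun t => by positivity


/-- energy estimate for the integral equation -/
theorem energy {w : ℝ → ℝ} {η x : ℝ → ℂ} {D : ℂ} (hw : Continuous w) (hw0 : ∀ φ, 0 ≤ w φ) (hη : Continuous η) (hx : Continuous x)
    (heq : ∀ φ ∈ Set.Ioo 0 Real.pi, η φ + (1 / (2 * Real.pi)) * ∫ ψ in (0:ℝ)..Real.pi, (w ψ : ℂ) * η ψ / Real.sin ((φ + ψ)/2) = D * x φ) :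
    ∫ φ, w φ * ‖η φ‖ ^ 2 ∂nup ≤ ‖D‖ ^ 2 * ∫ φ, w φ * ‖x φ‖ ^ 2 ∂nup := by
  set u : ℝ → ℂ := fun φ => (w φ : ℂ) * η φ with hu
  have huc : Continuous u := by fun_prop
  obtain ⟨B, hB⟩ := bdd_nup huc
  have hcu : Measurable fun φ => (starRingEnd ℂ) (u φ) := (Complex.continuous_conj.comp huc).measurable
  have hki := kernel_int hcu huc.measurable (B := B) (fun φ hφ => by simpa using hB φ hφ) hB
  have hpos := kernel_pos huc.measurable hB
  rw [integral_prod _ hki] at hpos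
  have e1 : ∫ φ, (∫ ψ, (starRingEnd ℂ) (u φ) * u ψ / Real.sin ((φ + ψ)/2) ∂nup) ∂nup =
      ∫ φ, (2 * Real.pi) * ((starRingEnd ℂ) (u φ) * (D * x φ) - (starRingEnd ℂ) (u φ) * η φ) ∂nup := by
    refine integral_congr_ae ?_
    filter_upwards [nup_ae] with φ hφ
    have h1 := heq φ hφ
    rw [int_nup] at h1
    simp only [mul_div_assoc]
    rw [integral_const_mul]
    rw [← h1]
    have hpi : (Real.pi : ℂ) ≠ 0 := by exact_mod_cast Real.pi_ne_zero
    simp only [hu, mul_div_assoc]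
    field_simp
    ring
  rw [e1, integral_const_mul] at hpos
  have c1 : Continuous fun φ => (starRingEnd ℂ) (u φ) * (D * x φ) := (Complex.continuous_conj.comp huc).mul (continuous_const.mul hx)
  have c2 : Continuous fun φ => (starRingEnd ℂ) (u φ) * η φ := (Complex.continuous_conj.comp huc).mul hη
  rw [integral_sub (cont_int_nup c1) (cont_int_nup c2)] at hpos
  have e2 : ∫ φ, (starRingEnd ℂ) (u φ) * η φ ∂nup = ((∫ φ, w φ * ‖η φ‖ ^ 2 ∂nup : ℝ) : ℂ) := by
    rw [← integral_complex_ofReal]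
    congr 1; funext φ
    simp only [hu, map_mul, Complex.conj_ofReal]
    rw [mul_assoc, mul_comm ((starRingEnd ℂ) (η φ)), Complex.mul_conj, Complex.normSq_eq_norm_sq]; push_cast; ring
  rw [e2] at hpos
  have e3 : ((2:ℂ) * Real.pi) = ((2 * Real.pi : ℝ) : ℂ) := by push_cast; ring
  rw [e3, Complex.re_ofReal_mul, Complex.sub_re, Complex.ofReal_re] at hpos
  have h3 : 0 ≤ (∫ φ, (starRingEnd ℂ) (u φ) * (D * x φ) ∂nup).re - ∫ φ, w φ * ‖η φ‖ ^ 2 ∂nup :=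
    nonneg_of_mul_nonneg_right hpos (by positivity)
  have h4 : (∫ φ, (starRingEnd ℂ) (u φ) * (D * x φ) ∂nup).re ≤ ∫ φ, (1/2 * (w φ * ‖η φ‖ ^ 2) + 1/2 * (‖D‖ ^ 2 * (w φ * ‖x φ‖ ^ 2))) ∂nup := by
    refine (Complex.re_le_norm _).trans ((norm_integral_le_integral_norm _).trans ?_)
    refine integral_mono (cont_int_nup c1.norm) (cont_int_nup (by fun_prop)) fun φ => ?_
    simp only [hu, norm_mul, RCLike.norm_conj, Complex.norm_real, Real.norm_eq_abs, abs_of_nonneg (hw0 φ)]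
    nlinarith [mul_nonneg (hw0 φ) (sq_nonneg (‖η φ‖ - ‖D‖ * ‖x φ‖))]
  rw [integral_add (cont_int_nup (by fun_prop)) (cont_int_nup (by fun_prop)), integral_const_mul, integral_const_mul, integral_const_mul] at h4
  linarith

/-- Cauchy–Schwarz in arithmetic-geometric form -/
theorem pairing {w : ℝ → ℝ} {η y : ℝ → ℂ} (hw : Continuous w) (hw0 : ∀ φ, 0 ≤ w φ) (hη : Continuous η) (hy : Continuous y)
    {X Y d : ℝ} (hd : 0 ≤ d) (hX : ∫ φ, w φ * ‖η φ‖ ^ 2 ∂nup ≤ d ^ 2 * X ^ 2) (hY : ∫ φ, w φ * ‖y φ‖ ^ 2 ∂nup ≤ Y ^ 2)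
    (hX0 : 0 < X) (hY0 : 0 < Y) :
    ‖∫ φ, (w φ : ℂ) * η φ * y φ ∂nup‖ ≤ d * (X * Y) := by
  rcases hd.eq_or_lt with rfl | hd
  · have hz : ∫ φ, w φ * ‖η φ‖ ^ 2 ∂nup = 0 := le_antisymm (by simpa using hX) (integral_nonneg fun φ => by have := hw0 φ; positivity)
    rw [integral_eq_zero_iff_of_nonneg (fun φ => by have := hw0 φ; positivity) (cont_int_nup (by fun_prop))] at hz
    rw [integral_congr_ae (g := fun _ => 0)]
    · simp
    · filter_upwards [hz] with φ hφ
      have : (w φ : ℂ) * η φ = 0 := by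
        rcases mul_eq_zero.1 hφ with h | h
        · simp [h]
        · have : η φ = 0 := by simpa using h
          simp [this]
      rw [this, zero_mul]
  refine (norm_integral_le_integral_norm _).trans ?_
  have h4 : ∫ φ, ‖(w φ : ℂ) * η φ * y φ‖ ∂nup ≤ ∫ φ, (Y / (2 * d * X) * (w φ * ‖η φ‖ ^ 2) + (d * X / (2 * Y)) * (w φ * ‖y φ‖ ^ 2)) ∂nup := by
    refine integral_mono (cont_int_nup (by fun_prop)) (cont_int_nup (by fun_prop)) fun φ => ?_
    simp only [norm_mul, Complex.norm_real, Real.norm_eq_abs, abs_of_nonneg (hw0 φ)]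
    have e : Y / (2 * d * X) * (w φ * ‖η φ‖ ^ 2) + (d * X / (2 * Y)) * (w φ * ‖y φ‖ ^ 2) - w φ * ‖η φ‖ * ‖y φ‖
       = w φ * (Y * ‖η φ‖ - d * X * ‖y φ‖) ^ 2 / (2 * d * X * Y) := by
      field_simp; ring
    have : 0 ≤ w φ * (Y * ‖η φ‖ - d * X * ‖y φ‖) ^ 2 / (2 * d * X * Y) := by have := hw0 φ; positivity
    linarith
  refine h4.trans ?_
  rw [integral_add (cont_int_nup (by fun_prop)) (cont_int_nup (by fun_prop)), integral_const_mul, integral_const_mul]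
  calc _ ≤ Y / (2 * d * X) * (d ^ 2 * X ^ 2) + (d * X / (2 * Y)) * Y ^ 2 := by gcongr
    _ = _ := by field_simp; ring

end Csin

end

section
set_option linter.all false
open MeasureTheory Filter Topology Complex

namespace Csin

def NN (θ θ' : ℝ → ℝ) (β : ℝ) : ℂ := ∫ x, ee (-θ x) * rho β x * GG θ θ' β x ∂vol1

theorem rho_conj (β x : ℝ) : (starRingEnd ℂ) (rho β x) = rho (-β) x := by
  unfold rho; rw [dq_imag, dq_imag]
  simp
  left; left; exact map_ofNat _ 2

theorem DD_conj (θ θ' : ℝ → ℝ) : (starRingEnd ℂ) (DD θ θ') = DD θ θ' := FD_conj (Kth_conj θ θ')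

theorem DD_re (θ θ' : ℝ → ℝ) : ((DD θ θ').re : ℂ) = DD θ θ' := Complex.conj_eq_iff_re.1 (DD_conj θ θ')

theorem DD_hasDerivAt {I : Set ℝ} (hI : IsOpen I) (hI' : IsPreconnected I) {θ θ' θd θd' : ℝ → ℝ → ℝ} {L : ℝ} {L2 : ℝ → ℝ}
    (hph : ∀ s ∈ I, PhOK (θ s) (θ' s) L (L2 s))
    (hd0 : ∀ s ∈ I, ∀ x, HasDerivAt (fun s => θ s x) (θd s x) s)
    (hd1 : ∀ s ∈ I, ∀ x, HasDerivAt (fun s => θ' s x) (θd' s x) s)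
    {n : ℕ} {c β : Fin n → ℝ → ℝ} {c0 β0 : ℝ} (hc : ∀ j, ∀ s ∈ I, |c j s| ≤ c0) (hβ0 : β0 < 1) (hβ : ∀ j, ∀ s ∈ I, |β j s| ≤ β0)
    (hS1 : ∀ s ∈ I, ∀ x y, ((θd s x - θd s y : ℝ) : ℂ) = ((x - y : ℝ):ℂ) * ∑ j, (c j s : ℂ) * rho (β j s) x * rho (β j s) y)
    (hS2 : ∀ s ∈ I, ∀ x, ((θd' s x : ℝ) : ℂ) = ∑ j, (c j s : ℂ) * rho (β j s) x * rho (β j s) x)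
    {s : ℝ} (hs : s ∈ I) :
    HasDerivAt (fun s => DD (θ s) (θ' s))
      (-((1 / (2 * Real.pi) : ℂ) * ∑ j, (c j s : ℂ) * (NN (θ s) (θ' s) (β j s) + (starRingEnd ℂ) (NN (θ s) (θ' s) (-β j s))))) s := by
  have hL := (hph s hs).nonneg
  have hpi : (Real.pi : ℂ) ≠ 0 := by exact_mod_cast Real.pi_ne_zero
  have hpi3 := Real.pi_gt_three
  set S : ℝ → ℝ → ℝ → ℂ := fun s x y => ∑ j, (c j s : ℂ) * rho (β j s) x * rho (β j s) y with hS
  set kd : ℝ → ℝ → ℝ → ℂ := fun s x y => ((Real.cos (θ s x - θ s y) / Real.pi : ℝ) : ℂ) * S s x y with hkd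
  have rb : ∀ j, ∀ s ∈ I, ∀ x, ‖rho (β j s) x‖ ≤ 1 / (1 - β0 ^ 2) := by
    intro j s hs x
    have h1 := hβ j s hs
    have hb0 : 0 ≤ β0 := (abs_nonneg _).trans h1
    have h2 := (LOK_rho (h1.trans_lt hβ0)).bd x
    refine h2.trans (one_div_le_one_div_of_le (by nlinarith) ?_)
    have := sq_le_sq' (abs_le.1 h1).1 (abs_le.1 h1).2
    linarith
  have rm : ∀ j s, s ∈ I → Measurable (rho (β j s)) := fun j s hs =>
    (LOK_rho ((hβ j s hs).trans_lt hβ0)).cont.measurable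
  set q := 1 / (1 - β0 ^ 2) with hq
  set M := max L (max (n * (c0 * q * q)) (max (|1 * q|) (max |c0 * q| q))) with hM
  have hMk : ∀ s ∈ I, KOK (Kth (θ s) (θ' s)) M := fun s hs => (hph s hs).KOK.mono (le_max_left _ _)
  have hMkd : ∀ s ∈ I, KOK (kd s) M := by
    intro s hs
    refine ⟨?_, fun x y => ?_⟩
    · simp only [hkd, hS, Function.uncurry]
      have m1 : Measurable (θ s) := (hph s hs).cont.measurable
      refine Measurable.mul (Complex.measurable_ofReal.comp ((Real.measurable_cos.comp ((m1.comp measurable_fst).sub (m1.comp measurable_snd))).div_const _)) ?_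
      refine Finset.measurable_sum _ fun j _ => ?_
      exact (((rm j s hs).comp measurable_fst).const_mul _).mul ((rm j s hs).comp measurable_snd)
    · refine le_trans ?_ ((le_max_left _ _).trans (le_max_right _ _))
      simp only [hkd, hS]
      rw [norm_mul]
      have h1 : ‖((Real.cos (θ s x - θ s y) / Real.pi : ℝ) : ℂ)‖ ≤ 1 := by
        rw [Complex.norm_real, Real.norm_eq_abs, abs_div, abs_of_pos Real.pi_pos, div_le_one Real.pi_pos]
        exact (Real.abs_cos_le_one _).trans (by linarith)
      have h2 : ‖∑ j, (c j s : ℂ) * rho (β j s) x * rho (β j s) y‖ ≤ n * (c0 * q * q) := by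
        refine (norm_sum_le _ _).trans ?_
        refine (Finset.sum_le_card_nsmul _ _ (c0 * q * q) fun j _ => ?_).trans (by simp)
        rw [norm_mul, norm_mul, Complex.norm_real, Real.norm_eq_abs]
        have a1 := hc j s hs
        have a2 := rb j s hs x
        have a3 := rb j s hs y
        have : 0 ≤ c0 := (abs_nonneg _).trans a1
        have : 0 ≤ q := (norm_nonneg _).trans a2
        gcongr
      calc _ ≤ 1 * (n * (c0 * q * q)) := mul_le_mul h1 h2 (norm_nonneg _) zero_le_one
        _ = _ := one_mul _
  have hder : ∀ s ∈ I, ∀ x y, HasDerivAt (fun s => Kth (θ s) (θ' s) x y) (kd s x y) s := by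
    intro s hs x y
    simp only [hkd, Kth]
    by_cases hxy : x = y
    · subst hxy
      simp only [if_true, sub_self, Real.cos_zero]
      have e1 := (hd1 s hs x).div_const Real.pi
      have e2 := e1.ofReal_comp
      refine e2.congr_deriv ?_
      simp only [hS]
      rw [← hS2 s hs x]; push_cast; ring
    · simp only [if_neg hxy]
      have hne : x - y ≠ 0 := sub_ne_zero.2 hxy
      have e1 := (((hd0 s hs x).sub (hd0 s hs y)).sin).div_const (Real.pi * (x - y))
      have e2 := e1.ofReal_comp
      refine e2.congr_deriv ?_
      have h3 := hS1 s hs x y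
      have hne' : ((x - y : ℝ) : ℂ) ≠ 0 := by exact_mod_cast hne
      simp only [hS]
      rw [Complex.ofReal_div, Complex.ofReal_mul, h3]
      push_cast at *
      field_simp
      simp only [Pi.sub_apply]; push_cast; ring
  set α : Fin n ⊕ Fin n → ℝ → ℂ := Sum.elim (fun j => Aβ (θ s) (β j s)) (fun j x => (starRingEnd ℂ) (Aβ (θ s) (-β j s) x)) with hα
  set b : Fin n ⊕ Fin n → ℝ → ℂ := Sum.elim (fun j x => (c j s / (2 * Real.pi) : ℂ) * (ee (-θ s x) * rho (β j s) x))
    (fun j x => (c j s / (2 * Real.pi) : ℂ) * (ee (θ s x) * rho (β j s) x)) with hb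
  have em : ∀ ε : ℝ, Measurable fun x => ee (ε * θ s x) := fun ε =>
    ee_cont.measurable.comp ((hph s hs).cont.measurable.const_mul ε)
  have rneg : ∀ j x, ‖rho (-β j s) x‖ ≤ q := fun j x => by
    rw [← rho_conj]; simpa using rb j s hs x
  have hα1 : ∀ m, FOK (α m) M := by
    rintro (j | j)
    · refine ⟨(em 1).mul (rm j s hs), fun x => ?_⟩
      simp only [hα, Sum.elim_inl, Aβ, norm_mul, norm_ee, one_mul]
      exact (rb j s hs x).trans (by simp [hM])
    · refine ⟨Complex.continuous_conj.measurable.comp ((em 1).mul ?_), fun x => ?_⟩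
      · have : rho (-β j s) = fun x => (starRingEnd ℂ) (rho (β j s) x) := by funext x; rw [rho_conj]
        rw [this]; exact Complex.continuous_conj.measurable.comp (rm j s hs)
      · simp only [hα, Sum.elim_inr, Aβ, RCLike.norm_conj, norm_mul, norm_ee, one_mul]
        exact (rneg j x).trans (by simp [hM])
  have cb : ∀ j x, ‖(c j s / (2 * Real.pi) : ℂ)‖ * ‖rho (β j s) x‖ ≤ M := by
    intro j x
    have h1 : ‖(c j s / (2 * Real.pi) : ℂ)‖ ≤ c0 := by
      rw [norm_div, norm_mul, Complex.norm_real, Complex.norm_real, Real.norm_eq_abs, Real.norm_eq_abs, abs_of_pos Real.pi_pos, Complex.norm_ofNat]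
      exact (div_le_self (abs_nonneg _) (by linarith)).trans (hc j s hs)
    have h2 := rb j s hs x
    have : 0 ≤ c0 := (norm_nonneg _).trans h1
    calc _ ≤ c0 * q := mul_le_mul h1 h2 (norm_nonneg _) this
      _ ≤ |c0 * q| := le_abs_self _
      _ ≤ M := by simp [hM]
  have hb1 : ∀ m, FOK (b m) M := by
    rintro (j | j)
    · refine ⟨?_, fun x => ?_⟩
      · have := ((em (-1)).mul (rm j s hs)).const_mul (c j s / (2 * Real.pi) : ℂ)
        simpa [hb] using this
      · simp only [hb, Sum.elim_inl]; rw [norm_mul, norm_mul, norm_ee, one_mul]; exact cb j x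
    · refine ⟨?_, fun x => ?_⟩
      · have := ((em 1).mul (rm j s hs)).const_mul (c j s / (2 * Real.pi) : ℂ)
        simpa [hb] using this
      · simp only [hb, Sum.elim_inr]; rw [norm_mul, norm_mul, norm_ee, one_mul]; exact cb j x
  have hsplit : ∀ x y, kd s x y = ∑ m, α m x * b m y := by
    intro x y
    rw [Fintype.sum_sum_type]
    simp only [hα, hb, Sum.elim_inl, Sum.elim_inr, hkd, hS, Aβ, one_mul, map_mul, rho_conj, neg_neg, ee_conj]
    rw [← Finset.sum_add_distrib, Finset.mul_sum]
    refine Finset.sum_congr rfl fun j _ => ?_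
    rw [Complex.ofReal_div, cos_cast, neg_sub, ee_sub, ee_sub, ee_neg, ee_neg]
    have := ee_ne (θ s x)
    have := ee_ne (θ s y)
    field_simp
  have main := FD_hasDerivAt (μ := vol1) hI hI' hMk hMkd hder hs hα1 hb1 hsplit
  refine main.congr_deriv ?_
  congr 1
  rw [Fintype.sum_sum_type, ← Finset.sum_add_distrib, Finset.mul_sum]
  refine Finset.sum_congr rfl fun j _ => ?_
  simp only [hα, hb, Sum.elim_inl, Sum.elim_inr]
  have i1 : ∫ t, (c j s / (2 * Real.pi) : ℂ) * (ee (-θ s t) * rho (β j s) t) * FG vol1 (Kth (θ s) (θ' s)) (Aβ (θ s) (β j s)) t ∂vol1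
      = (c j s / (2 * Real.pi) : ℂ) * NN (θ s) (θ' s) (β j s) := by
    unfold NN GG; rw [← integral_const_mul]; congr 1; funext t; ring
  have i2 : ∫ t, (c j s / (2 * Real.pi) : ℂ) * (ee (θ s t) * rho (β j s) t) * FG vol1 (Kth (θ s) (θ' s)) (fun x => (starRingEnd ℂ) (Aβ (θ s) (-β j s) x)) t ∂vol1
      = (c j s / (2 * Real.pi) : ℂ) * (starRingEnd ℂ) (NN (θ s) (θ' s) (-β j s)) := by
    unfold NN GG; rw [← integral_conj, ← integral_const_mul]; congr 1; funext t
    rw [FG_conj (Kth_conj _ _)]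
    simp only [map_mul, rho_conj, ee_conj, neg_neg]; ring
  rw [i1, i2]
  ring

end Csin

end

section
set_option linter.all false
open MeasureTheory Filter Topology Complex

namespace Csin

theorem log_cart {a b : ℝ} (ha : 0 < a) :
    Complex.log (a + b * I) = ((1/2 * Real.log (a^2 + b^2) : ℝ) : ℂ) + (Real.arctan (b / a) : ℝ) * I := by
  have hz : ((a:ℂ) + b * I) = Complex.mk a b := by rw [Complex.mk_eq_add_mul_I]
  rw [hz]
  set z := Complex.mk a b with hzz
  apply Complex.ext
  · rw [Complex.log_re]
    simp only [add_re, ofReal_re, mul_re, I_re, I_im, ofReal_im]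
    rw [Complex.norm_def, Real.log_sqrt (Complex.normSq_nonneg _), Complex.normSq_apply]
    simp only [hzz]; ring_nf
  · rw [Complex.log_im]
    simp only [add_im, ofReal_re, mul_im, I_re, I_im, ofReal_im]
    have h : |z.arg| < Real.pi / 2 := Complex.abs_arg_lt_pi_div_two_iff.2 (Or.inl ha)
    have h2 := Complex.tan_arg z
    rw [← Real.arctan_tan (abs_lt.1 h).1 (abs_lt.1 h).2, h2]
    simp [hzz]

/-- phase family -/
def thP (r ρ w x : ℝ) : ℝ := r * Real.arctan (2 * ρ / (1 - ρ^2) * x) + w * x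
def qP (ρ x : ℝ) : ℝ := (1 - ρ^2)^2 + 4 * ρ^2 * x^2
def thP' (r ρ w x : ℝ) : ℝ := 2 * r * ρ * (1 - ρ^2) / qP ρ x + w
def ThP (r ρ w : ℝ) (z : ℂ) : ℂ :=
  r * (Complex.log (1 + I * ρ * z) - Complex.log (1 - I * ρ * z)) + I * w * z
def Ew (r ρ w φ : ℝ) : ℝ :=
  Real.exp (r * (Real.log (1 - 2 * ρ * Real.sin φ + ρ^2) - Real.log (1 + 2 * ρ * Real.sin φ + ρ^2)) - 2 * w * Real.sin φ)

theorem qP_pos {ρ : ℝ} (h : |ρ| < 1) (x : ℝ) : 0 < qP ρ x := by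
  have := (sq_lt_one_iff_abs_lt_one ρ).2 h
  unfold qP; have : 0 < 1 - ρ^2 := by linarith
  positivity

theorem one_sub_sq {ρ : ℝ} (h : |ρ| < 1) : 0 < 1 - ρ^2 := by
  have := (sq_lt_one_iff_abs_lt_one ρ).2 h
  linarith

theorem sin_abs {ρ : ℝ} (h : |ρ| < 1) (φ : ℝ) : |ρ * Real.sin φ| < 1 := by
  rw [abs_mul]
  nlinarith [Real.abs_sin_le_one φ, abs_nonneg ρ, abs_nonneg (Real.sin φ)]

theorem ThP_circle {ρ : ℝ} (h : |ρ| < 1) (r w φ : ℝ) :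
    ThP r ρ w (ee φ) = ((r/2 * (Real.log (1 - 2 * ρ * Real.sin φ + ρ^2) - Real.log (1 + 2 * ρ * Real.sin φ + ρ^2)) - w * Real.sin φ : ℝ) : ℂ)
      + (thP r ρ w (Real.cos φ) : ℝ) * I := by
  have hs := abs_lt.1 (sin_abs h φ)
  have h1 := one_sub_sq h
  have a1 : 0 < 1 - ρ * Real.sin φ := by linarith [hs.2]
  have a2 : 0 < 1 + ρ * Real.sin φ := by linarith [hs.1]
  have e1 : (1 + I * ρ * ee φ : ℂ) = ((1 - ρ * Real.sin φ : ℝ) : ℂ) + (ρ * Real.cos φ : ℝ) * I := by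
    rw [ee_eq]; push_cast; linear_combination (ρ:ℂ) * Complex.sin φ * I_sq
  have e2 : (1 - I * ρ * ee φ : ℂ) = ((1 + ρ * Real.sin φ : ℝ) : ℂ) + (-(ρ * Real.cos φ) : ℝ) * I := by
    rw [ee_eq]; push_cast; linear_combination -(ρ:ℂ) * Complex.sin φ * I_sq
  have c2 := Real.sin_sq_add_cos_sq φ
  have l1 : (1 - ρ * Real.sin φ)^2 + (ρ * Real.cos φ)^2 = 1 - 2 * ρ * Real.sin φ + ρ^2 := by
    linear_combination ρ^2 * c2
  have l2 : (1 + ρ * Real.sin φ)^2 + (-(ρ * Real.cos φ))^2 = 1 + 2 * ρ * Real.sin φ + ρ^2 := by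
    linear_combination ρ^2 * c2
  have at1 : Real.arctan (ρ * Real.cos φ / (1 - ρ * Real.sin φ)) - Real.arctan (-(ρ * Real.cos φ) / (1 + ρ * Real.sin φ))
      = Real.arctan (2 * ρ / (1 - ρ^2) * Real.cos φ) := by
    rw [neg_div, Real.arctan_neg, sub_neg_eq_add]
    have key : (ρ * Real.cos φ) * (ρ * Real.cos φ) < (1 - ρ * Real.sin φ) * (1 + ρ * Real.sin φ) := by nlinarith
    rw [Real.arctan_add]
    · congr 1
      have : 1 - ρ * Real.cos φ / (1 - ρ * Real.sin φ) * (ρ * Real.cos φ / (1 + ρ * Real.sin φ)) = (1 - ρ^2) / ((1 - ρ * Real.sin φ) * (1 + ρ * Real.sin φ)) := by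
        field_simp
        linear_combination -ρ^2 * c2
      rw [this]
      field_simp
      ring
    · rw [div_mul_div_comm, div_lt_one (by positivity)]; exact key
  unfold ThP thP
  rw [e1, e2, log_cart a1, log_cart a2, l1, l2, ← at1, ee_eq]
  push_cast
  linear_combination (w:ℂ) * Complex.sin φ * I_sq

theorem ThP_rel {ρ : ℝ} (h : |ρ| < 1) (r w φ : ℝ) :
    ThP r ρ w (ee φ) + ThP r ρ w (ee (-φ)) = 2 * I * thP r ρ w (Real.cos φ) := by
  rw [ThP_circle h, ThP_circle h, Real.sin_neg, Real.cos_neg]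
  push_cast
  ring_nf

theorem E2_ThP {ρ : ℝ} (h : |ρ| < 1) (r w φ : ℝ) : E2 (ThP r ρ w) φ = Ew r ρ w φ := by
  unfold E2 Ew
  rw [ThP_circle h, ThP_circle h, Real.sin_neg, Real.cos_neg]
  push_cast
  congr 1
  ring_nf

theorem slit1 {ρ : ℝ} (h : |ρ| < 1) {z : ℂ} (hz : ‖z‖ ≤ 1) {ε : ℂ} (hε : ‖ε‖ = 1) : 1 + ε * ρ * z ∈ Complex.slitPlane := by
  refine Complex.mem_slitPlane_of_norm_lt_one ?_
  rw [norm_mul, norm_mul, hε, one_mul, Complex.norm_real, Real.norm_eq_abs]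
  nlinarith [abs_nonneg ρ, norm_nonneg z]

theorem ThP_hasDeriv {ρ : ℝ} (h : |ρ| < 1) (r w : ℝ) {z : ℂ} (hz : ‖z‖ ≤ 1) :
    HasDerivAt (ThP r ρ w) (2 * I * (r * ρ / (1 + ρ^2 * z^2) + w / 2)) z := by
  have s1 := slit1 h hz (ε := I) (by simp)
  have s2 := slit1 h hz (ε := -I) (by simp)
  have d1 : HasDerivAt (fun z : ℂ => 1 + I * ρ * z) (I * ρ) z := by
    simpa using ((hasDerivAt_id z).const_mul (I * ρ : ℂ)).const_add 1
  have d2 : HasDerivAt (fun z : ℂ => 1 - I * ρ * z) (-(I * ρ)) z := by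
    simpa using ((hasDerivAt_id z).const_mul (I * ρ : ℂ)).const_sub 1
  have s2' : 1 - I * ρ * z ∈ Complex.slitPlane := by convert s2 using 1; ring
  have n1 := Complex.slitPlane_ne_zero s1
  have n2 := Complex.slitPlane_ne_zero s2'
  have d3 : HasDerivAt (fun z : ℂ => I * w * z) (I * w) z := by
    simpa using ((hasDerivAt_id z).const_mul (I * w : ℂ))
  have := (((d1.clog s1).sub (d2.clog s2')).const_mul (r:ℂ)).add d3
  refine this.congr_deriv ?_
  have n3 : 1 + (ρ:ℂ)^2 * z^2 = (1 + I * ρ * z) * (1 - I * ρ * z) := by linear_combination (ρ:ℂ)^2 * z^2 * I_sq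
  rw [n3]
  field_simp
  ring

theorem ThP_OK {ρ : ℝ} (h : |ρ| < 1) (r w : ℝ) : ThOK (thP r ρ w) (ThP r ρ w) where
  cont := fun z hz => (ThP_hasDeriv h r w (by simpa using hz)).continuousAt.continuousWithinAt
  diff := fun z hz => (ThP_hasDeriv h r w hz.le).differentiableAt
  rel := ThP_rel h r w

theorem thP_deriv {ρ : ℝ} (h : |ρ| < 1) (r w x : ℝ) : HasDerivAt (thP r ρ w) (thP' r ρ w x) x := by
  have h1 := one_sub_sq h
  have hq := qP_pos h x
  have d1 : HasDerivAt (fun x => 2 * ρ / (1 - ρ^2) * x) (2 * ρ / (1 - ρ^2)) x := by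
    simpa using (hasDerivAt_id x).const_mul (2 * ρ / (1 - ρ^2))
  have d2 : HasDerivAt (fun x => w * x) w x := by simpa using (hasDerivAt_id x).const_mul w
  refine ((d1.arctan.const_mul r).add d2).congr_deriv ?_
  unfold thP'
  have : 1 + (2 * ρ / (1 - ρ^2) * x)^2 = qP ρ x / (1 - ρ^2)^2 := by unfold qP; field_simp; ring
  rw [this]; field_simp

theorem thP_PhOK {ρ ρ1 : ℝ} (hρ : |ρ| ≤ ρ1) (h : ρ1 < 1) {r w R W : ℝ} (hr : |r| ≤ R) (hw : |w| ≤ W) :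
    PhOK (thP r ρ w) (thP' r ρ w) (2 * R / (1 - ρ1^2) + W) (8 * R / (1 - ρ1^2)^3) := by
  have hρ' := hρ.trans_lt h
  have h1 := one_sub_sq hρ'
  have hρ0 := abs_nonneg ρ
  have hR : 0 ≤ R := (abs_nonneg r).trans hr
  have h2 : 0 < 1 - ρ1^2 := by nlinarith
  have h3 : 1 - ρ1^2 ≤ 1 - ρ^2 := by rw [← sq_abs ρ]; nlinarith
  have hq : ∀ x, (1 - ρ^2)^2 ≤ qP ρ x := fun x => by unfold qP; nlinarith [mul_nonneg (sq_nonneg ρ) (sq_nonneg x)]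
  have hnum : |2 * r * ρ * (1 - ρ^2)| ≤ 2 * R * (1 - ρ^2) := by
    rw [abs_mul, abs_mul, abs_mul, abs_of_pos h1, abs_two]
    have : |r| * |ρ| ≤ R * 1 := mul_le_mul hr hρ'.le hρ0 hR
    nlinarith
  refine ⟨fun x => thP_deriv hρ' r w x, fun x => ?_, fun x y => ?_⟩
  · unfold thP'
    refine (abs_add_le _ _).trans (add_le_add ?_ hw)
    rw [abs_div, abs_of_pos (qP_pos hρ' x)]
    calc _ ≤ 2 * R * (1 - ρ^2) / (1 - ρ^2)^2 := by gcongr; exact hq x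
      _ = 2 * R / (1 - ρ^2) := by field_simp
      _ ≤ _ := by gcongr
  · have qx := qP_pos hρ' x
    have qy := qP_pos hρ' y
    have e : thP' r ρ w x - thP' r ρ w y = 2 * r * ρ * (1 - ρ^2) * (4 * ρ^2 * (y + x) * (y - x)) / (qP ρ x * qP ρ y) := by
      unfold thP'; field_simp; unfold qP; ring
    set a := 1 - ρ^2 with ha
    have hz : ∀ z, |ρ * z| ≤ qP ρ z / (4 * a) := fun z => by
      rw [le_div_iff₀ (by positivity)]
      unfold qP
      have := sq_nonneg (a - 2 * |ρ * z|)
      have e2 : |ρ * z|^2 = ρ^2 * z^2 := by rw [sq_abs]; ring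
      nlinarith
    have hqx := hq x
    have hqy := hq y
    have s1 : |ρ * y| * a ^ 3 * 4 ≤ qP ρ x * qP ρ y := by
      have := hz y
      rw [le_div_iff₀ (by positivity)] at this
      calc _ = a^2 * (|ρ * y| * (4 * a)) := by ring
        _ ≤ _ := mul_le_mul hqx this (by positivity) qx.le
    have s2 : |ρ * x| * a ^ 3 * 4 ≤ qP ρ x * qP ρ y := by
      have := hz x
      rw [le_div_iff₀ (by positivity)] at this
      calc _ = (|ρ * x| * (4 * a)) * a^2 := by ring
        _ ≤ _ := mul_le_mul this hqy (by positivity) qx.le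
    have s3 : |4 * ρ^2 * (y + x)| * a^3 ≤ 2 * (qP ρ x * qP ρ y) := by
      have e3 : |4 * ρ^2 * (y + x)| ≤ 4 * (|ρ * y| + |ρ * x|) := by
        have : 4 * ρ^2 * (y + x) = 4 * (ρ * (ρ * y + ρ * x)) := by ring
        rw [this, abs_mul, abs_mul, abs_of_pos (by norm_num : (0:ℝ) < 4)]
        have := abs_add_le (ρ * y) (ρ * x)
        nlinarith [abs_nonneg (ρ * y + ρ * x)]
      have : 0 < a^3 := by positivity
      nlinarith
    rw [e, abs_div, abs_of_pos (mul_pos qx qy), abs_mul, abs_mul (4 * ρ^2 * (y + x)), abs_sub_comm y x]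
    have ha1 : a ≤ 1 := by nlinarith [sq_nonneg ρ]
    calc _ ≤ 2 * R * a * (2 * (qP ρ x * qP ρ y) / a^3 * |x - y|) / (qP ρ x * qP ρ y) := by
          gcongr
          rw [le_div_iff₀ (by positivity)]; exact s3
      _ = 4 * R * a / a^3 * |x - y| := by field_simp; ring
      _ ≤ _ := by
          refine mul_le_mul_of_nonneg_right ?_ (abs_nonneg _)
          refine div_le_div₀ (by positivity) ?_ (by positivity) (by gcongr)
          nlinarith

end Csin

end

section
set_option linter.all false
open MeasureTheory Filter Topology Complex

namespace Csin

def DP (r ρ w : ℝ) : ℝ := (DD (thP r ρ w) (thP' r ρ w)).re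
def et (r ρ w β : ℝ) : ℝ → ℂ := eta (thP r ρ w) (thP' r ρ w) (ThP r ρ w) β
def BB (r ρ w β : ℝ) : ℂ := ∫ ψ, (Ew r ρ w ψ : ℂ) * et r ρ w β ψ * eb β (-ψ) ∂nup
def bP (ρ : ℝ) : ℝ := 2 * ρ / (1 + ρ^2)
def bP' (ρ : ℝ) : ℝ := 2 * (1 - ρ^2) / (1 + ρ^2)^2

theorem DP_cast (r ρ w : ℝ) : DD (thP r ρ w) (thP' r ρ w) = (DP r ρ w : ℂ) := (DD_re _ _).symm

theorem thP_PhOK' {ρ : ℝ} (h : |ρ| < 1) (r w : ℝ) : PhOK (thP r ρ w) (thP' r ρ w) (2 * |r| / (1 - |ρ|^2) + |w|) (8 * |r| / (1 - |ρ|^2)^3) :=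
  thP_PhOK le_rfl h le_rfl le_rfl

theorem NN_formula {ρ β : ℝ} (h : |ρ| < 1) (hβ : |β| < 1) (r w : ℝ) :
    (1 + β^2) * NN (thP r ρ w) (thP' r ρ w) β =
      2 * Real.pi * DP r ρ w * ((r * ρ / (1 - ρ^2 * β^2) + w/2 : ℝ) : ℂ) + BB r ρ w β := by
  have := eta_fun (thP_PhOK' h r w) (ThP_OK h r w) hβ
  unfold NN
  rw [this, DP_cast, (ThP_hasDeriv h r w (norm_bI hβ).le).deriv, int_nup]
  congr 1
  · have : (1 + (ρ:ℂ)^2 * (β * I)^2) = 1 - ρ^2 * β^2 := by linear_combination (ρ:ℂ)^2 * β^2 * I_sq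
    rw [this]; push_cast
    linear_combination (-2 * Real.pi * DP r ρ w * (r * ρ / (1 - ρ^2 * β^2) + w/2) : ℂ) * I_sq
  · unfold BB et
    congr 1; funext ψ; rw [E2_ThP h]

theorem NN_re {ρ β : ℝ} (h : |ρ| < 1) (hβ : |β| < 1) (r w : ℝ) :
    (1 + β^2) * (NN (thP r ρ w) (thP' r ρ w) β).re =
      2 * Real.pi * DP r ρ w * (r * ρ / (1 - ρ^2 * β^2) + w/2 : ℝ) + (BB r ρ w β).re := by
  have := congrArg Complex.re (NN_formula h hβ r w)
  have e1 : (1 + (β:ℂ)^2) = ((1 + β^2 : ℝ) : ℂ) := by push_cast; ring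
  have e2 : (2 * Real.pi * DP r ρ w * ((r * ρ / (1 - ρ^2 * β^2) + w/2 : ℝ) : ℂ) : ℂ) = ((2 * Real.pi * DP r ρ w * (r * ρ / (1 - ρ^2 * β^2) + w/2 : ℝ) : ℝ) : ℂ) := by
    push_cast; ring
  rw [e1, e2, re_ofReal_mul, add_re, ofReal_re] at this
  exact this

theorem hasDerivAt_re {f : ℝ → ℂ} {f' : ℂ} {x : ℝ} (h : HasDerivAt f f' x) : HasDerivAt (fun x => (f x).re) f'.re x :=
  reCLM.hasFDerivAt.comp_hasDerivAt x h

theorem DP_w_deriv {ρ : ℝ} (h : |ρ| < 1) (r w : ℝ) :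
    HasDerivAt (fun w => DP r ρ w) (-(2 * r * ρ + w) * DP r ρ w - (1 / Real.pi) * (BB r ρ w 0).re) w := by
  have hpi : (Real.pi : ℂ) ≠ 0 := by exact_mod_cast Real.pi_ne_zero
  have main := DD_hasDerivAt (I := Metric.ball w 1) Metric.isOpen_ball (convex_ball w 1).isPreconnected (θ := fun w => thP r ρ w) (θ' := fun w => thP' r ρ w)
    (θd := fun w x => x) (θd' := fun w x => 1) (L := 2 * |r| / (1 - |ρ|^2) + (|w| + 1)) (L2 := fun _ => 8 * |r| / (1 - |ρ|^2)^3)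
    (fun s hs => thP_PhOK le_rfl h le_rfl (by
      have := abs_sub_abs_le_abs_sub s w
      rw [Metric.mem_ball, Real.dist_eq] at hs; linarith))
    (fun s hs x => by simpa [thP] using ((hasDerivAt_id s).mul_const x).const_add (r * Real.arctan (2 * ρ / (1 - ρ^2) * x)))
    (fun s hs x => by simpa [thP'] using (hasDerivAt_id s).const_add (2 * r * ρ * (1 - ρ^2) / qP ρ x))
    (n := 1) (c := fun _ _ => 1) (β := fun _ _ => 0) (c0 := 1) (β0 := 0) (by simp) (by simp) (by simp)
    (by simp [rho, dq]) (by simp [rho, dq]) (s := w) (by simp)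
  have hn := NN_re h (β := 0) (by simp) r w
  refine (hasDerivAt_re main).congr_deriv ?_
  simp only [Finset.univ_unique, Finset.sum_singleton, neg_zero, ofReal_one, one_mul]
  rw [Complex.add_conj]
  have hn' : (NN (thP r ρ w) (thP' r ρ w) 0).re = 2 * Real.pi * DP r ρ w * (r * ρ + w/2) + (BB r ρ w 0).re := by
    simpa using hn
  have e : -((1 / (2 * Real.pi) : ℂ) * ((2 * (NN (thP r ρ w) (thP' r ρ w) 0).re : ℝ) : ℂ)) = ((-(1 / (2 * Real.pi) * (2 * (NN (thP r ρ w) (thP' r ρ w) 0).re)) : ℝ) : ℂ) := by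
    push_cast; ring
  rw [e, ofReal_re, hn']
  field_simp
  ring

theorem rho_eq {β : ℝ} (h : |β| < 1) (x : ℝ) : rho β x = ((1 - β^2 : ℝ) + (2 * β * x : ℝ) * I) / (qP β x : ℝ) := by
  unfold rho
  have hq : ((qP β x : ℝ) : ℂ) ≠ 0 := by exact_mod_cast (qP_pos h x).ne'
  rw [div_eq_div_iff (dq_imag_ne h x) hq, dq_imag]
  unfold qP; push_cast
  linear_combination (4 * β^2 * x^2 : ℂ) * I_sq

def thD (r s x : ℝ) : ℝ := r * (2 * (1 + s^2) * x / qP s x) - r * bP' s * x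
def thD' (r s x : ℝ) : ℝ := r * (2 * (1 + s^2) * ((1 - s^2)^2 - 4 * s^2 * x^2) / (qP s x)^2) - r * bP' s

theorem bP_deriv (s : ℝ) : HasDerivAt bP (bP' s) s := by
  have h2 : 0 < 1 + s^2 := by positivity
  have d1 : HasDerivAt (fun s : ℝ => 2 * s) 2 s := by simpa using (hasDerivAt_id s).const_mul (2:ℝ)
  have d2 : HasDerivAt (fun s : ℝ => 1 + s^2) (2 * s) s := by simpa using (hasDerivAt_pow 2 s).const_add 1
  refine (d1.div d2 h2.ne').congr_deriv ?_
  unfold bP'; field_simp; ring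

theorem thP_sderiv {s : ℝ} (h : |s| < 1) (r y x : ℝ) : HasDerivAt (fun s => thP r s (y - r * bP s) x) (thD r s x) s := by
  have h1 := one_sub_sq h
  have hq := qP_pos h x
  have d1 : HasDerivAt (fun s : ℝ => 2 * s) 2 s := by simpa using (hasDerivAt_id s).const_mul (2:ℝ)
  have d2 : HasDerivAt (fun s : ℝ => 1 - s^2) (-(2 * s)) s := by simpa using (hasDerivAt_pow 2 s).const_sub 1
  have d3 := ((d1.div d2 h1.ne').mul_const x).arctan.const_mul r
  have d4 := (((bP_deriv s).const_mul r).const_sub y).mul_const x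
  refine (d3.add d4).congr_deriv ?_
  unfold thD
  simp only [Pi.div_apply]
  have : 1 + (2 * s / (1 - s^2) * x)^2 = qP s x / (1 - s^2)^2 := by unfold qP; field_simp; ring
  rw [this]; field_simp; ring

theorem thP'_sderiv {s : ℝ} (h : |s| < 1) (r y x : ℝ) : HasDerivAt (fun s => thP' r s (y - r * bP s) x) (thD' r s x) s := by
  have h1 := one_sub_sq h
  have hq := qP_pos h x
  have d1 : HasDerivAt (fun s : ℝ => 2 * r * s) (2 * r) s := by simpa using (hasDerivAt_id s).const_mul (2*r:ℝ)
  have d2 : HasDerivAt (fun s : ℝ => 1 - s^2) (-(2 * s)) s := by simpa using (hasDerivAt_pow 2 s).const_sub 1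
  have d5 : HasDerivAt (fun s : ℝ => 4 * s^2 * x^2) (8 * s * x^2) s := by
    refine (((hasDerivAt_pow 2 s).const_mul (4:ℝ)).mul_const (x^2)).congr_deriv ?_
    push_cast; ring
  have dq : HasDerivAt (fun s => qP s x) (2 * (1 - s^2) * (-(2*s)) + 8 * s * x^2) s := by
    refine ((d2.pow 2).add d5).congr_deriv ?_
    simp
  have d3 := (d1.mul d2).div dq hq.ne'
  have d4 := (((bP_deriv s).const_mul r).const_sub y)
  refine (d3.add d4).congr_deriv ?_
  unfold thD'
  simp only [Pi.mul_apply]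
  have hq2 : qP s x ≠ 0 := hq.ne'
  rw [← sub_eq_add_neg]
  congr 1
  rw [mul_div_assoc', div_left_inj' (by positivity)]
  unfold qP; ring

theorem DP_s_deriv {s : ℝ} (h0 : 0 < s) (h : s < 1) (r y : ℝ) {w : ℝ} (hw : w = y - r * bP s) :
    HasDerivAt (fun s => DP r s (y - r * bP s))
      (-(r * (4 * (r * s / (1 - s^4) + w/2) - 2 * bP' s * (r * s + w/2))) * DP r s w
        - (r / Real.pi) * (BB r s w s + BB r s w (-s) - bP' s * BB r s w 0).re) s := by
  have hpi : (Real.pi : ℂ) ≠ 0 := by exact_mod_cast Real.pi_ne_zero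
  set s1 := (s + 1)/2 with hs1
  have hs11 : s1 < 1 := by simp only [hs1]; linarith
  have hs12 : s < s1 := by simp only [hs1]; linarith
  have hab : ∀ t ∈ Set.Ioo 0 s1, |t| ≤ s1 := fun t ht => by rw [abs_of_pos ht.1]; exact ht.2.le
  have hab1 : ∀ t ∈ Set.Ioo 0 s1, |t| < 1 := fun t ht => (hab t ht).trans_lt hs11
  have hbb : ∀ t ∈ Set.Ioo 0 s1, |bP t| ≤ 1 := fun t ht => by
    unfold bP
    have : 0 < t := ht.1
    rw [abs_of_pos (by positivity), div_le_one (by positivity)]; nlinarith [sq_nonneg (t-1)]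
  have hbb' : ∀ t ∈ Set.Ioo 0 s1, |bP' t| ≤ 2 := fun t ht => by
    unfold bP'
    have h1 := one_sub_sq (hab1 t ht)
    rw [abs_of_pos (by positivity), div_le_iff₀ (by positivity)]; nlinarith [sq_nonneg t, sq_nonneg (t^2)]
  have S2 : ∀ t ∈ Set.Ioo 0 s1, ∀ x y, ∑ j, (((![fun s => r * (1 + s^2), fun s => r * (1 + s^2), fun s => - (r * bP' s)] : Fin 3 → ℝ → ℝ) j t : ℝ) : ℂ) *
      rho ((![fun s => s, fun s => -s, fun s => 0] : Fin 3 → ℝ → ℝ) j t) x * rho ((![fun s => s, fun s => -s, fun s => 0] : Fin 3 → ℝ → ℝ) j t) y =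
      ((r * (2 * (1 + t^2) * ((1 - t^2)^2 - 4 * t^2 * x * y)) / (qP t x * qP t y) - r * bP' t : ℝ) : ℂ) := by
    intro t ht x y
    have hx : ((qP t x : ℝ):ℂ) ≠ 0 := by exact_mod_cast (qP_pos (hab1 t ht) x).ne'
    have hy : ((qP t y : ℝ):ℂ) ≠ 0 := by exact_mod_cast (qP_pos (hab1 t ht) y).ne'
    have r0 : ∀ x, rho 0 x = 1 := fun x => by simp [rho, dq]
    have qn : ∀ x, qP (-t) x = qP t x := fun x => by unfold qP; ring
    rw [Fin.sum_univ_three]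
    simp only [Matrix.cons_val_zero, Matrix.cons_val_one, Matrix.cons_val, r0, mul_one]
    rw [rho_eq (hab1 t ht), rho_eq (hab1 t ht), rho_eq (by simpa using hab1 t ht), rho_eq (by simpa using hab1 t ht), qn, qn]
    push_cast
    field_simp
    linear_combination (-8 * r * t^2 * x * y * (1 + t^2) * (-1) : ℂ) * I_sq
  have main := DD_hasDerivAt (I := Set.Ioo 0 s1) isOpen_Ioo isPreconnected_Ioo (θ := fun s => thP r s (y - r * bP s)) (θ' := fun s => thP' r s (y - r * bP s))
    (θd := thD r) (θd' := thD' r) (L := 2 * |r| / (1 - s1^2) + (|y| + |r|)) (L2 := fun _ => 8 * |r| / (1 - s1^2)^3)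
    (fun t ht => thP_PhOK (hab t ht) hs11 le_rfl (by
      refine (abs_sub _ _).trans ?_
      rw [abs_mul]
      nlinarith [hbb t ht, abs_nonneg r]))
    (fun t ht x => thP_sderiv (hab1 t ht) r y x)
    (fun t ht x => thP'_sderiv (hab1 t ht) r y x)
    (n := 3) (c := ![fun s => r * (1 + s^2), fun s => r * (1 + s^2), fun s => - (r * bP' s)])
    (β := ![fun s => s, fun s => -s, fun s => 0]) (c0 := |r| * 2) (β0 := s1) (by
      intro j t ht
      have := hab1 t ht
      have h1 := one_sub_sq this
      have e : |1 + t^2| ≤ 2 := by rw [abs_of_pos (by positivity)]; linarith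
      have e2 := hbb' t ht
      fin_cases j
      · show |r * (1 + t^2)| ≤ _; rw [abs_mul]; gcongr
      · show |r * (1 + t^2)| ≤ _; rw [abs_mul]; gcongr
      · show |-(r * bP' t)| ≤ _; rw [abs_neg, abs_mul]; gcongr)
    hs11 (by
      intro j t ht
      have := hab t ht
      have h0 : 0 ≤ s1 := (abs_nonneg _).trans this
      fin_cases j <;> simpa)
    (by
      intro t ht x y
      rw [S2 t ht x y, ← ofReal_mul]
      congr 1
      have hx := (qP_pos (hab1 t ht) x).ne'
      have hy := (qP_pos (hab1 t ht) y).ne'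
      unfold thD
      field_simp
      unfold qP
      ring)
    (by
      intro t ht x
      rw [S2 t ht x x]
      congr 1
      have hx := (qP_pos (hab1 t ht) x).ne'
      unfold thD'
      field_simp)
    (s := s) ⟨h0, hs12⟩
  refine (hasDerivAt_re main).congr_deriv ?_
  have hs : |s| < 1 := hab1 s ⟨h0, hs12⟩
  have hsn : |-s| < 1 := by simpa using hs
  have n0 := NN_re hs (β := 0) (by simp) r w
  have n1 := NN_re hs (β := s) hs r w
  have n2 := NN_re hs (β := -s) hsn r w
  rw [Fin.sum_univ_three]
  simp only [Matrix.cons_val_zero, Matrix.cons_val_one, Matrix.cons_val, neg_zero, neg_neg]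
  rw [← hw]
  set N0 := NN (thP r s w) (thP' r s w) 0
  set N1 := NN (thP r s w) (thP' r s w) s
  set N2 := NN (thP r s w) (thP' r s w) (-s)
  have e1 : (1 / (2 * Real.pi) : ℂ) = ((1 / (2 * Real.pi) : ℝ) : ℂ) := by push_cast; ring
  rw [e1, neg_re, re_ofReal_mul]
  simp only [add_re, re_ofReal_mul, conj_re, sub_re]
  have hs4 : (1 - s^4) ≠ 0 := by
    have : 1 - s^4 = (1 - s^2) * (1 + s^2) := by ring
    rw [this]; have := one_sub_sq hs; positivity
  rw [neg_sq] at n2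
  have e4 : s^2 * s^2 = s^4 := by ring
  rw [e4] at n1 n2
  have f1 : N1.re = (2 * Real.pi * DP r s w * (r * s / (1 - s^4) + w/2) + (BB r s w s).re) / (1 + s^2) := by
    rw [eq_div_iff (by positivity), mul_comm]; exact n1
  have f2 : N2.re = (2 * Real.pi * DP r s w * (r * s / (1 - s^4) + w/2) + (BB r s w (-s)).re) / (1 + s^2) := by
    rw [eq_div_iff (by positivity), mul_comm]; exact n2
  have f0 : N0.re = 2 * Real.pi * DP r s w * (r * s + w/2) + (BB r s w 0).re := by simpa using n0
  rw [f1, f2, f0]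
  have hpp := Real.pi_ne_zero
  have hss : 1 + s^2 ≠ 0 := by positivity
  generalize r * s / (1 - s^4) + w/2 = A
  field_simp
  ring

end Csin

end

section
set_option linter.all false
open MeasureTheory Filter Topology Complex

namespace Csin

def Y0 (ρ a b c m n : ℂ) : ℂ := ((a + b)/2 - ρ * (m - n)/2) / (1 - ρ^4)
def Y1 (ρ a b c m n : ℂ) : ℂ := (-(a - b)/(4*ρ) + (m + n)/4) / (1 - ρ^2)
def Y2 (ρ a b c m n : ℂ) : ℂ := ((2 + ρ^2) * (((a + b)/2 - ρ * (m - n)/2) / (1 - ρ^4)) - (c - (a + b)/2)/ρ^2 - ((m - n)/(2*ρ) - ρ^2*(a+b)/2)/(1 - ρ^4))/4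

def FB (ρ h0 h1 h2 e0 e1 e2 : ℂ) : ℂ := (1+ρ^2)^2*(h2*e0 + h0*e2 - h1*e1) - 4*ρ^2*(h2*e2)

theorem bilin {ρ : ℂ} (h0 : ρ ≠ 0) (h1 : 1 - ρ^2 ≠ 0) (h2 : 1 + ρ^2 ≠ 0) (a b c m n k p q u x y z : ℂ) :
    a * y + b * x - (2 * (1 - ρ^2)/(1+ρ^2)^2) * (c * z) + (m * q + n * p - (2 * (1 - ρ^2)/(1+ρ^2)^2) * (k * u)) =
    (8 * ρ^2 * (1 - ρ^2)/(1+ρ^2)^2) * (FB ρ (Y0 ρ a b c m n) (Y1 ρ a b c m n) (Y2 ρ a b c m n) (Y0 ρ x y z p q) (Y1 ρ x y z p q) (Y2 ρ x y z p q)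
     + FB ρ (Y0 ρ m n k a b) (Y1 ρ m n k a b) (Y2 ρ m n k a b) (Y0 ρ p q u x y) (Y1 ρ p q u x y) (Y2 ρ p q u x y)) := by
  have h4 : 1 - ρ^4 = (1 - ρ^2) * (1 + ρ^2) := by ring
  unfold FB Y0 Y1 Y2
  rw [h4]
  field_simp
  ring

/-- linear integral equation solutions -/
structure Sol (w : ℝ → ℝ) (D : ℂ) (η x : ℝ → ℂ) : Prop where
  ce : Continuous η
  cx : Continuous x
  eq : ∀ φ ∈ Set.Ioo 0 Real.pi, η φ + (1 / (2 * Real.pi)) * ∫ ψ in (0:ℝ)..Real.pi, (w ψ : ℂ) * η ψ / Real.sin ((φ + ψ)/2) = D * x φ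

theorem Sol_int {w : ℝ → ℝ} (hw : Continuous w) {η : ℝ → ℂ} (hη : Continuous η) {φ : ℝ} (hφ : φ ∈ Set.Ioo 0 Real.pi) :
    IntervalIntegrable (fun ψ => (w ψ : ℂ) * η ψ / Real.sin ((φ + ψ)/2)) volume 0 Real.pi := by
  apply ContinuousOn.intervalIntegrable
  rw [Set.uIcc_of_le Real.pi_pos.le]
  refine ContinuousOn.div (by fun_prop) (by fun_prop) fun ψ hψ => ?_
  exact_mod_cast (Real.sin_pos_of_pos_of_lt_pi (by linarith [hφ.1, hψ.1]) (by linarith [hφ.2, hψ.2])).ne'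

theorem Sol.add {w : ℝ → ℝ} (hw : Continuous w) {D : ℂ} {η x η' x' : ℝ → ℂ} (h : Sol w D η x) (h' : Sol w D η' x') :
    Sol w D (fun φ => η φ + η' φ) (fun φ => x φ + x' φ) := by
  refine ⟨h.ce.add h'.ce, h.cx.add h'.cx, fun φ hφ => ?_⟩
  rw [mul_add, ← h.eq φ hφ, ← h'.eq φ hφ]
  have : ∀ ψ, (w ψ : ℂ) * (η ψ + η' ψ) / Real.sin ((φ + ψ)/2) = (w ψ : ℂ) * η ψ / Real.sin ((φ + ψ)/2) + (w ψ : ℂ) * η' ψ / Real.sin ((φ + ψ)/2) := fun ψ => by ring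
  simp_rw [this]
  rw [intervalIntegral.integral_add (Sol_int hw h.ce hφ) (Sol_int hw h'.ce hφ)]
  ring

theorem Sol.smul {w : ℝ → ℝ} {D : ℂ} {η x : ℝ → ℂ} (h : Sol w D η x) (k : ℂ) :
    Sol w D (fun φ => k * η φ) (fun φ => k * x φ) := by
  refine ⟨h.ce.const_mul k, h.cx.const_mul k, fun φ hφ => ?_⟩
  rw [mul_left_comm, ← h.eq φ hφ]
  have : ∀ ψ, (w ψ : ℂ) * (k * η ψ) / Real.sin ((φ + ψ)/2) = k * ((w ψ : ℂ) * η ψ / Real.sin ((φ + ψ)/2)) := fun ψ => by ring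
  simp_rw [this]
  rw [intervalIntegral.integral_const_mul]
  ring

theorem Sol.conj {w : ℝ → ℝ} {D : ℝ} {η x : ℝ → ℂ} (h : Sol w D η x) :
    Sol w D (fun φ => (starRingEnd ℂ) (η φ)) (fun φ => (starRingEnd ℂ) (x φ)) := by
  refine ⟨Complex.continuous_conj.comp h.ce, Complex.continuous_conj.comp h.cx, fun φ hφ => ?_⟩
  have := congrArg (starRingEnd ℂ) (h.eq φ hφ)
  rw [map_mul, conj_ofReal] at this
  rw [← this, map_add, map_mul, int_nup, int_nup, ← integral_conj]
  congr 2
  · simp; exact (map_ofNat _ 2).symm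
  · congr 1; funext ψ; rw [map_div₀, map_mul, conj_ofReal, conj_ofReal]

theorem Sol.lin5 {w : ℝ → ℝ} (hw : Continuous w) {D : ℂ} {a b c m n a' b' c' m' n' : ℝ → ℂ} (ha : Sol w D a a') (hb : Sol w D b b') (hc : Sol w D c c')
    (hm : Sol w D m m') (hn : Sol w D n n') (k1 k2 k3 k4 k5 : ℂ) :
    Sol w D (fun φ => k1 * a φ + (k2 * b φ + (k3 * c φ + (k4 * m φ + k5 * n φ)))) (fun φ => k1 * a' φ + (k2 * b' φ + (k3 * c' φ + (k4 * m' φ + k5 * n' φ)))) :=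
  (ha.smul k1).add hw ((hb.smul k2).add hw ((hc.smul k3).add hw ((hm.smul k4).add hw (hn.smul k5))))

theorem Sol.Y {w : ℝ → ℝ} (hw : Continuous w) {D : ℂ} {a b c m n a' b' c' m' n' : ℝ → ℂ} (ha : Sol w D a a') (hb : Sol w D b b') (hc : Sol w D c c')
    (hm : Sol w D m m') (hn : Sol w D n n') (ρ : ℂ) :
    Sol w D (fun φ => Y0 ρ (a φ) (b φ) (c φ) (m φ) (n φ)) (fun φ => Y0 ρ (a' φ) (b' φ) (c' φ) (m' φ) (n' φ)) ∧
    Sol w D (fun φ => Y1 ρ (a φ) (b φ) (c φ) (m φ) (n φ)) (fun φ => Y1 ρ (a' φ) (b' φ) (c' φ) (m' φ) (n' φ)) ∧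
    Sol w D (fun φ => Y2 ρ (a φ) (b φ) (c φ) (m φ) (n φ)) (fun φ => Y2 ρ (a' φ) (b' φ) (c' φ) (m' φ) (n' φ)) := by
  refine ⟨?_, ?_, ?_⟩
  · convert Sol.lin5 hw ha hb hc hm hn (1/2/(1-ρ^4)) (1/2/(1-ρ^4)) 0 (-ρ/2/(1-ρ^4)) (ρ/2/(1-ρ^4)) using 2 <;> unfold Y0 <;> ring
  · convert Sol.lin5 hw ha hb hc hm hn (-1/(4*ρ)/(1-ρ^2)) (1/(4*ρ)/(1-ρ^2)) 0 (1/4/(1-ρ^2)) (1/4/(1-ρ^2)) using 2 <;> unfold Y1 <;> ring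
  · convert Sol.lin5 hw ha hb hc hm hn (((2+ρ^2)/2/(1-ρ^4) + 1/2/ρ^2 + ρ^2/2/(1-ρ^4))/4) (((2+ρ^2)/2/(1-ρ^4) + 1/2/ρ^2 + ρ^2/2/(1-ρ^4))/4) (-1/ρ^2/4) 
      (((2+ρ^2)*(-ρ/2)/(1-ρ^4) - 1/(2*ρ)/(1-ρ^4))/4) (-((2+ρ^2)*(-ρ/2)/(1-ρ^4) - 1/(2*ρ)/(1-ρ^4))/4) using 2 <;> unfold Y2 <;> ring

theorem Ew_cont {ρ : ℝ} (h : |ρ| < 1) (r w : ℝ) : Continuous (Ew r ρ w) := by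
  have h1 : ∀ φ, 1 - 2 * ρ * Real.sin φ + ρ^2 ≠ 0 := fun φ => by
    have := abs_lt.1 (sin_abs h φ)
    have := one_sub_sq h
    have : (ρ * Real.sin φ)^2 ≤ ρ^2 := by nlinarith [Real.sin_sq_le_one φ, sq_nonneg ρ]
    nlinarith
  have h2 : ∀ φ, 1 + 2 * ρ * Real.sin φ + ρ^2 ≠ 0 := fun φ => by
    have := h1 (-φ); simpa using this
  unfold Ew
  fun_prop (disch := assumption)

theorem et_Sol {ρ β : ℝ} (h : |ρ| < 1) (hβ : |β| < 1) (r w : ℝ) : Sol (Ew r ρ w) (DP r ρ w) (et r ρ w β) (eb β) := by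
  refine ⟨eta_cont (thP_PhOK' h r w) (ThP_OK h r w) hβ, ?_, fun φ hφ => ?_⟩
  · unfold eb
    exact (ee_cont.comp (by fun_prop)).div (by have := ee_cont; fun_prop) fun φ => one_sub_ne hβ (ee_mem_cb φ)
  · have := eta_eq (thP_PhOK' h r w) (ThP_OK h r w) hβ hφ
    rw [DP_cast] at this
    simp_rw [E2_ThP h] at this
    exact this

theorem eb_conj (β φ : ℝ) : eb β (-φ) = (starRingEnd ℂ) (eb (-β) φ) := by
  unfold eb
  simp [ee_conj, neg_div, sub_eq_add_neg]


theorem ebY {ρ : ℝ} (h0 : ρ ≠ 0) (h : |ρ| < 1) (φ : ℝ) :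
    Y0 ρ (eb ρ φ) (eb (-ρ) φ) (eb 0 φ) (I * (starRingEnd ℂ) (eb ρ φ)) (I * (starRingEnd ℂ) (eb (-ρ) φ)) =
      ee (φ/2) / ((1+ρ^2)^2 - 4 * ρ^2 * Real.sin φ^2 : ℝ) ∧
    Y1 ρ (eb ρ φ) (eb (-ρ) φ) (eb 0 φ) (I * (starRingEnd ℂ) (eb ρ φ)) (I * (starRingEnd ℂ) (eb (-ρ) φ)) =
      ee (φ/2) * Real.sin φ / ((1+ρ^2)^2 - 4 * ρ^2 * Real.sin φ^2 : ℝ) ∧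
    Y2 ρ (eb ρ φ) (eb (-ρ) φ) (eb 0 φ) (I * (starRingEnd ℂ) (eb ρ φ)) (I * (starRingEnd ℂ) (eb (-ρ) φ)) =
      ee (φ/2) * Real.sin φ^2 / ((1+ρ^2)^2 - 4 * ρ^2 * Real.sin φ^2 : ℝ) := by
  have hn : |-ρ| < 1 := by simpa using h
  have hρ : (ρ:ℂ) ≠ 0 := by exact_mod_cast h0
  have k1 : (1 - (ρ:ℂ)^2) ≠ 0 := by exact_mod_cast (one_sub_sq h).ne'
  have k2 : (1 + (ρ:ℂ)^2) ≠ 0 := by exact_mod_cast (by positivity : 1 + ρ^2 ≠ 0)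
  have h4 : 1 - (ρ:ℂ)^4 = (1 - ρ^2) * (1 + ρ^2) := by ring
  set v : ℂ := I * ee φ with hv
  have hv0 : v ≠ 0 := mul_ne_zero I_ne_zero (ee_ne φ)
  set g := ee (φ/2) with hg
  have hgg : ee φ = g * g := by rw [hg, ← ee_add]; ring_nf
  have hg0 : g ≠ 0 := ee_ne _
  have n1 : 1 - ρ * v ≠ 0 := by
    have := one_sub_ne h (ee_mem_cb φ); rwa [mul_assoc] at this
  have n2 : 1 + ρ * v ≠ 0 := by
    have := one_sub_ne hn (ee_mem_cb φ); rw [mul_assoc, ← hv] at this; push_cast at this; rwa [neg_mul, sub_neg_eq_add] at this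
  have hvn : ‖v‖ = 1 := by simp [hv, norm_ee]
  have m1 : v - ρ ≠ 0 := by
    intro e; rw [sub_eq_zero.1 e] at hvn; simp at hvn; linarith
  have m2 : v + ρ ≠ 0 := by
    intro e; rw [eq_neg_of_add_eq_zero_left e] at hvn; simp at hvn; linarith
  have e1 : eb ρ φ = g / (1 - ρ * v) := by unfold eb; rw [mul_assoc]
  have e2 : eb (-ρ) φ = g / (1 + ρ * v) := by unfold eb; push_cast; rw [mul_assoc, ← hv, neg_mul, sub_neg_eq_add]
  have e3 : eb 0 φ = g := by unfold eb; simp [hg]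
  have vI : ∀ β : ℝ, 1 - β * I * ee (-φ) = (v + β) / v := fun β => by
    rw [eq_div_iff hv0, hv]
    linear_combination (-(β:ℂ) * ee φ * ee (-φ)) * I_sq + (β : ℂ) * ee_mul_neg φ
  have i0 : ∀ β : ℝ, I * eb β (-φ) = - g / (v + β) ∨ v + β = 0 := fun β => by
    by_cases hh : v + β = 0
    · right; exact hh
    left
    unfold eb
    rw [vI]
    have : ee (-φ/2) = g⁻¹ := by rw [neg_div, ee_neg]
    rw [this]
    field_simp
    rw [hv, hgg]
    linear_combination g^2 * I_sq
  have e4 : I * (starRingEnd ℂ) (eb ρ φ) = -g / (v - ρ) := by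
    have e5 := eb_conj (-ρ) φ
    rw [neg_neg] at e5
    rw [← e5]
    rcases i0 (-ρ) with h | h
    · rw [h]; push_cast; rw [sub_eq_add_neg]
    · push_cast at h; rw [← sub_eq_add_neg] at h; exact absurd h m1
  have e5 : I * (starRingEnd ℂ) (eb (-ρ) φ) = -g / (v + ρ) := by
    rw [← eb_conj ρ φ]
    exact (i0 ρ).resolve_right m2
  have hs : ((Real.sin φ : ℝ) : ℂ) = -(v + 1/v)/2 := by
    rw [sin_cast, hv]
    have := ee_mul_neg φ
    have := ee_ne φ
    rw [ee_neg]; field_simp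
    linear_combination I_sq
  have d1 : (((1+ρ^2)^2 - 4 * ρ^2 * Real.sin φ^2 : ℝ) : ℂ) = (1 - ρ*v)*(1+ρ*v)*((v-ρ)*(v+ρ))/v^2 := by
    push_cast [hs]
    field_simp
    ring
  rw [d1, hs, e4, e5, e1, e2, e3]
  refine ⟨?_, ?_, ?_⟩
  · unfold Y0; rw [h4]; field_simp; ring
  · unfold Y1; field_simp; ring
  · unfold Y2; rw [h4]; field_simp; ring

end Csin

end

section
set_option linter.all false
open MeasureTheory Filter Topology Complex

namespace Csin

theorem FB_bound {w : ℝ → ℝ} (hw : Continuous w) (hw0 : ∀ φ, 0 ≤ w φ) {h0 h1 h2 e0 e1 e2 : ℝ → ℂ}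
    (c0 : Continuous h0) (c1 : Continuous h1) (c2 : Continuous h2) (d0 : Continuous e0) (d1 : Continuous e1) (d2 : Continuous e2)
    {d Q0 Q1 Q2 : ℝ} (hd : 0 ≤ d) (q0 : 0 < Q0) (q1 : 0 < Q1) (q2 : 0 < Q2)
    (H0 : ∫ φ, w φ * ‖h0 φ‖^2 ∂nup ≤ d^2 * Q0^2) (H1 : ∫ φ, w φ * ‖h1 φ‖^2 ∂nup ≤ d^2 * Q1^2) (H2 : ∫ φ, w φ * ‖h2 φ‖^2 ∂nup ≤ d^2 * Q2^2)
    (E0 : ∫ φ, w φ * ‖e0 φ‖^2 ∂nup ≤ Q0^2) (E1 : ∫ φ, w φ * ‖e1 φ‖^2 ∂nup ≤ Q1^2) (E2 : ∫ φ, w φ * ‖e2 φ‖^2 ∂nup ≤ Q2^2)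
    {ρ : ℝ} (hρ : |ρ| < 1) :
    ‖∫ φ, (w φ : ℂ) * FB ρ (h0 φ) (h1 φ) (h2 φ) (e0 φ) (e1 φ) (e2 φ) ∂nup‖ ≤ d * (4 * (2 * (Q0 * Q2) + Q1^2) + 4 * Q2^2) := by
  have P20 := pairing hw hw0 c2 d0 hd H2 E0 q2 q0
  have P02 := pairing hw hw0 c0 d2 hd H0 E2 q0 q2
  have P11 := pairing hw hw0 c1 d1 hd H1 E1 q1 q1
  have P22 := pairing hw hw0 c2 d2 hd H2 E2 q2 q2
  have i1 : Integrable (fun φ => (w φ : ℂ) * h2 φ * e0 φ) nup := cont_int_nup (by fun_prop)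
  have i2 : Integrable (fun φ => (w φ : ℂ) * h0 φ * e2 φ) nup := cont_int_nup (by fun_prop)
  have i3 : Integrable (fun φ => (w φ : ℂ) * h1 φ * e1 φ) nup := cont_int_nup (by fun_prop)
  have i4 : Integrable (fun φ => (w φ : ℂ) * h2 φ * e2 φ) nup := cont_int_nup (by fun_prop)
  have e : ∫ φ, (w φ : ℂ) * FB ρ (h0 φ) (h1 φ) (h2 φ) (e0 φ) (e1 φ) (e2 φ) ∂nup = 
     ((1 + ρ^2)^2 : ℝ) * ((∫ φ, (w φ : ℂ) * h2 φ * e0 φ ∂nup) + (∫ φ, (w φ : ℂ) * h0 φ * e2 φ ∂nup) - (∫ φ, (w φ : ℂ) * h1 φ * e1 φ ∂nup))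
      - (4 * ρ^2 : ℝ) * ∫ φ, (w φ : ℂ) * h2 φ * e2 φ ∂nup := by
    have i12 : Integrable (fun φ => (w φ : ℂ) * h2 φ * e0 φ + (w φ : ℂ) * h0 φ * e2 φ) nup := cont_int_nup (by fun_prop)
    have i123 : Integrable (fun φ => ((1 + ρ^2)^2 : ℝ) * ((w φ : ℂ) * h2 φ * e0 φ + (w φ : ℂ) * h0 φ * e2 φ - (w φ : ℂ) * h1 φ * e1 φ)) nup := cont_int_nup (by fun_prop)
    rw [← integral_add i1 i2, ← integral_sub i12 i3, ← integral_const_mul, ← integral_const_mul, ← integral_sub i123 (i4.const_mul _)]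
    congr 1; funext φ; unfold FB; push_cast; ring
  rw [e]
  have hs : ρ^2 ≤ 1 := by linarith [one_sub_sq hρ]
  refine (norm_sub_le _ _).trans ?_
  rw [norm_mul, norm_mul, norm_real, norm_real, Real.norm_of_nonneg (by positivity), Real.norm_of_nonneg (by positivity)]
  have n1 := norm_sub_le ((∫ φ, (w φ : ℂ) * h2 φ * e0 φ ∂nup) + (∫ φ, (w φ : ℂ) * h0 φ * e2 φ ∂nup)) (∫ φ, (w φ : ℂ) * h1 φ * e1 φ ∂nup)
  have n2 := norm_add_le (∫ φ, (w φ : ℂ) * h2 φ * e0 φ ∂nup) (∫ φ, (w φ : ℂ) * h0 φ * e2 φ ∂nup)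
  have n3 : ‖(∫ φ, (w φ : ℂ) * h2 φ * e0 φ ∂nup) + (∫ φ, (w φ : ℂ) * h0 φ * e2 φ ∂nup) - (∫ φ, (w φ : ℂ) * h1 φ * e1 φ ∂nup)‖ ≤ d * (2 * (Q0 * Q2) + Q1^2) := by
    nlinarith
  have n4 : (1 + ρ^2)^2 ≤ 4 := by nlinarith [sq_nonneg ρ]
  have := mul_le_mul n4 n3 (norm_nonneg _) (by norm_num)
  have := mul_le_mul (by linarith : 4 * ρ^2 ≤ 4) P22 (norm_nonneg _) (by norm_num)
  nlinarith

theorem exp_int {a : ℝ} (ha : 0 < a) : ∫ φ, Real.exp (-(a * φ)) ∂nup ≤ 1/a ∧ ∫ φ, Real.exp (-(a * (Real.pi - φ))) ∂nup ≤ 1 / a := by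
  have key : ∫ φ, Real.exp (-(a * φ)) ∂nup ≤ 1/a := by
    rw [← int_nup, intervalIntegral.integral_comp_mul_left (fun x => Real.exp (-x)) ha.ne']
    simp
    have := Real.exp_pos (-(a * Real.pi))
    have : 0 < a⁻¹ := by positivity
    nlinarith
  refine ⟨key, ?_⟩
  rw [← int_nup] at key ⊢
  rw [intervalIntegral.integral_comp_sub_left (fun x => Real.exp (-(a * x)))]
  simpa using key

theorem exp_sin_int {c : ℝ} (hc : 0 < c) : ∫ φ, Real.exp (-(c / 2 * Real.sin φ)) ∂nup ≤ 8 / c := by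
  have h1 := exp_int (a := c/4) (by positivity)
  have i1 : Integrable (fun φ => Real.exp (-(c/4 * φ))) nup := cont_int_nup (by fun_prop)
  have i2 : Integrable (fun φ => Real.exp (-(c/4 * (Real.pi - φ)))) nup := cont_int_nup (by fun_prop)
  have : ∫ φ, Real.exp (-(c / 2 * Real.sin φ)) ∂nup ≤ ∫ φ, (Real.exp (-(c/4 * φ)) + Real.exp (-(c/4 * (Real.pi - φ)))) ∂nup := by
    refine integral_mono_ae (cont_int_nup (by fun_prop)) (i1.add i2) ?_
    filter_upwards [nup_ae] with φ hφ
    rcases sin_lower hφ with h | h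
    · have : Real.exp (-(c / 2 * Real.sin φ)) ≤ Real.exp (-(c/4 * φ)) := Real.exp_le_exp.2 (by nlinarith)
      have := Real.exp_pos (-(c/4 * (Real.pi - φ)))
      linarith
    · have : Real.exp (-(c / 2 * Real.sin φ)) ≤ Real.exp (-(c/4 * (Real.pi - φ))) := Real.exp_le_exp.2 (by nlinarith)
      have := Real.exp_pos (-(c/4 * φ))
      linarith
  rw [integral_add i1 i2] at this
  have e : 1 / (c/4) = 4 / c := by field_simp
  rw [e] at h1
  have : 8 / c = 4/c + 4/c := by ring
  linarith

theorem pow_exp_le {c x : ℝ} (hc : 0 < c) (hx : 0 ≤ x) (m : ℕ) : x^m * Real.exp (-(c * x)) ≤ m.factorial * (2/c)^m * Real.exp (-(c/2*x)) := by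
  have := Real.pow_div_factorial_le_exp (x := c/2*x) (by positivity) m
  have e : Real.exp (-(c*x)) = Real.exp (-(c/2*x)) * Real.exp (-(c/2*x)) := by rw [← Real.exp_add]; ring_nf
  have hm : (0:ℝ) < m.factorial := by positivity
  rw [div_le_iff₀ hm] at this
  have e2 : (c/2*x)^m * (2/c)^m = x^m := by rw [← mul_pow]; congr 1; field_simp
  rw [← e2, e]
  have h1 : (c/2*x)^m * Real.exp (-(c/2*x)) ≤ m.factorial := by
    calc _ ≤ Real.exp (c/2*x) * m.factorial * Real.exp (-(c/2*x)) := by gcongr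
      _ = m.factorial := by rw [mul_right_comm, ← Real.exp_add]; simp
  calc _ = ((c/2*x)^m * Real.exp (-(c/2*x))) * ((2/c)^m * Real.exp (-(c/2*x))) := by ring
    _ ≤ m.factorial * ((2/c)^m * Real.exp (-(c/2*x))) := by gcongr
    _ = _ := by ring

theorem sin_pow_int {c : ℝ} (hc : 0 < c) (m : ℕ) : ∫ φ, Real.sin φ^m * Real.exp (-(c * Real.sin φ)) ∂nup ≤ m.factorial * (2/c)^m * (8/c) := by
  refine le_trans (integral_mono_ae (cont_int_nup (by fun_prop)) (g := fun φ => m.factorial * (2/c)^m * Real.exp (-(c/2*Real.sin φ))) (cont_int_nup (by fun_prop)) ?_) ?_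
  · filter_upwards [nup_ae] with φ hφ
    exact pow_exp_le hc (Real.sin_pos_of_mem_Ioo hφ).le m
  · rw [integral_const_mul]
    have := exp_sin_int hc
    gcongr

/-- bound for weighted norms -/
theorem wY_bound {w : ℝ → ℝ} (hw : Continuous w) {c K b ρ : ℝ} (hc : 0 < c) (hK : 0 < K) (hb : b = bP ρ) (h1 : |ρ| < 1)
    (hE : ∀ φ ∈ Set.Ioo 0 Real.pi, w φ ≤ K * Real.exp (-(c * Real.sin φ)) * (1 - b^2 * Real.sin φ^2)^2) 
    {y : ℝ → ℂ} (hy : Continuous y) (k : ℕ) (hyk : ∀ φ, ‖y φ‖ = |Real.sin φ|^k / |(1+ρ^2)^2 - 4 * ρ^2 * Real.sin φ^2|)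
    (hw0 : ∀ φ, 0 ≤ w φ) (hk : ((2*k).factorial : ℝ) * 2^(2*k) * 8 ≤ 3600) :
    ∫ φ, w φ * ‖y φ‖^2 ∂nup ≤ (60 * Real.sqrt (K/c) / c^k)^2 := by
  have : ∫ φ, w φ * ‖y φ‖^2 ∂nup ≤ ∫ φ, K * (Real.sin φ^(2*k) * Real.exp (-(c * Real.sin φ))) ∂nup := by
    refine integral_mono_ae (cont_int_nup (by fun_prop)) (cont_int_nup (by fun_prop)) ?_
    filter_upwards [nup_ae] with φ hφ
    rw [hyk, div_pow, ← pow_mul, sq_abs, mul_comm k 2, pow_mul, sq_abs, ← pow_mul]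
    have hden : (1+ρ^2)^2 - 4 * ρ^2 * Real.sin φ^2 = (1+ρ^2)^2 * (1 - b^2 * Real.sin φ^2) := by
      rw [hb]; unfold bP; field_simp; ring
    have hpos : 0 < (1+ρ^2)^2 - 4 * ρ^2 * Real.sin φ^2 := by
      have := one_sub_sq h1
      have := Real.sin_sq_le_one φ
      nlinarith [sq_nonneg ρ, mul_pos (one_sub_sq h1) (one_sub_sq h1)]
    rw [hden] at hpos ⊢
    have hp2 : 0 < 1 - b^2 * Real.sin φ^2 := by
      by_contra hh; push Not at hh; nlinarith [sq_nonneg (1+ρ^2)]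
    set g := 1 - b^2 * Real.sin φ^2
    have hS : 0 ≤ Real.sin φ ^(2*k) := by rw [pow_mul]; positivity
    have hr : (1:ℝ) ≤ ((1 + ρ^2)^2)^2 := by
      have : (1:ℝ) ≤ 1 + ρ^2 := by nlinarith [sq_nonneg ρ]
      have := one_le_pow₀ (n := 4) this
      calc (1:ℝ) ≤ _ := this
        _ = _ := by ring
    rw [← mul_div_assoc, div_le_iff₀ (by positivity)]
    calc _ ≤ (K * Real.exp (-(c * Real.sin φ)) * g^2) * Real.sin φ^(2*k) := by gcongr; exact hE φ hφ
      _ = K * (Real.sin φ^(2*k) * Real.exp (-(c * Real.sin φ))) * (1 * g^2) := by ring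
      _ ≤ _ := by rw [mul_pow]; gcongr
  refine this.trans ?_
  rw [integral_const_mul]
  have h3 := sin_pow_int hc (2*k)
  calc _ ≤ K * ((2*k).factorial * (2/c)^(2*k) * (8/c)) := by gcongr
    _ = ((2*k).factorial * 2^(2*k) * 8) * (K / c / (c^k)^2) := by rw [div_pow, ← pow_mul, mul_comm k 2]; field_simp
    _ ≤ 3600 * (K / c / (c^k)^2) := by gcongr
    _ = _ := by rw [div_pow, mul_pow, Real.sq_sqrt (by positivity)]; ring


theorem Ew_pos (r ρ w φ : ℝ) : 0 < Ew r ρ w φ := Real.exp_pos _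

theorem Y_swap (ρ : ℝ) (p q u : ℂ) :
    Y0 ρ (I * (starRingEnd ℂ) p) (I * (starRingEnd ℂ) q) (I * (starRingEnd ℂ) u) p q = I * (starRingEnd ℂ) (Y0 ρ p q u (I * (starRingEnd ℂ) p) (I * (starRingEnd ℂ) q)) ∧
    Y1 ρ (I * (starRingEnd ℂ) p) (I * (starRingEnd ℂ) q) (I * (starRingEnd ℂ) u) p q = I * (starRingEnd ℂ) (Y1 ρ p q u (I * (starRingEnd ℂ) p) (I * (starRingEnd ℂ) q)) ∧
    Y2 ρ (I * (starRingEnd ℂ) p) (I * (starRingEnd ℂ) q) (I * (starRingEnd ℂ) u) p q = I * (starRingEnd ℂ) (Y2 ρ p q u (I * (starRingEnd ℂ) p) (I * (starRingEnd ℂ) q)) := by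
  have h2 : (starRingEnd ℂ) 2 = 2 := map_ofNat _ 2
  have h4 : (starRingEnd ℂ) 4 = 4 := map_ofNat _ 4
  refine ⟨?_, ?_, ?_⟩
  · unfold Y0; simp only [map_mul, map_div₀, map_sub, map_add, map_pow, conj_I, conj_conj, conj_ofReal, map_one, h2]
    ring_nf; simp only [I_sq]; ring
  · unfold Y1; simp only [map_mul, map_div₀, map_sub, map_add, map_neg, map_pow, conj_I, conj_conj, conj_ofReal, map_one, h2, h4]
    ring_nf; simp only [I_sq]; ring
  · unfold Y2; simp only [map_mul, map_div₀, map_sub, map_add, map_neg, map_pow, conj_I, conj_conj, conj_ofReal, map_one, h2, h4]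
    ring_nf; simp only [I_sq]; ring

theorem Sol_energy {w : ℝ → ℝ} (hw : Continuous w) (hw0 : ∀ φ, 0 ≤ w φ) {D : ℝ} {η x : ℝ → ℂ} (h : Sol w D η x) {Q : ℝ}
    (hQ : ∫ φ, w φ * ‖x φ‖^2 ∂nup ≤ Q^2) : ∫ φ, w φ * ‖η φ‖^2 ∂nup ≤ |D|^2 * Q^2 := by
  have := energy hw hw0 h.ce h.cx h.eq
  rw [norm_real, Real.norm_eq_abs] at this
  exact this.trans (by gcongr)

theorem FB_int {w : ℝ → ℝ} (hw : Continuous w) {h0 h1 h2 e0 e1 e2 : ℝ → ℂ}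
    (c0 : Continuous h0) (c1 : Continuous h1) (c2 : Continuous h2) (d0 : Continuous e0) (d1 : Continuous e1) (d2 : Continuous e2) (ρ : ℝ) :
    Integrable (fun φ => (w φ : ℂ) * FB ρ (h0 φ) (h1 φ) (h2 φ) (e0 φ) (e1 φ) (e2 φ)) nup := cont_int_nup (by unfold FB; fun_prop)

set_option maxHeartbeats 1600000 in
theorem rem_bound {s r w c K : ℝ} (h0 : 0 < s) (h1 : s < 1) (hc : 1 ≤ c) (hK : 0 < K)
    (hE : ∀ φ ∈ Set.Ioo 0 Real.pi, Ew r s w φ ≤ K * Real.exp (-(c * Real.sin φ)) * (1 - (bP s)^2 * Real.sin φ^2)^2) :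
    |(BB r s w s + BB r s w (-s) - bP' s * BB r s w 0).re| ≤ 460800 * (s^2 * (1 - s^2)) * (K / c^3) * |DP r s w| := by
  have hs : |s| < 1 := by rw [abs_of_pos h0]; exact h1
  have hns : |-s| < 1 := by simpa using hs
  have hz : |(0:ℝ)| < 1 := by simp
  have hc0 : 0 < c := by linarith
  set W := Ew r s w with hW
  have cW : Continuous W := Ew_cont hs r w
  have W0 : ∀ φ, 0 ≤ W φ := fun φ => (Ew_pos _ _ _ _).le
  have Sa := et_Sol hs hs r w
  have Sb := et_Sol hs hns r w
  have Sc := et_Sol hs hz r w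
  have Sm := Sa.conj.smul I
  have Sn := Sb.conj.smul I
  have Sk := Sc.conj.smul I
  obtain ⟨T0, T1, T2⟩ := Sol.Y cW Sa Sb Sc Sm Sn s
  obtain ⟨U0, U1, U2⟩ := Sol.Y cW Sm Sn Sk Sa Sb s
  have den : ∀ φ, ‖(((1+s^2)^2 - 4 * s^2 * Real.sin φ^2 : ℝ) : ℂ)‖ = |(1+s^2)^2 - 4 * s^2 * Real.sin φ^2| := fun φ => by rw [norm_real, Real.norm_eq_abs]
  have y0 : ∀ φ, ‖Y0 s (eb s φ) (eb (-s) φ) (eb 0 φ) (I * (starRingEnd ℂ) (eb s φ)) (I * (starRingEnd ℂ) (eb (-s) φ))‖ = |Real.sin φ|^0 / |(1+s^2)^2 - 4 * s^2 * Real.sin φ^2| := fun φ => by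
    rw [(ebY h0.ne' hs φ).1, norm_div, den, norm_ee, pow_zero]
  have y1 : ∀ φ, ‖Y1 s (eb s φ) (eb (-s) φ) (eb 0 φ) (I * (starRingEnd ℂ) (eb s φ)) (I * (starRingEnd ℂ) (eb (-s) φ))‖ = |Real.sin φ|^1 / |(1+s^2)^2 - 4 * s^2 * Real.sin φ^2| := fun φ => by
    rw [(ebY h0.ne' hs φ).2.1, norm_div, den, norm_mul, norm_ee, norm_real, Real.norm_eq_abs, one_mul, pow_one]
  have y2 : ∀ φ, ‖Y2 s (eb s φ) (eb (-s) φ) (eb 0 φ) (I * (starRingEnd ℂ) (eb s φ)) (I * (starRingEnd ℂ) (eb (-s) φ))‖ = |Real.sin φ|^2 / |(1+s^2)^2 - 4 * s^2 * Real.sin φ^2| := fun φ => by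
    rw [(ebY h0.ne' hs φ).2.2, norm_div, den, norm_mul, norm_ee, norm_pow, norm_real, Real.norm_eq_abs, one_mul]
  have nI : ∀ z : ℂ, ‖I * (starRingEnd ℂ) z‖ = ‖z‖ := fun z => by rw [norm_mul, norm_I, one_mul, Complex.norm_conj]
  have V0 := wY_bound cW hc0 hK rfl hs hE T0.cx 0 y0 W0 (by norm_num [Nat.factorial])
  have V1 := wY_bound cW hc0 hK rfl hs hE T1.cx 1 y1 W0 (by norm_num [Nat.factorial])
  have V2 := wY_bound cW hc0 hK rfl hs hE T2.cx 2 y2 W0 (by norm_num [Nat.factorial])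
  have X0 := wY_bound cW hc0 hK rfl hs hE U0.cx 0 (fun φ => by rw [(Y_swap s _ _ _).1, nI]; exact y0 φ) W0 (by norm_num [Nat.factorial])
  have X1 := wY_bound cW hc0 hK rfl hs hE U1.cx 1 (fun φ => by rw [(Y_swap s _ _ _).2.1, nI]; exact y1 φ) W0 (by norm_num [Nat.factorial])
  have X2 := wY_bound cW hc0 hK rfl hs hE U2.cx 2 (fun φ => by rw [(Y_swap s _ _ _).2.2, nI]; exact y2 φ) W0 (by norm_num [Nat.factorial])
  have hQ : ∀ k : ℕ, 0 < 60 * Real.sqrt (K/c) / c^k := fun k => by positivity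
  have B1 := FB_bound cW W0 T0.ce T1.ce T2.ce U0.cx U1.cx U2.cx (abs_nonneg (DP r s w)) (hQ 0) (hQ 1) (hQ 2)
    (Sol_energy cW W0 T0 V0) (Sol_energy cW W0 T1 V1) (Sol_energy cW W0 T2 V2) X0 X1 X2 hs
  have B2 := FB_bound cW W0 U0.ce U1.ce U2.ce T0.cx T1.cx T2.cx (abs_nonneg (DP r s w)) (hQ 0) (hQ 1) (hQ 2)
    (Sol_energy cW W0 U0 X0) (Sol_energy cW W0 U1 X1) (Sol_energy cW W0 U2 X2) V0 V1 V2 hs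
  set X := BB r s w s + BB r s w (-s) - bP' s * BB r s w 0 with hX
  have ceb : ∀ β : ℝ, |β| < 1 → Continuous (eb β) := fun β hβ => (et_Sol hs hβ r w).cx
  have ceb' : ∀ β : ℝ, |β| < 1 → Continuous (fun φ => (starRingEnd ℂ) (eb β φ)) := fun β hβ => Complex.continuous_conj.comp (ceb β hβ)
  have E1 : BB r s w s = ∫ φ, (W φ : ℂ) * (et r s w s φ * (starRingEnd ℂ) (eb (-s) φ)) ∂nup := by
    unfold BB; congr 1; funext φ; rw [eb_conj, mul_assoc]
  have E2 : BB r s w (-s) = ∫ φ, (W φ : ℂ) * (et r s w (-s) φ * (starRingEnd ℂ) (eb s φ)) ∂nup := by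
    unfold BB; congr 1; funext φ; rw [eb_conj, mul_assoc, neg_neg]
  have E3 : BB r s w 0 = ∫ φ, (W φ : ℂ) * (et r s w 0 φ * (starRingEnd ℂ) (eb 0 φ)) ∂nup := by
    unfold BB; congr 1; funext φ; rw [eb_conj, mul_assoc, neg_zero]
  have a1 := Sa.ce
  have a2 := Sb.ce
  have a3 := Sc.ce
  have b1 := ceb' s hs
  have b2 := ceb' (-s) hns
  have b3 := ceb' 0 hz
  have cWc : Continuous (fun φ => (W φ : ℂ)) := continuous_ofReal.comp cW
  have i1 : Integrable (fun φ => (W φ : ℂ) * (et r s w s φ * (starRingEnd ℂ) (eb (-s) φ))) nup := cont_int_nup (cWc.mul (a1.mul b2))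
  have i2 : Integrable (fun φ => (W φ : ℂ) * (et r s w (-s) φ * (starRingEnd ℂ) (eb s φ))) nup := cont_int_nup (cWc.mul (a2.mul b1))
  have i3 : Integrable (fun φ => (bP' s : ℂ) * ((W φ : ℂ) * (et r s w 0 φ * (starRingEnd ℂ) (eb 0 φ)))) nup := cont_int_nup (continuous_const.mul (cWc.mul (a3.mul b3)))
  have i12 : Integrable (fun φ => (W φ : ℂ) * (et r s w s φ * (starRingEnd ℂ) (eb (-s) φ)) + (W φ : ℂ) * (et r s w (-s) φ * (starRingEnd ℂ) (eb s φ))) nup := cont_int_nup ((cWc.mul (a1.mul b2)).add (cWc.mul (a2.mul b1)))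
  have EX : X = ∫ φ, ((W φ : ℂ) * (et r s w s φ * (starRingEnd ℂ) (eb (-s) φ)) + (W φ : ℂ) * (et r s w (-s) φ * (starRingEnd ℂ) (eb s φ))
       - (bP' s : ℂ) * ((W φ : ℂ) * (et r s w 0 φ * (starRingEnd ℂ) (eb 0 φ)))) ∂nup := by
    rw [hX, E1, E2, E3, ← integral_const_mul, ← integral_add i1 i2, ← integral_sub i12 i3]

  have i4' : Integrable (fun φ => (W φ : ℂ) * (et r s w s φ * (starRingEnd ℂ) (eb (-s) φ)) + (W φ : ℂ) * (et r s w (-s) φ * (starRingEnd ℂ) (eb s φ))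
       - (bP' s : ℂ) * ((W φ : ℂ) * (et r s w 0 φ * (starRingEnd ℂ) (eb 0 φ)))) nup := cont_int_nup (((cWc.mul (a1.mul b2)).add (cWc.mul (a2.mul b1))).sub (continuous_const.mul (cWc.mul (a3.mul b3))))
  have i5 : Integrable (fun φ => (starRingEnd ℂ) ((W φ : ℂ) * (et r s w s φ * (starRingEnd ℂ) (eb (-s) φ)) + (W φ : ℂ) * (et r s w (-s) φ * (starRingEnd ℂ) (eb s φ))
       - (bP' s : ℂ) * ((W φ : ℂ) * (et r s w 0 φ * (starRingEnd ℂ) (eb 0 φ))))) nup := cont_int_nup (Complex.continuous_conj.comp (((cWc.mul (a1.mul b2)).add (cWc.mul (a2.mul b1))).sub (continuous_const.mul (cWc.mul (a3.mul b3)))))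
  have hρ : (s:ℂ) ≠ 0 := by exact_mod_cast h0.ne'
  have k1 : (1 - (s:ℂ)^2) ≠ 0 := by exact_mod_cast (one_sub_sq hs).ne'
  have k2 : (1 + (s:ℂ)^2) ≠ 0 := by exact_mod_cast (by positivity : 1 + s^2 ≠ 0)
  have t0 := T0.ce
  have t1 := T1.ce
  have t2 := T2.ce
  have t3 := T0.cx
  have t4 := T1.cx
  have t5 := T2.cx
  have u0 := U0.ce
  have u1 := U1.ce
  have u2 := U2.ce
  have u3 := U0.cx
  have u4 := U1.cx
  have u5 := U2.cx
  have key : I * (X + (starRingEnd ℂ) X) = ((8 * s^2 * (1 - s^2)/(1+s^2)^2 : ℝ) : ℂ) * (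
      (∫ φ, (W φ : ℂ) * FB s (Y0 s (et r s w s φ) (et r s w (-s) φ) (et r s w 0 φ) (I * (starRingEnd ℂ) (et r s w s φ)) (I * (starRingEnd ℂ) (et r s w (-s) φ)))
         (Y1 s (et r s w s φ) (et r s w (-s) φ) (et r s w 0 φ) (I * (starRingEnd ℂ) (et r s w s φ)) (I * (starRingEnd ℂ) (et r s w (-s) φ)))
         (Y2 s (et r s w s φ) (et r s w (-s) φ) (et r s w 0 φ) (I * (starRingEnd ℂ) (et r s w s φ)) (I * (starRingEnd ℂ) (et r s w (-s) φ)))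
         (Y0 s (I * (starRingEnd ℂ) (eb s φ)) (I * (starRingEnd ℂ) (eb (-s) φ)) (I * (starRingEnd ℂ) (eb 0 φ)) (eb s φ) (eb (-s) φ))
         (Y1 s (I * (starRingEnd ℂ) (eb s φ)) (I * (starRingEnd ℂ) (eb (-s) φ)) (I * (starRingEnd ℂ) (eb 0 φ)) (eb s φ) (eb (-s) φ))
         (Y2 s (I * (starRingEnd ℂ) (eb s φ)) (I * (starRingEnd ℂ) (eb (-s) φ)) (I * (starRingEnd ℂ) (eb 0 φ)) (eb s φ) (eb (-s) φ)) ∂nup) +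
      (∫ φ, (W φ : ℂ) * FB s (Y0 s (I * (starRingEnd ℂ) (et r s w s φ)) (I * (starRingEnd ℂ) (et r s w (-s) φ)) (I * (starRingEnd ℂ) (et r s w 0 φ)) (et r s w s φ) (et r s w (-s) φ))
         (Y1 s (I * (starRingEnd ℂ) (et r s w s φ)) (I * (starRingEnd ℂ) (et r s w (-s) φ)) (I * (starRingEnd ℂ) (et r s w 0 φ)) (et r s w s φ) (et r s w (-s) φ))
         (Y2 s (I * (starRingEnd ℂ) (et r s w s φ)) (I * (starRingEnd ℂ) (et r s w (-s) φ)) (I * (starRingEnd ℂ) (et r s w 0 φ)) (et r s w s φ) (et r s w (-s) φ))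
         (Y0 s (eb s φ) (eb (-s) φ) (eb 0 φ) (I * (starRingEnd ℂ) (eb s φ)) (I * (starRingEnd ℂ) (eb (-s) φ)))
         (Y1 s (eb s φ) (eb (-s) φ) (eb 0 φ) (I * (starRingEnd ℂ) (eb s φ)) (I * (starRingEnd ℂ) (eb (-s) φ)))
         (Y2 s (eb s φ) (eb (-s) φ) (eb 0 φ) (I * (starRingEnd ℂ) (eb s φ)) (I * (starRingEnd ℂ) (eb (-s) φ))) ∂nup)) := by
    rw [← integral_add (FB_int cW t0 t1 t2 u3 u4 u5 s) (FB_int cW u0 u1 u2 t3 t4 t5 s), ← integral_const_mul, EX, ← integral_conj,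
      ← integral_add i4' i5, ← integral_const_mul]
    congr 1; funext φ
    have := bilin hρ k1 k2 (et r s w s φ) (et r s w (-s) φ) (et r s w 0 φ) (I * (starRingEnd ℂ) (et r s w s φ)) (I * (starRingEnd ℂ) (et r s w (-s) φ)) (I * (starRingEnd ℂ) (et r s w 0 φ))
      (eb s φ) (eb (-s) φ) (eb 0 φ) (I * (starRingEnd ℂ) (eb s φ)) (I * (starRingEnd ℂ) (eb (-s) φ)) (I * (starRingEnd ℂ) (eb 0 φ))
    have e2 := congrArg (fun z => (W φ : ℂ) * z) this
    beta_reduce at e2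
    unfold bP'
    simp only [map_sub, map_add, map_mul, conj_conj, conj_ofReal]
    push_cast
    linear_combination e2
  have hre : X + (starRingEnd ℂ) X = ((2 * X.re : ℝ) : ℂ) := Complex.add_conj X
  have hn := congrArg norm key
  rw [hre, norm_mul, norm_I, one_mul, norm_real, Real.norm_eq_abs, abs_mul, abs_of_pos (by norm_num : (0:ℝ) < 2), norm_mul, norm_real, Real.norm_eq_abs] at hn
  have h12 : 0 < 1 - s^2 := one_sub_sq hs
  have hκ : |8 * s^2 * (1 - s^2)/(1+s^2)^2| ≤ 8 * (s^2 * (1 - s^2)) := by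
    rw [abs_of_nonneg (by positivity), div_le_iff₀ (by positivity), mul_assoc]
    have : (1:ℝ) ≤ (1 + s^2)^2 := by nlinarith [sq_nonneg s]
    have h8 : 0 ≤ 8 * (s^2 * (1 - s^2)) := by positivity
    nlinarith
  have hq : 4 * (2 * ((60 * Real.sqrt (K/c) / c^0) * (60 * Real.sqrt (K/c) / c^2)) + (60 * Real.sqrt (K/c) / c^1)^2) + 4 * (60 * Real.sqrt (K/c) / c^2)^2 ≤ 57600 * (K/c^3) := by
    have hsq : Real.sqrt (K/c)^2 = K/c := Real.sq_sqrt (by positivity)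
    have : 4 * (2 * ((60 * Real.sqrt (K/c) / c^0) * (60 * Real.sqrt (K/c) / c^2)) + (60 * Real.sqrt (K/c) / c^1)^2) + 4 * (60 * Real.sqrt (K/c) / c^2)^2
       = Real.sqrt (K/c)^2 * (43200 / c^2 + 14400 / c^4) := by field_simp; ring
    rw [this, hsq]
    have h4 : 14400 / c^4 ≤ 14400 / c^2 := by
      apply div_le_div_of_nonneg_left (by norm_num) (by positivity)
      exact pow_le_pow_right₀ hc (by norm_num)
    calc _ ≤ K / c * (43200 / c^2 + 14400 / c^2) := by gcongr
      _ = _ := by field_simp; ring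
  have D0 := abs_nonneg (DP r s w)
  have B1' := B1.trans (mul_le_mul_of_nonneg_left hq D0)
  have B2' := B2.trans (mul_le_mul_of_nonneg_left hq D0)
  have := (norm_add_le _ _).trans (add_le_add B1' B2')
  have f := mul_le_mul hκ this (norm_nonneg _) (by positivity)
  rw [← hn] at f
  have e : 8 * (s^2 * (1 - s^2)) * (|DP r s w| * (57600 * (K / c^3)) + |DP r s w| * (57600 * (K / c^3))) = 2 * (460800 * (s^2 * (1 - s^2)) * (K / c^3) * |DP r s w|) := by ring
  rw [e] at f
  linarith

end Csin

end

section
set_option linter.all false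
open MeasureTheory Filter Topology Complex

namespace Csin

theorem ode_log {Y Y' g g' : ℝ → ℝ} {a b : ℝ} (hab : a ≤ b) (hY : ContinuousOn Y (Set.Icc a b)) (hg : ContinuousOn g (Set.Icc a b))
    (dY : ∀ x ∈ Set.Ioo a b, HasDerivAt Y (Y' x) x) (dg : ∀ x ∈ Set.Ioo a b, HasDerivAt g (g' x) x)
    (hb : ∀ x ∈ Set.Ioo a b, |Y' x| ≤ g' x * |Y x|) (h : 0 < Y a ∨ 0 < Y b) :
    0 < Y a ∧ 0 < Y b ∧ |Real.log (Y b) - Real.log (Y a)| ≤ g b - g a := by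
  have hU : MonotoneOn (fun x => Y x^2 * Real.exp (2 * g x)) (Set.Icc a b) := by
    refine monotoneOn_of_hasDerivWithinAt_nonneg (convex_Icc a b) (by fun_prop) (f' := fun x => (2 * Y x * Y' x) * Real.exp (2 * g x) + Y x^2 * (Real.exp (2 * g x) * (2 * g' x))) ?_ ?_
    · intro x hx
      rw [interior_Icc] at hx ⊢
      have d1 := (dY x hx).pow 2
      have d2 := ((dg x hx).const_mul 2).exp
      refine ((d1.mul d2).hasDerivWithinAt).congr_deriv ?_
      simp
    · intro x hx
      rw [interior_Icc] at hx
      have := hb x hx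
      have e := Real.exp_pos (2 * g x)
      have k : -(g' x * |Y x|^2) ≤ Y x * Y' x := by
        have := neg_abs_le (Y x * Y' x)
        rw [abs_mul] at this
        nlinarith [mul_le_mul_of_nonneg_left (hb x hx) (abs_nonneg (Y x))]
      rw [sq_abs] at k
      have : 2 * Y x * Y' x * Real.exp (2 * g x) + Y x ^ 2 * (Real.exp (2 * g x) * (2 * g' x)) = 2 * Real.exp (2 * g x) * (Y x * Y' x + g' x * Y x^2) := by ring
      rw [this]
      have : 0 ≤ Y x * Y' x + g' x * Y x^2 := by linarith
      positivity
  have hV : AntitoneOn (fun x => Y x^2 * Real.exp (-(2 * g x))) (Set.Icc a b) := by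
    refine antitoneOn_of_hasDerivWithinAt_nonpos (convex_Icc a b) (by fun_prop) (f' := fun x => (2 * Y x * Y' x) * Real.exp (-(2 * g x)) + Y x^2 * (Real.exp (-(2 * g x)) * (-(2 * g' x)))) ?_ ?_
    · intro x hx
      rw [interior_Icc] at hx ⊢
      have d1 := (dY x hx).pow 2
      have d2 := ((dg x hx).const_mul 2).neg.exp
      refine ((d1.mul d2).hasDerivWithinAt).congr_deriv ?_
      simp
    · intro x hx
      rw [interior_Icc] at hx
      have e := Real.exp_pos (-(2 * g x))
      have k : Y x * Y' x ≤ (g' x * |Y x|^2) := by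
        have := le_abs_self (Y x * Y' x)
        rw [abs_mul] at this
        nlinarith [mul_le_mul_of_nonneg_left (hb x hx) (abs_nonneg (Y x))]
      rw [sq_abs] at k
      have : 2 * Y x * Y' x * Real.exp (-(2 * g x)) + Y x ^ 2 * (Real.exp (-(2 * g x)) * (-(2 * g' x))) = -(2 * Real.exp (-(2 * g x)) * (g' x * Y x^2 - Y x * Y' x)) := by ring
      rw [this]
      have : 0 ≤ g' x * Y x^2 - Y x * Y' x := by linarith
      have : 0 ≤ 2 * Real.exp (-(2 * g x)) * (g' x * Y x^2 - Y x * Y' x) := by positivity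
      linarith
  have ma : a ∈ Set.Icc a b := Set.left_mem_Icc.2 hab
  have mb : b ∈ Set.Icc a b := Set.right_mem_Icc.2 hab
  have nz : ∀ x ∈ Set.Icc a b, Y x ≠ 0 := by
    intro x hx h0
    rcases h with h | h
    · have := hU ma hx hx.1
      simp only [h0] at this
      have : 0 < Y a^2 * Real.exp (2 * g a) := by positivity
      simp at *; linarith
    · have := hV hx mb hx.2
      simp only [h0] at this
      have : 0 < Y b^2 * Real.exp (-(2 * g b)) := by positivity
      simp at *; linarith
  have hpos : 0 < Y a ∧ 0 < Y b := by
    rcases h with h | h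
    · refine ⟨h, ?_⟩
      by_contra hh
      push Not at hh
      obtain ⟨x, hx, hx0⟩ := intermediate_value_Icc' hab hY (show (0:ℝ) ∈ Set.Icc (Y b) (Y a) from ⟨hh, h.le⟩)
      exact nz x hx hx0
    · refine ⟨?_, h⟩
      by_contra hh
      push Not at hh
      obtain ⟨x, hx, hx0⟩ := intermediate_value_Icc hab hY (show (0:ℝ) ∈ Set.Icc (Y a) (Y b) from ⟨hh, h.le⟩)
      exact nz x hx hx0
  refine ⟨hpos.1, hpos.2, ?_⟩
  have l1 := hU ma mb hab
  have l2 := hV ma mb hab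
  have pa := hpos.1
  have pb := hpos.2
  simp only at l1 l2
  have l1' := Real.log_le_log (by positivity) l1
  have l2' := Real.log_le_log (by positivity) l2
  rw [Real.log_mul (by positivity) (by positivity), Real.log_mul (by positivity) (by positivity), Real.log_exp, Real.log_exp, Real.log_pow, Real.log_pow] at l1' l2'
  push_cast at l1' l2'
  rw [abs_le]
  constructor <;> linarith

def MM (r ρ w : ℝ) : ℝ := r^2 * (Real.log (1 + ρ^2) - Real.log (1 - ρ^2)) + 2 * r * ρ * w + w^2/2
def Psi (r ρ w : ℝ) : ℝ := DP r ρ w * Real.exp (MM r ρ w)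

theorem Psi_w_deriv {ρ : ℝ} (h : |ρ| < 1) (r w : ℝ) :
    HasDerivAt (fun w => Psi r ρ w) (-(1 / Real.pi) * (BB r ρ w 0).re * Real.exp (MM r ρ w)) w := by
  have d1 := DP_w_deriv h r w
  have d2 : HasDerivAt (fun w => MM r ρ w) (2 * r * ρ + w) w := by
    unfold MM
    have := (((hasDerivAt_id w).const_mul (2 * r * ρ)).add (((hasDerivAt_id w).pow 2).div_const 2)).const_add (r^2 * (Real.log (1 + ρ^2) - Real.log (1 - ρ^2)))
    refine (this.congr_deriv ?_).congr_of_eventuallyEq (Eventually.of_forall fun x => ?_)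
    · simp
    · simp; ring
  refine (d1.mul d2.exp).congr_deriv ?_
  ring

theorem Psi_s_deriv {s : ℝ} (h0 : 0 < s) (h : s < 1) (r y : ℝ) {w : ℝ} (hw : w = y - r * bP s) :
    HasDerivAt (fun s => Psi r s (y - r * bP s)) (-(r / Real.pi) * (BB r s w s + BB r s w (-s) - bP' s * BB r s w 0).re * Real.exp (MM r s w)) s := by
  have d1 := DP_s_deriv h0 h r y hw
  have hs1 : 0 < 1 - s^2 := by nlinarith
  have hs2 : 0 < 1 + s^2 := by positivity
  have d2 : HasDerivAt (fun s => MM r s (y - r * bP s)) (r * (4 * (r * s / (1 - s^4) + w/2) - 2 * bP' s * (r * s + w/2))) s := by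
    unfold MM
    have hp : HasDerivAt (fun s : ℝ => s^2) (2 * s) s := by simpa using hasDerivAt_pow 2 s
    have a1 := ((hp.const_add 1).log hs2.ne').sub ((hp.const_sub 1).log hs1.ne')
    have a2 := (((bP_deriv s).const_mul r).const_sub y)
    have a3 := ((hasDerivAt_id s).const_mul (2 * r)).mul a2
    have := ((a1.const_mul (r^2)).add a3).add ((a2.pow 2).div_const 2)
    refine this.congr_deriv ?_
    rw [← hw]
    have : 1 - s^4 = (1 - s^2) * (1 + s^2) := by ring
    rw [this]
    simp
    field_simp
    ring
  refine (d1.mul d2.exp).congr_deriv ?_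
  rw [← hw]
  ring

theorem DP_tendsto0 (r y : ℝ) : Tendsto (fun s => DP r s (y - r * bP s)) (𝓝 0) (𝓝 (DP r 0 y)) := by
  have hb : ContinuousAt bP 0 := (bP_deriv 0).continuousAt
  have hb0 : bP 0 = 0 := by simp [bP]
  have hev : ∀ᶠ s in 𝓝 (0:ℝ), |s| ≤ 1/2 ∧ |y - r * bP s| ≤ |y| + 1 := by
    have h1 : ∀ᶠ s in 𝓝 (0:ℝ), |s| < 1/2 := by
      have : ContinuousAt (fun s : ℝ => |s|) 0 := by fun_prop
      exact this.eventually_lt_const (by simp)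
    have h2 : ∀ᶠ s in 𝓝 (0:ℝ), |y - r * bP s| < |y| + 1 := by
      have : ContinuousAt (fun s : ℝ => |y - r * bP s|) 0 := by fun_prop
      exact this.eventually_lt_const (by simp [hb0])
    filter_upwards [h1, h2] with s a b using ⟨a.le, b.le⟩
  have hk : ∀ᶠ s in 𝓝 (0:ℝ), KOK (Kth (thP r s (y - r * bP s)) (thP' r s (y - r * bP s))) (2 * |r| / (1 - (1/2)^2) + (|y| + 1)) := by
    filter_upwards [hev] with s hs
    exact (thP_PhOK hs.1 (by norm_num) le_rfl hs.2).KOK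
  have hc1 : ∀ x, ContinuousAt (fun s => thP r s (y - r * bP s) x) 0 := fun x => by
    unfold thP
    have : ContinuousAt (fun s : ℝ => 2 * s / (1 - s^2)) 0 := ContinuousAt.div (by fun_prop) (by fun_prop) (by norm_num)
    fun_prop
  have hc2 : ∀ x, ContinuousAt (fun s => thP' r s (y - r * bP s) x) 0 := fun x => by
    unfold thP' qP
    have : ContinuousAt (fun s : ℝ => 2 * r * s * (1 - s^2) / ((1 - s^2)^2 + 4 * s^2 * x^2)) 0 := ContinuousAt.div (by fun_prop) (by fun_prop) (by norm_num)
    fun_prop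
  have := FD_tendsto (μ := vol1) (l := 𝓝 (0:ℝ)) (k0 := Kth (thP r 0 y) (thP' r 0 y)) hk (fun x z => by
    have t1 := (hc1 x).tendsto
    have t2 := (hc1 z).tendsto
    have t3 := (hc2 x).tendsto
    rw [hb0, mul_zero, sub_zero] at t1 t2 t3
    unfold Kth
    split_ifs with hxz
    · exact (continuous_ofReal.tendsto _).comp (t3.div_const _)
    · exact (continuous_ofReal.tendsto _).comp (((Real.continuous_sin.tendsto _).comp (t1.sub t2)).div_const _)) (by positivity)
  exact (continuous_re.tendsto _).comp this

theorem Psi_contOn {s1 : ℝ} (hs1 : s1 < 1) (r y : ℝ) : ContinuousOn (fun s => Psi r s (y - r * bP s)) (Set.Icc 0 s1) := by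
  intro s hs
  rcases hs.1.eq_or_lt with h | h
  · subst h
    apply ContinuousAt.continuousWithinAt
    unfold Psi
    refine ContinuousAt.mul ?_ ?_
    · have := DP_tendsto0 r y
      unfold ContinuousAt
      simpa [bP] using this
    · have hb : ContinuousAt bP 0 := (bP_deriv 0).continuousAt
      unfold MM
      have : ContinuousAt (fun s : ℝ => Real.log (1 + s^2) - Real.log (1 - s^2)) 0 :=
        (ContinuousAt.log (by fun_prop) (by norm_num)).sub (ContinuousAt.log (by fun_prop) (by norm_num))
      fun_prop
  · exact (Psi_s_deriv h (hs.2.trans_lt hs1) r y rfl).continuousAt.continuousWithinAt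

theorem path_s {s1 r y c K : ℝ} (h0 : 0 ≤ s1) (h1 : s1 < 1) (hc : 1 ≤ c) (hK : 0 < K)
    (hE : ∀ s ∈ Set.Ioo 0 s1, ∀ φ ∈ Set.Ioo 0 Real.pi, Ew r s (y - r * bP s) φ ≤ K * Real.exp (-(c * Real.sin φ)) * (1 - (bP s)^2 * Real.sin φ^2)^2)
    (hp : 0 < Psi r 0 y ∨ 0 < Psi r s1 (y - r * bP s1)) :
    0 < Psi r 0 y ∧ 0 < Psi r s1 (y - r * bP s1) ∧ |Real.log (Psi r s1 (y - r * bP s1)) - Real.log (Psi r 0 y)| ≤ 153600 * |r| * s1^3 * (K/c^3) := by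
  have hb0 : bP 0 = 0 := by simp [bP]
  have := ode_log (Y := fun s => Psi r s (y - r * bP s)) (g := fun s => 153600 * |r| * s^3 * (K/c^3)) (g' := fun s => 460800 * |r| * s^2 * (K/c^3)) h0
    (Psi_contOn h1 r y) (by fun_prop) (fun s hs => Psi_s_deriv hs.1 (hs.2.trans h1) r y rfl) (fun s hs => ?_) (fun s hs => ?_) (by simpa [hb0] using hp)
  · simpa [hb0] using this
  · have := (((hasDerivAt_pow 3 s).const_mul (153600 * |r|)).mul_const (K/c^3))
    refine this.congr_deriv ?_
    rw [show 3 - 1 = 2 from rfl]; push_cast; ring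
  · have hr := rem_bound hs.1 (hs.2.trans h1) hc hK (hE s hs)
    unfold Psi
    rw [abs_mul, abs_mul, abs_mul, abs_neg, abs_div, abs_of_pos Real.pi_pos, abs_of_pos (Real.exp_pos _)]
    have hpi : |r| / Real.pi ≤ |r| := div_le_self (abs_nonneg _) (by linarith [Real.pi_gt_three])
    have hs2 : s^2 * (1 - s^2) ≤ s^2 := by nlinarith [sq_nonneg s, sq_nonneg (s^2)]
    have hc0 : 0 < c := by linarith
    rw [← mul_assoc]
    refine mul_le_mul_of_nonneg_right ?_ (Real.exp_pos _).le
    calc _ ≤ |r| * (460800 * (s^2 * (1 - s^2)) * (K / c^3) * |DP r s (y - r * bP s)|) := by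
          refine mul_le_mul hpi hr (abs_nonneg _) (abs_nonneg _)
      _ ≤ |r| * (460800 * s^2 * (K / c^3) * |DP r s (y - r * bP s)|) := by gcongr
      _ = _ := by ring


theorem BB0_bound {ρ r w c : ℝ} (h : |ρ| < 1) (hc : 0 < c)
    (hE : ∀ φ ∈ Set.Ioo 0 Real.pi, Ew r ρ w φ ≤ Real.exp (-(c * Real.sin φ))) : |(BB r ρ w 0).re| ≤ |DP r ρ w| * (8/c) := by
  have hz : |(0:ℝ)| < 1 := by simp
  have cW := Ew_cont h r w
  have W0 : ∀ φ, 0 ≤ Ew r ρ w φ := fun φ => (Ew_pos _ _ _ _).le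
  have S := et_Sol h hz r w
  have hn : ∀ φ, ‖eb 0 φ‖ = 1 := fun φ => by simp [eb, norm_ee]
  have hs : ∀ f : ℝ → ℝ, ∫ φ, Ew r ρ w φ * ‖eb 0 (f φ)‖^2 ∂nup ≤ (Real.sqrt (8/c))^2 := fun f => by
    rw [Real.sq_sqrt (by positivity)]
    simp only [hn, one_pow, mul_one]
    refine (integral_mono_ae (cont_int_nup cW) (g := fun φ => Real.sin φ^0 * Real.exp (-(c * Real.sin φ))) (cont_int_nup (by fun_prop)) ?_).trans ((sin_pow_int hc 0).trans (by simp))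
    filter_upwards [nup_ae] with φ hφ
    simpa using hE φ hφ
  have q : 0 < Real.sqrt (8/c) := by positivity
  have := pairing cW W0 S.ce (S.cx.comp continuous_neg) (abs_nonneg (DP r ρ w)) (Sol_energy cW W0 S (hs id)) (hs _) q q
  rw [Real.mul_self_sqrt (by positivity)] at this
  exact (abs_re_le_norm _).trans this

theorem path_w {ρ r w1 c : ℝ} (h : |ρ| < 1) (hw : 0 ≤ w1) (hc : 0 < c)
    (hE : ∀ w ∈ Set.Ioo 0 w1, ∀ φ ∈ Set.Ioo 0 Real.pi, Ew r ρ w φ ≤ Real.exp (-(c * Real.sin φ)))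
    (hp : 0 < Psi r ρ 0 ∨ 0 < Psi r ρ w1) : 
    0 < Psi r ρ 0 ∧ 0 < Psi r ρ w1 ∧ |Real.log (Psi r ρ w1) - Real.log (Psi r ρ 0)| ≤ 8/c * w1 := by
  have := ode_log (Y := fun w => Psi r ρ w) (g := fun w => 8/c * w) (g' := fun w => 8/c) hw
    (fun w _ => (Psi_w_deriv h r w).continuousAt.continuousWithinAt) (by fun_prop) (fun w _ => Psi_w_deriv h r w) (fun w _ => by simpa using (hasDerivAt_id w).const_mul (8/c)) (fun w hw => ?_) hp
  · simpa using this
  · have hr := BB0_bound h hc (hE w hw)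
    unfold Psi
    rw [abs_mul, abs_mul, abs_mul, abs_neg, abs_of_pos (by positivity : 0 < 1 / Real.pi), abs_of_pos (Real.exp_pos _), ← mul_assoc]
    refine mul_le_mul_of_nonneg_right ?_ (Real.exp_pos _).le
    have hpi : 1 / Real.pi ≤ 1 := by rw [div_le_one Real.pi_pos]; linarith [Real.pi_gt_three]
    calc _ ≤ 1 * (|DP r ρ w| * (8/c)) := mul_le_mul hpi hr (abs_nonneg _) (by norm_num)
      _ = _ := by ring

end Csin

end

section
set_option linter.all false
open MeasureTheory Filter Topology Complex

namespace Csin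

theorem ll_lower {t : ℝ} (h0 : 0 ≤ t) (h1 : t < 1) : 2 * t + 2/3 * t^3 ≤ Real.log (1 + t) - Real.log (1 - t) := by
  have hs := Real.hasSum_log_sub_log_of_abs_lt_one (x := t) (by rw [abs_of_nonneg h0]; exact h1)
  have := sum_le_hasSum (Finset.range 2) (fun i _ => by positivity) hs
  rw [Finset.sum_range_succ, Finset.sum_range_succ] at this
  norm_num at this
  linarith

theorem ll_upper {t : ℝ} (h0 : 0 ≤ t) (h1 : t < 1) : Real.log (1 + t) - Real.log (1 - t) ≤ 2 * t + 2/3 * t^3 / (1 - t^2) := by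
  have hs := Real.hasSum_log_sub_log_of_abs_lt_one (x := t) (by rw [abs_of_nonneg h0]; exact h1)
  rw [← hasSum_nat_add_iff' 1] at hs
  have ht2 : t^2 < 1 := by nlinarith
  have hg := (hasSum_geometric_of_lt_one (sq_nonneg t) ht2).mul_left (2/3 * t^3)
  have := hasSum_le (fun n => ?_) hs hg
  · rw [Finset.sum_range_one] at this
    norm_num at this
    rw [div_eq_mul_inv]
    linarith
  · have e : 2 * (1 / (2 * ((n + 1 : ℕ) : ℝ) + 1)) * t^(2 * (n+1) + 1) = (2 / (2 * (n:ℝ) + 3)) * (t^3 * (t^2)^n) := by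
      push_cast; rw [← pow_mul]; ring
    rw [e]
    have : 2 / (2 * (n:ℝ) + 3) ≤ 2/3 := by
      apply div_le_div_of_nonneg_left (by norm_num) (by norm_num)
      have : (0:ℝ) ≤ n := by positivity
      linarith
    calc _ ≤ 2/3 * (t^3 * (t^2)^n) := by gcongr
      _ = _ := by ring

theorem bP_bd {ρ : ℝ} (h0 : 0 < ρ) (h1 : ρ < 1) : 0 < bP ρ ∧ bP ρ < 1 ∧ bP ρ ≤ 2 * ρ := by
  unfold bP
  refine ⟨by positivity, ?_, ?_⟩
  · rw [div_lt_one (by positivity)]; nlinarith [sq_nonneg (1 - ρ), mul_pos (sub_pos.2 h1) (sub_pos.2 h1)]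
  · exact div_le_self (by linarith) (by nlinarith [sq_nonneg ρ])

theorem Ew_eq {ρ : ℝ} (h0 : 0 < ρ) (h1 : ρ < 1) (r w : ℝ) {φ : ℝ} (hφ : φ ∈ Set.Ioo 0 Real.pi) :
    0 ≤ bP ρ * Real.sin φ ∧ bP ρ * Real.sin φ < 1 ∧ bP ρ * Real.sin φ ≤ Real.sin φ ∧ bP ρ * Real.sin φ ≤ bP ρ ∧
    Ew r ρ w φ = Real.exp (-(r * (Real.log (1 + bP ρ * Real.sin φ) - Real.log (1 - bP ρ * Real.sin φ))) - 2 * w * Real.sin φ) := by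
  obtain ⟨b0, b1, _⟩ := bP_bd h0 h1
  have s0 := Real.sin_pos_of_mem_Ioo hφ
  have s1 := Real.sin_le_one φ
  have t1 : bP ρ * Real.sin φ < 1 := by nlinarith
  have t0 : 0 ≤ bP ρ * Real.sin φ := by positivity
  refine ⟨t0, t1, by nlinarith, by nlinarith, ?_⟩
  unfold Ew
  have e1 : 1 - 2 * ρ * Real.sin φ + ρ^2 = (1 + ρ^2) * (1 - bP ρ * Real.sin φ) := by unfold bP; field_simp; ring
  have e2 : 1 + 2 * ρ * Real.sin φ + ρ^2 = (1 + ρ^2) * (1 + bP ρ * Real.sin φ) := by unfold bP; field_simp; ring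
  rw [e1, e2, Real.log_mul (by positivity) (by linarith), Real.log_mul (by positivity) (by linarith)]
  congr 1; ring

theorem Ew_A {ρ r y : ℝ} (h0 : 0 < ρ) (h1 : ρ < 1) (hr : 2 ≤ r) {φ : ℝ} (hφ : φ ∈ Set.Ioo 0 Real.pi) :
    Ew r ρ (y - r * bP ρ) φ ≤ 1 * Real.exp (-(2 * (y - 2) * Real.sin φ)) * (1 - (bP ρ)^2 * Real.sin φ^2)^2 := by
  obtain ⟨t0, t1, t2, t3, e⟩ := Ew_eq h0 h1 r (y - r * bP ρ) hφ
  rw [e, ← mul_pow]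
  set t := bP ρ * Real.sin φ with ht
  have l1 := ll_lower t0 t1
  have e3 : 1 - t^2 = Real.exp (Real.log (1 - t) + Real.log (1 + t)) := by
    rw [Real.exp_add, Real.exp_log (by linarith), Real.exp_log (by linarith)]; ring
  rw [e3, ← Real.exp_nat_mul, one_mul, ← Real.exp_add, Real.exp_le_exp]
  have l2 : 0 ≤ Real.log (1 + t) := Real.log_nonneg (by linarith)
  have t3 : 0 ≤ t^3 := by positivity
  have e4 : (y - r * bP ρ) * Real.sin φ = y * Real.sin φ - r * t := by rw [ht]; ring
  push_cast
  nlinarith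

theorem Ew_C {ρ r w : ℝ} (h0 : 0 < ρ) (h1 : ρ < 1) (hr : 0 ≤ r) (hw : 0 ≤ w) {φ : ℝ} (hφ : φ ∈ Set.Ioo 0 Real.pi) :
    Ew r ρ w φ ≤ Real.exp (-(2 * r * bP ρ * Real.sin φ)) := by
  obtain ⟨t0, t1, t2, t3, e⟩ := Ew_eq h0 h1 r w hφ
  have s0 := Real.sin_pos_of_mem_Ioo hφ
  rw [e, Real.exp_le_exp]
  set t := bP ρ * Real.sin φ with ht
  have l1 := ll_lower t0 t1
  have t3 : 0 ≤ t^3 := by positivity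
  have : 2 * r * bP ρ * Real.sin φ = 2 * r * t := by rw [ht]; ring
  rw [this]
  have := mul_nonneg hw s0.le
  nlinarith

theorem Ew_B {ρ R y w3 : ℝ} (h0 : 0 < ρ) (h1 : ρ < 1) (hR : 0 ≤ R) (hb : (bP ρ)^2 ≤ 1/10) (hR3 : R * (bP ρ)^3 ≤ 3 * w3) {φ : ℝ} (hφ : φ ∈ Set.Ioo 0 Real.pi) :
    Ew (-R) ρ (y - (-R) * bP ρ) φ ≤ 2 * Real.exp (-(2 * (y - 10/9 * w3) * Real.sin φ)) * (1 - (bP ρ)^2 * Real.sin φ^2)^2 := by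
  obtain ⟨t0, t1, t2, t3, e⟩ := Ew_eq h0 h1 (-R) (y - (-R) * bP ρ) hφ
  have s0 := Real.sin_pos_of_mem_Ioo hφ
  have s1 := Real.sin_le_one φ
  rw [e, ← mul_pow]
  have hb0 := (bP_bd h0 h1).1
  set t := bP ρ * Real.sin φ with ht
  have ht2 : t^2 ≤ 1/10 := by nlinarith
  have l1 := ll_upper t0 t1
  have e3 : 1 ≤ 2 * (1 - t^2)^2 := by nlinarith
  have key : R * (Real.log (1 + t) - Real.log (1 - t)) - 2 * R * t ≤ 20/9 * w3 * Real.sin φ := by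
    have a1 : 2/3 * t^3 / (1 - t^2) ≤ 20/27 * t^3 := by
      rw [div_le_iff₀ (by linarith)]
      have : 0 ≤ t^3 := by positivity
      nlinarith
    have a2 : R * t^3 ≤ 3 * w3 * Real.sin φ := by
      have e : R * t^3 = R * bP ρ^3 * Real.sin φ^3 := by rw [ht]; ring
      have hs3 : Real.sin φ^3 ≤ Real.sin φ := by nlinarith [mul_pos s0 s0]
      have hp : 0 ≤ R * bP ρ^3 := by positivity
      rw [e]
      calc _ ≤ R * bP ρ^3 * Real.sin φ := by gcongr
        _ ≤ _ := by gcongr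
    nlinarith
  calc _ ≤ Real.exp (-(2 * (y - 10/9 * w3) * Real.sin φ)) * 1 := by
        rw [mul_one, Real.exp_le_exp]
        have e4 : (y - -R * bP ρ) * Real.sin φ = y * Real.sin φ + R * t := by rw [ht]; ring
        nlinarith
    _ ≤ Real.exp (-(2 * (y - 10/9 * w3) * Real.sin φ)) * (2 * (1 - t^2)^2) := by gcongr
    _ = _ := by ring

theorem Psi_zero (r y : ℝ) : Psi r 0 y = Psi 0 0 y := by
  have e1 : thP r 0 y = thP 0 0 y := by funext x; simp [thP]
  have e2 : thP' r 0 y = thP' 0 0 y := by funext x; simp [thP']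
  unfold Psi DP MM
  rw [e1, e2]; simp

/-! truncated kernels -/
def trunc (k : ℝ → ℝ → ℂ) (x y : ℝ) : ℂ := if x ∈ Set.Ioo (-1:ℝ) 1 ∧ y ∈ Set.Ioo (-1:ℝ) 1 then k x y else 0

theorem FD_trunc (k : ℝ → ℝ → ℂ) : FD vol1 (trunc k) = FD vol1 k :=
  FD_congr1 fun x hx y hy => by simp only [trunc]; rw [if_pos ⟨hx, hy⟩]

theorem KOK_trunc {θ θ' : ℝ → ℝ} (hd : ∀ x, HasDerivAt θ (θ' x) x) (hc : Measurable θ') {L : ℝ} (hL : ∀ x ∈ Set.Ioo (-1:ℝ) 1, |θ' x| ≤ L) :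
    KOK (trunc (Kth θ θ')) L := by
  have hpi := Real.pi_gt_three
  have cθ : Continuous θ := continuous_iff_continuousAt.2 fun x => (hd x).continuousAt
  have hL0 : 0 ≤ L := (abs_nonneg _).trans (hL 0 (by norm_num))
  refine ⟨?_, fun x y => ?_⟩
  · unfold trunc Kth Function.uncurry
    refine Measurable.ite ?_ ?_ measurable_const
    · exact (measurableSet_Ioo.preimage measurable_fst).inter (measurableSet_Ioo.preimage measurable_snd)
    · refine Measurable.ite (measurableSet_eq_fun measurable_fst measurable_snd) ?_ ?_
      · have : Measurable (fun p : ℝ × ℝ => θ' p.1) := hc.comp measurable_fst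
        exact Complex.measurable_ofReal.comp (this.div_const _)
      · have := cθ.measurable
        fun_prop
  · unfold trunc
    split_ifs with h
    · unfold Kth
      split_ifs with hxy
      · rw [norm_real, Real.norm_eq_abs, abs_div, abs_of_pos Real.pi_pos, div_le_iff₀ Real.pi_pos]
        have := hL x h.1
        nlinarith
      · rw [norm_real, Real.norm_eq_abs, abs_div, abs_mul, abs_of_pos Real.pi_pos]
        have hpos : 0 < |x - y| := abs_pos.2 (sub_ne_zero.2 hxy)
        rw [div_le_iff₀ (by positivity)]
        have l := (convex_Ioo (-1:ℝ) 1).norm_image_sub_le_of_norm_hasDerivWithin_le (fun z _ => (hd z).hasDerivWithinAt) (fun z hz => by rw [Real.norm_eq_abs]; exact hL z hz) h.2 h.1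
        rw [Real.norm_eq_abs, Real.norm_eq_abs] at l
        have := Real.abs_sin_le_abs (x := θ x - θ y)
        have : 0 ≤ L * |x - y| := by positivity
        nlinarith
    · simpa using hL0


def cub (y w3 x : ℝ) : ℝ := y * x + w3 * (x^3 - 3/2 * x)
def cub' (y w3 x : ℝ) : ℝ := y + w3 * (3 * x^2 - 3/2)
def RB (w3 ε : ℝ) : ℝ := 3 * w3 / (8 * ε^3)
def DC (y w3 : ℝ) : ℝ := (FD vol1 (Kth (cub y w3) (cub' y w3))).re

theorem cub_deriv (y w3 x : ℝ) : HasDerivAt (cub y w3) (cub' y w3 x) x := by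
  have h := ((hasDerivAt_id x).const_mul y).add (((hasDerivAt_pow 3 x).sub ((hasDerivAt_id x).const_mul (3/2))).const_mul w3)
  refine h.congr_deriv ?_
  unfold cub'; rw [show 3 - 1 = 2 from rfl]; push_cast; ring

theorem thB' {ε : ℝ} (h0 : 0 < ε) (h1 : ε < 1) (y w3 x : ℝ) :
    thP' (-(RB w3 ε)) ε (y - (-(RB w3 ε)) * bP ε) x = y + (3/2 * w3) * ((2 * x^2 - 1 + ε^2) / (qP ε x * (1 + ε^2))) := by
  have hq : qP ε x ≠ 0 := (qP_pos (by rw [abs_of_pos h0]; exact h1) x).ne'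
  unfold thP' RB bP
  field_simp
  unfold qP
  ring

theorem thB'_bd {ε : ℝ} (h0 : 0 < ε) (h1 : ε ≤ 1/2) (y w3 x : ℝ) (hx : x ∈ Set.Icc (-1:ℝ) 1) :
    |thP' (-(RB w3 ε)) ε (y - (-(RB w3 ε)) * bP ε) x| ≤ |y| + 6 * |w3| := by
  rw [thB' h0 (by linarith)]
  have h4 : ε^2 ≤ 1/4 := by nlinarith
  have hq : 9/16 ≤ qP ε x := by
    unfold qP
    have h5 := mul_self_le_mul_self (by norm_num : (0:ℝ) ≤ 3/4) (by linarith : 3/4 ≤ 1 - ε^2)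
    nlinarith [mul_nonneg (sq_nonneg ε) (sq_nonneg x)]
  have hn : |2 * x^2 - 1 + ε^2| ≤ 9/4 := by
    rw [abs_le]; constructor <;> nlinarith [sq_nonneg x, hx.1, hx.2, sq_nonneg ε]
  have hd : 9/16 ≤ qP ε x * (1 + ε^2) := by nlinarith [sq_nonneg ε]
  refine (abs_add_le _ _).trans (add_le_add le_rfl ?_)
  rw [abs_mul, abs_mul, abs_of_pos (by norm_num : (0:ℝ) < 3/2), abs_div, abs_of_pos (by linarith : 0 < qP ε x * (1 + ε^2))]
  have : |2 * x^2 - 1 + ε^2| / (qP ε x * (1 + ε^2)) ≤ 4 := by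
    rw [div_le_iff₀ (by linarith)]; linarith
  nlinarith [abs_nonneg w3]

theorem thB'_lim (y w3 x : ℝ) : Tendsto (fun ε => thP' (-(RB w3 ε)) ε (y - (-(RB w3 ε)) * bP ε) x) (𝓝[>] 0) (𝓝 (cub' y w3 x)) := by
  have h : ContinuousAt (fun ε : ℝ => y + (3/2 * w3) * ((2 * x^2 - 1 + ε^2) / (qP ε x * (1 + ε^2)))) 0 := by
    unfold qP
    have : ContinuousAt (fun ε : ℝ => (2 * x^2 - 1 + ε^2) / (((1 - ε^2)^2 + 4 * ε^2 * x^2) * (1 + ε^2))) 0 := ContinuousAt.div (by fun_prop) (by fun_prop) (by norm_num)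
    fun_prop
  have h2 := h.tendsto.mono_left (nhdsWithin_le_nhds (s := Set.Ioi 0))
  have e : y + (3/2 * w3) * ((2 * x^2 - 1 + 0^2) / (qP 0 x * (1 + 0^2))) = cub' y w3 x := by unfold qP cub'; norm_num; ring
  rw [e] at h2
  refine h2.congr' ?_
  filter_upwards [Ioo_mem_nhdsGT (show (0:ℝ) < 1 by norm_num)] with ε hε
  rw [thB' hε.1 hε.2]

theorem evB : ∀ᶠ ε in 𝓝[>] (0:ℝ), ε ∈ Set.Ioo (0:ℝ) (1/10) := Ioo_mem_nhdsGT (by norm_num)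

theorem thB_lim (y w3 : ℝ) {x : ℝ} (hx : x ∈ Set.Ioo (-1:ℝ) 1) : Tendsto (fun ε => thP (-(RB w3 ε)) ε (y - (-(RB w3 ε)) * bP ε) x) (𝓝[>] 0) (𝓝 (cub y w3 x)) := by
  have c' : Continuous (cub' y w3) := by unfold cub'; fun_prop
  have e0 : cub y w3 x = ∫ t in (0:ℝ)..x, cub' y w3 t := by
    rw [intervalIntegral.integral_eq_sub_of_hasDerivAt (fun t _ => cub_deriv y w3 t) (c'.intervalIntegrable _ _)]
    simp [cub]
  have e1 : ∀ᶠ ε in 𝓝[>] (0:ℝ), ∫ t in (0:ℝ)..x, thP' (-(RB w3 ε)) ε (y - (-(RB w3 ε)) * bP ε) t = thP (-(RB w3 ε)) ε (y - (-(RB w3 ε)) * bP ε) x := by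
    filter_upwards [evB] with ε hε
    have hab : |ε| < 1 := by rw [abs_of_pos hε.1]; linarith [hε.2]
    have P := thP_PhOK' hab (-(RB w3 ε)) (y - (-(RB w3 ε)) * bP ε)
    rw [intervalIntegral.integral_eq_sub_of_hasDerivAt (fun t _ => P.deriv t) (P.cont'.intervalIntegrable _ _)]
    simp [thP]
  rw [e0]
  refine Tendsto.congr' e1 ?_
  have hsub : ∀ t ∈ Set.uIoc 0 x, t ∈ Set.Icc (-1:ℝ) 1 := fun t ht => by
    have := Set.uIoc_subset_uIcc ht
    rw [Set.mem_uIcc] at this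
    rcases this with h | h <;> constructor <;> linarith [h.1, h.2, hx.1, hx.2]
  refine intervalIntegral.tendsto_integral_filter_of_dominated_convergence (fun _ => |y| + 6 * |w3|) ?_ ?_ (by simp) ?_
  · filter_upwards [evB] with ε hε
    have hab : |ε| < 1 := by rw [abs_of_pos hε.1]; linarith [hε.2]
    have P := thP_PhOK' hab (-(RB w3 ε)) (y - (-(RB w3 ε)) * bP ε)
    exact P.cont'.aestronglyMeasurable
  · filter_upwards [evB] with ε hε
    refine Eventually.of_forall fun t ht => ?_
    rw [Real.norm_eq_abs]
    exact thB'_bd hε.1 (by linarith [hε.2]) _ _ _ (hsub t ht)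
  · exact Eventually.of_forall fun t ht => thB'_lim y w3 t

theorem DP_limB (y w3 : ℝ) : Tendsto (fun ε => DP (-(RB w3 ε)) ε (y - (-(RB w3 ε)) * bP ε)) (𝓝[>] 0) (𝓝 (DC y w3)) := by
  have := FD_tendsto (μ := vol1) (l := 𝓝[>] (0:ℝ)) (k := fun ε => trunc (Kth (thP (-(RB w3 ε)) ε (y - (-(RB w3 ε)) * bP ε)) (thP' (-(RB w3 ε)) ε (y - (-(RB w3 ε)) * bP ε))))
    (k0 := trunc (Kth (cub y w3) (cub' y w3))) (M := |y| + 6 * |w3|) ?_ ?_ (by positivity)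
  · simp only [FD_trunc] at this
    exact (continuous_re.tendsto _).comp this
  · filter_upwards [evB] with ε hε
    have hab : |ε| < 1 := by rw [abs_of_pos hε.1]; linarith [hε.2]
    have P := thP_PhOK' hab (-(RB w3 ε)) (y - (-(RB w3 ε)) * bP ε)
    exact KOK_trunc P.deriv P.cont'.measurable fun x hx => thB'_bd hε.1 (by linarith [hε.2]) _ _ _ ⟨hx.1.le, hx.2.le⟩
  · intro x z
    by_cases h : x ∈ Set.Ioo (-1:ℝ) 1 ∧ z ∈ Set.Ioo (-1:ℝ) 1
    · simp only [trunc, if_pos h]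
      have t1 := thB_lim y w3 h.1
      have t2 := thB_lim y w3 h.2
      have t3 := thB'_lim y w3 x
      unfold Kth
      split_ifs with hxz
      · exact (continuous_ofReal.tendsto _).comp (t3.div_const _)
      · exact (continuous_ofReal.tendsto _).comp (((Real.continuous_sin.tendsto _).comp (t1.sub t2)).div_const _)
    · simp only [trunc, if_neg h]; exact tendsto_const_nhds

theorem MM_limB (y w3 : ℝ) : Tendsto (fun ε => MM (-(RB w3 ε)) ε (y - (-(RB w3 ε)) * bP ε)) (𝓝[>] 0) (𝓝 (y^2/2 - 3/4 * y * w3 + 3/8 * w3^2)) := by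
  have hl : Tendsto (fun ε : ℝ => (Real.log (1 + ε^2) - Real.log (1 - ε^2) - 2 * ε^2) / ε^6) (𝓝[>] 0) (𝓝 (2/3)) := by
    have up : Tendsto (fun ε : ℝ => 2/3 / (1 - (ε^2)^2)) (𝓝[>] 0) (𝓝 (2/3)) := by
      have : ContinuousAt (fun ε : ℝ => 2/3 / (1 - (ε^2)^2)) 0 := ContinuousAt.div (by fun_prop) (by fun_prop) (by norm_num)
      have := this.tendsto.mono_left (nhdsWithin_le_nhds (s := Set.Ioi 0))
      simpa using this
    refine tendsto_of_tendsto_of_tendsto_of_le_of_le' tendsto_const_nhds up ?_ ?_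
    · filter_upwards [evB] with ε hε
      have := ll_lower (t := ε^2) (by positivity) (by nlinarith [hε.1, hε.2])
      have := hε.1
      rw [le_div_iff₀ (by positivity)]
      linarith
    · filter_upwards [evB] with ε hε
      have h4 : (ε^2) < 1 := by nlinarith [hε.1, hε.2]
      have l := ll_upper (t := ε^2) (by positivity) h4
      have := hε.1
      rw [div_le_iff₀ (by positivity)]
      have e : 2/3 / (1 - (ε^2)^2) * ε^6 = 2/3 * (ε^2)^3 / (1 - (ε^2)^2) := by ring
      rw [e]; linarith
  have h2 : Tendsto (fun ε : ℝ => y^2/2 - 3/4 * y * w3 / (1 + ε^2) + 9 * w3^2/64 * ((Real.log (1 + ε^2) - Real.log (1 - ε^2) - 2 * ε^2) / ε^6 + 2 / (1 + ε^2)^2)) (𝓝[>] 0)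
      (𝓝 (y^2/2 - 3/4 * y * w3 + 9 * w3^2/64 * (2/3 + 2))) := by
    have t1 : Tendsto (fun ε : ℝ => 3/4 * y * w3 / (1 + ε^2)) (𝓝[>] 0) (𝓝 (3/4 * y * w3)) := by
      have : ContinuousAt (fun ε : ℝ => 3/4 * y * w3 / (1 + ε^2)) 0 := ContinuousAt.div (by fun_prop) (by fun_prop) (by norm_num)
      have := this.tendsto.mono_left (nhdsWithin_le_nhds (s := Set.Ioi 0))
      simpa using this
    have t2 : Tendsto (fun ε : ℝ => 2 / (1 + ε^2)^2) (𝓝[>] 0) (𝓝 2) := by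
      have : ContinuousAt (fun ε : ℝ => 2 / (1 + ε^2)^2) 0 := ContinuousAt.div (by fun_prop) (by fun_prop) (by norm_num)
      have := this.tendsto.mono_left (nhdsWithin_le_nhds (s := Set.Ioi 0))
      simpa using this
    exact (tendsto_const_nhds.sub t1).add ((hl.add t2).const_mul _)
  have e : y^2/2 - 3/4 * y * w3 + 9 * w3^2/64 * (2/3 + 2) = y^2/2 - 3/4 * y * w3 + 3/8 * w3^2 := by ring
  rw [e] at h2
  refine h2.congr' ?_
  filter_upwards [evB] with ε hε
  have h0 := hε.1.ne'
  have h1 : 1 + ε^2 ≠ 0 := by positivity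
  unfold MM RB bP
  field_simp
  ring

theorem pathB {y w3 : ℝ} (hw : 0 < w3) (hc : 1 ≤ 2 * (y - 10/9 * w3)) (hp : 0 < Psi 0 0 y) :
    0 < DC y w3 ∧ |Real.log (DC y w3) + (y^2/2 - 3/4 * y * w3 + 3/8 * w3^2) - Real.log (Psi 0 0 y)| ≤ 115200 * w3 / (2 * (y - 10/9 * w3))^3 := by
  set c := 2 * (y - 10/9 * w3) with hcdef
  have hc0 : 0 < c := by linarith
  set B := 115200 * w3 / c^3 with hB
  have main : ∀ᶠ ε in 𝓝[>] (0:ℝ), Psi 0 0 y * Real.exp (-B) ≤ Psi (-(RB w3 ε)) ε (y - (-(RB w3 ε)) * bP ε) ∧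
      Psi (-(RB w3 ε)) ε (y - (-(RB w3 ε)) * bP ε) ≤ Psi 0 0 y * Real.exp B := by
    filter_upwards [evB] with ε hε
    have h0 := hε.1
    have hR : 0 ≤ RB w3 ε := by unfold RB; positivity
    have P := path_s (s1 := ε) (r := -(RB w3 ε)) (y := y) (c := c) (K := 2) h0.le (by linarith [hε.2]) hc (by norm_num) (fun s hs φ hφ => by
      obtain ⟨b0, b1, b2⟩ := bP_bd hs.1 (by linarith [hs.2, hε.2])
      refine Ew_B hs.1 (by linarith [hs.2, hε.2]) hR ?_ ?_ hφ
      · nlinarith [hs.2, hε.2]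
      · have : bP s ≤ 2 * ε := by linarith [hs.2]
        calc _ ≤ RB w3 ε * (2 * ε)^3 := by gcongr
          _ = 3 * w3 := by unfold RB; field_simp; ring) (Or.inl (by rw [Psi_zero]; exact hp))
    rw [Psi_zero] at P
    obtain ⟨p1, p2, p3⟩ := P
    have e : 153600 * |-(RB w3 ε)| * ε^3 * (2/c^3) = B := by
      rw [abs_neg, abs_of_nonneg hR, hB]; unfold RB; field_simp; ring
    rw [e, abs_le] at p3
    constructor
    · rw [← Real.log_le_log_iff (by positivity) p2, Real.log_mul p1.ne' (Real.exp_pos _).ne', Real.log_exp]; linarith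
    · rw [← Real.log_le_log_iff p2 (by positivity), Real.log_mul p1.ne' (Real.exp_pos _).ne', Real.log_exp]; linarith
  have lim : Tendsto (fun ε => Psi (-(RB w3 ε)) ε (y - (-(RB w3 ε)) * bP ε)) (𝓝[>] 0) (𝓝 (DC y w3 * Real.exp (y^2/2 - 3/4 * y * w3 + 3/8 * w3^2))) :=
    (DP_limB y w3).mul ((Real.continuous_exp.tendsto _).comp (MM_limB y w3))
  have l1 := ge_of_tendsto lim (main.mono fun _ h => h.1)
  have l2 := le_of_tendsto lim (main.mono fun _ h => h.2)
  set m := y^2/2 - 3/4 * y * w3 + 3/8 * w3^2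
  have hpos : 0 < DC y w3 := by
    have : 0 < DC y w3 * Real.exp m := lt_of_lt_of_le (by positivity) l1
    exact pos_of_mul_pos_left this (Real.exp_pos _).le
  refine ⟨hpos, ?_⟩
  rw [← Real.log_le_log_iff (by positivity) (by positivity), Real.log_mul hp.ne' (Real.exp_pos _).ne', Real.log_exp, Real.log_mul hpos.ne' (Real.exp_pos _).ne', Real.log_exp] at l1
  rw [← Real.log_le_log_iff (by positivity) (by positivity), Real.log_mul hp.ne' (Real.exp_pos _).ne', Real.log_exp, Real.log_mul hpos.ne' (Real.exp_pos _).ne', Real.log_exp] at l2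
  rw [abs_le]; constructor <;> linarith

end Csin

end

section
set_option linter.all false
open MeasureTheory Filter Topology

namespace Csin

section
variable {μ : Measure ℝ} [IsFiniteMeasure μ]

theorem FT_smul (k : ℝ → ℝ → ℂ) (z : ℂ) (m : ℕ) :
    FT μ (fun x y => z * k x y) m = z^m * FT μ k m := by
  unfold FT
  rw [← integral_const_mul]
  refine integral_congr_ae (ae_of_all _ fun v => ?_)
  have : dk (fun x y => z * k x y) v = z • dk k v := by
    ext i j; simp [dk]
  simp only [this, Matrix.det_smul, Fintype.card_fin]

theorem KOK.smul {k : ℝ → ℝ → ℂ} {M : ℝ} (h : KOK k M) {z : ℂ} {R : ℝ} (hz : ‖z‖ ≤ R) :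
    KOK (fun x y => z * k x y) (R * M) :=
  ⟨h.meas.const_mul z, fun x y => by
    rw [norm_mul]; exact mul_le_mul hz (h.bd x y) (norm_nonneg _) ((norm_nonneg _).trans hz)⟩

theorem FD_smul_diff {k : ℝ → ℝ → ℂ} {M : ℝ} (h : KOK k M) :
    Differentiable ℂ fun z : ℂ => FD μ (fun x y => z * k x y) := by
  intro z
  have hR : Summable fun n : ℕ => ‖(((-1:ℂ)^n / (n.factorial : ℂ)) * FT μ (fun x y => ((‖z‖+1:ℝ):ℂ) * k x y) n)‖ :=
    (summable_FD (h.smul (le_refl _))).norm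
  have hd := Complex.differentiableOn_tsum_of_summable_norm (U := Metric.ball (0:ℂ) (‖z‖+1))
    (F := fun n z => ((-1:ℂ)^n / (n.factorial : ℂ)) * FT μ (fun x y => z * k x y) n) hR
    (fun n => by simp only [FT_smul]; fun_prop) Metric.isOpen_ball
    (fun n w hw => by
      simp only [FT_smul, norm_mul, norm_pow]
      have : ‖w‖ ≤ ‖((‖z‖+1:ℝ):ℂ)‖ := by
        rw [Complex.norm_real, Real.norm_of_nonneg (by positivity)]
        exact (mem_ball_zero_iff.1 hw).le
      gcongr)
  exact hd.differentiableAt (Metric.isOpen_ball.mem_nhds (by simp))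

theorem FOK.mul_int {a b : ℝ → ℂ} {M M' : ℝ} (ha : FOK a M) (hb : FOK b M') :
    Integrable (fun t => a t * b t) μ :=
  Integrable.of_bound (ha.meas.mul hb.meas).aestronglyMeasurable (M * M')
    (ae_of_all _ fun t => by
      rw [norm_mul]; exact mul_le_mul (ha.bd t) (hb.bd t) (norm_nonneg _) ((norm_nonneg _).trans (ha.bd t)))

theorem FD_zero : FD μ (fun x y => 0) = 1 := by
  unfold FD
  rw [tsum_eq_single 0]
  · simp [FT, pi_real]
  · intro n hn
    have : FT μ (fun x y => 0) n = 0 := by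
      have := FT_smul (μ := μ) (fun x y => 0) 0 n
      simpa [hn] using this
    rw [this, mul_zero]

set_option maxHeartbeats 1000000 in
theorem FD_rank {n : ℕ} {A B : Fin n → ℝ → ℂ} {M : ℝ} (hA : ∀ j, FOK (A j) M) (hB : ∀ j, FOK (B j) M) :
    FD μ (fun x y => ∑ j, A j x * B j y) =
      (1 - Matrix.of fun j l => ∫ t, B j t * A l t ∂μ).det := by
  set k : ℝ → ℝ → ℂ := fun x y => ∑ j, A j x * B j y with hkdef
  set Mm : Matrix (Fin n) (Fin n) ℂ := Matrix.of fun j l => ∫ t, B j t * A l t ∂μ with hMm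
  have hk : KOK k (n * (M * M)) := by
    refine ⟨?_, fun x y => ?_⟩
    · have : Function.uncurry k = fun p : ℝ × ℝ => ∑ j, A j p.1 * B j p.2 := by ext p; rfl
      rw [this]
      exact Finset.measurable_sum _ fun j _ =>
        ((hA j).meas.comp measurable_fst).mul ((hB j).meas.comp measurable_snd)
    · refine (norm_sum_le _ _).trans ?_
      refine (Finset.sum_le_sum (g := fun _ => M * M) fun j _ => ?_).trans (by simp)
      rw [norm_mul]
      exact mul_le_mul ((hA j).bd x) ((hB j).bd y) (norm_nonneg _) ((norm_nonneg _).trans ((hA j).bd x))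
  set M2 := max |M| (2 * (n * (M * M))) with hM2
  have hA2 : ∀ j, FOK (A j) M2 := fun j => (hA j).mono ((le_abs_self M).trans (le_max_left _ _))
  have hB2 : ∀ j, FOK (B j) M2 := fun j => (hB j).mono ((le_abs_self M).trans (le_max_left _ _))
  have hkt : ∀ s ∈ Set.Ioo (-2:ℝ) 2, KOK (fun x y => (s:ℂ) * k x y) M2 := fun s hs =>
    (hk.smul (R := 2) (by rw [Complex.norm_real, Real.norm_eq_abs, abs_le]; exact ⟨hs.1.le, hs.2.le⟩)).mono (le_max_right _ _)
  have hk2 : KOK k M2 := hk.mono (by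
    have := hk.nonneg
    refine le_trans ?_ (le_max_right _ _); linarith)
  set D : ℝ → ℂ := fun s => FD μ (fun x y => (s:ℂ) * k x y) with hD
  set δ : ℂ → ℂ := fun z => (1 - z • Mm).det with hδ
  have hDd : ∀ s ∈ Set.Ioo (-2:ℝ) 2, HasDerivAt D
      (-∑ m, ∫ t, B m t * FG μ (fun x y => (s:ℂ) * k x y) (A m) t ∂μ) s := fun s hs =>
    FD_hasDerivAt (I := Set.Ioo (-2:ℝ) 2) isOpen_Ioo isPreconnected_Ioo (k := fun s x y => (s:ℂ) * k x y)
      (kd := fun s x y => k x y) hkt (fun s _ => hk2)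
      (fun s _ x y => by
        simpa using (Complex.ofRealCLM.hasDerivAt (x := s)).mul_const (k x y)) hs hA2 hB2 (fun x y => rfl)
  have hδd : ∀ s : ℝ, HasDerivAt (fun s : ℝ => δ s) (-((1 - (s:ℂ) • Mm).adjugate * Mm).trace) s := by
    intro s
    have h := hasDerivAt_det (A := fun s : ℝ => 1 - (s:ℂ) • Mm) (A' := fun _ => -Mm) (s := s)
      (fun i j => by
        have h1 := ((Complex.ofRealCLM.hasDerivAt (x := s)).mul_const (Mm i j)).const_sub ((1 : Matrix (Fin n) (Fin n) ℂ) i j)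
        simpa using h1)
    refine h.congr_deriv ?_
    rw [Matrix.trace, ← Finset.sum_neg_distrib]
    refine Finset.sum_congr rfl fun j _ => ?_
    rw [← Matrix.cramer_apply, Matrix.cramer_eq_adjugate_mulVec]
    simp [Matrix.mulVec, dotProduct, Matrix.mul_apply]
  have key : ∀ s ∈ Set.Ioo (-2:ℝ) 2, δ s * (-∑ m, ∫ t, B m t * FG μ (fun x y => (s:ℂ) * k x y) (A m) t ∂μ)
      = D s * (-((1 - (s:ℂ) • Mm).adjugate * Mm).trace) := by
    intro s hs
    set G : Fin n → ℝ → ℂ := fun j => FG μ (fun x y => (s:ℂ) * k x y) (A j) with hG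
    set g : Matrix (Fin n) (Fin n) ℂ := Matrix.of fun m j => ∫ t, B m t * G j t ∂μ with hg
    have hGb : ∀ j, ∃ C, FOK (G j) C := fun j => FG_bdd (hkt s hs) (hA2 j)
    have e1 : ∀ j x, G j x = D s * A j x + (s:ℂ) * ∑ l, A l x * g l j := by
      intro j x
      obtain ⟨C, hC⟩ := hGb j
      rw [hG]; simp only
      rw [FG_eq (hkt s hs) (hA2 j) x]
      congr 1
      simp only [mul_assoc]
      rw [integral_const_mul]
      congr 1
      simp only [hkdef, Finset.sum_mul, hg, Matrix.of_apply]
      rw [integral_finset_sum _ fun l _ => by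
        simp only [mul_assoc]; exact ((hB l).mul_int hC).const_mul _]
      refine Finset.sum_congr rfl fun l _ => ?_
      simp only [mul_assoc]
      rw [integral_const_mul]
    have e2 : g = D s • Mm + (s:ℂ) • (Mm * g) := by
      ext m j
      simp only [Matrix.add_apply, Matrix.smul_apply, Matrix.mul_apply, smul_eq_mul]
      conv_lhs => rw [hg]
      simp only [Matrix.of_apply]
      have : ∀ t, B m t * G j t = D s * (B m t * A j t) + (s:ℂ) * ∑ l, (B m t * A l t) * g l j := by
        intro t; rw [e1, mul_add, Finset.mul_sum, Finset.mul_sum, Finset.mul_sum]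
        congr 1
        · ring
        · exact Finset.sum_congr rfl fun l _ => by ring
      simp only [this]
      rw [integral_add (((hB m).mul_int (hA j)).const_mul _)
        ((integrable_finset_sum _ fun l _ => ((hB m).mul_int (hA l)).mul_const _).const_mul _),
        integral_const_mul, integral_const_mul,
        integral_finset_sum _ fun l _ => ((hB m).mul_int (hA l)).mul_const _]
      simp only [integral_mul_const, hMm, Matrix.of_apply]
    have e3 : (1 - (s:ℂ) • Mm) * g = D s • Mm := by
      rw [sub_mul, one_mul, smul_mul_assoc]; nth_rewrite 1 [e2]; abel
    have e4 : δ s • g = D s • ((1 - (s:ℂ) • Mm).adjugate * Mm) := by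
      have := congrArg (fun X => (1 - (s:ℂ) • Mm).adjugate * X) e3
      simp only [← mul_assoc, Matrix.adjugate_mul, mul_smul_comm] at this
      rw [← this, smul_mul_assoc, one_mul]
    have e5 : δ s * g.trace = D s * ((1 - (s:ℂ) • Mm).adjugate * Mm).trace := by
      have := congrArg Matrix.trace e4
      simpa [Matrix.trace_smul] using this
    have : ∑ m, ∫ t, B m t * FG μ (fun x y => (s:ℂ) * k x y) (A m) t ∂μ = g.trace := rfl
    rw [this, mul_neg, mul_neg, e5]
  have hδ0 : δ 0 = 1 := by simp [hδ]
  have hD0 : D 0 = 1 := by simp only [hD]; simpa using FD_zero (μ := μ)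
  have hδdiff : Differentiable ℂ δ := by
    simp only [hδ, Matrix.det_apply]
    have : ∀ i j : Fin n, Differentiable ℂ fun z : ℂ => (1 - z • Mm) i j := fun i j => by
      simp only [Matrix.sub_apply, Matrix.smul_apply, smul_eq_mul]; fun_prop
    refine Differentiable.fun_sum fun σ _ => Differentiable.const_smul ?_ _
    exact Differentiable.fun_finset_prod fun i _ => this _ _
  have hne : ∀ᶠ s : ℝ in 𝓝 0, δ s ≠ 0 := by
    have : ContinuousAt (fun s : ℝ => δ s) 0 := (hδd 0).continuousAt
    exact this.eventually_ne (by simp [hδ0])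
  obtain ⟨η, hη, hηs⟩ := Metric.eventually_nhds_iff.1 hne
  set b := min (η/2) 1 with hb
  have hb0 : 0 < b := by positivity
  have hb1 : b ≤ 1 := min_le_right _ _
  have hbη : b < η := (min_le_left _ _).trans_lt (by linarith)
  have hnz : ∀ s ∈ Set.Icc 0 b, δ s ≠ 0 := fun s hs => hηs (by
    rw [dist_zero_right, Real.norm_of_nonneg hs.1]; linarith [hs.2])
  have hder : ∀ s ∈ Set.Icc 0 b, HasDerivAt (fun s : ℝ => D s / δ s) 0 s := fun s hs => by
    have hs2 : s ∈ Set.Ioo (-2:ℝ) 2 := ⟨by linarith [hs.1], by linarith [hs.2]⟩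
    refine ((hDd s hs2).div (hδd s) (hnz s hs)).congr_deriv ?_
    rw [div_eq_zero_iff]; left
    rw [sub_eq_zero, mul_comm, key s hs2]
  have hconst := constant_of_has_deriv_right_zero (f := fun s : ℝ => D s / δ s) (a := 0) (b := b)
    (fun s hs => (hder s hs).continuousAt.continuousWithinAt)
    (fun s hs => (hder s ⟨hs.1, hs.2.le⟩).hasDerivWithinAt)
  have heq : ∀ s ∈ Set.Icc 0 b, FD μ (fun x y => (s:ℂ) * k x y) = δ s := fun s hs => by
    have := hconst s hs
    rw [hD0, Complex.ofReal_zero, hδ0, div_one, div_eq_one_iff_eq (hnz s hs)] at this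
    exact this
  have hfin : (fun z : ℂ => FD μ (fun x y => z * k x y)) = δ := by
    refine AnalyticOnNhd.eq_of_frequently_eq (z₀ := 0) (fun z _ => (FD_smul_diff hk).analyticAt z)
      (fun z _ => hδdiff.analyticAt z) ?_
    have hT : Tendsto (fun s : ℝ => (s:ℂ)) (𝓝[>] 0) (𝓝[≠] 0) := by
      refine tendsto_nhdsWithin_iff.2 ⟨?_, ?_⟩
      · have := (Complex.continuous_ofReal.tendsto 0).mono_left (nhdsWithin_le_nhds (s := Set.Ioi (0:ℝ)))
        simpa using this
      · filter_upwards [self_mem_nhdsWithin] with s hs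
        simpa using (ne_of_gt hs)
    refine hT.frequently (Eventually.frequently ?_)
    filter_upwards [Ioc_mem_nhdsGT hb0] with s hs
    exact heq s ⟨hs.1.le, hs.2⟩
  have := congrFun hfin 1
  simpa [hδ] using this

end
end Csin

end

section
set_option linter.all false
open MeasureTheory Filter Topology Complex

namespace Csin

/-- dirichlet kernel identity -/
theorem dir_sum (n : ℕ) (d : ℝ) :
    (Real.sin d : ℂ) * ∑ j ∈ Finset.range n, exp (((2 * j + 1 - n) * d : ℝ) * I) = (Real.sin (n * d) : ℂ) := by
  have h : ∀ j : ℕ, (Real.sin d : ℂ) * exp (((2 * j + 1 - n) * d : ℝ) * I) =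
      (exp (((2 * (j + 1 : ℕ) - n) * d : ℝ) * I) - exp (((2 * j - n) * d : ℝ) * I)) / (2 * I) := by
    intro j
    have e1 : (((2 * (j + 1 : ℕ) - n) * d : ℝ) * I : ℂ) = ((2 * j + 1 - n) * d : ℝ) * I + d * I := by push_cast; ring
    have e2 : (((2 * j - n) * d : ℝ) * I : ℂ) = ((2 * j + 1 - n) * d : ℝ) * I + (-d) * I := by push_cast; ring
    rw [e1, e2, exp_add, exp_add, ofReal_sin, Complex.sin]
    field_simp
    rw [I_sq]; ring
  rw [Finset.mul_sum, Finset.sum_congr rfl fun j _ => h j, ← Finset.sum_div,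
    Finset.sum_range_sub (fun j : ℕ => exp (((2 * j - n) * d : ℝ) * I))]
  have e1 : (((2 * (n:ℕ) - n) * d : ℝ) * I : ℂ) = (n * d : ℝ) * I := by push_cast; ring
  have e2 : (((2 * ((0:ℕ):ℝ) - n) * d : ℝ) * I : ℂ) = -(n * d : ℝ) * I := by push_cast; ring
  rw [e1, e2, ofReal_sin, Complex.sin]
  field_simp
  rw [I_sq]; ring

def aN (σ : ℝ) (n : ℕ) (j : Fin n) (x : ℝ) : ℂ :=
  ((Real.sqrt (σ / Real.pi) * Real.cos (Real.arctan (σ * x)) : ℝ) : ℂ) *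
    exp (((2 * (j:ℕ) + 1 - n) * Real.arctan (σ * x) : ℝ) * I)
def bN (σ : ℝ) (n : ℕ) (j : Fin n) (x : ℝ) : ℂ :=
  ((Real.sqrt (σ / Real.pi) * Real.cos (Real.arctan (σ * x)) : ℝ) : ℂ) *
    exp (-(((2 * (j:ℕ) + 1 - n) * Real.arctan (σ * x) : ℝ) * I))

theorem aN_FOK (σ : ℝ) (n : ℕ) (j : Fin n) : FOK (aN σ n j) (Real.sqrt (σ / Real.pi)) := by
  refine ⟨?_, fun x => ?_⟩
  · refine Continuous.measurable ?_
    unfold aN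
    have := Real.continuous_arctan
    fun_prop
  · unfold aN
    rw [norm_mul, norm_exp_ofReal_mul_I, mul_one, norm_real, norm_mul, Real.norm_of_nonneg (Real.sqrt_nonneg _)]
    exact mul_le_of_le_one_right (Real.sqrt_nonneg _) (Real.abs_cos_le_one _)

theorem bN_FOK (σ : ℝ) (n : ℕ) (j : Fin n) : FOK (bN σ n j) (Real.sqrt (σ / Real.pi)) := by
  refine ⟨?_, fun x => ?_⟩
  · refine Continuous.measurable ?_
    unfold bN
    have := Real.continuous_arctan
    fun_prop
  · unfold bN
    rw [← neg_mul, ← ofReal_neg, norm_mul, norm_exp_ofReal_mul_I, mul_one, norm_real, norm_mul, Real.norm_of_nonneg (Real.sqrt_nonneg _)]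
    exact mul_le_of_le_one_right (Real.sqrt_nonneg _) (Real.abs_cos_le_one _)

theorem sum_ab {σ : ℝ} (hσ : 0 < σ) (n : ℕ) (x y : ℝ) :
    ∑ j, aN σ n j x * bN σ n j y = ((σ / Real.pi * (Real.cos (Real.arctan (σ * x)) * Real.cos (Real.arctan (σ * y))) : ℝ) : ℂ) *
      ∑ j ∈ Finset.range n, exp (((2 * j + 1 - n) * (Real.arctan (σ * x) - Real.arctan (σ * y)) : ℝ) * I) := by
  rw [Finset.mul_sum, ← Fin.sum_univ_eq_sum_range (fun j : ℕ => ((σ / Real.pi * (Real.cos (Real.arctan (σ * x)) * Real.cos (Real.arctan (σ * y))) : ℝ) : ℂ) * exp (((2 * j + 1 - n) * (Real.arctan (σ * x) - Real.arctan (σ * y)) : ℝ) * I))]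
  refine Finset.sum_congr rfl fun j _ => ?_
  unfold aN bN
  have e : ((((2 * (j:ℕ) + 1 - n) * (Real.arctan (σ * x) - Real.arctan (σ * y)) : ℝ) : ℂ) * I) =
    ((2 * (j:ℕ) + 1 - n) * Real.arctan (σ * x) : ℝ) * I + -(((2 * (j:ℕ) + 1 - n) * Real.arctan (σ * y) : ℝ) * I) := by
    push_cast; ring
  rw [e, exp_add]
  have hs : σ / Real.pi = Real.sqrt (σ / Real.pi) * Real.sqrt (σ / Real.pi) := (Real.mul_self_sqrt (by positivity)).symm
  rw [hs]
  simp only [Real.sqrt_mul_self (Real.sqrt_nonneg _)]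
  simp only [ofReal_mul]
  ring

theorem Kth_rank {ρ : ℝ} (h0 : 0 < ρ) (h1 : ρ < 1) (n : ℕ) (x y : ℝ) :
    Kth (thP n ρ 0) (thP' n ρ 0) x y = ∑ j, aN (2 * ρ / (1 - ρ^2)) n j x * bN (2 * ρ / (1 - ρ^2)) n j y := by
  have h2 : 0 < 1 - ρ^2 := by nlinarith
  set σ := 2 * ρ / (1 - ρ^2) with hσ
  have hσ0 : 0 < σ := by positivity
  have hπ := Real.pi_pos
  rw [sum_ab hσ0]
  unfold Kth
  split_ifs with h
  · subst h
    simp only [sub_self, mul_zero, ofReal_zero, zero_mul, exp_zero, Finset.sum_const, Finset.card_range, nsmul_eq_mul, mul_one]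
    rw [← ofReal_natCast, ← ofReal_mul]
    congr 1
    have hc : Real.cos (Real.arctan (σ * x)) * Real.cos (Real.arctan (σ * x)) = 1 / (1 + (σ * x)^2) := by
      rw [← pow_two, Real.cos_sq_arctan]
    rw [hc]
    have hq : 0 < qP ρ x := qP_pos (by rw [abs_of_pos h0]; exact h1) x
    have : 1 + (σ * x)^2 = qP ρ x / (1 - ρ^2)^2 := by
      rw [hσ]; unfold qP; field_simp; ring
    rw [this, hσ]; unfold thP'
    field_simp
    ring
  · set a := Real.arctan (σ * x) with ha
    set b := Real.arctan (σ * y) with hb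
    have hca : 0 < Real.cos a := Real.cos_arctan_pos _
    have hcb : 0 < Real.cos b := Real.cos_arctan_pos _
    have hxy : x - y ≠ 0 := sub_ne_zero.2 h
    have hta : σ * x * Real.cos a = Real.sin a := by
      rw [← Real.tan_mul_cos hca.ne', ha, Real.tan_arctan]
    have htb : σ * y * Real.cos b = Real.sin b := by
      rw [← Real.tan_mul_cos hcb.ne', hb, Real.tan_arctan]
    have hs : Real.sin (a - b) = σ * (x - y) * (Real.cos a * Real.cos b) := by
      rw [Real.sin_sub, ← hta, ← htb]; ring
    have hd := dir_sum n (a - b)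
    have hth : thP n ρ 0 x - thP n ρ 0 y = n * (a - b) := by
      unfold thP; rw [← hσ, ← ha, ← hb]; ring
    rw [hth, ofReal_div, ← hd, hs]
    have hx' : (x:ℂ) - y ≠ 0 := by rw [← ofReal_sub]; exact_mod_cast hxy
    have hπ' : (Real.pi : ℂ) ≠ 0 := by exact_mod_cast hπ.ne'
    generalize ∑ j ∈ Finset.range n, exp (((2 * j + 1 - n) * (a - b) : ℝ) * I) = S
    push_cast
    field_simp

theorem DP_rank {ρ : ℝ} (h0 : 0 < ρ) (h1 : ρ < 1) (n : ℕ) :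
    (DP n ρ 0 : ℂ) = (1 - Matrix.of fun j l => ∫ t, bN (2 * ρ / (1 - ρ^2)) n j t * aN (2 * ρ / (1 - ρ^2)) n l t ∂vol1).det := by
  haveI : IsFiniteMeasure vol1 := by unfold vol1; infer_instance
  rw [← DP_cast]
  unfold DD
  rw [← FD_rank (aN_FOK _ n) (bN_FOK _ n)]
  congr 1
  ext x y
  exact Kth_rank h0 h1 n x y

theorem int_ba {σ : ℝ} (hσ : 0 < σ) (n : ℕ) (j l : Fin n) :
    ∫ t, bN σ n j t * aN σ n l t ∂vol1 =
      (1 / Real.pi) * ∫ u in (-Real.arctan σ)..(Real.arctan σ), exp (2 * ((l:ℕ) - (j:ℕ) : ℂ) * u * I) := by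
  have hπ := Real.pi_pos
  have hd : ∀ x : ℝ, HasDerivAt (fun x => Real.arctan (σ * x)) (σ / (1 + (σ * x)^2)) x := fun x => by
    have h1 := (Real.hasDerivAt_arctan (σ * x)).comp x ((hasDerivAt_id x).const_mul σ)
    refine h1.congr_deriv ?_
    simp only [mul_one]; ring
  have hc : Continuous fun x : ℝ => σ / (1 + (σ * x)^2) :=
    continuous_const.div (by fun_prop) fun x => by positivity
  have h := intervalIntegral.integral_comp_smul_deriv (a := -1) (b := 1) (f := fun x => Real.arctan (σ * x))
    (f' := fun x => σ / (1 + (σ * x)^2)) (g := fun u : ℝ => exp (2 * ((l:ℕ) - (j:ℕ) : ℂ) * u * I))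
    (fun x _ => hd x) hc.continuousOn (by fun_prop)
  simp only [mul_neg, mul_one, Real.arctan_neg] at h
  rw [← h]
  unfold vol1
  rw [← integral_Ioc_eq_integral_Ioo, ← intervalIntegral.integral_of_le (by norm_num), ← intervalIntegral.integral_const_mul]
  refine intervalIntegral.integral_congr fun x _ => ?_
  simp only [Function.comp]
  unfold aN bN
  have e : (2 * ((l:ℕ) - (j:ℕ) : ℂ) * (Real.arctan (σ * x) : ℝ) * I) =
    ((2 * (l:ℕ) + 1 - n) * Real.arctan (σ * x) : ℝ) * I + -(((2 * (j:ℕ) + 1 - n) * Real.arctan (σ * x) : ℝ) * I) := by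
    push_cast; ring
  rw [e, exp_add]
  have hcs : σ / (1 + (σ * x)^2) = Real.pi * ((Real.sqrt (σ / Real.pi) * Real.cos (Real.arctan (σ * x))) * (Real.sqrt (σ / Real.pi) * Real.cos (Real.arctan (σ * x)))) := by
    rw [show ∀ a b : ℝ, (a * b) * (a * b) = (a * a) * b^2 by intros; ring, Real.mul_self_sqrt (by positivity), Real.cos_sq_arctan]
    field_simp
  have hπ' : (Real.pi : ℂ) ≠ 0 := by exact_mod_cast hπ.ne'
  rw [hcs, real_smul]
  simp only [ofReal_mul]
  field_simp

/-- the complementary arc -/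
theorem compl_arc (a : ℝ) (m : ℤ) :
    (if m = 0 then (1:ℂ) else 0) - (1 / Real.pi) * ∫ u in (-a)..a, exp (2 * (m : ℂ) * u * I) =
      exp (2 * m * a * I) * ((1 / Real.pi) * ∫ u in (0:ℝ)..(Real.pi - 2 * a), exp (2 * (m:ℂ) * u * I)) := by
  have hπ' : (Real.pi : ℂ) ≠ 0 := by exact_mod_cast Real.pi_ne_zero
  by_cases hm : m = 0
  · subst hm; simp; field_simp; ring
  · have hm' : (2 * (m:ℂ) * I) ≠ 0 := by
      have : (m:ℂ) ≠ 0 := by exact_mod_cast hm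
      simp [this]
    have hF : ∀ p q : ℝ, ∫ u in p..q, exp (2 * (m:ℂ) * u * I) = (exp (2 * m * I * q) - exp (2 * m * I * p)) / (2 * m * I) := by
      intro p q
      rw [← integral_exp_mul_complex hm']
      refine intervalIntegral.integral_congr fun u _ => ?_
      congr 1; ring
    rw [hF, hF, if_neg hm]
    have e1 : (2 * (m:ℂ) * I * ((Real.pi - 2 * a : ℝ) : ℂ)) = -(2 * m * a * I) + -(2 * m * a * I) + m * (2 * Real.pi * I) := by push_cast; ring
    have e2 : exp ((m:ℂ) * (2 * Real.pi * I)) = 1 := exp_int_mul_two_pi_mul_I m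
    have e3 : (2 * (m:ℂ) * I * ((-a : ℝ) : ℂ)) = -(2 * m * a * I) := by push_cast; ring
    have e4 : (2 * (m:ℂ) * I * ((a : ℝ) : ℂ)) = 2 * m * a * I := by ring
    have e5 : (2 * (m:ℂ) * I * ((0 : ℝ) : ℂ)) = 0 := by simp
    rw [e1, e3, e4, e5, exp_add, exp_add, e2, exp_zero, exp_neg]
    have := exp_ne_zero (2 * m * a * I)
    field_simp
    ring

def TT (n : ℕ) (h : ℝ) : Matrix (Fin n) (Fin n) ℂ := Matrix.of fun j l =>
  (1 / Real.pi) * ∫ u in (0:ℝ)..h, exp (2 * ((l:ℕ) - (j:ℕ) : ℂ) * u * I)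

theorem DP_TT {ρ : ℝ} (h0 : 0 < ρ) (h1 : ρ < 1) (n : ℕ) :
    (DP n ρ 0 : ℂ) = (TT n (Real.pi - 2 * Real.arctan (2 * ρ / (1 - ρ^2)))).det := by
  have h2 : 0 < 1 - ρ^2 := by nlinarith
  set σ := 2 * ρ / (1 - ρ^2) with hσ
  have hσ0 : 0 < σ := by positivity
  rw [DP_rank h0 h1 n, ← hσ]
  set a := Real.arctan σ with ha
  have e : (1 - Matrix.of fun j l : Fin n => ∫ t, bN σ n j t * aN σ n l t ∂vol1) =
      Matrix.of fun j l : Fin n => exp (-(2 * (j:ℕ) * a * I)) * (Matrix.of (fun j l : Fin n => exp (2 * (l:ℕ) * a * I) * TT n (Real.pi - 2 * a) j l)) j l := by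
    ext j l
    have hc := compl_arc a ((l:ℕ) - (j:ℕ) : ℤ)
    push_cast at hc
    simp only [Matrix.sub_apply, Matrix.of_apply, TT, int_ba hσ0, ← ha]
    have e1 : (1 : Matrix (Fin n) (Fin n) ℂ) j l = if ((l:ℕ) : ℤ) - (j:ℕ) = 0 then 1 else 0 := by
      rw [Matrix.one_apply]
      congr 1
      rw [Fin.ext_iff, eq_iff_iff]
      omega
    rw [e1, hc, ← mul_assoc (exp (-(2 * (j:ℕ) * a * I))), ← exp_add]
    congr 2; ring
  rw [e, Matrix.det_mul_column, Matrix.det_mul_row, ← mul_assoc, ← Finset.prod_mul_distrib]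
  rw [Finset.prod_eq_one, one_mul]
  intro j _
  rw [← exp_add]; simp

end Csin

end

section
set_option linter.all false
open MeasureTheory Filter Topology Complex

namespace Csin

def NM (n : ℕ) (h : ℝ) : Matrix (Fin n) (Fin n) ℂ := Matrix.of fun j l =>
  (1 / Real.pi) * ∫ u in (0:ℝ)..h, (exp (-(2 * u * I)) - 1)^(j:ℕ) * (exp (2 * u * I) - 1)^(l:ℕ)
def NH (n : ℕ) (h : ℝ) : Matrix (Fin n) (Fin n) ℂ := Matrix.of fun j l =>
  (1 / Real.pi) * ∫ v in (0:ℝ)..1, ((exp (-(2 * ((h * v : ℝ):ℂ) * I)) - 1) / h)^(j:ℕ) * ((exp (2 * ((h * v : ℝ):ℂ) * I) - 1) / h)^(l:ℕ)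
def Pas (n : ℕ) : Matrix (Fin n) (Fin n) ℂ := Matrix.of fun j l => ((j:ℕ).choose (l:ℕ) : ℂ)

theorem Pas_det (n : ℕ) : (Pas n).det = 1 := by
  rw [Matrix.det_of_lowerTriangular]
  · exact Finset.prod_eq_one fun i _ => by simp [Pas]
  · intro i j hij
    have : (i:ℕ) < (j:ℕ) := by simpa using hij
    simp [Pas, Nat.choose_eq_zero_of_lt this]

theorem pow_pas (n : ℕ) (j : Fin n) (z : ℂ) : z^(j:ℕ) = ∑ a : Fin n, Pas n j a * (z - 1)^(a:ℕ) := by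
  simp only [Pas, Matrix.of_apply]
  rw [Fin.sum_univ_eq_sum_range (fun a : ℕ => ((j:ℕ).choose a : ℂ) * (z - 1)^a)]
  conv_lhs => rw [show z = (z - 1) + 1 by ring, add_pow]
  rw [← Finset.sum_subset (Finset.range_subset_range.2 (Nat.succ_le_of_lt j.2))]
  · exact Finset.sum_congr rfl fun a _ => by simp; ring
  · intro a _ ha
    rw [Finset.mem_range, not_lt] at ha
    rw [Nat.choose_eq_zero_of_lt (by omega)]; simp

theorem TT_NN (n : ℕ) (h : ℝ) : (TT n h).det = (NM n h).det := by
  have : TT n h = Pas n * NM n h * (Pas n).transpose := by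
    ext j l
    simp only [Matrix.mul_apply, Matrix.transpose_apply, TT, NM, Matrix.of_apply]
    have e : ∀ u : ℝ, exp (2 * ((l:ℕ) - (j:ℕ) : ℂ) * u * I) =
        ∑ b : Fin n, ∑ a : Fin n, Pas n j a * ((exp (-(2 * u * I)) - 1)^(a:ℕ) * (exp (2 * u * I) - 1)^(b:ℕ)) * Pas n l b := by
      intro u
      have : exp (2 * ((l:ℕ) - (j:ℕ) : ℂ) * u * I) = exp (-(2 * u * I))^(j:ℕ) * exp (2 * u * I)^(l:ℕ) := by
        rw [← exp_nat_mul, ← exp_nat_mul, ← exp_add]; congr 1; ring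
      rw [this, pow_pas n j, pow_pas n l, Finset.sum_mul_sum, Finset.sum_comm]
      refine Finset.sum_congr rfl fun b _ => Finset.sum_congr rfl fun a _ => ?_
      ring
    simp only [e]
    rw [intervalIntegral.integral_finset_sum fun b _ => Continuous.intervalIntegrable (by fun_prop) _ _, Finset.mul_sum]
    refine Finset.sum_congr rfl fun b _ => ?_
    rw [intervalIntegral.integral_finset_sum fun b _ => Continuous.intervalIntegrable (by fun_prop) _ _, Finset.mul_sum, Finset.sum_mul]
    refine Finset.sum_congr rfl fun a _ => ?_
    rw [intervalIntegral.integral_mul_const, intervalIntegral.integral_const_mul]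
    ring
  rw [this, Matrix.det_mul, Matrix.det_mul, Matrix.det_transpose, Pas_det]; ring

theorem NN_NH (n : ℕ) {h : ℝ} (hh : 0 < h) : (NM n h).det = (h:ℂ)^(n^2) * (NH n h).det := by
  have hc : (h:ℂ) ≠ 0 := by exact_mod_cast hh.ne'
  have : NM n h = Matrix.of fun j l : Fin n => (h:ℂ)^((j:ℕ)+1) * (Matrix.of (fun j l : Fin n => (h:ℂ)^(l:ℕ) * NH n h j l)) j l := by
    ext j l
    simp only [NM, NH, Matrix.of_apply]
    have := intervalIntegral.smul_integral_comp_mul_left (a := 0) (b := 1) (fun u : ℝ => (exp (-(2 * u * I)) - 1)^(j:ℕ) * (exp (2 * u * I) - 1)^(l:ℕ)) h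
    simp only [mul_zero, mul_one] at this
    rw [← this]
    have e : ∀ v : ℝ, (exp (-(2 * ((h * v : ℝ):ℂ) * I)) - 1)^(j:ℕ) * (exp (2 * ((h * v : ℝ):ℂ) * I) - 1)^(l:ℕ) =
       ((h:ℂ)^(j:ℕ) * (h:ℂ)^(l:ℕ)) * (((exp (-(2 * ((h * v : ℝ):ℂ) * I)) - 1) / h)^(j:ℕ) * ((exp (2 * ((h * v : ℝ):ℂ) * I) - 1) / h)^(l:ℕ)) := by
      intro v
      rw [div_pow, div_pow]; field_simp
    simp only [e]
    rw [intervalIntegral.integral_const_mul, real_smul]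
    ring
  rw [this, Matrix.det_mul_column, Matrix.det_mul_row, ← mul_assoc]
  congr 1
  rw [Finset.prod_pow_eq_pow_sum, Finset.prod_pow_eq_pow_sum, ← pow_add]
  congr 1
  rw [Fin.sum_univ_eq_sum_range (fun i => i + 1), Fin.sum_univ_eq_sum_range (fun i => i), ← Finset.sum_add_distrib]
  clear this
  induction n with
  | zero => simp
  | succ n ih =>
    rw [Finset.sum_range_succ, ih]
    ring

def Hn (n : ℕ) : ℝ := (Matrix.of fun i j : Fin n => 1 / ((i:ℕ) + (j:ℕ) + 1 : ℝ)).det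

theorem ratio_lim (c : ℂ) : Tendsto (fun h : ℝ => (exp (c * h) - 1) / h) (𝓝[>] 0) (𝓝 c) := by
  have h1 : HasDerivAt (fun h : ℝ => exp (c * h)) c 0 := by
    have := ((Complex.ofRealCLM.hasDerivAt (x := 0)).const_mul c).cexp
    simpa using this
  have h2 := h1.tendsto_slope.mono_left (nhdsWithin_mono _ (fun x (hx : 0 < x) => (ne_of_gt hx)))
  refine h2.congr fun h => ?_
  simp [slope_def_module, div_eq_inv_mul]

theorem NH_lim (n : ℕ) (j l : Fin n) : Tendsto (fun h => NH n h j l) (𝓝[>] 0)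
    (𝓝 ((1 / Real.pi) * ((-(2 * I))^(j:ℕ) * (2 * I)^(l:ℕ) * (((1 / ((j:ℕ) + (l:ℕ) + 1) : ℝ)) : ℂ)))) := by
  simp only [NH, Matrix.of_apply]
  refine Tendsto.const_mul _ ?_
  have e : ((-(2 * I))^(j:ℕ) * (2 * I)^(l:ℕ) * (((1 / ((j:ℕ) + (l:ℕ) + 1) : ℝ)) : ℂ)) =
      ∫ v in (0:ℝ)..1, (-(2 * v * I))^(j:ℕ) * (2 * v * I)^(l:ℕ) := by
    have : ∀ v : ℝ, (-(2 * v * I))^(j:ℕ) * (2 * v * I)^(l:ℕ) = ((-(2 * I))^(j:ℕ) * (2 * I)^(l:ℕ)) * ((v^((j:ℕ)+(l:ℕ)) : ℝ) : ℂ) := by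
      intro v
      rw [show -(2 * (v:ℂ) * I) = -(2 * I) * v by ring, show (2 * (v:ℂ) * I) = (2 * I) * v by ring, mul_pow, mul_pow]
      push_cast; ring
    simp only [this]
    rw [intervalIntegral.integral_const_mul, intervalIntegral.integral_ofReal, integral_pow]
    simp
  rw [e]
  have hb : ∀ c : ℂ, ‖c‖ = 2 → c.re = 0 → ∀ h : ℝ, 0 < h → ∀ v ∈ Set.Ioc (0:ℝ) 1, ‖(exp (c * ((h * v : ℝ) : ℂ)) - 1) / h‖ ≤ 2 := by
    intro c hc hr h hh v hv
    have hci : c = c.im * I := by apply Complex.ext <;> simp [hr]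
    have : c * ((h * v : ℝ) : ℂ) = I * ((c.im * (h * v) : ℝ) : ℂ) := by
      conv_lhs => rw [hci]
      push_cast; ring
    rw [norm_div, this, norm_real, Real.norm_of_nonneg hh.le, div_le_iff₀ hh]
    refine (Real.norm_exp_I_mul_ofReal_sub_one_le).trans ?_
    have h2 : |c.im| = 2 := by
      rw [hci, norm_mul, norm_I, mul_one, norm_real] at hc; exact hc
    rw [norm_mul, Real.norm_eq_abs, h2, Real.norm_of_nonneg (by have := hv.1; positivity)]
    nlinarith [hv.2]
  refine intervalIntegral.tendsto_integral_filter_of_dominated_convergence (fun _ => 2^(j:ℕ) * 2^(l:ℕ)) ?_ ?_ ?_ ?_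
  · refine Eventually.of_forall fun h => Continuous.aestronglyMeasurable (by fun_prop)
  · filter_upwards [self_mem_nhdsWithin] with h hh
    refine ae_of_all _ fun v hv => ?_
    rw [Set.uIoc_of_le zero_le_one] at hv
    rw [norm_mul, norm_pow, norm_pow]
    have h1 := hb (-(2 * I)) (by simp) (by simp) h hh v hv
    have h2 := hb (2 * I) (by simp) (by simp) h hh v hv
    rw [show -(2 * I) * ((h * v : ℝ) : ℂ) = -(2 * ((h * v : ℝ):ℂ) * I) by ring] at h1
    rw [show (2 * I) * ((h * v : ℝ) : ℂ) = (2 * ((h * v : ℝ):ℂ) * I) by ring] at h2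
    gcongr
  · exact intervalIntegrable_const
  · refine ae_of_all _ fun v hv => ?_
    refine Tendsto.mul (Tendsto.pow ?_ _) (Tendsto.pow ?_ _)
    · refine (ratio_lim (-(2 * v * I))).congr fun h => ?_
      congr 3; push_cast; ring
    · refine (ratio_lim (2 * v * I)).congr fun h => ?_
      congr 3; push_cast; ring

theorem det_tendsto {n : ℕ} {A : ℝ → Matrix (Fin n) (Fin n) ℂ} {B : Matrix (Fin n) (Fin n) ℂ} {l : Filter ℝ}
    (h : ∀ i j, Tendsto (fun t => A t i j) l (𝓝 (B i j))) : Tendsto (fun t => (A t).det) l (𝓝 B.det) := by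
  simp only [Matrix.det_apply]
  exact tendsto_finset_sum _ fun σ _ => Tendsto.const_smul (tendsto_finset_prod _ fun i _ => h _ _) _

theorem NH_det_lim (n : ℕ) : Tendsto (fun h => (NH n h).det) (𝓝[>] 0)
    (𝓝 (((∏ a ∈ Finset.range n, (4:ℝ)^a) / Real.pi^n * Hn n : ℝ) : ℂ)) := by
  have h := det_tendsto (B := Matrix.of fun j l : Fin n => (1 / Real.pi) * ((-(2 * I))^(j:ℕ) * (2 * I)^(l:ℕ) * (((1 / ((j:ℕ) + (l:ℕ) + 1) : ℝ)) : ℂ))) (NH_lim n)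
  convert h using 2
  have e : (Matrix.of fun j l : Fin n => (1 / (Real.pi:ℂ)) * ((-(2 * I))^(j:ℕ) * (2 * I)^(l:ℕ) * (((1 / ((j:ℕ) + (l:ℕ) + 1) : ℝ)) : ℂ))) =
    Matrix.of fun j l : Fin n => ((1 / (Real.pi:ℂ)) * (-(2 * I))^(j:ℕ)) * (Matrix.of (fun j l : Fin n => (2 * I)^(l:ℕ) * ((ofRealHom.mapMatrix (Matrix.of fun i j : Fin n => 1 / ((i:ℕ) + (j:ℕ) + 1 : ℝ))) : Matrix (Fin n) (Fin n) ℂ) j l)) j l := by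
    ext j l; simp; ring
  rw [e, Matrix.det_mul_column, Matrix.det_mul_row, ← RingHom.map_det, ← mul_assoc, ← Finset.prod_mul_distrib]
  change _ = _ * ((Hn n : ℝ) : ℂ)
  rw [ofReal_mul]
  congr 1
  rw [Fin.prod_univ_eq_prod_range (fun j => 1 / (Real.pi:ℂ) * (-(2 * I))^j * (2 * I)^j)]
  have : ∀ j : ℕ, 1 / (Real.pi:ℂ) * (-(2 * I))^j * (2 * I)^j = (1 / Real.pi) * 4^j := by
    intro j; rw [mul_assoc, ← mul_pow]; congr 2
    rw [show -(2 * I) * (2 * I) = -4 * (I * I) by ring, I_mul_I]; ring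
  simp only [this]
  rw [Finset.prod_mul_distrib, Finset.prod_const, Finset.card_range]
  push_cast
  ring

end Csin

end

section
set_option linter.all false
open MeasureTheory Filter Topology

namespace Csin

def FF (n : ℕ) : ℝ := 2^(n^2) * ((∏ a ∈ Finset.range n, (4:ℝ)^a) / Real.pi^n * Hn n)
def hR (ρ : ℝ) : ℝ := Real.pi - 2 * Real.arctan (2 * ρ / (1 - ρ^2))

theorem hR_pos (ρ : ℝ) : 0 < hR ρ := by
  unfold hR; linarith [Real.arctan_lt_pi_div_two (2 * ρ / (1 - ρ^2))]

theorem hR_lim : Tendsto hR (𝓝[<] 1) (𝓝[>] 0) := by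
  refine tendsto_nhdsWithin_iff.2 ⟨?_, Eventually.of_forall hR_pos⟩
  have h1 : Tendsto (fun ρ : ℝ => 2 * ρ / (1 - ρ^2)) (𝓝[<] 1) atTop := by
    have h2 : Tendsto (fun ρ : ℝ => 1 - ρ^2) (𝓝[<] 1) (𝓝[>] 0) := by
      refine tendsto_nhdsWithin_iff.2 ⟨?_, ?_⟩
      · have : ContinuousAt (fun ρ : ℝ => 1 - ρ^2) 1 := by fun_prop
        have := this.tendsto.mono_left (nhdsWithin_le_nhds (s := Set.Iio 1))
        simpa using this
      · filter_upwards [Ioo_mem_nhdsLT (show (0:ℝ) < 1 by norm_num)] with ρ hρ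
        have := hρ.1; have := hρ.2
        simp only [Set.mem_Ioi]; nlinarith
    have h3 : Tendsto (fun ρ : ℝ => 2 * ρ) (𝓝[<] 1) (𝓝 2) := by
      have : ContinuousAt (fun ρ : ℝ => 2 * ρ) 1 := by fun_prop
      have := this.tendsto.mono_left (nhdsWithin_le_nhds (s := Set.Iio 1))
      simpa using this
    exact h3.pos_mul_atTop (by norm_num) h2.inv_tendsto_nhdsGT_zero
  have h4 := (Real.tendsto_arctan_atTop.mono_right nhdsWithin_le_nhds).comp h1
  have h5 := (h4.const_mul 2).const_sub Real.pi
  rw [show Real.pi - 2 * (Real.pi / 2) = 0 by ring] at h5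
  exact h5

theorem Psi_hR {ρ : ℝ} (h0 : 0 < ρ) (h1 : ρ < 1) (n : ℕ) :
    Psi n ρ 0 = (hR ρ / Real.sin (hR ρ / 2))^(n^2) * ((NH n (hR ρ)).det).re := by
  have h2 : 0 < 1 - ρ^2 := by nlinarith
  have hs : Real.sin (hR ρ / 2) = (1 - ρ^2) / (1 + ρ^2) := by
    have : hR ρ / 2 = Real.pi/2 - Real.arctan (2 * ρ / (1 - ρ^2)) := by unfold hR; ring
    rw [this, Real.sin_pi_div_two_sub, Real.cos_arctan]
    have : 1 + (2 * ρ / (1 - ρ^2))^2 = ((1 + ρ^2) / (1 - ρ^2))^2 := by field_simp; ring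
    rw [this, Real.sqrt_sq (by positivity)]
    field_simp
  have hM : Real.exp (MM n ρ 0) = ((1 + ρ^2) / (1 - ρ^2))^(n^2) := by
    unfold MM
    rw [← Real.log_div (by positivity) h2.ne']
    rw [show (n:ℝ)^2 * Real.log ((1 + ρ^2) / (1 - ρ^2)) + 2 * n * ρ * 0 + 0^2/2 = ((n^2 : ℕ) : ℝ) * Real.log ((1 + ρ^2) / (1 - ρ^2)) by push_cast; ring]
    rw [Real.exp_nat_mul, Real.exp_log (by positivity)]
  have hD : DP n ρ 0 = (hR ρ)^(n^2) * ((NH n (hR ρ)).det).re := by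
    have := DP_TT h0 h1 n
    rw [TT_NN] at this
    change _ = (NM n (hR ρ)).det at this
    rw [NN_NH n (hR_pos ρ)] at this
    have h3 := congrArg Complex.re this
    rw [Complex.ofReal_re, ← Complex.ofReal_pow, Complex.re_ofReal_mul] at h3
    exact h3
  unfold Psi
  rw [hD, hM, hs, div_div_eq_mul_div, div_pow, div_pow, mul_pow]
  field_simp

theorem Psi_lim (n : ℕ) : Tendsto (fun ρ => Psi n ρ 0) (𝓝[<] 1) (𝓝 (FF n)) := by
  have h1 : Tendsto (fun h : ℝ => h / Real.sin (h / 2)) (𝓝[>] 0) (𝓝 2) := by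
    have hd : HasDerivAt (fun h : ℝ => Real.sin (h / 2)) (1/2) 0 := by
      have := ((hasDerivAt_id (0:ℝ)).div_const 2).sin
      simpa using this
    have h2 := hd.tendsto_slope.mono_left (nhdsWithin_mono _ (fun x (hx : 0 < x) => (ne_of_gt hx)))
    have h3 := h2.inv₀ (by norm_num)
    norm_num at h3
    refine h3.congr fun h => ?_
    simp [slope_def_field]
  have h2 := (Complex.continuous_re.tendsto _).comp (NH_det_lim n)
  have h3 := ((h1.pow (n^2)).mul h2).comp hR_lim
  rw [Complex.ofReal_re] at h3
  refine h3.congr' ?_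
  filter_upwards [Ioo_mem_nhdsLT (show (0:ℝ) < 1 by norm_num)] with ρ hρ
  rw [Psi_hR hρ.1 hρ.2]; rfl

theorem pathAC {n : ℕ} {y : ℝ} (hn : 2 ≤ n) (hy : n ≤ y) (hy3 : 3 ≤ y) (hF : 0 < FF n) :
    0 < Psi 0 0 y ∧ |Real.log (Psi 0 0 y) - Real.log (FF n)| ≤ 8 / (2 * n) * (y - n) + 153600 * n * (1 / (2 * (y - 2))^3) := by
  have hL := Psi_lim n
  have hn2 : (2:ℝ) ≤ n := by exact_mod_cast hn
  have hev : ∀ᶠ ρ in 𝓝[<] (1:ℝ), 0 < Psi 0 0 y ∧ |Real.log (Psi 0 0 y) - Real.log (Psi n ρ 0)| ≤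
      8 / (2 * n * bP ρ) * (y - n * bP ρ) + 153600 * n * (1 / (2 * (y - 2))^3) := by
    filter_upwards [Ioo_mem_nhdsLT (show (0:ℝ) < 1 by norm_num), hL.eventually (lt_mem_nhds hF)] with ρ hρ hP
    obtain ⟨b0, b1, _⟩ := bP_bd hρ.1 hρ.2
    have hw : 0 ≤ y - n * bP ρ := by nlinarith
    obtain ⟨_, hp2, hp3⟩ := path_w (r := n) (ρ := ρ) (w1 := y - n * bP ρ) (c := 2 * n * bP ρ)
      (by rw [abs_of_pos hρ.1]; exact hρ.2) hw (by positivity)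
      (fun w hw φ hφ => Ew_C hρ.1 hρ.2 (by linarith) hw.1.le hφ) (Or.inl hP)
    obtain ⟨hq1, _, hq3⟩ := path_s (r := n) (s1 := ρ) (y := y) (c := 2 * (y - 2)) (K := 1) hρ.1.le hρ.2 (by linarith) one_pos
      (fun s hs φ hφ => Ew_A hs.1 (hs.2.trans hρ.2) hn2 hφ) (Or.inr hp2)
    rw [Psi_zero] at hq1 hq3
    refine ⟨hq1, ?_⟩
    have hc : 0 < (2 * (y - 2))^3 := by have : 0 < y - 2 := by linarith
                                        positivity
    have : 153600 * |(n:ℝ)| * ρ^3 * (1 / (2 * (y - 2))^3) ≤ 153600 * n * (1 / (2 * (y - 2))^3) := by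
      rw [abs_of_nonneg (by linarith : (0:ℝ) ≤ n)]
      refine mul_le_mul_of_nonneg_right ?_ (by positivity)
      refine mul_le_of_le_one_right (by positivity) (pow_le_one₀ hρ.1.le hρ.2.le)
    rw [abs_le] at hp3 hq3 ⊢
    constructor <;> linarith [hp3.1, hp3.2, hq3.1, hq3.2]
  have hev1 := hev.mono fun ρ h => h.1
  refine ⟨hev1.exists.choose_spec, ?_⟩
  have hb : Tendsto bP (𝓝[<] 1) (𝓝 1) := by
    have : ContinuousAt bP 1 := by
      unfold bP
      exact ContinuousAt.div (by fun_prop) (by fun_prop) (by norm_num)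
    have := this.tendsto.mono_left (nhdsWithin_le_nhds (s := Set.Iio 1))
    rwa [show bP 1 = 1 by unfold bP; norm_num] at this
  have hn0 : (0:ℝ) < n := by linarith
  have t1 : Tendsto (fun ρ => 8 / (2 * n * bP ρ) * (y - n * bP ρ) + 153600 * n * (1 / (2 * (y - 2))^3)) (𝓝[<] 1)
      (𝓝 (8 / (2 * n * 1) * (y - n * 1) + 153600 * n * (1 / (2 * (y - 2))^3))) :=
    (((tendsto_const_nhds.div (hb.const_mul _) (by positivity))).mul ((hb.const_mul _).const_sub _)).add_const _
  rw [mul_one, mul_one] at t1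
  have t2 : Tendsto (fun ρ => |Real.log (Psi 0 0 y) - Real.log (Psi n ρ 0)|) (𝓝[<] 1) (𝓝 |Real.log (Psi 0 0 y) - Real.log (FF n)|) :=
    ((hL.log hF.ne').const_sub _).abs
  exact le_of_tendsto_of_tendsto t2 t1 (hev.mono fun ρ h => h.2)

end Csin

end

section
set_option linter.all false
open MeasureTheory Filter Topology

namespace Csin

def nodeN (j : ℕ) : ℝ := -((j:ℝ) + 1)
def numN (n : ℕ) : Polynomial ℝ := Lagrange.nodal (Finset.range n) (fun i : ℕ => (i:ℝ))
def coefN (n j : ℕ) : ℝ := Lagrange.nodalWeight (Finset.range (n+1)) nodeN j * (numN n).eval (nodeN j)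

theorem parfrac (n i : ℕ) : ∑ j ∈ Finset.range (n+1), 1 / ((i:ℝ) + j + 1) * coefN n j =
    (∏ k ∈ Finset.range n, ((i:ℝ) - k)) / ∏ k ∈ Finset.range (n+1), ((i:ℝ) + k + 1) := by
  have hinj : Set.InjOn nodeN (Finset.range (n+1) : Set ℕ) := fun a _ b _ h => by
    unfold nodeN at h
    have : (a:ℝ) = b := by linarith
    exact_mod_cast this
  have hdeg : (numN n).degree < (Finset.range (n+1)).card := by
    unfold numN
    rw [Lagrange.degree_nodal]; simp
    exact_mod_cast Nat.lt_succ_self n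
  have h := Lagrange.eq_interpolate hinj hdeg
  have hx : ∀ j ∈ Finset.range (n+1), (i:ℝ) ≠ nodeN j := fun j _ => by
    unfold nodeN
    have : (0:ℝ) ≤ i := Nat.cast_nonneg _
    have : (0:ℝ) ≤ j := Nat.cast_nonneg _
    intro h; linarith
  have h2 := congrArg (Polynomial.eval (i:ℝ)) h
  rw [Lagrange.eval_interpolate_not_at_node _ hx] at h2
  have e1 : (numN n).eval (i:ℝ) = ∏ k ∈ Finset.range n, ((i:ℝ) - k) := by
    unfold numN; rw [Lagrange.eval_nodal]
  have e2 : (Lagrange.nodal (Finset.range (n+1)) nodeN).eval (i:ℝ) = ∏ k ∈ Finset.range (n+1), ((i:ℝ) + k + 1) := by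
    rw [Lagrange.eval_nodal]; refine Finset.prod_congr rfl fun k _ => ?_
    unfold nodeN; ring
  rw [← e1, ← e2, h2, mul_div_cancel_left₀ _ (Lagrange.eval_nodal_not_at_node hx)]
  refine Finset.sum_congr rfl fun j _ => ?_
  unfold coefN
  rw [show (i:ℝ) - nodeN j = i + j + 1 by unfold nodeN; ring]
  ring

theorem prod_fact (n : ℕ) : ∏ k ∈ Finset.range n, ((n:ℝ) - k) = n.factorial := by
  rw [← Nat.descFactorial_self, Nat.descFactorial_eq_prod_range, Nat.cast_prod]
  refine Finset.prod_congr rfl fun k hk => ?_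
  rw [Nat.cast_sub (Finset.mem_range.1 hk).le]

theorem prod_asc (n m : ℕ) : (n.factorial : ℝ) * ∏ k ∈ Finset.range m, ((n:ℝ) + k + 1) = (n+m).factorial := by
  rw [← Nat.factorial_mul_ascFactorial, Nat.ascFactorial_eq_prod_range]
  push_cast
  congr 1
  exact Finset.prod_congr rfl fun k hk => by ring

theorem coefN_last (n : ℕ) : coefN n n = Nat.centralBinom n := by
  have e : (Finset.range (n+1)).erase n = Finset.range n := by ext; simp; omega
  unfold coefN Lagrange.nodalWeight numN
  rw [e, Lagrange.eval_nodal, ← Finset.prod_mul_distrib]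
  have : ∀ j ∈ Finset.range n, (nodeN n - nodeN j)⁻¹ * (nodeN n - j) = ((n:ℝ) + j + 1) / (n - j) := fun j hj => by
    unfold nodeN
    have : (j:ℝ) < n := by exact_mod_cast Finset.mem_range.1 hj
    have h1 : (n:ℝ) - j ≠ 0 := by linarith
    have h2 : (-((n:ℝ) + 1) - -(j + 1)) ≠ 0 := by intro h; apply h1; linarith
    field_simp
    ring
  rw [Finset.prod_congr rfl this, Finset.prod_div_distrib, prod_fact]
  have h1 := prod_asc n n
  have h2 : (Nat.centralBinom n * n.factorial * n.factorial : ℝ) = ((n+n).factorial : ℝ) := by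
    have := Nat.choose_mul_factorial_mul_factorial (show n ≤ 2 * n by omega)
    rw [show 2 * n - n = n by omega] at this
    rw [← two_mul, ← this, Nat.centralBinom]; push_cast; ring
  have h3 : (n.factorial : ℝ) ≠ 0 := by exact_mod_cast n.factorial_ne_zero
  field_simp
  apply mul_left_cancel₀ h3
  rw [h1, ← h2]; ring

theorem Hn_succ (n : ℕ) : Hn (n+1) = Hn n / ((2 * n + 1) * (Nat.centralBinom n : ℝ)^2) := by
  set A : Matrix (Fin (n+1)) (Fin (n+1)) ℝ := Matrix.of fun i j => 1 / ((i:ℕ) + (j:ℕ) + 1 : ℝ) with hA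
  set c : Fin (n+1) → ℝ := fun j => coefN n j with hc
  have hAc : ∀ i : Fin (n+1), A.mulVec c i = (∏ k ∈ Finset.range n, (((i:ℕ):ℝ) - k)) / ∏ k ∈ Finset.range (n+1), (((i:ℕ):ℝ) + k + 1) := by
    intro i
    rw [← parfrac, ← Fin.sum_univ_eq_sum_range (fun j : ℕ => 1 / (((i:ℕ):ℝ) + j + 1) * coefN n j)]
    rfl
  have h1 : (A.updateCol (Fin.last n) (A.mulVec c)).det = A.det * coefN n n := by
    rw [← Matrix.cramer_apply, Matrix.cramer_eq_adjugate_mulVec, Matrix.mulVec_mulVec, Matrix.adjugate_mul,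
      Matrix.smul_mulVec, Matrix.one_mulVec]
    simp [hc]
  have h2 : (A.updateCol (Fin.last n) (A.mulVec c)).det = A.mulVec c (Fin.last n) * Hn n := by
    rw [Matrix.det_succ_column _ (Fin.last n), Fin.sum_univ_castSucc, Finset.sum_eq_zero, zero_add]
    · simp only [Matrix.updateCol_self]
      have : (A.updateCol (Fin.last n) (A.mulVec c)).submatrix (Fin.last n).succAbove (Fin.last n).succAbove =
          Matrix.of fun i j : Fin n => 1 / ((i:ℕ) + (j:ℕ) + 1 : ℝ) := by
        ext i j
        simp [Matrix.submatrix_apply, Fin.succAbove_last, hA]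
      rw [this]
      unfold Hn
      rw [Even.neg_one_pow ⟨_, rfl⟩]; ring
    · intro i _
      simp only [Matrix.updateCol_self]
      rw [hAc]
      have : ∏ k ∈ Finset.range n, (((i.castSucc:ℕ):ℝ) - k) = 0 :=
        Finset.prod_eq_zero (i := (i:ℕ)) (Finset.mem_range.2 i.2) (by simp)
      rw [this]; simp
  have h3 : A.det * Nat.centralBinom n = (n.factorial : ℝ) / (∏ k ∈ Finset.range (n+1), ((n:ℝ) + k + 1)) * Hn n := by
    rw [← coefN_last, ← h1, h2, hAc, Fin.val_last, prod_fact]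
  have hb : (Nat.centralBinom n : ℝ) ≠ 0 := by exact_mod_cast (Nat.centralBinom_pos n).ne'
  have h3' : (n.factorial : ℝ) ≠ 0 := by exact_mod_cast n.factorial_ne_zero
  have h5 : (Nat.centralBinom n * n.factorial * n.factorial : ℝ) = ((n+n).factorial : ℝ) := by
    have := Nat.choose_mul_factorial_mul_factorial (show n ≤ 2 * n by omega)
    rw [show 2 * n - n = n by omega] at this
    rw [← two_mul, ← this, Nat.centralBinom]; push_cast; ring
  have h6 : ∏ k ∈ Finset.range (n+1), ((n:ℝ) + k + 1) = (2 * n + 1) * Nat.centralBinom n * n.factorial := by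
    apply mul_left_cancel₀ h3'
    rw [prod_asc, ← add_assoc, Nat.factorial_succ]
    push_cast; rw [← h5]; ring
  rw [h6] at h3
  change Hn (n+1) * _ = _ at h3
  rw [eq_div_iff (by positivity)]
  have h7 : Hn (n+1) * ((2 * n + 1) * (Nat.centralBinom n : ℝ)^2) = (Hn (n+1) * Nat.centralBinom n) * ((2 * n + 1) * Nat.centralBinom n) := by ring
  rw [h7, h3]
  field_simp

theorem FF_zero : FF 0 = 1 := by simp [FF, Hn]

theorem FF_succ (n : ℕ) : FF (n+1) = FF n * (2 * 16^n / (Real.pi * (2 * n + 1) * (Nat.centralBinom n : ℝ)^2)) := by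
  unfold FF
  rw [Hn_succ, Finset.prod_range_succ, show (n+1)^2 = n^2 + (n + n + 1) by ring, pow_add 2, pow_succ 2, pow_add 2, pow_succ Real.pi]
  have hb : (Nat.centralBinom n : ℝ) ≠ 0 := by exact_mod_cast (Nat.centralBinom_pos n).ne'
  have : (16:ℝ)^n = 2^n * 2^n * 4^n := by rw [← mul_pow, ← mul_pow]; norm_num
  rw [this]
  have hπ := Real.pi_pos
  field_simp

theorem FF_pos (n : ℕ) : 0 < FF n := by
  induction n with
  | zero => rw [FF_zero]; norm_num
  | succ n ih =>
    rw [FF_succ]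
    have : (0:ℝ) < Nat.centralBinom n := by exact_mod_cast Nat.centralBinom_pos n
    have hπ := Real.pi_pos
    positivity

end Csin

end

section
set_option linter.all false
open MeasureTheory Filter Topology

namespace Csin

/-- telescoping tail bound -/
theorem tail_bound {a b : ℕ → ℝ} {A : ℝ} {m : ℕ} (ha : Tendsto a atTop (𝓝 A)) (hb : ∀ n, 0 ≤ b n)
    (h : ∀ n, m ≤ n → |a (n+1) - a n| ≤ b n - b (n+1)) (n : ℕ) (hn : m ≤ n) : |a n - A| ≤ b n := by
  have h1 : ∀ k, |a (n+k) - a n| ≤ b n - b (n+k) := by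
    intro k
    induction k with
    | zero => simp
    | succ k ih =>
      have h2 := h (n+k) (by omega)
      rw [abs_le] at *
      rw [← add_assoc]
      constructor <;> linarith [ih.1, ih.2, h2.1, h2.2]
  have h2 : Tendsto (fun k => |a (n+k) - a n|) atTop (𝓝 |A - a n|) := by
    have : Tendsto (fun k => a (n+k)) atTop (𝓝 A) := by
      have := (tendsto_add_atTop_iff_nat n).2 ha
      simpa [add_comm] using this
    exact (this.sub_const _).abs
  rw [abs_sub_comm]
  exact le_of_tendsto h2 (Eventually.of_forall fun k => (h1 k).trans (by linarith [hb (n+k)]))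

def pn (n : ℕ) : ℝ := Nat.centralBinom n / 4^n

theorem pn_pos (n : ℕ) : 0 < pn n := by
  have : (0:ℝ) < Nat.centralBinom n := by exact_mod_cast Nat.centralBinom_pos n
  unfold pn; positivity

theorem pn_succ (n : ℕ) : pn (n+1) = pn n * ((2 * n + 1) / (2 * n + 2)) := by
  have h := Nat.succ_mul_centralBinom_succ n
  have h' : ((n:ℝ) + 1) * Nat.centralBinom (n+1) = 2 * (2 * n + 1) * Nat.centralBinom n := by exact_mod_cast h
  unfold pn
  rw [pow_succ]
  have : (Nat.centralBinom (n+1) : ℝ) = 2 * (2 * n + 1) * Nat.centralBinom n / (n + 1) := by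
    rw [eq_div_iff (by positivity)]; linarith
  rw [this]
  field_simp
  ring

theorem W_pn (n : ℕ) : Real.Wallis.W n = 1 / ((2 * n + 1) * (pn n)^2) := by
  induction n with
  | zero => simp [pn, Real.Wallis.W]
  | succ n ih =>
    rw [Real.Wallis.W_succ, ih, pn_succ]
    have := pn_pos n
    push_cast
    field_simp
    ring

def un (n : ℕ) : ℝ := n * (pn n)^2

theorem un_lim : Tendsto un atTop (𝓝 (1 / Real.pi)) := by
  have h := Real.Wallis.tendsto_W_nhds_pi_div_two
  have hπ := Real.pi_pos
  have h2 : Tendsto (fun n : ℕ => (n:ℝ) / (2 * n + 1)) atTop (𝓝 (1/2)) := by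
    have : Tendsto (fun n : ℕ => (1:ℝ) / (2 + (n:ℝ)⁻¹)) atTop (𝓝 (1 / (2 + 0))) :=
      tendsto_const_nhds.div (tendsto_const_nhds.add tendsto_inv_atTop_nhds_zero_nat) (by norm_num)
    rw [add_zero] at this
    refine this.congr' ?_
    filter_upwards [eventually_gt_atTop 0] with n hn
    have : (0:ℝ) < n := by exact_mod_cast hn
    field_simp
  have h3 := h2.mul (h.inv₀ (by positivity))
  have e : (1/2) * (Real.pi/2)⁻¹ = 1 / Real.pi := by field_simp
  rw [e] at h3
  refine h3.congr fun n => ?_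
  rw [W_pn]; unfold un
  have := pn_pos n
  field_simp

theorem log_one_add_bd {x : ℝ} (hx : 0 ≤ x) : |Real.log (1 + x) - x| ≤ x^2 := by
  have h1 := Real.log_le_sub_one_of_pos (show 0 < 1 + x by linarith)
  have h2 := Real.one_sub_inv_le_log_of_pos (show 0 < 1 + x by linarith)
  have h3 : 1 - (1+x)⁻¹ - x ≥ -x^2 := by
    have : 1 - (1+x)⁻¹ - x + x^2 = x^3 / (1+x) := by field_simp; ring
    have : 0 ≤ x^3/(1+x) := by positivity
    linarith
  rw [abs_le]; constructor <;> nlinarith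

theorem un_asym (n : ℕ) (hn : 1 ≤ n) : |Real.log (Real.pi * un n) + 1 / (4 * n)| ≤ 1 / (n:ℝ)^2 := by
  have hπ := Real.pi_pos
  have ha : Tendsto (fun n : ℕ => Real.log (Real.pi * un n) + 1 / (4 * n)) atTop (𝓝 0) := by
    have h1 := ((un_lim.const_mul Real.pi)).log (by positivity)
    rw [show Real.pi * (1 / Real.pi) = 1 by field_simp, Real.log_one] at h1
    have h2 : Tendsto (fun n : ℕ => 1 / (4 * (n:ℝ))) atTop (𝓝 0) := by
      have := tendsto_inv_atTop_nhds_zero_nat (𝕜 := ℝ).const_mul (1/4)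
      rw [mul_zero] at this
      refine this.congr fun n => by rw [one_div, one_div, mul_inv]
    simpa using h1.add h2
  have := tail_bound (b := fun n => 1 / (n:ℝ)^2) (m := 1) ha (fun n => by positivity) (fun n hn => ?_) n hn
  · simpa using this
  · have hn0 : (0:ℝ) < n := by exact_mod_cast hn
    have hp := pn_pos n
    have hu : 0 < un n := by unfold un; positivity
    have e1 : Real.pi * un (n+1) = (Real.pi * un n) * (1 + 1 / (4 * n * (n+1))) := by
      unfold un; rw [pn_succ]; push_cast; field_simp; ring
    rw [e1, Real.log_mul (by positivity) (by positivity)]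
    have e2 := log_one_add_bd (show 0 ≤ 1 / (4 * (n:ℝ) * (n+1)) by positivity)
    have e3 : Real.log (Real.pi * un n) + Real.log (1 + 1 / (4 * n * (n+1))) + 1 / (4 * ((n+1:ℕ):ℝ)) - (Real.log (Real.pi * un n) + 1 / (4 * n)) =
        Real.log (1 + 1 / (4 * n * (n+1))) - 1 / (4 * n * (n+1)) := by
      push_cast; field_simp; ring
    rw [e3]
    refine e2.trans ?_
    push_cast
    have e4 : 1 / (n:ℝ)^2 - 1 / ((n:ℝ)+1)^2 - (1 / (4 * (n:ℝ) * (n+1)))^2 = (2 * n + 1 - 1/16) / (n^2 * (n+1)^2) := by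
      field_simp; ring
    have : 0 ≤ (2 * n + 1 - 1/16) / ((n:ℝ)^2 * (n+1)^2) := by
      apply div_nonneg _ (by positivity)
      linarith
    linarith

def SN (N : ℕ) : ℝ := ∑ k ∈ Finset.range N, ((k:ℝ)+1) * Real.log (k+1)

theorem logFF (n : ℕ) : Real.log (FF n) = -(2 * n^2 + n) * Real.log 2 - n * Real.log Real.pi
    - n * (2 * Real.log (pn n)) - 4 * SN n + SN (2 * n) := by
  have hπ := Real.pi_pos
  induction n with
  | zero => simp [FF_zero, SN]
  | succ n ih =>
    have hp := pn_pos n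
    have e1 : FF (n+1) = FF n * (2 / (Real.pi * (2 * n + 1) * (pn n)^2)) := by
      rw [FF_succ]; unfold pn
      have hb : (Nat.centralBinom n : ℝ) ≠ 0 := by exact_mod_cast (Nat.centralBinom_pos n).ne'
      rw [show (16:ℝ)^n = 4^n * 4^n by rw [← mul_pow]; norm_num]
      field_simp
    rw [e1, Real.log_mul (FF_pos n).ne' (by positivity), ih, Real.log_div (by norm_num) (by positivity),
      Real.log_mul (by positivity) (by positivity), Real.log_mul (by positivity) (by positivity), Real.log_pow,
      pn_succ, Real.log_mul (by positivity) (by positivity), Real.log_div (by positivity) (by positivity)]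
    have e2 : SN (n+1) = SN n + (n+1) * Real.log (n+1) := by unfold SN; rw [Finset.sum_range_succ]
    have e3 : SN (2 * (n+1)) = SN (2 * n) + (2 * n + 1) * Real.log (2 * n + 1) + (2 * n + 2) * Real.log (2 * n + 2) := by
      unfold SN; rw [show 2 * (n+1) = 2 * n + 1 + 1 by ring, Finset.sum_range_succ, Finset.sum_range_succ]
      push_cast
      rw [show (2 * (n:ℝ) + 1 + 1) = 2 * n + 2 by ring]
    have e4 : Real.log (2 * n + 2) = Real.log 2 + Real.log (n+1) := by
      rw [← Real.log_mul (by norm_num) (by positivity)]; ring_nf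
    rw [e2, e3, e4]
    push_cast
    ring

end Csin

end

section
set_option linter.all false
open MeasureTheory Filter Topology

namespace Csin

theorem EM_step {E : Type*} [NormedAddCommGroup E] [NormedSpace ℝ E] {G g g1 g2 g3 : ℝ → E} {B : ℝ}
    (h0 : ∀ t ∈ Set.Icc (0:ℝ) 1, HasDerivAt G (g t) t)
    (h1 : ∀ t ∈ Set.Icc (0:ℝ) 1, HasDerivAt g (g1 t) t)
    (h2 : ∀ t ∈ Set.Icc (0:ℝ) 1, HasDerivAt g1 (g2 t) t)
    (h3 : ∀ t ∈ Set.Icc (0:ℝ) 1, HasDerivAt g2 (g3 t) t)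
    (hB : ∀ t ∈ Set.Icc (0:ℝ) 1, ‖g3 t‖ ≤ B) :
    ‖(1/2:ℝ) • (g 0 + g 1) - (G 1 - G 0) - (1/12:ℝ) • (g1 1 - g1 0)‖ ≤ B / 4 := by
  have hB0 : 0 ≤ B := (norm_nonneg _).trans (hB 0 (by simp))
  have key : ∀ (f f' : ℝ → E) (C : ℝ), 0 ≤ C → (∀ t ∈ Set.Icc (0:ℝ) 1, HasDerivAt f (f' t) t) → f 0 = 0 →
      (∀ t ∈ Set.Icc (0:ℝ) 1, ‖f' t‖ ≤ C) → ∀ t ∈ Set.Icc (0:ℝ) 1, ‖f t‖ ≤ C := by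
    intro f f' C hC hd hf0 hb t ht
    have := norm_image_sub_le_of_norm_deriv_le_segment' (f := f) (f' := f') (C := C) (a := 0) (b := 1)
      (fun x hx => (hd x hx).hasDerivWithinAt) (fun x hx => hb x ⟨hx.1, hx.2.le⟩) t ht
    rw [hf0, sub_zero, sub_zero] at this
    exact this.trans (mul_le_of_le_one_right hC ht.2)
  have hid : ∀ t : ℝ, HasDerivAt (fun t : ℝ => t) 1 t := fun t => hasDerivAt_id t
  have hψ : ∀ t ∈ Set.Icc (0:ℝ) 1, ‖(1/6:ℝ) • (g1 0 - g1 t) + (t/6) • g2 t‖ ≤ B / 6 := by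
    apply key _ (fun t => (t/6) • g3 t) _ (by positivity)
    · intro t ht
      have a1 := (((h2 t ht).const_sub (g1 0)).const_smul (1/6:ℝ)).add
        (((hid t).div_const 6).smul (h3 t ht))
      exact a1.congr_deriv (by module)
    · simp
    · intro t ht
      rw [norm_smul, Real.norm_of_nonneg (by linarith [ht.1])]
      have := hB t ht
      nlinarith [ht.1, ht.2, norm_nonneg (g3 t)]
  have hφ1 : ∀ t ∈ Set.Icc (0:ℝ) 1,
      ‖(1/2:ℝ) • (g 0 - g t) + (t/3) • g1 t + (t/6) • g1 0 - (t^2/12) • g2 t‖ ≤ B / 4 := by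
    apply key _ (fun t => (1/6:ℝ) • (g1 0 - g1 t) + (t/6) • g2 t - (t^2/12) • g3 t) _ (by positivity)
    · intro t ht
      have a1 := (((((h1 t ht).const_sub (g 0)).const_smul (1/2:ℝ)).add
        (((hid t).div_const 3).smul (h2 t ht))).add
        (((hid t).div_const 6).smul_const (g1 0))).sub ((((hid t).pow 2).div_const 12).smul (h3 t ht))
      exact a1.congr_deriv (by simp; module)
    · simp
    · intro t ht
      refine (norm_sub_le _ _).trans ?_
      have e1 := hψ t ht
      have e2 : ‖(t^2/12) • g3 t‖ ≤ B / 12 := by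
        rw [norm_smul, Real.norm_of_nonneg (by positivity)]
        have := hB t ht
        have : t^2 ≤ 1 := by nlinarith [ht.1, ht.2]
        nlinarith [ht.1, ht.2, norm_nonneg (g3 t)]
      linarith
  have hφ : ∀ t ∈ Set.Icc (0:ℝ) 1,
      ‖(t/2) • (g 0 + g t) - (G t - G 0) - (t^2/12) • (g1 t - g1 0)‖ ≤ B / 4 := by
    apply key _ (fun t => (1/2:ℝ) • (g 0 - g t) + (t/3) • g1 t + (t/6) • g1 0 - (t^2/12) • g2 t) _ (by positivity)
    · intro t ht
      have a1 := ((((hid t).div_const 2).smul ((h1 t ht).const_add (g 0))).sub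
        ((h0 t ht).sub_const (G 0))).sub ((((hid t).pow 2).div_const 12).smul ((h2 t ht).sub_const (g1 0)))
      exact a1.congr_deriv (by simp; module)
    · simp
    · exact hφ1
  simpa using hφ 1 (by simp)

/-- real sequence -/
def aSN (N : ℕ) : ℝ := SN N - ((N:ℝ)^2/2 + N/2 + 1/12) * Real.log N + (N:ℝ)^2/4

theorem aSN_step (N : ℕ) (hN : 1 ≤ N) : |aSN (N+1) - aSN N| ≤ 1/(4*(N:ℝ)^2) := by
  have hx : (1:ℝ) ≤ N := by exact_mod_cast hN
  have hne : ∀ t ∈ Set.Icc (0:ℝ) 1, (N:ℝ) + t ≠ 0 := fun t ht => by linarith [ht.1]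
  have hid : ∀ t : ℝ, HasDerivAt (fun t : ℝ => (N:ℝ) + t) 1 t := fun t => (hasDerivAt_id t).const_add _
  have hlog : ∀ t ∈ Set.Icc (0:ℝ) 1, HasDerivAt (fun t : ℝ => Real.log (N + t)) (1/(N+t)) t :=
    fun t ht => (hid t).log (hne t ht)
  have := EM_step (E := ℝ) (G := fun t => (N+t)^2 * Real.log (N+t) / 2 - (N+t)^2/4)
    (g := fun t => (N+t) * Real.log (N+t)) (g1 := fun t => Real.log (N+t) + 1)
    (g2 := fun t => 1/(N+t)) (g3 := fun t => -1/(N+t)^2) (B := 1/(N:ℝ)^2)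
    (fun t ht => by
      have := hne t ht
      exact (((((hid t).pow 2).mul (hlog t ht)).div_const 2).sub
        (((hid t).pow 2).div_const 4)).congr_deriv (by simp; field_simp; ring))
    (fun t ht => by
      have := hne t ht
      exact ((hid t).mul (hlog t ht)).congr_deriv (by field_simp))
    (fun t ht => (hlog t ht).add_const 1)
    (fun t ht => by
      have := hne t ht
      have h5 := (hid t).inv this
      simp only [one_div]
      exact h5)
    (fun t ht => by
      rw [Real.norm_eq_abs, abs_div, abs_neg, abs_one, abs_of_nonneg (by positivity)]
      apply one_div_le_one_div_of_le (by positivity)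
      gcongr; linarith [ht.1])
  rw [Real.norm_eq_abs] at this
  convert this using 1
  · congr 1
    simp only [aSN, SN, Finset.sum_range_succ, add_zero, smul_eq_mul]
    push_cast
    ring
  · field_simp

theorem aSN_rate {A : ℝ} (h : Tendsto aSN atTop (𝓝 A)) (N : ℕ) (hN : 1 ≤ N) : |aSN N - A| ≤ 1 / (2 * N) := by
  refine tail_bound (b := fun n => 1 / (2 * n)) (m := 1) h (fun n => by positivity) ?_ N hN
  intro n hn
  refine (aSN_step n hn).trans ?_
  have hx : (1:ℝ) ≤ n := by exact_mod_cast hn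
  push_cast
  rw [div_sub_div _ _ (by positivity) (by positivity), div_le_div_iff₀ (by positivity) (by positivity)]
  nlinarith

end Csin

end

section
set_option linter.all false
open MeasureTheory Filter Topology

namespace Csin

def TZ (N : ℕ) (z : ℂ) : ℂ := ∑ k ∈ Finset.range (N+1), ((k:ℂ)+1)^(-z) + ((N:ℂ)+1)^(1-z)/(z-1)
  - ((N:ℂ)+1)^(-z)/2 + z * ((N:ℂ)+1)^(-z-1)/12

def UZ : Set ℂ := {z | -(3/2) < z.re} ∩ ({z | z.re - z.im < 1} ∩ Metric.ball 0 10)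

theorem UZ_open : IsOpen UZ := by
  refine IsOpen.inter ?_ (IsOpen.inter ?_ Metric.isOpen_ball)
  · exact isOpen_lt continuous_const Complex.continuous_re
  · exact isOpen_lt (Complex.continuous_re.sub Complex.continuous_im) continuous_const

theorem UZ_convex : Convex ℝ UZ := by
  refine Convex.inter ?_ (Convex.inter ?_ (convex_ball _ _))
  · exact convex_halfSpace_re_gt _
  · exact convex_halfSpace_lt (f := fun z : ℂ => z.re - z.im)
      (Complex.reLm - Complex.imLm).isLinear 1

theorem UZ_ne {z : ℂ} (hz : z ∈ UZ) : z ≠ 1 := by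
  rintro rfl
  have := hz.2.1
  norm_num at this

theorem dcpow (x : ℝ) (hx : 0 < x) (r : ℂ) (t : ℝ) (ht : 0 ≤ t) :
    HasDerivAt (fun t : ℝ => ((x + t : ℝ) : ℂ)^r) (r * ((x+t:ℝ):ℂ)^(r-1)) t := by
  have h1 : HasDerivAt (fun w : ℂ => (x:ℂ) + w) 1 (t:ℂ) := (hasDerivAt_id _).const_add _
  have hm : (x:ℂ) + t ∈ Complex.slitPlane := by
    rw [← Complex.ofReal_add]
    exact Complex.ofReal_mem_slitPlane.2 (by linarith)
  have := (HasDerivAt.cpow_const (c := r) h1 hm).comp_ofReal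
  simpa using this

theorem TZ_step (N : ℕ) {z : ℂ} (hz : z ∈ UZ) :
    ‖TZ (N+1) z - TZ N z‖ ≤ 330 * ((N:ℝ)+1)^(-(3/2):ℝ) := by
  have hx : (0:ℝ) < (N:ℝ)+1 := by positivity
  have hz1 : z - 1 ≠ 0 := sub_ne_zero.2 (UZ_ne hz)
  have hz1' : 1 - z ≠ 0 := sub_ne_zero.2 (UZ_ne hz).symm
  have hn : ‖z‖ ≤ 10 := by have := hz.2.2; simp at this; exact this.le
  have := EM_step (E := ℂ) (G := fun t => (((N:ℝ)+1 + t : ℝ) : ℂ)^(1-z) / (1-z))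
    (g := fun t => (((N:ℝ)+1 + t : ℝ) : ℂ)^(-z))
    (g1 := fun t => (-z) * (((N:ℝ)+1 + t : ℝ) : ℂ)^(-z-1))
    (g2 := fun t => (-z) * ((-z-1) * (((N:ℝ)+1 + t : ℝ) : ℂ)^(-z-1-1)))
    (g3 := fun t => (-z) * ((-z-1) * ((-z-1-1) * (((N:ℝ)+1 + t : ℝ) : ℂ)^(-z-1-1-1))))
    (B := 1320 * ((N:ℝ)+1)^(-(3/2):ℝ))
    (fun t ht => by
      refine ((dcpow _ hx (1-z) t ht.1).div_const (1-z)).congr_deriv ?_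
      rw [mul_div_cancel_left₀ _ hz1']
      congr 1; ring)
    (fun t ht => dcpow _ hx _ t ht.1)
    (fun t ht => (dcpow _ hx _ t ht.1).const_mul _)
    (fun t ht => ((dcpow _ hx _ t ht.1).const_mul _).const_mul _)
    (fun t ht => by
      have ht0 := ht.1
      have hb : (1:ℝ) ≤ (N:ℝ)+1+t := by have : (0:ℝ) ≤ N := by positivity
                                        linarith
      rw [norm_mul, norm_mul, norm_mul, Complex.norm_cpow_eq_rpow_re_of_pos (by linarith), norm_neg]
      have e1 : ‖-z-1‖ ≤ 11 := by
        refine (norm_sub_le _ _).trans ?_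
        rw [norm_neg, norm_one]; linarith
      have e2 : ‖-z-1-1‖ ≤ 12 := by
        refine (norm_sub_le _ _).trans ?_
        rw [norm_one]; linarith
      have e3 : ((N:ℝ)+1+t)^((-z-1-1-1).re) ≤ ((N:ℝ)+1)^(-(3/2):ℝ) := by
        calc _ ≤ ((N:ℝ)+1+t)^(-(3/2):ℝ) := by
              apply Real.rpow_le_rpow_of_exponent_le hb
              have := hz.1
              simp at this ⊢
              linarith
          _ ≤ _ := by
              apply Real.rpow_le_rpow_of_nonpos hx (by linarith) (by norm_num)
      calc _ ≤ 10 * (11 * (12 * ((N:ℝ)+1)^(-(3/2):ℝ))) := by gcongr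
        _ = _ := by ring)
  convert this using 1
  · congr 1
    simp only [TZ, Finset.sum_range_succ _ (N+1), Complex.real_smul]
    rw [show (1 - z) = -(z-1) by ring, div_neg, div_neg]
    push_cast
    rw [add_zero]
    ring
  · ring

theorem TZ_unif : ∃ Lz : ℂ → ℂ, TendstoUniformlyOn TZ Lz atTop UZ := by
  have hs : Summable (fun N : ℕ => 330 * ((N:ℝ)+1)^(-(3/2):ℝ)) := by
    apply Summable.mul_left
    have := (summable_nat_add_iff 1).2 (Real.summable_nat_rpow.2 (show (-(3/2):ℝ) < -1 by norm_num))
    simpa using this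
  have := tendstoUniformlyOn_tsum_nat hs (s := UZ) (f := fun N z => TZ (N+1) z - TZ N z)
    (fun n z hz => TZ_step n hz)
  refine ⟨fun z => TZ 0 z + ∑' n, (TZ (n+1) z - TZ n z), ?_⟩
  rw [Metric.tendstoUniformlyOn_iff] at this ⊢
  intro ε hε
  filter_upwards [this ε hε] with n hn z hz
  have := hn z hz
  rw [Finset.sum_range_sub (fun n => TZ n z), dist_eq_norm] at this
  rw [dist_eq_norm]
  convert this using 2
  ring

theorem cast1_ne (N : ℕ) : (N:ℂ)+1 ≠ 0 := by exact_mod_cast Nat.succ_ne_zero N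

theorem TZ_diff (N : ℕ) : DifferentiableOn ℂ (TZ N) UZ := by
  intro z hz
  apply DifferentiableAt.differentiableWithinAt
  have hz1 : z - 1 ≠ 0 := sub_ne_zero.2 (UZ_ne hz)
  unfold TZ
  have hc : ∀ (k : ℕ) (f : ℂ → ℂ), DifferentiableAt ℂ f z → DifferentiableAt ℂ (fun z => ((k:ℂ)+1)^(f z)) z :=
    fun k f hf => hf.const_cpow (Or.inl (cast1_ne k))
  refine DifferentiableAt.add (DifferentiableAt.sub (DifferentiableAt.add ?_ ?_) ?_) ?_
  · refine DifferentiableAt.fun_sum fun k _ => hc k _ (by fun_prop)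
  · exact (hc N _ (by fun_prop)).div (by fun_prop) hz1
  · exact (hc N _ (by fun_prop)).div_const 2
  · exact (differentiableAt_id.mul (hc N _ (by fun_prop))).div_const 12

theorem TZ_zeta {z : ℂ} (hz : 1 < z.re) : Tendsto (fun N => TZ N z) atTop (𝓝 (riemannZeta z)) := by
  have hs : Summable (fun n : ℕ => 1 / ((n:ℂ)+1)^z) := by
    have := (summable_nat_add_iff 1).2 (Complex.summable_one_div_nat_cpow.2 hz)
    simpa using this
  have h1 := hs.hasSum.tendsto_sum_nat
  rw [← zeta_eq_tsum_one_div_nat_add_one_cpow hz] at h1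
  have h2 := h1.comp (tendsto_add_atTop_nat 1)
  have h0 : ∀ r : ℂ, r.re < 0 → Tendsto (fun N : ℕ => ((N:ℂ)+1)^r) atTop (𝓝 0) := by
    intro r hr
    rw [tendsto_zero_iff_norm_tendsto_zero]
    have h3 := (tendsto_rpow_neg_atTop (y := -r.re) (by linarith)).comp
      ((tendsto_natCast_atTop_atTop (R := ℝ)).comp (tendsto_add_atTop_nat 1))
    refine h3.congr fun N => ?_
    have := Complex.norm_cpow_eq_rpow_re_of_pos (x := (N:ℝ)+1) (by positivity) r
    push_cast at this
    rw [this]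
    simp
  have := ((h2.add ((h0 (1-z) (by simpa using hz)).div_const (z-1))).sub
    ((h0 (-z) (by simp; linarith)).div_const 2)).add
    (((h0 (-z-1) (by simp; linarith)).const_mul z).div_const 12)
  simp only [zero_div, mul_zero, add_zero, sub_zero] at this
  refine this.congr fun N => ?_
  simp only [TZ, Function.comp, Complex.cpow_neg, one_div]

theorem TZ_lim : TendstoUniformlyOn TZ riemannZeta atTop UZ := by
  obtain ⟨Lz, hL⟩ := TZ_unif
  have hLd : DifferentiableOn ℂ Lz UZ :=
    hL.tendstoLocallyUniformlyOn.differentiableOn (Eventually.of_forall TZ_diff) UZ_open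
  have hZd : DifferentiableOn ℂ riemannZeta UZ := fun z hz =>
    (differentiableAt_riemannZeta (UZ_ne hz)).differentiableWithinAt
  have h2 : (2 + 2 * Complex.I : ℂ) ∈ UZ := by
    refine ⟨by norm_num, by norm_num, ?_⟩
    rw [mem_ball_zero_iff]
    refine (norm_add_le _ _).trans_lt ?_
    simp
    norm_num
  have heq : Set.EqOn Lz riemannZeta UZ := by
    refine (hLd.analyticOnNhd UZ_open).eqOn_of_preconnected_of_eventuallyEq (hZd.analyticOnNhd UZ_open)
      UZ_convex.isPreconnected h2 ?_
    have ho : IsOpen (UZ ∩ {z : ℂ | 1 < z.re}) :=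
      UZ_open.inter (isOpen_lt continuous_const Complex.continuous_re)
    filter_upwards [ho.mem_nhds ⟨h2, by simp⟩] with z hz
    exact tendsto_nhds_unique (hL.tendsto_at hz.1) (TZ_zeta hz.2)
  exact hL.congr_right heq

theorem TZ_deriv (N : ℕ) : deriv (TZ N) (-1) = ((-aSN (N+1) + 1/12 : ℝ) : ℂ) := by
  have hc : ∀ (k : ℕ) (f : ℂ → ℂ) (f' z : ℂ), HasDerivAt f f' z →
      HasDerivAt (fun z => ((k:ℂ)+1)^(f z)) (((k:ℂ)+1)^(f z) * Complex.log ((k:ℂ)+1) * f') z :=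
    fun k f f' z hf => hf.const_cpow (Or.inl (cast1_ne k))
  have hi := hasDerivAt_id (-1:ℂ)
  have hs : HasDerivAt (fun z : ℂ => ∑ k ∈ Finset.range (N+1), ((k:ℂ)+1)^(-z)) _ (-1) :=
    HasDerivAt.fun_sum fun k _ => hc k _ _ _ hi.neg
  have h1 := (((hs.add ((hc N _ _ _ (hi.const_sub 1)).div (hi.sub_const 1) (by norm_num))).sub
    ((hc N _ _ _ hi.neg).div_const 2))).add
    ((hi.mul (hc N _ _ _ (hi.neg.sub_const 1))).div_const 12)
  have h2 : HasDerivAt (TZ N) _ (-1) := h1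
  rw [h2.deriv]
  have hl : ∀ k : ℕ, Complex.log ((k:ℂ)+1) = ((Real.log ((k:ℝ)+1) : ℝ) : ℂ) := by
    intro k
    rw [Complex.ofReal_log (by positivity)]; simp
  simp only [hl, aSN, SN]
  simp
  norm_num
  push_cast
  ring

theorem aSN_lim : Tendsto aSN atTop (𝓝 (1/12 - (deriv riemannZeta (-1)).re)) := by
  have h1 : (-1:ℂ) ∈ UZ := by
    refine ⟨by norm_num, by norm_num, ?_⟩
    rw [mem_ball_zero_iff]; norm_num
  have := (TZ_lim.tendstoLocallyUniformlyOn.deriv (Eventually.of_forall TZ_diff) UZ_open).tendsto_at h1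
  have h2 := (Complex.continuous_re.tendsto _).comp this
  have h3 : Tendsto (fun N => aSN (N+1)) atTop (𝓝 (1/12 - (deriv riemannZeta (-1)).re)) := by
    refine (h2.const_sub (1/12)).congr fun N => ?_
    simp only [Function.comp, TZ_deriv, Complex.ofReal_re]
    ring
  exact (tendsto_add_atTop_iff_nat 1).1 h3

end Csin

end

section
set_option linter.all false
open MeasureTheory Filter Topology

namespace Csin

theorem logFF_asym (n : ℕ) (hn : 1 ≤ n) :
    |Real.log (FF n) - (-(1/4) * Real.log n + (1/12) * Real.log 2 + 3 * (deriv riemannZeta (-1)).re)| ≤ 4 / n := by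
  have hx : (1:ℝ) ≤ n := by exact_mod_cast hn
  have hp := pn_pos n
  have h1 := un_asym n hn
  have h2 := aSN_rate aSN_lim n hn
  have h3 := aSN_rate aSN_lim (2*n) (by omega)
  have hu : Real.log (Real.pi * un n) = Real.log Real.pi + (Real.log n + 2 * Real.log (pn n)) := by
    unfold un
    rw [Real.log_mul Real.pi_ne_zero (by positivity), Real.log_mul (by positivity) (by positivity),
      Real.log_pow]
    simp
  have e1 : SN n = aSN n + ((n:ℝ)^2/2 + n/2 + 1/12) * Real.log n - (n:ℝ)^2/4 := by unfold aSN; ring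
  have e2 : SN (2*n) = aSN (2*n) + (2*(n:ℝ)^2 + n + 1/12) * (Real.log 2 + Real.log n) - (n:ℝ)^2 := by
    rw [← Real.log_mul (by norm_num) (by positivity)]
    unfold aSN; push_cast; ring
  have h4 : |n * Real.log (Real.pi * un n) + 1/4| ≤ 1 / n := by
    have : n * Real.log (Real.pi * un n) + 1/4 = n * (Real.log (Real.pi * un n) + 1/(4*n)) := by
      field_simp
    rw [this, abs_mul, abs_of_nonneg (by positivity)]
    calc _ ≤ (n:ℝ) * (1/(n:ℝ)^2) := by gcongr
      _ = _ := by field_simp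
  set ζ := (deriv riemannZeta (-1)).re
  have key : Real.log (FF n) - (-(1/4) * Real.log n + (1/12) * Real.log 2 + 3 * ζ)
      = -(n * Real.log (Real.pi * un n) + 1/4) - 4 * (aSN n - (1/12 - ζ)) + (aSN (2*n) - (1/12-ζ)) := by
    rw [logFF, e1, e2, hu]; ring
  rw [key]
  push_cast at h3
  have h5 : 1 / (2 * (n:ℝ)) = (1/2) * (1/n) := by field_simp
  have h6 : 1 / (2 * (2 * (n:ℝ))) = (1/4) * (1/n) := by field_simp; norm_num
  rw [h5] at h2
  rw [h6] at h3
  have h7 : (4:ℝ) / n = 4 * (1/n) := by ring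
  rw [h7]
  have h8 : (0:ℝ) < 1/n := by positivity
  rw [abs_le] at *
  constructor <;> linarith [h2.1, h2.2, h3.1, h3.2, h4.1, h4.2]

theorem log_diff {a b m : ℝ} (hm : 0 < m) (ha : m ≤ a) (hb : m ≤ b) :
    |Real.log a - Real.log b| ≤ |a - b| / m := by
  have key : ∀ a b : ℝ, m ≤ a → m ≤ b → Real.log a - Real.log b ≤ |a - b| / m := by
    intro a b ha hb
    have h0 : 0 < b := by linarith
    have h0' : 0 < a := by linarith
    rw [← Real.log_div h0'.ne' h0.ne']
    refine (Real.log_le_sub_one_of_pos (by positivity)).trans ?_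
    rw [div_sub_one h0.ne']
    calc _ ≤ |a-b|/b := by gcongr; exact le_abs_self _
      _ ≤ _ := by gcongr
  rw [abs_le]
  constructor
  · have := key b a hb ha
    rw [abs_sub_comm] at this
    linarith
  · exact key a b ha hb

theorem logPsi_asym (y : ℝ) (hy : 4 ≤ y) : 0 < Psi 0 0 y ∧
    |Real.log (Psi 0 0 y) - (-(1/4) * Real.log y + (1/12) * Real.log 2 + 3 * (deriv riemannZeta (-1)).re)|
      ≤ 400000 / y := by
  set n := ⌊y⌋₊ with hn
  have h1 : (n:ℝ) ≤ y := Nat.floor_le (by linarith)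
  have h2 : y < n + 1 := Nat.lt_floor_add_one y
  have h4 : 4 ≤ n := Nat.le_floor (by exact_mod_cast hy)
  have hx : (4:ℝ) ≤ n := by exact_mod_cast h4
  obtain ⟨hp, hb⟩ := pathAC (n := n) (y := y) (by omega) h1 (by linarith) (FF_pos n)
  refine ⟨hp, ?_⟩
  have h3 := logFF_asym n (by omega)
  have h5 := log_diff (a := y) (b := n) (m := n) (by linarith) h1 le_rfl
  have h6 : |y - n| / n ≤ 1 / (n:ℝ) := by
    gcongr
    rw [abs_le]; constructor <;> linarith
  have h7 : 8/(2*(n:ℝ))*(y-n) ≤ 4 * (1/n) := by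
    have : 8/(2*(n:ℝ))*(y-n) = 4 * (1/n) * (y-n) := by field_simp; ring
    rw [this]
    apply mul_le_of_le_one_right (by positivity) (by linarith)
  have h8 : 153600*(n:ℝ)*(1/(2*(y-2))^3) ≤ 153600 * (1/n) := by
    have : (n:ℝ)^3 ≤ (2*(y-2))^3 := by gcongr; linarith
    calc _ ≤ 153600*(n:ℝ)*(1/(n:ℝ)^3) := by gcongr
      _ = 153600 * (1/n) * (1/n) := by field_simp
      _ ≤ _ := by
        apply mul_le_of_le_one_right (by positivity)
        rw [div_le_one (by positivity)]; linarith
  have h9 : 1/(n:ℝ) ≤ 2 / y := by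
    rw [div_le_div_iff₀ (by positivity) (by linarith)]; linarith
  have h10 : 400000 / y = 200000 * (2/y) := by ring
  rw [h10]
  have h11 : (4:ℝ)/n = 4*(1/n) := by ring
  rw [h11] at h3
  have h12 := h5.trans h6
  have h13 : (0:ℝ) < 1/n := by positivity
  rw [abs_le] at *
  constructor <;> linarith [h12.1, h12.2, h3.1, h3.2, hb.1, hb.2]

theorem fred_DC (x s : ℝ) (hs : 0 < s) :
    fredholmDet s (Kcsin x 1) = ((DC (2*s^3+x*s) (4/3*s^3) : ℝ) : ℂ) := by
  set y := 2*s^3+x*s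
  set w := 4/3*s^3
  have hL : ∀ t ∈ Set.Ioo (-1:ℝ) 1, |cub' y w t| ≤ |y| + |w| * 5 := by
    intro t ht
    unfold cub'
    refine (abs_add_le _ _).trans ?_
    rw [abs_mul]
    gcongr
    rw [abs_le]
    constructor <;> nlinarith [ht.1, ht.2]
  have h1 := fredholmDet_eq (k := Kcsin x 1) hs (KOK_trunc (cub_deriv y w) (by unfold cub'; fun_prop) hL) ?_
  · rw [h1, FD_trunc]
    unfold DC
    exact (DD_re _ _).symm
  · intro a ha b hb
    have hs' : s ≠ 0 := hs.ne'
    simp only [trunc]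
    rw [if_pos ⟨ha, hb⟩]
    unfold Kcsin Kth
    by_cases hab : a = b
    · rw [if_pos (by rw [hab]), if_pos hab, ← Complex.ofReal_mul]
      congr 1
      unfold cub'
      simp only [y, w]
      field_simp
      ring
    · have hab' : a - b ≠ 0 := sub_ne_zero.2 hab
      have hne : s * a ≠ s * b := fun h => hab (mul_left_cancel₀ hs' h)
      rw [if_neg hne, if_neg hab, ← Complex.ofReal_mul]
      congr 1
      have e1 : 4/3*1*((s*a)^3 - (s*b)^3) + x*(s*a - s*b) = cub y w a - cub y w b := by
        unfold cub
        simp only [y, w]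
        ring
      rw [e1, ← mul_sub]
      field_simp

theorem final {x X s : ℝ} (hX : |x| ≤ X) (hs : 10 * (X + 1) ≤ s) :
    0 < (fredholmDet s (Kcsin x 1)).re ∧ (fredholmDet s (Kcsin x 1)).im = 0 ∧
      |Real.log (fredholmDet s (Kcsin x 1)).re -
        (-(2/3)*s^6 - s^4*x - (1/2)*s^2*x^2 - (3/4)*Real.log s
          - (1/6)*Real.log 2 + 3*(deriv riemannZeta (-1)).re)| ≤ 2000000 / s := by
  have hX0 : 0 ≤ X := (abs_nonneg x).trans hX
  have hs10 : 10 ≤ s := by linarith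
  have hs0 : 0 < s := by linarith
  have hxs : |x| ≤ s / 10 := by linarith
  have hxs3 : |x * s| ≤ s^3 / 100 := by
    rw [abs_mul, abs_of_pos hs0]
    calc |x| * s ≤ s/10 * s := by gcongr
      _ ≤ _ := by nlinarith [sq_nonneg s]
  have hs3 : 1000 ≤ s^3 := by
    calc (1000:ℝ) = 10^3 := by norm_num
      _ ≤ _ := by gcongr
  rw [fred_DC x s hs0, Complex.ofReal_re, Complex.ofReal_im]
  set y := 2*s^3+x*s with hy
  set w := 4/3*s^3 with hw
  obtain ⟨b1, b2⟩ := abs_le.1 hxs3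
  obtain ⟨hp, hP⟩ := logPsi_asym y (by linarith)
  have hlow : s^3/2 ≤ 2*(y - 10/9*w) := by rw [hy, hw]; linarith
  obtain ⟨hD, hDb⟩ := pathB (y := y) (w3 := w) (by positivity) (by linarith) hp
  refine ⟨hD, rfl, ?_⟩
  have e1 : 115200*w/(2*(y-10/9*w))^3 ≤ 1300000 / s := by
    calc _ ≤ 115200*w/(s^3/2)^3 := by gcongr
      _ = 1228800 / s^6 := by rw [hw]; field_simp; norm_num
      _ ≤ 1300000 / s^6 := by gcongr; norm_num
      _ ≤ 1300000 / s := by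
        gcongr
        exact le_self_pow₀ (by linarith) (by norm_num)
  have e2 : 400000 / y ≤ 400000 / s := by
    gcongr
    have : s ≤ s^3 := le_self_pow₀ (by linarith) (by norm_num)
    linarith
  have e3 : |Real.log y - Real.log (2*s^3)| ≤ 1 / s := by
    refine (log_diff (m := s^3) (by positivity) (by linarith) (by linarith)).trans ?_
    have : y - 2*s^3 = x*s := by rw [hy]; ring
    rw [this, abs_mul, abs_of_pos hs0]
    calc |x| * s/s^3 ≤ s/10*s/s^3 := by gcongr
      _ = 1/10 * (1/s) := by field_simp
      _ ≤ _ := by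
        have : 0 < 1/s := by positivity
        linarith
  have e4 : Real.log (2*s^3) = Real.log 2 + 3 * Real.log s := by
    rw [Real.log_mul (by norm_num) (by positivity), Real.log_pow]; norm_num
  have e5 : y^2/2 - 3/4*y*w + 3/8*w^2 = (2/3)*s^6 + s^4*x + (1/2)*s^2*x^2 := by
    rw [hy, hw]; ring
  rw [e5] at hDb
  rw [e4] at e3
  have hDb' := hDb.trans e1
  have hP' := hP.trans e2
  have r1 : 1300000 / s = 1300000 * (1/s) := by ring
  have r2 : 400000 / s = 400000 * (1/s) := by ring
  have r3 : 2000000 / s = 2000000 * (1/s) := by ring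
  have h1s : 0 < 1/s := by positivity
  rw [r1] at hDb'
  rw [r2] at hP'
  rw [r3]
  clear hDb hP
  rw [abs_le] at hDb' hP' e3 ⊢
  constructor <;> linarith [hDb'.1, hDb'.2, hP'.1, hP'.2, e3.1, e3.2]

end Csin

end

/-- Large-gap asymptotics of the cubic sine kernel Fredholm determinant (Theorem 2). -/
theorem csin_determinant_asymptotics (𝒦 : Set ℝ) (hK : IsCompact 𝒦) :
    ∃ C > (0:ℝ), ∃ s0 > (0:ℝ), ∀ x ∈ 𝒦, ∀ s : ℝ, s0 ≤ s →
      0 < (fredholmDet s (Kcsin x 1)).re ∧ (fredholmDet s (Kcsin x 1)).im = 0 ∧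
      |Real.log (fredholmDet s (Kcsin x 1)).re -
        (-(2/3)*s^6 - s^4*x - (1/2)*s^2*x^2 - (3/4)*Real.log s
          - (1/6)*Real.log 2 + 3*(deriv riemannZeta (-1)).re)| ≤ C / s := by
  obtain ⟨X, hX⟩ := hK.isBounded.exists_norm_le
  refine ⟨2000000, by norm_num, 10 * (max X 0 + 1), by positivity, fun x hx s hs => ?_⟩
  exact Csin.final (X := max X 0) ((hX x hx).trans (le_max_left _ _)) hs

end
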